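/- There exist universal constants c and κ such that for every polynomial f ∈ ℤ[y_1,y_2,y_3] of total degree d ∈ {3,4} which is irreducible in ℚ[y_1,y_2,y_3] and NCC over ℚ, and whose homogeneous degree-d part f_d is 2-irreducible over ℚ, one has for all real B ≥ 2: if d = 4 then N_aff(f,B) ≤ c · (log B)^κ · B, and if d = 3 then N_aff(f,B) ≤ c · (log B)^κ · B^{2/√3}. -/

import Mathlib

open MvPolynomial

/-- The number of integral points of height at most `B` on the zero set of `f`. -/
noncomputable def Naff {n : ℕ} (f : MvPolynomial (Fin n) ℤ) (B : ℝ) : ℕ :=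
  Set.ncard {x : Fin n → ℤ | MvPolynomial.eval x f = 0 ∧ ∀ i, (|x i| : ℝ) ≤ B}

/-- The linear form with coefficients `c`. -/
noncomputable def linForm {K : Type*} [CommSemiring K] {n : ℕ} (c : Fin n → K) :
    MvPolynomial (Fin n) K :=
  ∑ i, MvPolynomial.C (c i) * MvPolynomial.X i

/-- `f` is NCC (not cylindrical over a curve) over `K`: it cannot be written as
`g(ℓ₁(x), ℓ₂(x))` for linear forms `ℓ₁, ℓ₂` over `K` and `g ∈ K[y₁,y₂]`. -/
def IsNCC {K : Type*} [CommSemiring K] {n : ℕ} (f : MvPolynomial (Fin n) K) : Prop :=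
  ¬ ∃ (c c' : Fin n → K) (g : MvPolynomial (Fin 2) K),
      f = MvPolynomial.aeval ![linForm c, linForm c'] g

/-- `f` is `r`-irreducible: every divisor of `f` of total degree at most `r` is a unit. -/
def RIrreducible {K : Type*} [CommSemiring K] {n : ℕ} (r : ℕ) (f : MvPolynomial (Fin n) K) : Prop :=
  ∀ g : MvPolynomial (Fin n) K, g ∣ f → g.totalDegree ≤ r → IsUnit g

namespace AffGrowth

/-- The substitution `x ↦ P + p u`. -/
noncomputable def shiftScale {n : ℕ} (P : Fin n → ℤ) (p : ℕ) :
    MvPolynomial (Fin n) ℤ →ₐ[ℤ] MvPolynomial (Fin n) ℤ :=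
  aeval fun i => C (P i) + C (p : ℤ) * X i

theorem eval_shiftScale {n : ℕ} (P u : Fin n → ℤ) (p : ℕ) (F : MvPolynomial (Fin n) ℤ) :
    eval u (shiftScale P p F) = eval (fun i => P i + p * u i) F := by
  have : ((eval u).comp (shiftScale P p : MvPolynomial (Fin n) ℤ →+* _)) =
      eval (fun i => P i + p * u i) := by
    ext i <;> simp [shiftScale]
  exact congrArg (fun g => g F) this

theorem coeff_aeval_scale {n : ℕ} (p : ℤ) (G : MvPolynomial (Fin n) ℤ) (α : Fin n →₀ ℕ) :
    coeff α (aeval (fun i => C p * X i : Fin n → MvPolynomial (Fin n) ℤ) G) =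
      p ^ α.degree * coeff α G := by
  induction G using MvPolynomial.induction_on' with
  | monomial a c =>
    have : aeval (fun i => C p * X i : Fin n → MvPolynomial (Fin n) ℤ) (monomial a c) =
        monomial a (p ^ a.degree * c) := by
      rw [aeval_monomial, Finsupp.prod_fintype _ _ (by simp)]
      simp only [mul_pow, Finset.prod_mul_distrib, ← C_pow]
      rw [← map_prod, Finset.prod_pow_eq_pow_sum, ← Finsupp.degree_eq_sum,
        monomial_eq, Finsupp.prod_fintype _ _ (by simp)]
      simp only [algebraMap_eq, C_mul]
      ring
    rw [this, coeff_monomial, coeff_monomial]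
    split_ifs with h
    · rw [h]
    · simp
  | add a b ha hb => rw [map_add, coeff_add, coeff_add, ha, hb, mul_add]

theorem pow_dvd_coeff_shiftScale {n : ℕ} (P : Fin n → ℤ) (p : ℕ) (F : MvPolynomial (Fin n) ℤ)
    (α : Fin n →₀ ℕ) : (p : ℤ) ^ α.degree ∣ coeff α (shiftScale P p F) := by
  have : shiftScale P p = (aeval (fun i => C (p : ℤ) * X i : Fin n → MvPolynomial (Fin n) ℤ)).comp
      (aeval (fun i => C (P i) + X i : Fin n → MvPolynomial (Fin n) ℤ)) := by
    ext i : 1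
    simp [shiftScale]
  rw [this, AlgHom.comp_apply, coeff_aeval_scale]
  exact dvd_mul_right _ _

/-- Polynomials vanishing to `p`-adic order `k` on the residue class of `P` modulo `p`. -/
noncomputable def ordIdeal {n : ℕ} (P : Fin n → ℤ) (p k : ℕ) : Ideal (MvPolynomial (Fin n) ℤ) :=
  (Ideal.span {C ((p : ℤ) ^ k)}).comap (shiftScale P p)

theorem mem_ordIdeal {n : ℕ} {P : Fin n → ℤ} {p k : ℕ} {F : MvPolynomial (Fin n) ℤ} :
    F ∈ ordIdeal P p k ↔ C ((p : ℤ) ^ k) ∣ shiftScale P p F := by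
  rw [ordIdeal, Ideal.mem_comap, Ideal.mem_span_singleton]

theorem ordIdeal_zero {n : ℕ} (P : Fin n → ℤ) (p : ℕ) : ordIdeal P p 0 = ⊤ := by
  ext F; simp [mem_ordIdeal]

theorem ordIdeal_anti {n : ℕ} (P : Fin n → ℤ) (p : ℕ) {j k : ℕ} (h : j ≤ k) :
    ordIdeal P p k ≤ ordIdeal P p j := by
  intro F hF
  rw [mem_ordIdeal] at *
  exact (map_dvd C (pow_dvd_pow _ h)).trans hF

theorem dvd_eval_of_mem_ordIdeal {n : ℕ} {P Q : Fin n → ℤ} {p k : ℕ}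
    {F : MvPolynomial (Fin n) ℤ} (hF : F ∈ ordIdeal P p k)
    (hQ : ∀ i, (p : ℤ) ∣ Q i - P i) : (p : ℤ) ^ k ∣ eval Q F := by
  choose u hu using hQ
  obtain ⟨G, hG⟩ := mem_ordIdeal.1 hF
  have h := eval_shiftScale P u p F
  rw [hG] at h
  have h2 : (fun i => P i + p * u i) = Q := by
    funext i; rw [← hu]; ring
  rw [h2, map_mul, eval_C] at h
  exact ⟨_, h.symm⟩

/-- Exponents of total degree at most `j`. -/
noncomputable def expLE (n j : ℕ) : Finset (Fin n →₀ ℕ) :=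
  (Finset.range (j + 1)).biUnion fun m => Finset.finsuppAntidiag Finset.univ m

theorem mem_expLE {n j : ℕ} {α : Fin n →₀ ℕ} : α ∈ expLE n j ↔ α.degree ≤ j := by
  simp [expLE, Finset.mem_finsuppAntidiag, Finsupp.degree_eq_sum]

theorem card_expLE (n j : ℕ) :
    (expLE n j).card = ∑ m ∈ Finset.range (j + 1), (n + m - 1).choose m := by
  rw [expLE, Finset.card_biUnion]
  · simp [Finset.card_finsuppAntidiag_nat_eq_choose]
  · intro a _ b _ hab
    rw [Function.onFun, Finset.disjoint_left]
    intro α h1 h2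
    simp only [Finset.mem_finsuppAntidiag] at h1 h2
    exact hab (h1.1.symm.trans h2.1)

theorem two_mul_card_expLE_two (j : ℕ) : 2 * (expLE 2 j).card = (j + 1) * (j + 2) := by
  rw [card_expLE]
  induction j with
  | zero => simp
  | succ j ih =>
    rw [Finset.sum_range_succ, mul_add, ih]
    have : (2 + (j + 1) - 1).choose (j + 1) = j + 2 := by
      rw [show 2 + (j + 1) - 1 = (j + 1) + 1 by omega, Nat.choose_succ_self_right]
    rw [this]; ring

theorem six_mul_card_expLE_three (j : ℕ) :
    6 * (expLE 3 j).card = (j + 1) * (j + 2) * (j + 3) := by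
  rw [card_expLE]
  induction j with
  | zero => simp
  | succ j ih =>
    rw [Finset.sum_range_succ, mul_add, ih]
    have h1 : (3 + (j + 1) - 1).choose (j + 1) = (j + 3).choose 2 := by
      rw [show 3 + (j + 1) - 1 = j + 3 by omega, ← Nat.choose_symm_of_eq_add]
      omega
    have h2 : 2 * (j + 3).choose 2 = (j + 3) * (j + 2) := by
      rw [mul_comm, Nat.choose_two_right, Nat.div_mul_cancel]
      · rfl
      · exact (Nat.even_mul_pred_self (j + 3)).two_dvd
    rw [h1, show 6 * (j + 3).choose 2 = 3 * (2 * (j + 3).choose 2) by ring, h2]; ring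

theorem ordIdeal_succ_relIndex {n : ℕ} (P : Fin n → ℤ) {p : ℕ} (hp : p.Prime) (j : ℕ) :
    (ordIdeal P p (j + 1)).toAddSubgroup.relIndex (ordIdeal P p j).toAddSubgroup ≠ 0 ∧
    (ordIdeal P p (j + 1)).toAddSubgroup.relIndex (ordIdeal P p j).toAddSubgroup ≤
      p ^ (expLE n j).card := by
  have : Fact p.Prime := ⟨hp⟩
  have hp0 : ((p : ℤ)) ≠ 0 := by exact_mod_cast hp.ne_zero
  have hdvd : ∀ F ∈ ordIdeal P p j, ∀ α, (p : ℤ) ^ j ∣ coeff α (shiftScale P p F) := by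
    intro F hF α
    exact (C_dvd_iff_dvd_coeff _ _).1 (mem_ordIdeal.1 hF) α
  let g : (ordIdeal P p j).toAddSubgroup →+ (expLE n j → ZMod p) :=
    { toFun := fun F α => ((coeff α.1 (shiftScale P p F.1) / (p : ℤ) ^ j : ℤ) : ZMod p)
      map_zero' := by funext α; simp
      map_add' := by
        intro F G
        funext α
        simp only [AddSubgroup.coe_add, map_add, coeff_add, Pi.add_apply]
        rw [Int.add_ediv_of_dvd_left (hdvd F.1 F.2 α), Int.cast_add] }
  have hk : g.ker ≤ (ordIdeal P p (j + 1)).toAddSubgroup.addSubgroupOf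
      (ordIdeal P p j).toAddSubgroup := by
    intro F hF
    rw [AddSubgroup.mem_addSubgroupOf]
    change F.1 ∈ ordIdeal P p (j + 1)
    rw [mem_ordIdeal, C_dvd_iff_dvd_coeff]
    intro α
    by_cases hα : α ∈ expLE n j
    · have h1 : g F ⟨α, hα⟩ = 0 := by rw [AddMonoidHom.mem_ker.1 hF]; rfl
      have h2 : (p : ℤ) ∣ coeff α (shiftScale P p F.1) / (p : ℤ) ^ j :=
        (ZMod.intCast_zmod_eq_zero_iff_dvd _ _).1 h1
      have h3 := mul_dvd_mul_left ((p : ℤ) ^ j) h2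
      rwa [Int.mul_ediv_cancel' (hdvd F.1 F.2 α), ← pow_succ] at h3
    · rw [mem_expLE, not_le] at hα
      exact (pow_dvd_pow _ hα).trans (pow_dvd_coeff_shiftScale P p _ α)
  have hfin : g.ker.index ≤ p ^ (expLE n j).card ∧ g.ker.index ≠ 0 := by
    rw [AddSubgroup.index_ker]
    refine ⟨?_, Nat.card_pos.ne'⟩
    refine (Nat.card_le_card_of_injective (fun x : g.range => x.1)
      Subtype.val_injective).trans ?_
    simp [Nat.card_eq_fintype_card, ZMod.card]
  have hd := AddSubgroup.index_dvd_of_le hk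
  exact ⟨fun h0 => hfin.2 (Nat.eq_zero_of_zero_dvd (h0 ▸ hd)),
    (Nat.le_of_dvd (Nat.pos_of_ne_zero hfin.2) hd).trans hfin.1⟩

theorem ordIdeal_relIndex {n : ℕ} (P : Fin n → ℤ) {p : ℕ} (hp : p.Prime) {i k : ℕ} (h : i ≤ k) :
    (ordIdeal P p k).toAddSubgroup.relIndex (ordIdeal P p i).toAddSubgroup ≠ 0 ∧
    (ordIdeal P p k).toAddSubgroup.relIndex (ordIdeal P p i).toAddSubgroup ≤
      p ^ (∑ j ∈ Finset.Ico i k, (expLE n j).card) := by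
  induction k, h using Nat.le_induction with
  | base => simp
  | succ k hk ih =>
    have h1 := ordIdeal_succ_relIndex P hp k
    rw [← AddSubgroup.relIndex_mul_relIndex (ordIdeal P p (k + 1)).toAddSubgroup
      (ordIdeal P p k).toAddSubgroup (ordIdeal P p i).toAddSubgroup
      (ordIdeal_anti P p (Nat.le_succ k)) (ordIdeal_anti P p hk), Finset.sum_Ico_succ_top hk,
      pow_add, mul_comm (p ^ _) (p ^ _)]
    exact ⟨mul_ne_zero h1.1 ih.1, Nat.mul_le_mul h1.2 ih.2⟩

theorem mul_mem_ordIdeal {n : ℕ} {P : Fin n → ℤ} {p : ℕ} (hp : p.Prime) {k v : ℕ}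
    {f f₁ g : MvPolynomial (Fin n) ℤ} (hf : shiftScale P p f = C ((p : ℤ) ^ v) * f₁)
    (hf₁ : ¬ C (p : ℤ) ∣ f₁) (h : f * g ∈ ordIdeal P p k) : g ∈ ordIdeal P p (k - v) := by
  rcases le_total k v with hkv | hkv
  · rw [Nat.sub_eq_zero_of_le hkv, ordIdeal_zero]; trivial
  rw [mem_ordIdeal] at *
  have hpr : Prime (C (p : ℤ) : MvPolynomial (Fin n) ℤ) :=
    (prime_C_iff (Fin n) (R := ℤ)).2 (Nat.prime_iff_prime_int.1 hp)
  have hne : (C ((p : ℤ) ^ v) : MvPolynomial (Fin n) ℤ) ≠ 0 := by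
    rw [C_pow]; exact pow_ne_zero _ hpr.ne_zero
  rw [map_mul, hf, mul_assoc, show (p : ℤ) ^ k = (p : ℤ) ^ v * (p : ℤ) ^ (k - v) by
    rw [← pow_add, Nat.add_sub_cancel' hkv], C_mul, mul_dvd_mul_iff_left hne] at h
  rw [C_pow] at h ⊢
  exact hpr.pow_dvd_of_dvd_mul_left _ hf₁ h

/-- Index bound for the ideal generated by `f` and the polynomials of high `p`-adic order. -/
theorem index_span_sup_ordIdeal {n : ℕ} {P : Fin n → ℤ} {p : ℕ} (hp : p.Prime) {k v : ℕ}
    {f f₁ : MvPolynomial (Fin n) ℤ} (hf : shiftScale P p f = C ((p : ℤ) ^ v) * f₁)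
    (hf₁ : ¬ C (p : ℤ) ∣ f₁) :
    (Ideal.span {f} ⊔ ordIdeal P p k).toAddSubgroup.index ≠ 0 ∧
    (Ideal.span {f} ⊔ ordIdeal P p k).toAddSubgroup.index ≤
      p ^ (∑ j ∈ Finset.Ico (k - v) k, (expLE n j).card) := by
  set I := ordIdeal P p k with hI
  have htop : (ordIdeal P p 0).toAddSubgroup = ⊤ := by rw [ordIdeal_zero]; rfl
  have hIfin : I.toAddSubgroup.index ≠ 0 := by
    have := (ordIdeal_relIndex P hp (Nat.zero_le k)).1
    rwa [htop, AddSubgroup.relIndex_top_right] at this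
  have hle : I ≤ Ideal.span {f} ⊔ I := le_sup_right
  -- multiplication by `f` on the finite quotient
  let μ : MvPolynomial (Fin n) ℤ →+ MvPolynomial (Fin n) ℤ := AddMonoidHom.mulLeft f
  have hsup : (Ideal.span {f} ⊔ I).toAddSubgroup = μ.range ⊔ I.toAddSubgroup := by
    ext F
    rw [AddSubgroup.mem_sup]
    change F ∈ Ideal.span {f} ⊔ I ↔ _
    rw [Submodule.mem_sup]
    constructor
    · rintro ⟨a, ha, b, hb, rfl⟩
      obtain ⟨c, rfl⟩ := Ideal.mem_span_singleton.1 ha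
      exact ⟨_, ⟨c, rfl⟩, b, hb, rfl⟩
    · rintro ⟨a, ⟨c, rfl⟩, b, hb, rfl⟩
      exact ⟨_, Ideal.mem_span_singleton.2 ⟨c, rfl⟩, b, hb, rfl⟩
  have h1 : I.toAddSubgroup.relIndex (μ.range ⊔ I.toAddSubgroup) =
      (I.toAddSubgroup.comap μ).index := by
    rw [AddSubgroup.relIndex_sup_right, AddSubgroup.index_comap]
  have h2 : I.toAddSubgroup.comap μ ≤ (ordIdeal P p (k - v)).toAddSubgroup := by
    intro g hg
    exact mul_mem_ordIdeal hp hf hf₁ hg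
  have hIle : I.toAddSubgroup ≤ I.toAddSubgroup.comap μ := by
    intro g hg
    exact I.mul_mem_left f hg
  have h3 := AddSubgroup.relIndex_mul_index (H := I.toAddSubgroup)
    (K := (Ideal.span {f} ⊔ I).toAddSubgroup) hle
  have h4 := AddSubgroup.relIndex_mul_index hIle
  rw [hsup, h1] at h3
  rw [← hsup] at h3
  have h5 : (I.toAddSubgroup.comap μ).index ≠ 0 := fun h => hIfin (by rw [← h3, h, zero_mul])
  have h6 : (Ideal.span {f} ⊔ I).toAddSubgroup.index =
      I.toAddSubgroup.relIndex (I.toAddSubgroup.comap μ) := by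
    apply Nat.eq_of_mul_eq_mul_left (Nat.pos_of_ne_zero h5)
    rw [h3, mul_comm, h4]
  have h7 := ordIdeal_relIndex P hp (Nat.sub_le k v)
  have h8 := AddSubgroup.relIndex_mul_relIndex _ _ _ hIle h2
  have h9 : (Ideal.span {f} ⊔ I).toAddSubgroup.index ≠ 0 := fun h =>
    hIfin (by rw [← h3, h, mul_zero])
  refine ⟨h9, ?_⟩
  rw [h6]
  refine le_trans (Nat.le_of_dvd (Nat.pos_of_ne_zero h7.1) ?_) h7.2
  exact ⟨_, h8.symm⟩

theorem index_ordIdeal {n : ℕ} (P : Fin n → ℤ) {p : ℕ} (hp : p.Prime) (k : ℕ) :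
    (ordIdeal P p k).toAddSubgroup.index ≠ 0 ∧
    (ordIdeal P p k).toAddSubgroup.index ≤ p ^ (∑ j ∈ Finset.range k, (expLE n j).card) := by
  have := ordIdeal_relIndex P hp (Nat.zero_le k)
  rwa [ordIdeal_zero, show (⊤ : Ideal (MvPolynomial (Fin n) ℤ)).toAddSubgroup = ⊤ from rfl,
    AddSubgroup.relIndex_top_right, ← Finset.range_eq_Ico] at this

theorem dvd_eval_of_mem_sup {n : ℕ} {P Q : Fin n → ℤ} {p k : ℕ}
    {f F : MvPolynomial (Fin n) ℤ} (hF : F ∈ Ideal.span {f} ⊔ ordIdeal P p k)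
    (hQ : ∀ i, (p : ℤ) ∣ Q i - P i) (hfQ : eval Q f = 0) : (p : ℤ) ^ k ∣ eval Q F := by
  obtain ⟨a, ha, b, hb, rfl⟩ := Submodule.mem_sup.1 hF
  obtain ⟨c, rfl⟩ := Ideal.mem_span_singleton.1 ha
  rw [map_add, map_mul, hfQ, zero_mul, zero_add]
  exact dvd_eval_of_mem_ordIdeal hb hQ

theorem pow_dvd_det_of_columns {ι : Type*} [Fintype ι] [DecidableEq ι] (B : Matrix ι ι ℤ)
    (J : Finset ι) (a : ℤ) (h : ∀ i, ∀ j ∈ J, a ∣ B i j) : a ^ J.card ∣ B.det := by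
  classical
  choose b hb using h
  let B' : Matrix ι ι ℤ := fun i j => if hj : j ∈ J then b i j hj else B i j
  have : B = Matrix.of fun i j => (if j ∈ J then a else 1) * B' i j := by
    ext i j
    by_cases hj : j ∈ J
    · simp [B', hj, ← hb]
    · simp [B', hj]
  rw [this, Matrix.det_mul_row, Finset.prod_ite_mem, Finset.univ_inter, Finset.prod_const]
  exact dvd_mul_right _ _

/-- Lower bound for an interpolation determinant in terms of divisibility on classes. -/
theorem prod_pow_le_index_mul_det {ι κ R : Type*} [Fintype ι] [DecidableEq ι] [Fintype κ]
    [AddCommGroup R] (F : ι → R) (ev : ι → R →+ ℤ) (W : κ → AddSubgroup R)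
    (hW : ∀ c, (W c).index ≠ 0) (S : Finset ℕ) (hS : ∀ p ∈ S, p.Prime) (k : ℕ → ℕ)
    (J : ℕ → Finset ι)
    (h : ∀ p ∈ S, ∀ j ∈ J p, ∃ c, ∀ x ∈ W c, (p : ℤ) ^ k p ∣ ev j x)
    (A : Matrix ι ι ℤ) (hA : ∀ i j, A i j = ev j (F i)) (hdet : A.det ≠ 0) :
    ∏ p ∈ S, p ^ (k p * (J p).card) ≤ (∏ c, (W c).index) * A.det.natAbs := by
  classical
  let φ : (ι → ℤ) →+ R :=
    { toFun := fun c => ∑ i, c i • F i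
      map_zero' := by simp
      map_add' := by intro a b; simp [add_smul, Finset.sum_add_distrib] }
  let M : AddSubgroup (ι → ℤ) := ⨅ c, (W c).comap φ
  have hc : ∀ c, ((W c).comap φ).index ≠ 0 ∧ ((W c).comap φ).index ≤ (W c).index := by
    intro c
    have hd : ((W c).comap φ).index ∣ (W c).index := by
      rw [AddSubgroup.index_comap]; exact AddSubgroup.relIndex_dvd_index_of_normal _ _
    exact ⟨fun h0 => hW c (Nat.eq_zero_of_zero_dvd (h0 ▸ hd)),
      Nat.le_of_dvd (Nat.pos_of_ne_zero (hW c)) hd⟩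
  have hM0 : M.index ≠ 0 := AddSubgroup.index_iInf_ne_zero fun c => (hc c).1
  have hM1 : M.index ≤ ∏ c, (W c).index :=
    (AddSubgroup.index_iInf_le _).trans (Finset.prod_le_prod' fun c _ => (hc c).2)
  have hfin : Finite ((ι → ℤ) ⧸ (AddSubgroup.toIntSubmodule M)) := by
    have : M.FiniteIndex := ⟨hM0⟩
    exact (inferInstance : Finite ((ι → ℤ) ⧸ M))
  have hrank := (Submodule.finiteQuotient_iff (AddSubgroup.toIntSubmodule M)).1 hfin
  have hcard : Module.finrank ℤ (AddSubgroup.toIntSubmodule M) = Fintype.card ι := by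
    rw [hrank]; simp
  let bN : Module.Basis ι ℤ (AddSubgroup.toIntSubmodule M) :=
    (Module.finBasisOfFinrankEq ℤ _ hcard).reindex (Fintype.equivFin ι).symm
  have hidx := AddSubgroup.index_eq_natAbs_det (Pi.basisFun ℤ ι) M bN
  let U : Matrix ι ι ℤ := fun i' i => (bN i').1 i
  have hU : M.index = U.det.natAbs := by
    rw [hidx, Module.Basis.det_apply, ← Matrix.det_transpose]
    rfl
  have hUA : ∀ i' j, (U * A) i' j = ev j (φ (bN i').1) := by
    intro i' j
    rw [Matrix.mul_apply]
    simp only [hA, U, φ, AddMonoidHom.coe_mk, ZeroHom.coe_mk, map_sum, map_zsmul, smul_eq_mul]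
  have hdvd : ∀ p ∈ S, (p : ℤ) ^ (k p * (J p).card) ∣ (U * A).det := by
    intro p hp
    rw [pow_mul]
    refine pow_dvd_det_of_columns _ (J p) _ fun i j hj => ?_
    rw [hUA]
    obtain ⟨c, hc⟩ := h p hp j hj
    apply hc
    have : (bN i).1 ∈ M := (bN i).2
    exact (AddSubgroup.mem_iInf.1 this c)
  have hprod : ((∏ p ∈ S, p ^ (k p * (J p).card) : ℕ) : ℤ) ∣ (U * A).det := by
    push_cast
    refine Finset.prod_dvd_of_coprime ?_ hdvd
    intro p hp q hq hpq
    exact (Nat.isCoprime_iff_coprime.2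
      ((Nat.coprime_primes (hS p hp) (hS q hq)).2 hpq)).pow
  have h1 := Int.natCast_dvd.1 hprod
  rw [Matrix.det_mul, Int.natAbs_mul, ← hU] at h1
  refine (Nat.le_of_dvd (Nat.mul_pos (Nat.pos_of_ne_zero hM0)
    (Int.natAbs_pos.2 hdet)) h1).trans (Nat.mul_le_mul_right _ hM1)

/-- If no nonzero combination of the functions vanishes on a set, some interpolation
determinant is nonzero. -/
theorem exists_det_ne_zero {ι α A : Type*} [Fintype ι] [DecidableEq ι] [CommRing A] [IsDomain A]
    (E : α → ι → A) (h : ∀ c : ι → A, c ≠ 0 → ∃ x, ∑ i, c i * E x i ≠ 0) :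
    ∃ x : ι → α, (Matrix.of fun i j => E (x j) i).det ≠ 0 := by
  classical
  let K := FractionRing A
  let r : α → (ι → K) := fun x i => algebraMap A K (E x i)
  have hspan : Submodule.span K (Set.range r) = ⊤ := by
    by_contra hne
    obtain ⟨g, hg0, hg⟩ := Submodule.exists_le_ker_of_lt_top _ (lt_top_iff_ne_top.2 hne)
    obtain ⟨b, hb⟩ := IsLocalization.exist_integer_multiples_of_finset (nonZeroDivisors A)
      (Finset.univ.image fun i => g (Pi.single i 1))
    have hb' : ∀ i, ∃ c : A, algebraMap A K c = (b : A) • g (Pi.single i 1) := fun i =>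
      hb _ (Finset.mem_image_of_mem _ (Finset.mem_univ i))
    choose c hc using hb'
    have hsum : ∀ x : ι → K, g x = ∑ i, x i * g (Pi.single i 1) := by
      intro x
      conv_lhs => rw [← Finset.univ_sum_single x, map_sum]
      refine Finset.sum_congr rfl fun i _ => ?_
      rw [← smul_eq_mul, ← map_smul, ← Pi.single_smul, smul_eq_mul, mul_one]
    have hbne : algebraMap A K (b : A) ≠ 0 :=
      (map_ne_zero_iff _ (IsFractionRing.injective A K)).2 (nonZeroDivisors.ne_zero b.2)
    have hc0 : c ≠ 0 := by
      rintro rfl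
      apply hg0
      ext i
      have := hc i
      rw [Pi.zero_apply, map_zero, Algebra.smul_def] at this
      have := (mul_eq_zero.1 this.symm).resolve_left hbne
      simpa using this
    obtain ⟨x, hx⟩ := h c hc0
    apply hx
    apply IsFractionRing.injective A K
    have h0 : g (r x) = 0 := hg (Submodule.subset_span ⟨x, rfl⟩)
    rw [hsum] at h0
    rw [map_zero, map_sum]
    simp only [map_mul, hc, Algebra.smul_def]
    calc _ = algebraMap A K (b : A) * ∑ i, r x i * g (Pi.single i 1) := by
          rw [Finset.mul_sum]; refine Finset.sum_congr rfl fun i _ => ?_; simp only [r]; ring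
      _ = 0 := by rw [h0, mul_zero]
  obtain ⟨s, hs, hsp, hli⟩ := exists_linearIndependent K (Set.range r)
  rw [hspan] at hsp
  let bs : Module.Basis s K (ι → K) := Module.Basis.mk hli (by rw [Subtype.range_coe, hsp])
  have : Fintype s := FiniteDimensional.fintypeBasisIndex bs
  have hcard : Fintype.card s = Fintype.card ι := by
    rw [← Module.finrank_eq_card_basis bs]; simp
  let e : ι ≃ s := (Fintype.equivOfCardEq hcard).symm
  choose x hx using fun j : ι => hs (e j).2
  refine ⟨x, fun h0 => ?_⟩
  have h1 : ((Pi.basisFun K ι).toMatrix (bs.reindex e.symm)).det ≠ 0 := by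
    rw [← Module.Basis.det_apply]
    exact ((Pi.basisFun K ι).isUnit_det (bs.reindex e.symm)).ne_zero
  apply h1
  have h2 : (Pi.basisFun K ι).toMatrix (bs.reindex e.symm) =
      (algebraMap A K).mapMatrix (Matrix.of fun i j => E (x j) i) := by
    ext i j
    have := congrFun (hx j) i
    simp only [r] at this
    simp [Module.Basis.toMatrix_apply, bs, this]
  rw [h2, ← RingHom.map_det, h0, map_zero]

theorem finrank_restrictTotalDegree (k : Type*) [Field k] (n N : ℕ) :
    Module.finrank k (restrictTotalDegree (Fin n) k N) = (expLE n N).card := by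
  have h := Module.finrank_eq_nat_card_basis
    (basisRestrictSupport k {α : Fin n →₀ ℕ | α.degree ≤ N})
  have h2 : Nat.card {α : Fin n →₀ ℕ | α.degree ≤ N} = (expLE n N).card := by
    have : {α : Fin n →₀ ℕ | α.degree ≤ N} = ((expLE n N : Finset _) : Set (Fin n →₀ ℕ)) := by
      ext α; simp [mem_expLE]
    rw [this, Nat.card_coe_set_eq, Set.ncard_coe_finset]
  rw [← h2, ← h]
  rfl

section Bezout

variable {k W : Type*} [Field k] [AddCommGroup W] [Module k W]

/-- Bezout-type bound: a linear map killing all multiples of two coprime plane polynomials has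
rank at most the product of the degrees. -/
theorem finrank_range_le_mul_of_coprime (F A : MvPolynomial (Fin 2) k)
    (hF : F ≠ 0) (hA : A ≠ 0) (hFA : ∀ g, F ∣ A * g → F ∣ g)
    (ψ : MvPolynomial (Fin 2) k →ₗ[k] W) [Module.Finite k (LinearMap.range ψ)]
    (hψF : ∀ g, ψ (F * g) = 0) (hψA : ∀ g, ψ (A * g) = 0) :
    Module.finrank k (LinearMap.range ψ) ≤ F.totalDegree * A.totalDegree := by
  classical
  set a := F.totalDegree with ha
  set b := A.totalDegree with hb
  obtain ⟨S, hS⟩ := (Module.finite_def.1 ‹Module.Finite k (LinearMap.range ψ)›)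
  choose g hg using fun x : LinearMap.range ψ => LinearMap.mem_range.1 x.2
  obtain ⟨M, hM⟩ : ∃ M, ∀ x ∈ S, (g x).totalDegree ≤ M :=
    ⟨S.sup fun x => (g x).totalDegree, fun x hx => Finset.le_sup (f := fun x => (g x).totalDegree) hx⟩
  let N := M + a + b
  let V := fun j => restrictTotalDegree (Fin 2) k j
  let ψN : V N →ₗ[k] LinearMap.range ψ := ψ.rangeRestrict.comp (V N).subtype
  have hsurj : LinearMap.range ψN = ⊤ := by
    rw [eq_top_iff, ← hS, Submodule.span_le]
    intro x hx
    refine ⟨⟨g x, ?_⟩, ?_⟩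
    · rw [mem_restrictTotalDegree]; exact (hM x hx).trans (by simp only [N]; omega)
    · exact Subtype.ext (hg x)
  have mulmem : ∀ (P u : MvPolynomial (Fin 2) k) (j l : ℕ), P.totalDegree + j ≤ l → u ∈ V j →
      P * u ∈ V l := by
    intro P u j l h hu
    rw [mem_restrictTotalDegree] at *
    exact (totalDegree_mul _ _).trans ((Nat.add_le_add_left hu _).trans h)
  let mulF : V (M + b) →ₗ[k] V N := ((LinearMap.mulLeft k F).comp (V (M + b)).subtype).codRestrict _
    fun u => mulmem F u _ _ (by simp only [N]; omega) u.2
  let mulA : V (M + a) →ₗ[k] V N := ((LinearMap.mulLeft k A).comp (V (M + a)).subtype).codRestrict _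
    fun u => mulmem A u _ _ (by simp only [N]; omega) u.2
  let T := mulF.coprod mulA
  let s1 : V M →ₗ[k] V (M + b) := ((LinearMap.mulLeft k A).comp (V M).subtype).codRestrict _
    fun u => mulmem A u _ _ (by omega) u.2
  let s2 : V M →ₗ[k] V (M + a) := -((LinearMap.mulLeft k F).comp (V M).subtype).codRestrict _
    fun u => mulmem F u _ _ (by omega) u.2
  have hker : LinearMap.ker T ≤ LinearMap.range (s1.prod s2) := by
    rintro ⟨u, v⟩ huv
    have h1 : F * u.1 + A * v.1 = 0 := congrArg Subtype.val (LinearMap.mem_ker.1 huv)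
    obtain ⟨w, hw⟩ := hFA v.1 ⟨-u.1, by linear_combination h1⟩
    have h2 : u.1 = A * (-w) := by
      apply mul_left_cancel₀ hF
      rw [hw] at h1
      linear_combination h1
    have hwM : -w ∈ V M := by
      by_cases hw0 : w = 0
      · simp [hw0]
      have h3 := u.2
      rw [mem_restrictTotalDegree] at h3 ⊢
      rw [h2, totalDegree_mul_of_isDomain hA (neg_ne_zero.2 hw0)] at h3
      omega
    refine ⟨⟨-w, hwM⟩, Prod.ext (Subtype.ext h2.symm) (Subtype.ext ?_)⟩
    change -(F * -w) = v.1
    rw [hw]; ring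
  have hcomp : LinearMap.range T ≤ LinearMap.ker ψN := by
    rintro _ ⟨⟨u, v⟩, rfl⟩
    rw [LinearMap.mem_ker]
    apply Subtype.ext
    change ψ (F * u.1 + A * v.1) = 0
    rw [map_add, hψF, hψA, add_zero]
  have d1 := LinearMap.finrank_range_add_finrank_ker ψN
  have d2 := LinearMap.finrank_range_add_finrank_ker T
  have d3 := Submodule.finrank_mono hker
  have d4 := LinearMap.finrank_range_le (s1.prod s2)
  have d5 := Submodule.finrank_mono hcomp
  rw [hsurj, finrank_top, finrank_restrictTotalDegree] at d1
  rw [Module.finrank_prod, finrank_restrictTotalDegree, finrank_restrictTotalDegree] at d2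
  rw [finrank_restrictTotalDegree] at d4
  have e1 := two_mul_card_expLE_two N
  have e2 := two_mul_card_expLE_two (M + a)
  have e3 := two_mul_card_expLE_two (M + b)
  have e4 := two_mul_card_expLE_two M
  have e5 : (N + 1) * (N + 2) + (M + 1) * (M + 2) =
      (M + a + 1) * (M + a + 2) + (M + b + 1) * (M + b + 2) + 2 * (a * b) := by
    simp only [N]; ring
  omega

/-- Simultaneous surjectivity of finitely many surjections with pairwise coprime kernels. -/
theorem surjective_pi_of_isCoprime_ker {ι R : Type*} [Finite ι] [CommRing R] {S : ι → Type*}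
    [∀ i, CommRing (S i)] (φ : ∀ i, R →+* S i) (hφ : ∀ i, Function.Surjective (φ i))
    (h : Pairwise fun i j => IsCoprime (RingHom.ker (φ i)) (RingHom.ker (φ j)))
    (y : ∀ i, S i) : ∃ r, ∀ i, φ i r = y i := by
  choose x hx using fun i => hφ i (y i)
  obtain ⟨r, hr⟩ := Ideal.exists_forall_sub_mem_ideal h x
  refine ⟨r, fun i => ?_⟩
  have := hr i
  rw [RingHom.mem_ker, map_sub, sub_eq_zero] at this
  rw [this, hx]

theorem isCoprime_ker_eval {σ : Type*} {P Q : σ → k} (h : P ≠ Q) :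
    IsCoprime (RingHom.ker (eval P : MvPolynomial σ k →+* k)) (RingHom.ker (eval Q)) := by
  obtain ⟨i, hi⟩ := Function.ne_iff.1 h
  have hne : P i - Q i ≠ 0 := sub_ne_zero.2 hi
  rw [Ideal.isCoprime_iff_exists]
  refine ⟨C (P i - Q i)⁻¹ * (C (P i) - X i), ?_, C (P i - Q i)⁻¹ * (X i - C (Q i)), ?_, ?_⟩
  · simp [RingHom.mem_ker]
  · simp [RingHom.mem_ker]
  · rw [← mul_add, show (C (P i) - X i + (X i - C (Q i)) : MvPolynomial σ k) = C (P i - Q i) by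
      rw [C_sub]; ring, ← C_mul, inv_mul_cancel₀ hne, C_1]

/-- The Bezout bound for the number of common zeros of coprime plane polynomials. -/
theorem card_common_zeros_le (F A : MvPolynomial (Fin 2) k)
    (hF : F ≠ 0) (hA : A ≠ 0) (hFA : ∀ g, F ∣ A * g → F ∣ g) (Z : Finset (Fin 2 → k))
    (hZF : ∀ P ∈ Z, eval P F = 0) (hZA : ∀ P ∈ Z, eval P A = 0) :
    Z.card ≤ F.totalDegree * A.totalDegree := by
  let ψ : MvPolynomial (Fin 2) k →ₗ[k] (Z → k) :=
    LinearMap.pi fun P => (aeval P.1 : MvPolynomial (Fin 2) k →ₐ[k] k).toLinearMap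
  have hsurj : LinearMap.range ψ = ⊤ := by
    rw [LinearMap.range_eq_top]
    intro y
    obtain ⟨r, hr⟩ := surjective_pi_of_isCoprime_ker
      (fun P : Z => (eval P.1 : MvPolynomial (Fin 2) k →+* k))
      (fun P c => ⟨C c, by simp⟩)
      (fun P Q hPQ => isCoprime_ker_eval fun h => hPQ (Subtype.ext h)) y
    refine ⟨r, funext fun P => ?_⟩
    simpa [ψ, aeval_eq_eval] using hr P
  have := finrank_range_le_mul_of_coprime F A hF hA hFA ψ
    (fun g => by ext P; simp [ψ, aeval_eq_eval, hZF P.1 P.2])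
    (fun g => by ext P; simp [ψ, aeval_eq_eval, hZA P.1 P.2])
  rwa [hsurj, finrank_top, Module.finrank_fintype_fun_eq_card, Fintype.card_coe] at this

end Bezout

theorem exists_primes (X K : ℕ) : ∃ S : Finset ℕ, S.card = K ∧
    ∀ p ∈ S, p.Prime ∧ X < p ∧ p ≤ 8 * (X + K + 2) * (Nat.log 2 (X + K + 2) + 1) := by
  set m := X + K + 2 with hm
  set l := Nat.log 2 m + 1 with hl
  set n := 8 * m * l with hn
  have hlm : m < 2 ^ l := Nat.lt_pow_succ_log_self (by norm_num) m
  have hl1 : 1 ≤ l := by omega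
  have hmR : (2:ℝ) ≤ m := by exact_mod_cast (by omega : 2 ≤ m)
  have hlR : (1:ℝ) ≤ l := by exact_mod_cast hl1
  have hn16 : 16 ≤ n := by
    calc 16 ≤ 8 * m * 1 := by omega
      _ ≤ n := Nat.mul_le_mul_left _ hl1
  have hnR : (16:ℝ) ≤ n := by exact_mod_cast hn16
  have hnE : (n:ℝ) = 8 * m * l := by rw [hn]; push_cast; ring
  have hlogm : Real.log m ≤ l * 0.7 := by
    have h2 := Real.log_two_lt_d9
    have : Real.log m ≤ Real.log ((2:ℝ) ^ l) :=
      Real.log_le_log (by linarith) (by exact_mod_cast hlm.le)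
    rw [Real.log_pow] at this
    nlinarith
  have hlogn : Real.log n ≤ 2.1 + l * 0.7 + l - 1 := by
    rw [hnE, Real.log_mul (by positivity) (by positivity), Real.log_mul (by norm_num) (by positivity)]
    have h8 : Real.log 8 = 3 * Real.log 2 := by
      rw [show (8:ℝ) = 2 ^ 3 by norm_num, Real.log_pow]; norm_num
    have := Real.log_two_lt_d9
    have := Real.log_le_sub_one_of_pos (by linarith : (0:ℝ) < l)
    linarith
  have hlogpos : 0 < Real.log n := Real.log_pos (by linarith)
  have hlogn1 : Real.log (n + 1) ≤ 0.1 * n + 2 := by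
    have h := Real.log_le_sub_one_of_pos (by positivity : (0:ℝ) < (n+1) / 10)
    rw [Real.log_div (by positivity) (by norm_num)] at h
    have h10 : Real.log 10 ≤ 2.8 := by
      have : Real.log 10 ≤ Real.log (2^4) := Real.log_le_log (by norm_num) (by norm_num)
      rw [Real.log_pow] at this
      have := Real.log_two_lt_d9
      push_cast at *
      linarith
    linarith
  have hpi := Chebyshev.pi_ge n
  have hge : (m:ℝ) ≤ (n * Real.log 2 - Real.log (n+1)) / Real.log n := by
    rw [le_div_iff₀ hlogpos]
    have h2 := Real.log_two_gt_d9
    have h3 : (m:ℝ) * Real.log n ≤ m * (2.1 + l * 0.7 + l - 1) :=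
      mul_le_mul_of_nonneg_left hlogn (by linarith)
    have h4 : (m:ℝ) * (2.1 + l * 0.7 + l - 1) ≤ m * (2.8 * l) := by
      apply mul_le_mul_of_nonneg_left _ (by linarith)
      linarith
    have h5 : (n:ℝ) * 0.69 ≤ n * Real.log 2 := mul_le_mul_of_nonneg_left (by linarith) (by linarith)
    have h6 : (m:ℝ) * (2.8 * l) = 0.35 * n := by rw [hnE]; ring
    linarith
  have hmpi : m ≤ Nat.primeCounting n := by
    have := hge.trans hpi
    exact_mod_cast this
  have hcard : K ≤ ((Finset.range (n+1)).filter fun p => p.Prime ∧ X < p).card := by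
    have h1 : Nat.primeCounting n = ((Finset.range (n+1)).filter Nat.Prime).card := by
      rw [Nat.primeCounting, Nat.primeCounting', Nat.count_eq_card_filter_range]
    have h2 : (Finset.range (n+1)).filter Nat.Prime ⊆
        ((Finset.range (n+1)).filter fun p => p.Prime ∧ X < p) ∪ Finset.range (X+1) := by
      intro p hp
      simp only [Finset.mem_union, Finset.mem_filter, Finset.mem_range] at *
      by_cases h : X < p
      · exact Or.inl ⟨hp.1, hp.2, h⟩
      · right; omega
    have h3 := (Finset.card_le_card h2).trans (Finset.card_union_le _ _)
    rw [Finset.card_range] at h3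
    omega
  obtain ⟨S, hS, hSc⟩ := Finset.exists_subset_card_eq hcard
  refine ⟨S, hSc, fun p hp => ?_⟩
  have := hS hp
  simp only [Finset.mem_filter, Finset.mem_range] at this
  exact ⟨this.2.1, this.2.2, by omega⟩

theorem sum_primesLE_log_le (n : ℕ) :
    ∑ p ∈ n.primesLE, Real.log p ≤ 2 * n := by
  rw [← Chebyshev.theta_eq_sum_primesLE_log]
  have h := Chebyshev.theta_le_log4_mul_x (x := n) (by positivity)
  have h4 : Real.log 4 = 2 * Real.log 2 := by
    rw [show (4:ℝ) = 2 ^ 2 by norm_num, Real.log_pow]; norm_num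
  have := Real.log_two_lt_d9
  have hn : (0:ℝ) ≤ n := by positivity
  nlinarith

theorem sum_log_div_rpow_le : ∃ C : ℝ, 0 ≤ C ∧ ∀ S : Finset ℕ,
    ∑ q ∈ S, Real.log q / (q:ℝ) ^ (3/2:ℝ) ≤ C := by
  have hs : Summable fun n : ℕ => 4 * ((n:ℝ) ^ (5/4:ℝ))⁻¹ :=
    (Real.summable_nat_rpow_inv.2 (by norm_num)).mul_left 4
  refine ⟨∑' n : ℕ, 4 * ((n:ℝ) ^ (5/4:ℝ))⁻¹, tsum_nonneg fun n => by positivity, fun S => ?_⟩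
  refine le_trans (Finset.sum_le_sum fun q _ => ?_) (hs.sum_le_tsum S fun n _ => by positivity)
  rcases Nat.eq_zero_or_pos q with rfl | hq
  · simp
  have hq0 : (0:ℝ) < q := by exact_mod_cast hq
  have h := Real.log_le_rpow_div hq0.le (ε := 1/4) (by norm_num)
  rw [div_le_iff₀ (by positivity)]
  refine h.trans (le_of_eq ?_)
  rw [← Real.rpow_neg hq0.le, mul_assoc, ← Real.rpow_add hq0]
  norm_num
  ring

theorem log_factorial_eq (n : ℕ) : Real.log (n.factorial) =
    ∑ p ∈ n.primesLE, (padicValNat p n.factorial) * Real.log p := by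
  have h := Nat.factorization_prod_pow_eq_self (Nat.factorial_ne_zero n)
  have hsub : n.factorial.factorization.support ⊆ n.primesLE := by
    intro p hp
    rw [Nat.support_factorization, Nat.mem_primeFactors] at hp
    rw [Nat.mem_primesLE]
    exact ⟨(hp.1.dvd_factorial).1 hp.2.1, hp.1⟩
  rw [Finsupp.prod_of_support_subset _ hsub _ (by simp)] at h
  conv_lhs => rw [← h]
  push_cast
  rw [Real.log_prod]
  · refine Finset.sum_congr rfl fun p hp => ?_
    rw [Real.log_pow, Nat.factorization_def _ (Nat.prime_of_mem_primesLE hp)]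
  · intro p hp
    have := (Nat.prime_of_mem_primesLE hp).pos
    positivity

theorem sum_log_div_ge : ∃ C : ℝ, 0 ≤ C ∧ ∀ n : ℕ, 1 ≤ n →
    Real.log n - C ≤ ∑ q ∈ n.primesLE, Real.log q / q := by
  obtain ⟨C, hC0, hC⟩ := sum_log_div_rpow_le
  refine ⟨2 * C + 1, by linarith, fun n hn => ?_⟩
  have hn0 : (0:ℝ) < n := by exact_mod_cast hn
  have h1 : (n:ℝ) * Real.log n - n ≤ Real.log n.factorial := by
    have h := Real.pow_div_factorial_le_exp (n:ℝ) hn0.le n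
    have hf : (0:ℝ) < n.factorial := by positivity
    have := Real.log_le_log (by positivity) h
    rw [Real.log_exp, Real.log_div (by positivity) hf.ne', Real.log_pow] at this
    linarith
  have h2 : Real.log n.factorial ≤ ∑ p ∈ n.primesLE,
      n * (Real.log p / p + 2 * (Real.log p / (p:ℝ)^(3/2:ℝ))) := by
    rw [log_factorial_eq]
    refine Finset.sum_le_sum fun p hp => ?_
    have hpp := Nat.prime_of_mem_primesLE hp
    haveI := Fact.mk hpp
    have hv : (p - 1) * padicValNat p n.factorial ≤ n := by
      rw [sub_one_mul_padicValNat_factorial]; omega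
    have hp2 : (2:ℝ) ≤ p := by exact_mod_cast hpp.two_le
    have hvR : ((p:ℝ) - 1) * padicValNat p n.factorial ≤ n := by
      have : ((p - 1 : ℕ) : ℝ) * padicValNat p n.factorial ≤ n := by exact_mod_cast hv
      rwa [Nat.cast_sub hpp.one_le, Nat.cast_one] at this
    have hlog : 0 ≤ Real.log p := Real.log_nonneg (by linarith)
    have hle : (p:ℝ)^(3/2:ℝ) ≤ p * p := by
      rw [← pow_two, ← Real.rpow_natCast]
      exact Real.rpow_le_rpow_of_exponent_le (by linarith) (by norm_num)
    have hpos : (0:ℝ) < (p:ℝ)^(3/2:ℝ) := by positivity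
    have h3 : (padicValNat p n.factorial : ℝ) ≤ n * (1 / p + 2 * (1 / (p:ℝ)^(3/2:ℝ))) := by
      have ha : (padicValNat p n.factorial : ℝ) ≤ n / (p - 1) := by
        rw [le_div_iff₀ (by linarith)]; linarith
      refine ha.trans ?_
      rw [div_eq_mul_inv]
      apply mul_le_mul_of_nonneg_left _ hn0.le
      have hb : 1 / ((p:ℝ) * p) ≤ 1 / (p:ℝ)^(3/2:ℝ) := one_div_le_one_div_of_le hpos hle
      have : ((p:ℝ) - 1)⁻¹ ≤ 1 / p + 2 * (1 / ((p:ℝ) * p)) := by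
        rw [inv_le_iff_one_le_mul₀ (by linarith)]
        have : (1 / (p:ℝ) + 2 * (1 / ((p:ℝ) * p))) * (p - 1) = 1 + (p - 2) / (p * p) := by
          field_simp; ring
        rw [this]
        have : 0 ≤ ((p:ℝ) - 2) / (p * p) := div_nonneg (by linarith) (by positivity)
        linarith
      linarith
    calc _ ≤ n * (1 / p + 2 * (1 / (p:ℝ)^(3/2:ℝ))) * Real.log p :=
          mul_le_mul_of_nonneg_right h3 hlog
      _ = _ := by ring
  rw [← Finset.mul_sum, Finset.sum_add_distrib, ← Finset.mul_sum] at h2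
  have h3 := hC n.primesLE
  have h4 : (n:ℝ) * (Real.log n - 1) ≤ n * (∑ q ∈ n.primesLE, Real.log q / q + 2 * C) := by
    have : (n:ℝ) * (∑ q ∈ n.primesLE, Real.log q / q + 2 * ∑ q ∈ n.primesLE, Real.log q / (q:ℝ)^(3/2:ℝ))
      ≤ n * (∑ q ∈ n.primesLE, Real.log q / q + 2 * C) :=
      mul_le_mul_of_nonneg_left (by linarith) hn0.le
    linarith
  have := le_of_mul_le_mul_left h4 hn0
  linarith

theorem sum_log_div_le (n : ℕ) (hn : 1 ≤ n) :
    ∑ q ∈ n.primesLE, Real.log q / q ≤ Real.log n + 2 := by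
  have hn0 : (0:ℝ) < n := by exact_mod_cast hn
  have h1 : Real.log n.factorial ≤ n * Real.log n := by
    rw [← Real.log_pow]
    apply Real.log_le_log (by positivity)
    exact_mod_cast Nat.factorial_le_pow n
  rw [log_factorial_eq] at h1
  have h2 : ∑ p ∈ n.primesLE, (n * (Real.log p / p) - Real.log p) ≤
      ∑ p ∈ n.primesLE, (padicValNat p n.factorial) * Real.log p := by
    refine Finset.sum_le_sum fun p hp => ?_
    have hpp := Nat.prime_of_mem_primesLE hp
    haveI := Fact.mk hpp
    have hp0 : (0:ℝ) < p := by exact_mod_cast hpp.pos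
    have hd : n / p ≤ padicValNat p n.factorial := by
      have h := padicValNat_mul_div_factorial (p := p) n
      rw [← h, padicValNat_factorial_mul]
      omega
    have hfl : (n:ℝ) / p - 1 ≤ (padicValNat p n.factorial : ℝ) := by
      have h1 : (n:ℝ) / p < (n / p : ℕ) + 1 := by
        rw [div_lt_iff₀ hp0]
        have := Nat.lt_mul_div_succ n hpp.pos
        have : n < (n / p + 1) * p := by linarith [Nat.mul_comm p (n/p+1)]
        exact_mod_cast this
      have : ((n / p : ℕ):ℝ) ≤ padicValNat p n.factorial := by exact_mod_cast hd
      linarith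
    have hlog : 0 ≤ Real.log p := Real.log_nonneg (by exact_mod_cast hpp.one_le)
    calc _ = ((n:ℝ) / p - 1) * Real.log p := by ring
      _ ≤ _ := mul_le_mul_of_nonneg_right hfl hlog
  rw [Finset.sum_sub_distrib, ← Finset.mul_sum] at h2
  have h3 := sum_primesLE_log_le n
  have h4 : (n:ℝ) * ∑ q ∈ n.primesLE, Real.log q / q ≤ n * (Real.log n + 2) := by linarith
  exact le_of_mul_le_mul_left h4 hn0

theorem sum_log_prime_divisors_le (S : Finset ℕ) (N M : ℕ) (hN : N ≠ 0)
    (hS : ∀ q ∈ S, q.Prime ∧ q ∣ N) (hM : Real.log N ≤ M) (hM1 : 1 ≤ M) :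
    ∑ q ∈ S, Real.log q / q ≤ Real.log M + 3 := by
  have hM0 : (0:ℝ) < M := by exact_mod_cast hM1
  have hdiv : ∏ q ∈ S, q ∣ N :=
    Finset.prod_primes_dvd N (fun q hq => (hS q hq).1.prime) (fun q hq => (hS q hq).2)
  have hlogS : ∑ q ∈ S, Real.log q ≤ M := by
    rw [← Real.log_prod (fun q hq => by have := (hS q hq).1.pos; positivity)]
    refine le_trans (Real.log_le_log ?_ ?_) hM
    · exact Finset.prod_pos fun q hq => by exact_mod_cast (hS q hq).1.pos
    · have := Nat.le_of_dvd (Nat.pos_of_ne_zero hN) hdiv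
      rw [← Nat.cast_prod]
      exact Nat.cast_le.2 this
  rw [← Finset.sum_filter_add_sum_filter_not S (fun q => q ≤ M)]
  have h1 : ∑ q ∈ S with q ≤ M, Real.log q / q ≤ Real.log M + 2 := by
    refine le_trans (Finset.sum_le_sum_of_subset_of_nonneg ?_ ?_) (sum_log_div_le M hM1)
    · intro q hq
      rw [Finset.mem_filter] at hq
      rw [Nat.mem_primesLE]
      exact ⟨hq.2, (hS q hq.1).1⟩
    · intro q hq _
      have := (Nat.prime_of_mem_primesLE hq).one_le
      exact div_nonneg (Real.log_nonneg (by exact_mod_cast this)) (by positivity)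
  have h2 : ∑ q ∈ S with ¬ q ≤ M, Real.log q / q ≤ 1 := by
    calc _ ≤ ∑ q ∈ S with ¬ q ≤ M, Real.log q / M := by
          refine Finset.sum_le_sum fun q hq => ?_
          rw [Finset.mem_filter] at hq
          have := (hS q hq.1).1.one_le
          apply div_le_div_of_nonneg_left (Real.log_nonneg (by exact_mod_cast this)) hM0
          exact_mod_cast (by omega : M ≤ q)
      _ ≤ ∑ q ∈ S, Real.log q / M := by
          refine Finset.sum_le_sum_of_subset_of_nonneg (Finset.filter_subset _ _) fun q hq _ => ?_
          exact div_nonneg (Real.log_nonneg (by exact_mod_cast (hS q hq).1.one_le)) hM0.le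
      _ ≤ 1 := by
          rw [← Finset.sum_div, div_le_one hM0]; exact hlogS
  linarith

theorem card_le_of_not_dvd {α : Type*} (Z : Finset α) (m : α → ℤ) {S : Finset ℕ} {B : ℕ}
    (hS : ∀ p ∈ S, p.Prime) (hm0 : ∀ x ∈ Z, m x ≠ 0) (hm : ∀ x ∈ Z, (m x).natAbs < 2 ^ S.card)
    (h : ∀ p ∈ S, (Z.filter fun x => ¬ (p : ℤ) ∣ m x).card ≤ B) : Z.card ≤ S.card * B := by
  classical
  refine (Finset.card_le_card fun x hx => ?_).trans (Finset.card_biUnion_le_card_mul S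
    (fun p => Z.filter fun x => ¬ (p : ℤ) ∣ m x) B h)
  by_contra hno
  simp only [Finset.mem_filter, Finset.mem_biUnion, not_and, not_exists, not_not] at hno
  have h1 := Nat.le_of_dvd (Int.natAbs_pos.2 (hm0 x hx)) (Finset.prod_primes_dvd _
    (fun p hp => (hS p hp).prime) fun p hp => Int.natCast_dvd.1 (hno p hp hx))
  have h2 := Finset.pow_card_le_prod S (fun p : ℕ => p) 2 fun p hp => (hS p hp).two_le
  have := hm x hx
  omega

attribute [local instance] Matrix.seminormedAddCommGroup in
theorem exists_small_kernel {ι α : Type*} [Fintype ι] (E : α → ι → ℤ) (M : ℕ) (hM : 1 ≤ M)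
    (hE : ∀ x i, |E x i| ≤ M) (c : ι → ℤ) (hc : c ≠ 0) (hk : ∀ x, ∑ i, c i * E x i = 0) :
    ∃ t : ι → ℤ, t ≠ 0 ∧ (∀ x, ∑ i, t i * E x i = 0) ∧
      ∀ i, (t i).natAbs ≤ (Fintype.card ι * M) ^ Fintype.card ι := by
  classical
  obtain ⟨i0, hi0⟩ : ∃ i, c i ≠ 0 := by
    by_contra h
    exact hc (funext fun i => not_not.1 (not_exists.1 h i))
  haveI : Nonempty ι := ⟨i0⟩
  set s := Fintype.card ι with hs
  have hs1 : 1 ≤ s := Fintype.card_pos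
  let r : α → ι → ℚ := fun x i => E x i
  obtain ⟨T, hT, hsp, hli⟩ := exists_linearIndependent ℚ (Set.range r)
  have hspan : Submodule.span ℚ T ≠ ⊤ := by
    rw [hsp]
    intro htop
    let g : (ι → ℚ) →ₗ[ℚ] ℚ := ∑ i, (c i : ℚ) • LinearMap.proj i
    have hg : Submodule.span ℚ (Set.range r) ≤ LinearMap.ker g := by
      rw [Submodule.span_le]
      rintro _ ⟨x, rfl⟩
      simp only [SetLike.mem_coe, LinearMap.mem_ker, g, LinearMap.sum_apply, LinearMap.smul_apply,
        LinearMap.proj_apply, smul_eq_mul, r]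
      exact_mod_cast hk x
    rw [htop] at hg
    have : g (Pi.single i0 1) = 0 := hg trivial
    simp [g, LinearMap.sum_apply, Pi.single_apply] at this
    exact hi0 this
  have hfin : T.Finite := hli.setFinite
  haveI : Fintype T := hfin.fintype
  have hcard : Fintype.card T < s := by
    have h1 := finrank_span_eq_card hli
    rw [Subtype.range_coe] at h1
    have h2 := Submodule.finrank_lt hspan
    rw [h1, Module.finrank_fintype_fun_eq_card] at h2
    exact h2
  have hrow : ∀ y : T, ∃ x, r x = y.1 := fun y => hT y.2
  choose row hrow using hrow
  have key : ∀ t : ι → ℤ, (∀ y : T, ∑ i, t i * E (row y) i = 0) → ∀ x, ∑ i, t i * E x i = 0 := by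
    intro t ht x
    let g : (ι → ℚ) →ₗ[ℚ] ℚ := ∑ i, (t i : ℚ) • LinearMap.proj i
    have hg : Submodule.span ℚ T ≤ LinearMap.ker g := by
      rw [Submodule.span_le]
      intro y hy
      have := ht ⟨y, hy⟩
      rw [SetLike.mem_coe, ← show r (row ⟨y, hy⟩) = y from hrow ⟨y, hy⟩]
      simp only [LinearMap.mem_ker, g, LinearMap.sum_apply, LinearMap.smul_apply,
        LinearMap.proj_apply, smul_eq_mul, r]
      exact_mod_cast this
    rw [hsp] at hg
    have h1 : g (r x) = 0 := hg (Submodule.subset_span ⟨x, rfl⟩)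
    simp only [g, LinearMap.sum_apply, LinearMap.smul_apply,
        LinearMap.proj_apply, smul_eq_mul, r] at h1
    exact_mod_cast h1
  rcases Nat.eq_zero_or_pos (Fintype.card T) with h0 | hpos
  · haveI : IsEmpty T := Fintype.card_eq_zero_iff.1 h0
    refine ⟨Pi.single i0 1, by simp, key _ fun y => isEmptyElim y, fun i => ?_⟩
    have h1 : 1 ≤ (s * M) ^ s := Nat.one_le_pow _ _ (Nat.mul_pos hs1 hM)
    by_cases h : i = i0
    · subst h; simpa using h1
    · simp [h]
  · let A : Matrix T ι ℤ := fun y i => E (row y) i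
    obtain ⟨t, ht0, ht, hn⟩ := Int.Matrix.exists_ne_zero_int_vec_norm_le A hcard hpos
    refine ⟨t, ht0, key t fun y => ?_, fun i => ?_⟩
    · have := congrFun ht y
      rw [Matrix.mulVec, dotProduct, Pi.zero_apply] at this
      rw [← this]
      exact Finset.sum_congr rfl fun i _ => mul_comm _ _
    · have hA : ‖A‖ ≤ M := by
        rw [Matrix.norm_le_iff (by positivity)]
        intro y i
        rw [Int.norm_eq_abs]
        exact_mod_cast hE (row y) i
      have h1 : max 1 ‖A‖ ≤ M := max_le (by exact_mod_cast hM) hA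
      have hsM : (1:ℝ) ≤ s * M := by exact_mod_cast Nat.mul_pos hs1 hM
      have h2 : ‖t‖ ≤ ((s:ℝ) * M) ^ s := by
        refine hn.trans ?_
        have hlt : ((Fintype.card T : ℕ) : ℝ) + 1 ≤ s := by exact_mod_cast hcard
        have hexp : ((Fintype.card T : ℕ) : ℝ) / (s - (Fintype.card T : ℕ)) ≤ s := by
          rw [div_le_iff₀ (by linarith)]
          have : (0:ℝ) ≤ s := by positivity
          nlinarith
        calc _ ≤ ((s:ℝ) * M) ^ (((Fintype.card T : ℕ) : ℝ) / (s - (Fintype.card T : ℕ))) := by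
              apply Real.rpow_le_rpow (by positivity)
              · exact mul_le_mul_of_nonneg_left h1 (by positivity)
              · apply div_nonneg (by positivity); linarith
          _ ≤ ((s:ℝ) * M) ^ (s:ℝ) := Real.rpow_le_rpow_of_exponent_le hsM hexp
          _ = _ := Real.rpow_natCast _ _
      have h3 : ‖t i‖ ≤ ‖t‖ := norm_le_pi_norm t i
      rw [Int.norm_eq_abs] at h3
      have h4 : (((t i).natAbs : ℕ) : ℝ) ≤ (((s * M) ^ s : ℕ) : ℝ) := by
        push_cast
        rw [Nat.cast_natAbs]
        push_cast
        exact h3.trans h2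
      exact_mod_cast h4

/-- Absolute values of monomials on a box. -/
theorem abs_prod_pow_le {n : ℕ} {x : Fin n → ℤ} {b : ℕ} (hx : ∀ i, |x i| ≤ b) (α : Fin n →₀ ℕ) :
    |∏ i, x i ^ α i| ≤ ((b ^ α.degree : ℕ) : ℤ) := by
  rw [Finset.abs_prod, Finsupp.degree_eq_sum, ← Finset.prod_pow_eq_pow_sum]
  push_cast
  refine Finset.prod_le_prod (fun i _ => abs_nonneg _) fun i _ => ?_
  rw [abs_pow]
  exact pow_le_pow_left₀ (abs_nonneg _) (hx i) _

theorem natAbs_det_le {ι : Type*} [Fintype ι] [DecidableEq ι] (A : Matrix ι ι ℤ) (m : ι → ℕ)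
    (h : ∀ i j, |A i j| ≤ m i) : A.det.natAbs ≤ (Fintype.card ι).factorial * ∏ i, m i := by
  have h1 : |A.det| ≤ (((Fintype.card ι).factorial * ∏ i, m i : ℕ) : ℤ) := by
    rw [Matrix.det_apply]
    refine (Finset.abs_sum_le_sum_abs _ _).trans ?_
    calc _ ≤ ∑ _σ : Equiv.Perm ι, ((∏ i, m i : ℕ) : ℤ) := by
          refine Finset.sum_le_sum fun σ _ => ?_
          have hs : |((Equiv.Perm.sign σ : ℤˣ) : ℤ)| = 1 := Int.isUnit_iff_abs_eq.1 (Units.isUnit _)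
          rw [Units.smul_def, smul_eq_mul, abs_mul, hs, one_mul, Finset.abs_prod]
          push_cast
          rw [← Equiv.prod_comp σ (fun i => (m i : ℤ))]
          exact Finset.prod_le_prod (fun i _ => abs_nonneg _) fun i _ => h _ _
      _ = _ := by
          rw [Finset.sum_const, Finset.card_univ, Fintype.card_perm]; simp
  rw [Int.abs_eq_natAbs] at h1
  exact_mod_cast h1

/-- The determinant method for a family of monomials. -/
theorem determinant_method {n : ℕ} (I : Finset (Fin n →₀ ℕ)) (Z : Finset (Fin n → ℤ)) (b : ℕ)
    (hZ : ∀ x ∈ Z, ∀ i, |x i| ≤ b)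
    (hno : ∀ g : MvPolynomial (Fin n) ℤ, g ≠ 0 → g.support ⊆ I → ∃ x ∈ Z, eval x g ≠ 0) :
    ∃ Q : I → Fin n → ℤ, (∀ j, Q j ∈ Z) ∧
      ∀ (κ : Type) [Fintype κ] (W : κ → Ideal (MvPolynomial (Fin n) ℤ))
        (_ : ∀ c, (W c).toAddSubgroup.index ≠ 0) (S : Finset ℕ) (_ : ∀ p ∈ S, p.Prime) (k : ℕ → ℕ)
        (J : ℕ → Finset I)
        (_ : ∀ p ∈ S, ∀ j ∈ J p, ∃ c, ∀ F ∈ W c, (p : ℤ) ^ k p ∣ eval (Q j) F),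
        ∏ p ∈ S, p ^ (k p * (J p).card) ≤ (∏ c, (W c).toAddSubgroup.index) *
          (I.card.factorial * b ^ ∑ α ∈ I, α.degree) := by
  classical
  obtain ⟨x, hx⟩ := exists_det_ne_zero (ι := I) (α := Z)
    (fun y α => ∏ i, y.1 i ^ α.1 i) (fun c hc => by
      let g : MvPolynomial (Fin n) ℤ := ∑ α : I, monomial α.1 (c α)
      have hcoeff : ∀ α : I, coeff α.1 g = c α := by
        intro α
        simp only [g, coeff_sum, coeff_monomial]
        rw [Finset.sum_eq_single α]
        · simp
        · intro β _ hβ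
          rw [if_neg (fun h => hβ (Subtype.ext h))]
        · simp
      have hg0 : g ≠ 0 := by
        intro h0
        apply hc
        funext α
        rw [← hcoeff, h0]; rfl
      have hsupp : g.support ⊆ I := by
        intro β hβ
        by_contra hβI
        rw [mem_support_iff] at hβ
        apply hβ
        simp only [g, coeff_sum, coeff_monomial]
        refine Finset.sum_eq_zero fun α _ => ?_
        rw [if_neg]
        rintro rfl
        exact hβI α.2
      obtain ⟨y, hy, hne⟩ := hno g hg0 hsupp
      refine ⟨⟨y, hy⟩, ?_⟩
      convert hne using 1
      simp only [g, map_sum, eval_monomial, Finsupp.prod_fintype _ _ (fun i => pow_zero _)])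
  refine ⟨fun j => (x j).1, fun j => (x j).2, fun κ _ W hW S hS k J h => ?_⟩
  have := prod_pow_le_index_mul_det (ι := I) (fun α => monomial α.1 (1:ℤ))
    (fun j => (eval (x j).1).toAddMonoidHom) (fun c => (W c).toAddSubgroup) hW S hS k J
    (fun p hp j hj => by
      obtain ⟨c, hc⟩ := h p hp j hj
      exact ⟨c, fun F hF => hc F hF⟩)
    (Matrix.of fun i j => ∏ l, (x j).1 l ^ i.1 l)
    (fun i j => by
      simp [eval_monomial, Finsupp.prod_fintype]) hx
  refine this.trans (Nat.mul_le_mul_left _ ?_)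
  refine (natAbs_det_le _ (fun α : I => b ^ α.1.degree) fun i j => ?_).trans (le_of_eq ?_)
  · exact abs_prod_pow_le (hZ _ (x j).2) _
  · rw [Fintype.card_coe, Finset.prod_pow_eq_pow_sum, Finset.sum_coe_sort I (fun α => α.degree)]

/-- Coefficients scale by powers of `p` under `shiftScale`. -/
theorem coeff_shiftScale {n : ℕ} (P : Fin n → ℤ) (p : ℕ) (F : MvPolynomial (Fin n) ℤ)
    (α : Fin n →₀ ℕ) :
    coeff α (shiftScale P p F) = (p : ℤ) ^ α.degree * coeff α (shiftScale P 1 F) := by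
  have : shiftScale P p = (aeval (fun i => C (p : ℤ) * X i : Fin n → MvPolynomial (Fin n) ℤ)).comp
      (shiftScale P 1) := by
    ext i : 1
    simp [shiftScale]
  rw [this, AlgHom.comp_apply, coeff_aeval_scale]

theorem coeff_single_eq {n : ℕ} (F : MvPolynomial (Fin n) ℤ) (i : Fin n) :
    coeff (Finsupp.single i 1) F = eval 0 (pderiv i F) := by
  classical
  induction F using MvPolynomial.induction_on' with
  | monomial a c =>
    rw [pderiv_monomial, eval_monomial, coeff_monomial]
    by_cases h : a = Finsupp.single i 1
    · subst h; simp
    · rw [if_neg h]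
      by_cases hi : a i = 0
      · simp [hi]
      · by_cases h2 : a - Finsupp.single i 1 = 0
        · exfalso
          apply h
          ext j
          have h3 := DFunLike.congr_fun h2 j
          rw [Finsupp.coe_tsub, Pi.sub_apply, Finsupp.coe_zero, Pi.zero_apply] at h3
          by_cases hj : j = i
          · subst hj; simp at h3 ⊢; omega
          · rw [Finsupp.single_eq_of_ne hj] at h3 ⊢; omega
        · obtain ⟨j, hj⟩ := Finsupp.ne_iff.1 h2
          rw [Finsupp.prod_fintype _ _ (by simp), Finset.prod_eq_zero (Finset.mem_univ j), mul_zero]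
          exact zero_pow hj
  | add a b ha hb => rw [coeff_add, map_add, map_add, ha, hb]

theorem pderiv_shiftScale_one {n : ℕ} (P : Fin n → ℤ) (F : MvPolynomial (Fin n) ℤ) (i : Fin n) :
    pderiv i (shiftScale P 1 F) = shiftScale P 1 (pderiv i F) := by
  induction F using MvPolynomial.induction_on with
  | C a => simp [shiftScale]
  | add a b ha hb => simp only [map_add, ha, hb]
  | mul_X a j ha =>
    rw [map_mul, Derivation.leibniz, Derivation.leibniz, ha]
    simp only [smul_eq_mul, map_add, map_mul]
    have h1 : pderiv i (shiftScale P 1 (X j)) = shiftScale P 1 (pderiv i (X j)) := by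
      simp only [shiftScale, aeval_X, map_add, pderiv_C, Nat.cast_one, C_1, one_mul, zero_add, pderiv_X]
      by_cases h : i = j
      · subst h; simp
      · rw [Pi.single_eq_of_ne (Ne.symm h)]; simp
    rw [h1]

theorem eval_zero_shiftScale {n : ℕ} (P : Fin n → ℤ) (p : ℕ) (F : MvPolynomial (Fin n) ℤ) :
    eval 0 (shiftScale P p F) = eval P F := by
  rw [eval_shiftScale]; simp

theorem exists_shiftScale_eq_of_nonsingular {n : ℕ} {P : Fin n → ℤ} {p : ℕ} (hp : p.Prime)
    {f : MvPolynomial (Fin n) ℤ} (h0 : eval P f = 0) {i : Fin n}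
    (h1 : ¬ (p : ℤ) ∣ eval P (pderiv i f)) :
    ∃ f₁, shiftScale P p f = C ((p : ℤ) ^ 1) * f₁ ∧ ¬ C (p : ℤ) ∣ f₁ := by
  have hp0 : (p : ℤ) ≠ 0 := by exact_mod_cast hp.ne_zero
  have hd : C ((p : ℤ) ^ 1) ∣ shiftScale P p f := by
    rw [C_dvd_iff_dvd_coeff]
    intro α
    by_cases hα : α = 0
    · subst hα
      have : coeff 0 (shiftScale P p f) = 0 := by
        have h2 := eval_zero_shiftScale P p f
        rw [h0] at h2
        rw [← h2, eval_zero]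
        rfl
      rw [this]
      exact dvd_zero _
    · rw [coeff_shiftScale]
      apply Dvd.dvd.mul_right
      apply pow_dvd_pow
      rw [Nat.one_le_iff_ne_zero, Ne, Finsupp.degree_eq_zero_iff]
      exact hα
  obtain ⟨f₁, hf₁⟩ := hd
  refine ⟨f₁, hf₁, fun hdvd => h1 ?_⟩
  have h2 := congrArg (coeff (Finsupp.single i 1)) hf₁
  rw [coeff_shiftScale, coeff_C_mul, coeff_single_eq (shiftScale P 1 f), pderiv_shiftScale_one,
    eval_zero_shiftScale, Finsupp.degree_single] at h2
  have h3 := mul_left_cancel₀ (pow_ne_zero 1 hp0) h2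
  rw [h3]
  exact (C_dvd_iff_dvd_coeff _ _).1 hdvd _

/-- Exponents of total degree at most `δ` in which the first variable has exponent `< d`. -/
noncomputable def lowExp (n d δ : ℕ) : Finset (Fin (n + 1) →₀ ℕ) :=
  (expLE (n + 1) δ).filter fun α => α 0 < d

theorem mem_lowExp {n d δ : ℕ} {α : Fin (n + 1) →₀ ℕ} :
    α ∈ lowExp n d δ ↔ α.degree ≤ δ ∧ α 0 < d := by
  rw [lowExp, Finset.mem_filter, mem_expLE]

theorem card_lowExp_add {n d δ : ℕ} (h : d ≤ δ) :
    (lowExp n d δ).card + (expLE (n + 1) (δ - d)).card = (expLE (n + 1) δ).card := by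
  classical
  rw [lowExp, ← Finset.card_filter_add_card_filter_not (s := expLE (n + 1) δ) (fun α => α 0 < d)]
  congr 1
  symm
  apply Finset.card_bij' (fun α _ => α - Finsupp.single 0 d) (fun α _ => α + Finsupp.single 0 d)
  · intro α hα
    rw [Finset.mem_filter, mem_expLE, not_lt] at hα
    exact tsub_add_cancel_of_le (Finsupp.single_le_iff.2 hα.2)
  · intro α hα
    exact add_tsub_cancel_right _ _
  · intro α hα
    rw [Finset.mem_filter, mem_expLE, not_lt] at hα
    rw [mem_expLE]
    have hle : Finsupp.single 0 d ≤ α := Finsupp.single_le_iff.2 hα.2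
    have := congrArg Finsupp.degree (tsub_add_cancel_of_le hle)
    rw [map_add, Finsupp.degree_single] at this
    omega
  · intro α hα
    rw [mem_expLE] at hα
    rw [Finset.mem_filter, mem_expLE, map_add, Finsupp.degree_single]
    refine ⟨by omega, ?_⟩
    simp

theorem lowExp_eq_expLE {n d δ : ℕ} (h : δ < d) : lowExp n d δ = expLE (n + 1) δ := by
  rw [lowExp, Finset.filter_true_of_mem]
  intro α hα
  rw [mem_expLE] at hα
  exact ((Finsupp.le_degree 0 α).trans hα).trans_lt h

theorem sum_degree_lowExp (n d δ : ℕ) :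
    ∑ α ∈ lowExp n d δ, α.degree + ∑ m ∈ Finset.range δ, (lowExp n d m).card =
      δ * (lowExp n d δ).card := by
  classical
  have h1 : ∀ m ∈ Finset.range δ, (lowExp n d m).card =
      ∑ α ∈ lowExp n d δ, if α.degree ≤ m then 1 else 0 := by
    intro m hm
    rw [Finset.mem_range] at hm
    rw [← Finset.sum_filter, Finset.sum_const, smul_eq_mul, mul_one]
    congr 1
    ext α
    simp only [Finset.mem_filter, mem_lowExp]
    constructor
    · rintro ⟨a, b⟩; exact ⟨⟨by omega, b⟩, a⟩
    · rintro ⟨⟨_, b⟩, a⟩; exact ⟨a, b⟩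
  rw [Finset.sum_congr rfl h1, Finset.sum_comm, ← Finset.sum_add_distrib, mul_comm,
    ← smul_eq_mul, ← Finset.sum_const]
  refine Finset.sum_congr rfl fun α hα => ?_
  rw [mem_lowExp] at hα
  rw [← Finset.sum_filter, Finset.sum_const, smul_eq_mul, mul_one]
  have : (Finset.range δ).filter (fun m => α.degree ≤ m) = Finset.Ico α.degree δ := by
    ext m; simp [and_comm]
  rw [this, Nat.card_Ico]
  omega

/-- For plane curves: lower bound for the number of admissible monomials. -/
theorem two_mul_card_lowExp_one_ge (e m : ℕ) :
    2 * e * (m + 1) ≤ 2 * (lowExp 1 e m).card + e * (e - 1) := by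
  rcases lt_or_ge m e with h | h
  · rw [lowExp_eq_expLE h, two_mul_card_expLE_two]
    obtain ⟨k, rfl⟩ : ∃ k, e = m + 1 + k := ⟨e - m - 1, by omega⟩
    rw [show m + 1 + k - 1 = m + k by omega]
    nlinarith [Nat.zero_le (k*k), Nat.le_self_pow two_ne_zero k]
  · have h1 := card_lowExp_add (n := 1) h
    have h2 := two_mul_card_expLE_two (m - e)
    have h3 := two_mul_card_expLE_two m
    obtain ⟨k, rfl⟩ : ∃ k, m = e + k := ⟨m - e, by omega⟩
    rw [show e + k - e = k by omega] at *
    rcases e with _ | e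
    · simp
    · rw [show e + 1 - 1 = e by omega]
      norm_num at *
      nlinarith

theorem two_mul_card_lowExp_one_le (e m : ℕ) (h : e ≤ m) :
    2 * (lowExp 1 e m).card + e * (e - 1) = 2 * e * (m + 1) := by
  have h1 := card_lowExp_add (n := 1) h
  have h2 := two_mul_card_expLE_two (m - e)
  have h3 := two_mul_card_expLE_two m
  obtain ⟨k, rfl⟩ : ∃ k, m = e + k := ⟨m - e, by omega⟩
  rw [show e + k - e = k by omega] at *
  rcases e with _ | e
  · simp [lowExp]
  · rw [show e + 1 - 1 = e by omega]
    norm_num at *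
    nlinarith

theorem two_mul_sum_degree_lowExp_one (e δ : ℕ) (h : e ≤ δ) :
    2 * ∑ α ∈ lowExp 1 e δ, α.degree ≤ e * δ * (δ + 1) := by
  have h1 := sum_degree_lowExp 1 e δ
  have h2 := two_mul_card_lowExp_one_le e δ h
  have h3 : ∑ m ∈ Finset.range δ, 2 * e * (m + 1) ≤
      2 * ∑ m ∈ Finset.range δ, (lowExp 1 e m).card + δ * (e * (e - 1)) := by
    rw [Finset.mul_sum]
    calc _ ≤ ∑ m ∈ Finset.range δ, (2 * (lowExp 1 e m).card + e * (e - 1)) :=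
          Finset.sum_le_sum fun m _ => two_mul_card_lowExp_one_ge e m
      _ = _ := by rw [Finset.sum_add_distrib, Finset.sum_const, Finset.card_range, smul_eq_mul]
  have h4 : ∑ m ∈ Finset.range δ, 2 * e * (m + 1) = e * δ * (δ + 1) := by
    rw [← Finset.mul_sum]
    have := Finset.sum_range_id_mul_two (δ + 1)
    rw [Finset.sum_range_succ'] at this
    simp only [add_zero, Nat.add_sub_cancel] at this
    linear_combination e * this
  have h5 : δ * (2 * (lowExp 1 e δ).card + e * (e - 1)) = δ * (2 * e * (δ + 1)) := by rw [h2]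
  nlinarith

/-- A nonzero polynomial of low degree in the first variable is not divisible by `F`. -/
theorem not_dvd_of_lt {K : Type*} [Field K] {n d : ℕ} {F g : MvPolynomial (Fin (n + 1)) K}
    (hF : coeff (Finsupp.single 0 d) F ≠ 0) (hg : g ≠ 0) (hlow : ∀ α ∈ g.support, α 0 < d) :
    ¬ F ∣ g := by
  rintro ⟨q, hq⟩
  have hq0 : q ≠ 0 := by rintro rfl; exact hg (by rw [hq, mul_zero])
  have hf0 : F ≠ 0 := by rintro rfl; exact hg (by rw [hq, zero_mul])
  have h1 := congrArg (degreeOf 0) hq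
  rw [degreeOf_mul_eq hf0 hq0] at h1
  have h2 : d ≤ degreeOf 0 F := by
    have := monomial_le_degreeOf 0 (mem_support_iff.2 hF)
    simpa using this
  have h3 : degreeOf 0 g < d := by
    obtain ⟨α, hα⟩ := support_nonempty.2 hg
    rw [degreeOf_lt_iff ((Nat.zero_le _).trans_lt (hlow α hα))]
    exact hlow
  omega

theorem not_dvd_of_support_subset {n d : ℕ} {f g : MvPolynomial (Fin (n + 1)) ℤ}
    (hf : coeff (Finsupp.single 0 d) f ≠ 0) (hg : g ≠ 0) (hlow : ∀ α ∈ g.support, α 0 < d) :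
    ¬ map (Int.castRingHom ℚ) f ∣ map (Int.castRingHom ℚ) g :=
  not_dvd_of_lt (by rw [coeff_map]; simpa using hf)
    (fun h => hg (map_injective _ (Int.cast_injective (α := ℚ)) (h.trans (map_zero _).symm)))
    fun α hα => hlow α (support_map_subset _ _ hα)

/-- Integral common zeros of an irreducible plane curve and another curve. -/
theorem card_zeros_le_of_not_dvd {h g : MvPolynomial (Fin 2) ℤ}
    (hirr : Irreducible (map (Int.castRingHom ℚ) h))
    (hg : ¬ map (Int.castRingHom ℚ) h ∣ map (Int.castRingHom ℚ) g) (Z : Finset (Fin 2 → ℤ))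
    (hZh : ∀ P ∈ Z, eval P h = 0) (hZg : ∀ P ∈ Z, eval P g = 0) :
    Z.card ≤ h.totalDegree * g.totalDegree := by
  classical
  have hinj : Function.Injective fun (P : Fin 2 → ℤ) (i : Fin 2) => (P i : ℚ) := by
    intro P Q hPQ
    funext i
    exact Int.cast_injective (congrFun hPQ i)
  have hev : ∀ (P : Fin 2 → ℤ) (F : MvPolynomial (Fin 2) ℤ),
      eval (fun i => (P i : ℚ)) (map (Int.castRingHom ℚ) F) = (eval P F : ℤ) := by
    intro P F
    rw [eval_map]
    exact (eval₂_comp_left (Int.castRingHom ℚ) (RingHom.id ℤ) P F).symm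
  have hp := hirr.prime
  have := card_common_zeros_le (map (Int.castRingHom ℚ) h) (map (Int.castRingHom ℚ) g)
    hp.ne_zero (fun h0 => hg (h0 ▸ dvd_zero _))
    (fun q hq => (hp.dvd_or_dvd hq).resolve_left hg) (Z.image fun P i => (P i : ℚ))
    (fun P hP => by
      obtain ⟨Q, hQ, rfl⟩ := Finset.mem_image.1 hP
      rw [hev, hZh Q hQ, Int.cast_zero])
    (fun P hP => by
      obtain ⟨Q, hQ, rfl⟩ := Finset.mem_image.1 hP
      rw [hev, hZg Q hQ, Int.cast_zero])
  rw [Finset.card_image_of_injective _ hinj] at this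
  refine this.trans (Nat.mul_le_mul ?_ ?_)
  · exact Finset.sup_mono (support_map_subset _ _)
  · exact Finset.sup_mono (support_map_subset _ _)

section
variable {R : Type*} [CommRing R] {n : ℕ}

/-- The restriction of a polynomial to the line through `x` with direction `v`. -/
noncomputable def linePoly (x v : Fin n → R) : MvPolynomial (Fin n) R →ₐ[R] Polynomial R :=
  aeval fun i => Polynomial.C (x i) + Polynomial.C (v i) * Polynomial.X

/-- The derivative of a polynomial in the direction `v`. -/
noncomputable def dirDeriv (v : Fin n → R) (f : MvPolynomial (Fin n) R) : MvPolynomial (Fin n) R :=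
  ∑ i, C (v i) * pderiv i f

theorem eval_linePoly (x v : Fin n → R) (f : MvPolynomial (Fin n) R) (t : R) :
    (linePoly x v f).eval t = eval (fun i => x i + t * v i) f := by
  induction f using MvPolynomial.induction_on with
  | C a => simp [linePoly]
  | add p q hp hq => simp only [map_add, Polynomial.eval_add, hp, hq]
  | mul_X p i hp =>
    rw [map_mul, map_mul, Polynomial.eval_mul, hp, eval_X]
    simp [linePoly, mul_comm t]

theorem derivative_linePoly (x v : Fin n → R) (f : MvPolynomial (Fin n) R) :
    Polynomial.derivative (linePoly x v f) = linePoly x v (dirDeriv v f) := by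
  induction f using MvPolynomial.induction_on with
  | C a => simp [linePoly, dirDeriv]
  | add p q hp hq => simp only [map_add, hp, hq, dirDeriv, mul_add, Finset.sum_add_distrib]
  | mul_X p i hp =>
    have h1 : dirDeriv v (p * X i) = dirDeriv v p * X i + p * C (v i) := by
      simp only [dirDeriv, pderiv_mul, mul_add, Finset.sum_add_distrib, Finset.sum_mul]
      congr 1
      · exact Finset.sum_congr rfl fun j _ => by ring
      · rw [Finset.sum_eq_single i]
        · rw [pderiv_X_self]; ring
        · intro j _ hj
          rw [pderiv_X_of_ne hj.symm]; ring
        · simp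
    rw [h1, map_mul, Polynomial.derivative_mul, hp, map_add, map_mul, map_mul]
    simp [linePoly]

theorem linePoly_monomial (x v : Fin n → R) (α : Fin n →₀ ℕ) :
    (linePoly x v (monomial α 1)).natDegree ≤ α.degree ∧
      (linePoly x v (monomial α 1)).coeff α.degree = eval v (monomial α 1) := by
  induction α using Finsupp.induction_linear with
  | zero =>
    rw [map_zero, ← C_apply, map_one, map_one, map_one]
    simp
  | add a b ha hb =>
    rw [← one_mul (1 : R), ← monomial_mul, map_mul, map_mul, map_add]
    exact ⟨Polynomial.natDegree_mul_le.trans (add_le_add ha.1 hb.1),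
      (Polynomial.coeff_mul_add_eq_of_natDegree_le ha.1 hb.1).trans (by rw [ha.2, hb.2])⟩
  | single i k =>
    have h1 : (linePoly x v (X i)).natDegree ≤ 1 := by
      rw [linePoly, aeval_X, add_comm]
      exact Polynomial.natDegree_linear_le
    rw [← X_pow_eq_monomial, map_pow, map_pow, Finsupp.degree_single]
    constructor
    · exact Polynomial.natDegree_pow_le_of_le k h1 |>.trans (mul_one k).le
    · have := Polynomial.coeff_pow_of_natDegree_le (m := k) h1
      rw [mul_one] at this
      rw [this, linePoly, aeval_X, eval_X]
      simp

theorem natDegree_linePoly_le (x v : Fin n → R) (f : MvPolynomial (Fin n) R) :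
    (linePoly x v f).natDegree ≤ f.totalDegree := by
  conv_lhs => rw [f.as_sum, map_sum]
  refine Polynomial.natDegree_sum_le_of_forall_le _ _ fun α hα => ?_
  rw [← mul_one (coeff α f), ← C_mul_monomial, map_mul, ← algebraMap_eq, AlgHom.commutes]
  exact (Polynomial.natDegree_C_mul_le _ _).trans ((linePoly_monomial x v α).1.trans
    (le_totalDegree hα))

theorem coeff_linePoly_top (x v : Fin n → R) {f : MvPolynomial (Fin n) R} {d : ℕ}
    (hd : f.totalDegree ≤ d) :
    (linePoly x v f).coeff d = eval v (homogeneousComponent d f) := by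
  rw [homogeneousComponent_apply]
  conv_lhs => rw [f.as_sum, map_sum]
  rw [Polynomial.finset_sum_coeff, map_sum, Finset.sum_filter]
  refine Finset.sum_congr rfl fun α hα => ?_
  have h1 := (le_totalDegree hα).trans hd
  change α.degree ≤ d at h1
  rw [← mul_one (coeff α f), ← C_mul_monomial, map_mul, map_mul, ← algebraMap_eq, AlgHom.commutes,
    Polynomial.algebraMap_eq, Polynomial.coeff_C_mul, algebraMap_eq, eval_C]
  split_ifs with h
  · rw [← h, (linePoly_monomial x v α).2]
  · rw [Polynomial.coeff_eq_zero_of_natDegree_lt, mul_zero]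
    exact (linePoly_monomial x v α).1.trans_lt (lt_of_le_of_ne h1 h)

end

/-- Restriction of a polynomial to a line parallel to the first axis. -/
noncomputable def fiberPoly {R : Type*} [CommRing R] {n : ℕ} (y : Fin n → R) :
    MvPolynomial (Fin (n + 1)) R →ₐ[R] Polynomial R :=
  aeval (Fin.cons Polynomial.X fun i => Polynomial.C (y i))

theorem fiberPoly_eq_linePoly {R : Type*} [CommRing R] {n : ℕ} (y : Fin n → R) :
    fiberPoly y = linePoly (Fin.cons 0 y) (Fin.cons 1 0) := by
  apply MvPolynomial.algHom_ext
  refine Fin.cases ?_ fun i => ?_ <;> simp [fiberPoly, linePoly]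

theorem eval_fiberPoly {R : Type*} [CommRing R] {n : ℕ} (y : Fin n → R) (x : R)
    (h : MvPolynomial (Fin (n + 1)) R) :
    (fiberPoly y h).eval x = eval (Fin.cons x y : Fin (n + 1) → R) h := by
  rw [fiberPoly_eq_linePoly, eval_linePoly]
  congr 2
  refine funext (Fin.cases ?_ fun i => ?_) <;> simp

theorem derivative_fiberPoly {R : Type*} [CommRing R] {n : ℕ} (y : Fin n → R)
    (h : MvPolynomial (Fin (n + 1)) R) :
    Polynomial.derivative (fiberPoly y h) = fiberPoly y (pderiv 0 h) := by
  rw [fiberPoly_eq_linePoly, derivative_linePoly, dirDeriv, Fin.sum_univ_succ]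
  simp

theorem natDegree_fiberPoly_le {R : Type*} [CommRing R] {n : ℕ} (y : Fin n → R)
    (h : MvPolynomial (Fin (n + 1)) R) : (fiberPoly y h).natDegree ≤ h.totalDegree :=
  fiberPoly_eq_linePoly y ▸ natDegree_linePoly_le _ _ h

theorem eval_of_tail_eq_zero {n d : ℕ} {R : Type*} [CommRing R] {F : MvPolynomial (Fin (n + 1)) R}
    (hF : F.IsHomogeneous d) {v : Fin (n + 1) → R} (hv : Fin.tail v = 0) :
    eval v F = coeff (Finsupp.single 0 d) F * v 0 ^ d := by
  rw [eval_eq', Finset.sum_eq_single (Finsupp.single 0 d)]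
  · rw [Fin.prod_univ_succ, Finset.prod_eq_one fun i _ => ?_, mul_one, Finsupp.single_eq_same]
    rw [Finsupp.single_eq_of_ne (Fin.succ_ne_zero i), pow_zero]
  · intro α hα hne
    by_cases h : ∃ i : Fin n, α i.succ ≠ 0
    · obtain ⟨i, hi⟩ := h
      rw [Finset.prod_eq_zero (Finset.mem_univ i.succ), mul_zero]
      rw [show v i.succ = 0 from congrFun hv i, zero_pow hi]
    · push Not at h
      refine absurd (Finsupp.ext fun i => ?_) hne
      have h1 : α.degree = d := by
        rw [Finsupp.degree_eq_weight_one]; exact hF (mem_support_iff.1 hα)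
      rw [Finsupp.degree_eq_sum, Fin.sum_univ_succ, Finset.sum_eq_zero fun i _ => h i, add_zero] at h1
      refine Fin.cases ?_ (fun i => ?_) i
      · rw [h1, Finsupp.single_eq_same]
      · rw [h i, Finsupp.single_eq_of_ne (Fin.succ_ne_zero i)]
  · intro h
    rw [notMem_support_iff.1 h, zero_mul]

theorem coeff_homogeneousComponent_single {n d : ℕ} {R : Type*} [CommSemiring R]
    (f : MvPolynomial (Fin (n + 1)) R) :
    coeff (Finsupp.single 0 d) (homogeneousComponent d f) = coeff (Finsupp.single 0 d) f := by
  rw [coeff_homogeneousComponent, Finsupp.degree_single, if_pos rfl]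

theorem coeff_fiberPoly_top {R : Type*} [CommRing R] {n d : ℕ} (y : Fin n → R)
    (h : MvPolynomial (Fin (n + 1)) R) (hd : h.totalDegree ≤ d) :
    (fiberPoly y h).coeff d = coeff (Finsupp.single 0 d) h := by
  rw [fiberPoly_eq_linePoly, coeff_linePoly_top _ _ hd,
    eval_of_tail_eq_zero (homogeneousComponent_isHomogeneous d h) (Fin.tail_cons _ _),
    coeff_homogeneousComponent_single, Fin.cons_zero, one_pow, mul_one]

theorem card_fiber_zeros_le {K : Type*} [CommRing K] [IsDomain K] [DecidableEq K] {n : ℕ}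
    (h : MvPolynomial (Fin (n + 1)) K)
    (T : Finset (Fin (n + 1) → K)) (y : Fin n → K) (hT : ∀ P ∈ T, Fin.tail P = y)
    (h0 : ∀ P ∈ T, eval P h = 0) (h1 : fiberPoly y h ≠ 0) : T.card ≤ h.totalDegree := by
  have hsub : T.image (fun P => P 0) ⊆ (fiberPoly y h).roots.toFinset := by
    intro x hx
    obtain ⟨P, hP, rfl⟩ := Finset.mem_image.1 hx
    rw [Multiset.mem_toFinset, Polynomial.mem_roots h1, Polynomial.IsRoot, eval_fiberPoly,
      ← hT P hP, Fin.cons_self_tail]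
    exact h0 P hP
  have hinj : Set.InjOn (fun P : Fin (n + 1) → K => P 0) T := by
    intro P hP Q hQ hPQ
    rw [← Fin.cons_self_tail P, ← Fin.cons_self_tail Q, hT P hP, hT Q hQ]
    exact congrArg (fun x => (Fin.cons x y : Fin (n + 1) → K)) hPQ
  rw [← Finset.card_image_of_injOn hinj]
  exact (Finset.card_le_card hsub).trans ((Multiset.toFinset_card_le _).trans
    ((Polynomial.card_roots' _).trans (natDegree_fiberPoly_le y h)))

theorem card_nonsingular_zeros_le_mul_card {K : Type*} [Field K] {n : ℕ}
    (h : MvPolynomial (Fin (n + 1)) K) (T : Finset (Fin (n + 1) → K))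
    (h0 : ∀ P ∈ T, eval P h = 0) (h1 : ∀ P ∈ T, eval P (pderiv 0 h) ≠ 0) (U : Finset (Fin n → K))
    (hU : ∀ P ∈ T, Fin.tail P ∈ U) : T.card ≤ h.totalDegree * U.card := by
  classical
  refine (Finset.card_le_mul_card_image (f := (Fin.tail : (Fin (n + 1) → K) → Fin n → K)) T
    h.totalDegree fun y hy => ?_).trans (Nat.mul_le_mul_left _ (Finset.card_le_card
      (Finset.image_subset_iff.2 hU)))
  obtain ⟨P, hP, rfl⟩ := Finset.mem_image.1 hy
  refine card_fiber_zeros_le h _ (Fin.tail P) (fun Q hQ => (Finset.mem_filter.1 hQ).2)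
    (fun Q hQ => h0 Q (Finset.mem_filter.1 hQ).1) fun hz => h1 P hP ?_
  rw [← Fin.cons_self_tail P, ← eval_fiberPoly, ← derivative_fiberPoly, hz]
  simp

theorem eval_zmod {n : ℕ} (p : ℕ) (Q : Fin n → ℤ) (h : MvPolynomial (Fin n) ℤ) :
    eval (fun i => (Q i : ZMod p)) (map (Int.castRingHom (ZMod p)) h) = (eval Q h : ℤ) := by
  rw [eval_map]
  exact (eval₂_comp_left (Int.castRingHom (ZMod p)) (RingHom.id ℤ) Q h).symm

theorem totalDegree_map_le' {n : ℕ} {R S : Type*} [CommSemiring R] [CommSemiring S] (φ : R →+* S)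
    (h : MvPolynomial (Fin n) R) : (map φ h).totalDegree ≤ h.totalDegree :=
  Finset.sup_mono (support_map_subset _ _)

/-- Number of residue classes of nonsingular integral zeros. -/
theorem card_image_nonsingular_le {n : ℕ} (h : MvPolynomial (Fin (n + 1)) ℤ) {p : ℕ}
    (hp : p.Prime) (Z : Finset (Fin (n + 1) → ℤ)) (h0 : ∀ Q ∈ Z, eval Q h = 0)
    (h1 : ∀ Q ∈ Z, ¬ (p : ℤ) ∣ eval Q (pderiv 0 h)) :
    (Z.image fun Q i => (Q i : ZMod p)).card ≤ h.totalDegree * p ^ n := by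
  haveI := Fact.mk hp
  have := card_nonsingular_zeros_le_mul_card (map (Int.castRingHom (ZMod p)) h)
    (Z.image fun Q i => (Q i : ZMod p)) (fun P hP => by
      obtain ⟨Q, hQ, rfl⟩ := Finset.mem_image.1 hP
      rw [eval_zmod, h0 Q hQ, Int.cast_zero])
    (fun P hP => by
      obtain ⟨Q, hQ, rfl⟩ := Finset.mem_image.1 hP
      rw [pderiv_map, eval_zmod, Ne, ZMod.intCast_zmod_eq_zero_iff_dvd]
      exact h1 Q hQ) Finset.univ (fun _ _ => Finset.mem_univ _)
  rw [Finset.card_univ, Fintype.card_fun, ZMod.card, Fintype.card_fin] at this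
  exact this.trans (Nat.mul_le_mul_right _ (totalDegree_map_le' _ _))

theorem abs_eval_le {n : ℕ} (g : MvPolynomial (Fin n) ℤ) (δ H b : ℕ) (hb : 1 ≤ b)
    (hδ : g.totalDegree ≤ δ) (hH : ∀ α, (coeff α g).natAbs ≤ H) (Q : Fin n → ℤ)
    (hQ : ∀ i, |Q i| ≤ b) : (eval Q g).natAbs ≤ (expLE n δ).card * (H * b ^ δ) := by
  have hsub : g.support ⊆ expLE n δ := by
    intro α hα
    rw [mem_expLE]
    exact (le_totalDegree hα).trans hδ
  rw [eval_eq]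
  refine (Int.natAbs_sum_le _ _).trans ?_
  calc _ ≤ ∑ α ∈ g.support, H * b ^ δ := by
        refine Finset.sum_le_sum fun α hα => ?_
        rw [Int.natAbs_mul]
        refine Nat.mul_le_mul (hH α) ?_
        have := abs_prod_pow_le hQ α
        rw [Int.abs_eq_natAbs] at this
        have h2 : (∏ i, Q i ^ α i).natAbs ≤ b ^ α.degree := by exact_mod_cast this
        have h3 : ∏ i ∈ α.support, Q i ^ α i = ∏ i, Q i ^ α i :=
          Finsupp.prod_fintype α (fun i k => Q i ^ k) (fun i => pow_zero _)
        rw [h3]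
        exact h2.trans (Nat.pow_le_pow_right hb (mem_expLE.1 (hsub hα)))
    _ = g.support.card * (H * b ^ δ) := by rw [Finset.sum_const, smul_eq_mul]
    _ ≤ _ := Nat.mul_le_mul_right _ (Finset.card_le_card hsub)

theorem totalDegree_pderiv_le {n : ℕ} {R : Type*} [CommRing R] (i : Fin n) (g : MvPolynomial (Fin n) R) :
    (pderiv i g).totalDegree ≤ g.totalDegree - 1 := by
  rw [totalDegree, Finset.sup_le_iff]
  intro α hα
  rw [mem_support_iff, coeff_pderiv] at hα
  have hm : α + Finsupp.single i 1 ∈ g.support := by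
    rw [mem_support_iff]; intro h0; apply hα; rw [h0]; simp
  have := le_totalDegree hm
  change (α + Finsupp.single i 1).degree ≤ _ at this
  rw [map_add, Finsupp.degree_single] at this
  change α.degree ≤ _
  omega

theorem natAbs_coeff_pderiv_le {n : ℕ} (i : Fin n) (g : MvPolynomial (Fin n) ℤ) (H : ℕ)
    (hH : ∀ α, (coeff α g).natAbs ≤ H) (α) :
    (coeff α (pderiv i g)).natAbs ≤ g.totalDegree * H := by
  by_cases h0 : coeff (α + Finsupp.single i 1) g = 0
  · rw [coeff_pderiv, h0]; simp
  have hm : α + Finsupp.single i 1 ∈ g.support := by rwa [mem_support_iff]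
  have := le_totalDegree hm
  change (α + Finsupp.single i 1).degree ≤ _ at this
  rw [map_add, Finsupp.degree_single] at this
  have h2 := Finsupp.le_degree i α
  rw [coeff_pderiv, Int.natAbs_mul, mul_comm]
  refine Nat.mul_le_mul ?_ (hH _)
  have : ((α i : ℤ) + 1).natAbs = α i + 1 := by norm_cast

  omega

theorem totalDegree_pderiv_lt {n : ℕ} {R : Type*} [CommRing R] (i : Fin n) {g : MvPolynomial (Fin n) R}
    (hg : 0 < g.totalDegree) : (pderiv i g).totalDegree < g.totalDegree :=
  (totalDegree_pderiv_le i g).trans_lt (Nat.pred_lt hg.ne')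

theorem sq_exponent_ineq {s δ e l : ℕ} {Lb y : ℝ} (he : 2 ≤ e) (hl : 1 ≤ l)
    (hδ : δ = 4 * e * l) (hs : 2 * s + e * (e - 1) = 2 * e * (δ + 1))
    (hLb : Lb ≤ l) (hLb0 : 0 ≤ Lb) (hy : Lb + 3 * e ≤ e * y)
    (h : (s:ℝ) * (s - 1) * y ≤ 2 * (s * (s - 1)) + e * δ * (δ + 1) * Lb) : False := by
  have heR : (2:ℝ) ≤ e := by exact_mod_cast he
  have hlR : (1:ℝ) ≤ l := by exact_mod_cast hl
  obtain ⟨x, hx⟩ : ∃ x : ℝ, x = 1 / (8 * l) := ⟨_, rfl⟩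
  have hxl : x * l = 1 / 8 := by rw [hx]; field_simp
  have hx0 : 0 < x := by rw [hx]; positivity
  have hx8 : x ≤ 1 / 8 := by nlinarith
  have hδR : (δ:ℝ) = 4 * e * l := by rw [hδ]; push_cast; ring
  have hδ1 : (1:ℝ) ≤ x * δ := by
    have : x * δ = e / 2 := by rw [hδR]; linear_combination 4 * (e:ℝ) * hxl
    linarith
  have hδ4 : (4:ℝ) ≤ δ := by rw [hδR]; nlinarith
  have hsR : 2 * (s:ℝ) + e * (e - 1) = 2 * e * (δ + 1) := by
    have : ((2 * s + e * (e - 1) : ℕ) : ℝ) = ((2 * e * (δ + 1) : ℕ) : ℝ) := by rw [hs]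
    push_cast [Nat.cast_sub (show 1 ≤ e by omega)] at this
    exact this
  have hU : (e:ℝ) * δ * (1 - x) = e * δ - e * e / 2 := by
    rw [hδR]; linear_combination (-4 * (e:ℝ) * e) * hxl
  have hs1 : (e:ℝ) * δ * (1 - x) ≤ s - 1 := by
    rw [hU]; nlinarith
  have hU0 : 0 ≤ (e:ℝ) * δ * (1 - x) := by
    apply mul_nonneg (by positivity); linarith
  have hss : ((e:ℝ) * δ * (1 - x)) ^ 2 ≤ s * (s - 1) := by nlinarith
  have hy2 : 0 ≤ y - 2 := by
    by_contra hneg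
    push Not at hneg
    nlinarith
  have h1 : ((e:ℝ) * δ * (1 - x)) ^ 2 * (y - 2) ≤ e * δ * (δ + 1) * Lb :=
    (mul_le_mul_of_nonneg_right hss hy2).trans (by linarith)
  have h2 : (e:ℝ) * δ * (δ + 1) * Lb ≤ e * δ * (δ * (1 + x)) * Lb := by
    apply mul_le_mul_of_nonneg_right _ hLb0
    apply mul_le_mul_of_nonneg_left _ (by positivity)
    linarith
  have hed : 0 < (e:ℝ) * δ * δ := by positivity
  have h3 : (1 - x) ^ 2 * (e * (y - 2)) ≤ (1 + x) * Lb := by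
    refine le_of_mul_le_mul_left ?_ hed
    calc _ = ((e:ℝ) * δ * (1 - x)) ^ 2 * (y - 2) := by ring
      _ ≤ _ := h1.trans h2
      _ = _ := by ring
  have h4 : (Lb + e) * (1 - x)^2 ≤ (1 + x) * Lb := by nlinarith [sq_nonneg (1 - x)]
  nlinarith [mul_nonneg hx0.le hLb0, mul_nonneg (sq_nonneg x) hLb0]

/-- Zeros of a plane curve in one nonsingular residue class of a large prime. -/
theorem card_class_le {h : MvPolynomial (Fin 2) ℤ} {e b l p : ℕ} (he : 2 ≤ e) (hl : 1 ≤ l)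
    (hb : 1 ≤ b) (hbl : b ≤ 2 ^ l) (hdeg : h.totalDegree = e)
    (hlead : coeff (Finsupp.single 0 e) h ≠ 0)
    (hirr : Irreducible (map (Int.castRingHom ℚ) h)) (hp : p.Prime) (hpb : 32 ^ e * b ≤ p ^ e)
    (Z : Finset (Fin 2 → ℤ)) (hZ : ∀ x ∈ Z, eval x h = 0 ∧ ∀ i, |x i| ≤ b)
    {P : Fin 2 → ℤ} (hP0 : eval P h = 0) (hP1 : ¬ (p : ℤ) ∣ eval P (pderiv 0 h))
    (hZP : ∀ x ∈ Z, ∀ i, (p : ℤ) ∣ x i - P i) : Z.card ≤ 4 * e ^ 2 * l := by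
  classical
  by_contra hcard
  push Not at hcard
  set δ := 4 * e * l with hδ
  have heδ : e ≤ δ := by rw [hδ]; nlinarith
  obtain ⟨Q, hQZ, hdet⟩ := determinant_method (lowExp 1 e δ) Z b (fun x hx => (hZ x hx).2)
    (fun g hg hsupp => by
      by_contra hno
      push Not at hno
      have h1 := card_zeros_le_of_not_dvd hirr
        (not_dvd_of_support_subset hlead hg fun α hα => (mem_lowExp.1 (hsupp hα)).2) Z
        (fun x hx => (hZ x hx).1) hno
      have h2 : g.totalDegree ≤ δ := by
        rw [totalDegree, Finset.sup_le_iff]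
        exact fun α hα => (mem_lowExp.1 (hsupp hα)).1
      have h3 : h.totalDegree * g.totalDegree ≤ e * δ := by rw [hdeg]; exact Nat.mul_le_mul_left _ h2
      rw [hδ] at h3
      nlinarith)
  set s := (lowExp 1 e δ).card with hs
  have hs2 : 2 * s + e * (e - 1) = 2 * e * (δ + 1) := two_mul_card_lowExp_one_le e δ heδ
  have hsd := two_mul_sum_degree_lowExp_one e δ heδ
  obtain ⟨f₁, hf₁, hf₁'⟩ := exists_shiftScale_eq_of_nonsingular hp hP0 hP1
  have hidx := index_span_sup_ordIdeal hp (k := s) hf₁ hf₁'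
  have hs1 : 1 ≤ s := by
    by_contra h0
    have : s = 0 := by omega
    rw [this] at hs2
    have h1 : e * (e - 1) ≤ e * e := Nat.mul_le_mul_left _ (by omega)
    have h2 : e * e ≤ e * δ := Nat.mul_le_mul_left _ heδ
    nlinarith
  have hmain := hdet Unit (fun _ => Ideal.span {h} ⊔ ordIdeal P p s) (fun _ => hidx.1) {p}
    (by simpa using hp) (fun _ => s) (fun _ => Finset.univ) (fun q hq j _ => by
      rw [Finset.mem_singleton] at hq
      subst hq
      exact ⟨(), fun F hF => dvd_eval_of_mem_sup hF (hZP _ (hQZ j)) (hZ _ (hQZ j)).1⟩)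
  rw [Finset.prod_singleton, Finset.card_univ, Fintype.card_coe, Finset.univ_unique,
    Finset.prod_singleton, ← hs] at hmain
  have hIco : Finset.Ico (s - 1) s = {s - 1} := by
    ext m; simp only [Finset.mem_Ico, Finset.mem_singleton]; omega
  have hle := hmain.trans (Nat.mul_le_mul_right _ hidx.2)
  rw [hIco, Finset.sum_singleton] at hle
  have hT := two_mul_card_expLE_two (s - 1)
  set T := (expLE 2 (s - 1)).card with hTdef
  set D := ∑ α ∈ lowExp 1 e δ, α.degree with hD
  rw [show s - 1 + 1 = s by omega, show s - 1 + 2 = s + 1 by omega] at hT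
  -- take logarithms
  have hp0 : (0:ℝ) < p := by exact_mod_cast hp.pos
  have hb0 : (0:ℝ) < b := by exact_mod_cast hb
  have hsR : (1:ℝ) ≤ s := by exact_mod_cast hs1
  have hLb0 : 0 ≤ Real.log b := Real.log_nonneg (by exact_mod_cast hb)
  have hlog : (s:ℝ) * s * Real.log p ≤
      T * Real.log p + (s * Real.log s + D * Real.log b) := by
    have h1 : ((p ^ (s * s) : ℕ) : ℝ) ≤ ((p ^ T * (s ^ s * b ^ D) : ℕ) : ℝ) := by
      apply Nat.cast_le.2
      exact hle.trans (Nat.mul_le_mul_left _ (Nat.mul_le_mul_right _ (Nat.factorial_le_pow s)))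
    push_cast at h1
    have h2 := Real.log_le_log (by positivity) h1
    rw [Real.log_mul (by positivity) (by positivity), Real.log_mul (by positivity) (by positivity),
      Real.log_pow, Real.log_pow, Real.log_pow, Real.log_pow] at h2
    push_cast at h2
    linarith
  have hTR : 2 * (T:ℝ) = s * (s + 1) := by exact_mod_cast hT
  have hDR : 2 * (D:ℝ) ≤ e * δ * (δ + 1) := by exact_mod_cast hsd
  have hlogs := Real.log_le_sub_one_of_pos (by linarith : (0:ℝ) < s)
  have hLbl : Real.log b ≤ l := by
    have : Real.log b ≤ Real.log ((2:ℝ) ^ l) := Real.log_le_log hb0 (by exact_mod_cast hbl)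
    rw [Real.log_pow] at this
    have h2 := Real.log_two_lt_d9
    have : (0:ℝ) ≤ l := by positivity
    nlinarith
  have hy : Real.log b + 3 * e ≤ e * Real.log p := by
    have h1 : ((32:ℝ) ^ e * b) ≤ (p:ℝ) ^ e := by exact_mod_cast hpb
    have h2 := Real.log_le_log (by positivity) h1
    rw [Real.log_mul (by positivity) (by positivity), Real.log_pow, Real.log_pow] at h2
    have h32 : Real.log 32 = 5 * Real.log 2 := by
      rw [show (32:ℝ) = 2 ^ 5 by norm_num, Real.log_pow]; norm_num
    have h3 := Real.log_two_gt_d9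
    have : (0:ℝ) ≤ e := by positivity
    rw [h32] at h2
    nlinarith
  refine sq_exponent_ineq he hl hδ hs2 hLbl hLb0 hy ?_
  have h5 : 2 * (s * Real.log s) ≤ 2 * ((s:ℝ) * (s - 1)) := by
    have := mul_le_mul_of_nonneg_left hlogs (by linarith : (0:ℝ) ≤ s)
    linarith
  have h6 : 2 * (D:ℝ) * Real.log b ≤ e * δ * (δ + 1) * Real.log b :=
    mul_le_mul_of_nonneg_right hDR hLb0
  have h7 : 2 * (T:ℝ) * Real.log p = s * (s + 1) * Real.log p := by rw [hTR]
  linarith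

theorem eval_sum_monomial {n : ℕ} (s : Finset (Fin n →₀ ℕ)) (t : s → ℤ) (x : Fin n → ℤ) :
    eval x (∑ α : s, monomial (α : Fin n →₀ ℕ) (t α)) = ∑ α : s, t α * ∏ i, x i ^ (α : Fin n →₀ ℕ) i := by
  simp only [map_sum, eval_monomial]
  refine Finset.sum_congr rfl fun α _ => ?_
  congr 1
  exact Finsupp.prod_fintype _ _ fun i => pow_zero _

/-- A set of integral points in a box lying on a hypersurface of degree at most `e` lies on one
with coefficients of controlled size. -/
theorem exists_small_vanishing {n e b : ℕ} {h : MvPolynomial (Fin n) ℤ} (hb : 1 ≤ b) (h0 : h ≠ 0)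
    (hdeg : h.totalDegree ≤ e) (Z : Finset (Fin n → ℤ))
    (hZ : ∀ x ∈ Z, eval x h = 0 ∧ ∀ i, |x i| ≤ b) :
    ∃ h' : MvPolynomial (Fin n) ℤ, h' ≠ 0 ∧ h'.totalDegree ≤ e ∧ (∀ x ∈ Z, eval x h' = 0) ∧
      ∀ α, (coeff α h').natAbs ≤ ((expLE n e).card * b ^ e) ^ (expLE n e).card := by
  classical
  have hrep : ∑ α : expLE n e, monomial (α : Fin n →₀ ℕ) (coeff (α : Fin n →₀ ℕ) h) = h := by
    rw [Finset.sum_coe_sort (expLE n e) fun α => monomial α (coeff α h)]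
    conv_rhs => rw [as_sum h]
    symm
    refine Finset.sum_subset (fun α hα => mem_expLE.2 ((le_totalDegree hα).trans hdeg)) ?_
    intro α _ hα
    rw [notMem_support_iff.1 hα, monomial_zero]
  obtain ⟨t, ht0, htk, htb⟩ := exists_small_kernel (α := Z) (ι := expLE n e)
    (fun x α => ∏ i, x.1 i ^ α.1 i) (b ^ e) (Nat.one_le_pow _ _ hb)
    (fun x α => (abs_prod_pow_le (hZ x.1 x.2).2 α.1).trans (by
      exact_mod_cast Nat.pow_le_pow_right hb (mem_expLE.1 α.2)))
    (fun α => coeff α.1 h) (by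
      intro hc
      apply h0
      rw [← hrep]
      exact Finset.sum_eq_zero fun α _ => by rw [congrFun hc α]; simp)
    (fun x => by
      rw [← eval_sum_monomial, hrep]
      exact (hZ x.1 x.2).1)
  have hco : ∀ α, coeff α (∑ β : expLE n e, monomial (β : Fin n →₀ ℕ) (t β)) =
      if hα : α ∈ expLE n e then t ⟨α, hα⟩ else 0 := by
    intro α
    simp only [coeff_sum, coeff_monomial]
    split_ifs with hα
    · rw [Finset.sum_eq_single ⟨α, hα⟩]
      · simp
      · intro β _ hβ
        rw [if_neg]
        intro h1
        exact hβ (Subtype.ext h1)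
      · simp
    · refine Finset.sum_eq_zero fun β _ => ?_
      rw [if_neg]
      rintro rfl
      exact hα β.2
  refine ⟨∑ α : expLE n e, monomial (α : Fin n →₀ ℕ) (t α), ?_, ?_, ?_, ?_⟩
  · intro hz
    apply ht0
    funext α
    have := hco α.1
    rw [hz, dif_pos α.2] at this
    simpa using this.symm
  · rw [totalDegree, Finset.sup_le_iff]
    intro α hα
    by_contra hlt
    rw [mem_support_iff, hco, dif_neg] at hα
    · exact hα rfl
    · rw [mem_expLE]; exact hlt
  · intro x hx
    rw [eval_sum_monomial]
    exact htk ⟨x, hx⟩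
  · intro α
    rw [hco]
    split_ifs with hα
    · simpa using htb ⟨α, hα⟩
    · simp

theorem totalDegree_map_rat {n : ℕ} (h : MvPolynomial (Fin n) ℤ) :
    (map (Int.castRingHom ℚ) h).totalDegree = h.totalDegree := by
  rw [totalDegree, totalDegree, support_map_of_injective _ Int.cast_injective]

theorem map_rat_injective {n : ℕ} : Function.Injective (map (σ := Fin n) (Int.castRingHom ℚ)) :=
  map_injective _ (Int.cast_injective (α := ℚ))

theorem eq_C_mul_of_dvd {n e : ℕ} {h h' : MvPolynomial (Fin n) ℤ} (hdeg : h.totalDegree = e)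
    (hdeg' : h'.totalDegree ≤ e) (h0' : h' ≠ 0)
    (hdvd : map (Int.castRingHom ℚ) h ∣ map (Int.castRingHom ℚ) h') :
    ∃ r : ℚ, r ≠ 0 ∧ map (Int.castRingHom ℚ) h' = C r * map (Int.castRingHom ℚ) h := by
  obtain ⟨q, hq⟩ := hdvd
  have hne : map (Int.castRingHom ℚ) h' ≠ 0 := fun hz => h0' (map_rat_injective (by rw [hz, map_zero]))
  have hq0 : q ≠ 0 := by rintro rfl; exact hne (by rw [hq, mul_zero])
  have hh0 : map (Int.castRingHom ℚ) h ≠ 0 := by intro hz; exact hne (by rw [hq, hz, zero_mul])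
  have := totalDegree_mul_of_isDomain hh0 hq0
  rw [← hq, totalDegree_map_rat, totalDegree_map_rat] at this
  have hq1 : q.totalDegree = 0 := by omega
  rw [totalDegree_eq_zero_iff_eq_C] at hq1
  refine ⟨coeff 0 q, ?_, ?_⟩
  · intro hz; apply hq0; rw [hq1, hz, C_0]
  · rw [hq]; conv_lhs => rw [hq1]
    ring

/-- A nonzero multiple of the same degree of an irreducible polynomial is irreducible. -/
theorem irreducible_of_eq_C_mul {n : ℕ} {h h' : MvPolynomial (Fin n) ℚ} {r : ℚ} (hr : r ≠ 0)
    (hirr : Irreducible h) (heq : h' = C r * h) : Irreducible h' := by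
  have hu : IsUnit (C r : MvPolynomial (Fin n) ℚ) := (isUnit_iff_ne_zero.2 hr).map C
  rw [heq]
  exact (irreducible_isUnit_mul hu).2 hirr

theorem not_dvd_of_totalDegree_lt {K : Type*} [Field K] {n : ℕ} {f g : MvPolynomial (Fin n) K}
    (hg : g ≠ 0) (h : g.totalDegree < f.totalDegree) : ¬ f ∣ g := fun hd =>
  absurd (totalDegree_le_of_dvd_of_isDomain hd hg) (not_le.2 h)

theorem pderiv_ne_zero_of_coeff {n d : ℕ} {f : MvPolynomial (Fin (n + 1)) ℤ} (hd0 : 0 < d)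
    (hl : coeff (Finsupp.single 0 d) f ≠ 0) : pderiv 0 f ≠ 0 := by
  intro hz
  have h1 : coeff (Finsupp.single 0 (d - 1)) (pderiv 0 f) = 0 := by rw [hz, coeff_zero]
  rw [coeff_pderiv, ← Finsupp.single_add, Nat.sub_add_cancel hd0] at h1
  rcases mul_eq_zero.1 h1 with h | h
  · exact hl h
  · have : (0 : ℤ) ≤ ((Finsupp.single (0 : Fin (n + 1)) (d - 1)) 0 : ℕ) := by positivity
    omega

theorem not_dvd_map_pderiv {n d : ℕ} {f : MvPolynomial (Fin (n + 1)) ℤ} (hd0 : 0 < d)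
    (hd : f.totalDegree = d) (hl : coeff (Finsupp.single 0 d) f ≠ 0) :
    ¬ map (Int.castRingHom ℚ) f ∣ map (Int.castRingHom ℚ) (pderiv 0 f) :=
  not_dvd_of_totalDegree_lt
    (fun h => pderiv_ne_zero_of_coeff hd0 hl (map_rat_injective (h.trans (map_zero _).symm))) (by
      rw [totalDegree_map_rat, totalDegree_map_rat]
      exact totalDegree_pderiv_lt 0 (hd ▸ hd0))

theorem regime_one_arith {e l K X s m : ℕ} (he : 2 ≤ e) (hl : 1 ≤ l)
    (hX : X ≤ 2 ^ (l + 6)) (hK : K = 25 * e ^ 3 * l) (hX1 : 1 ≤ X) (hs : s ≤ K)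
    (hm : m ≤ 8 * (X + K + 2) * (Nat.log 2 (X + K + 2) + 1)) :
    e ^ 2 + (e ^ 2 + s * (e * m * (4 * e ^ 2 * l))) ≤ 10 ^ 6 * e ^ 10 * l ^ 4 * X := by
  have hlog : Nat.log 2 (X + K + 2) + 1 ≤ 17 * e * l := by
    have h1 : X + K + 2 < 2 ^ (2 * l + 3 * e + 11) := by
      have h2 : e ^ 3 ≤ 2 ^ (3 * e) := by
        rw [show 3 * e = e * 3 by ring, pow_mul]
        exact Nat.pow_le_pow_left Nat.lt_two_pow_self.le 3
      have h3 : l ≤ 2 ^ l := Nat.lt_two_pow_self.le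
      have h4 : K ≤ 25 * 2 ^ (3 * e) * 2 ^ l := by
        rw [hK]; gcongr
      have h5 : 1 ≤ 2 ^ l := Nat.one_le_two_pow
      have h6 : 1 ≤ 2 ^ (3 * e) := Nat.one_le_two_pow
      have e1 : 2 ^ (2 * l + 3 * e + 11) = 2048 * (2 ^ (3 * e) * (2 ^ l * 2 ^ l)) := by
        rw [pow_add, pow_add, two_mul, pow_add]; ring
      have e2 : 2 ^ (l + 6) = 64 * 2 ^ l := by rw [pow_add]; ring
      rw [e1]; rw [e2] at hX
      generalize 2 ^ l = u at *
      generalize 2 ^ (3 * e) = v at *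
      have h7 : u ≤ u * u := by nlinarith
      have h8 : u ≤ v * (u * u) := by nlinarith
      have h9 : v * u ≤ v * (u * u) := Nat.mul_le_mul_left _ h7
      nlinarith
    have := Nat.log_lt_of_lt_pow (by omega) h1
    nlinarith
  have hK2 : X + K + 2 ≤ 28 * (e ^ 3 * l * X) := by
    have h1 : 1 ≤ e ^ 3 * l := Nat.one_le_iff_ne_zero.2 (by positivity)
    have : K = 25 * (e ^ 3 * l) := by rw [hK]; ring
    rw [this]
    generalize e ^ 3 * l = u at *
    nlinarith
  have hm2 : m ≤ 8 * (28 * (e ^ 3 * l * X)) * (17 * e * l) := hm.trans (by gcongr)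
  calc e ^ 2 + (e ^ 2 + s * (e * m * (4 * e ^ 2 * l)))
      ≤ e ^ 2 + (e ^ 2 + 25 * e ^ 3 * l * (e * (8 * (28 * (e ^ 3 * l * X)) * (17 * e * l)) * (4 * e ^ 2 * l))) := by
        gcongr; rw [← hK]; exact hs
    _ = 2 * e ^ 2 + 380800 * (e ^ 10 * l ^ 4 * X) := by ring
    _ ≤ 2 * (e ^ 10 * l ^ 4 * X) + 380800 * (e ^ 10 * l ^ 4 * X) := by
        gcongr
        calc e ^ 2 = e ^ 2 * 1 * 1 := by ring
          _ ≤ e ^ 10 * l ^ 4 * X := by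
            gcongr
            · omega
            · norm_num
            · exact Nat.one_le_pow _ _ hl
    _ ≤ _ := by
        rw [← add_mul]
        calc _ ≤ 10 ^ 6 * (e ^ 10 * l ^ 4 * X) := Nat.mul_le_mul_right _ (by norm_num)
          _ = _ := by ring

theorem exponent_arith {e l s : ℕ} (he : 2 ≤ e) (hl : 1 ≤ l) (hs : s ≤ 3 * e ^ 2) :
    (2 + 2 * e) + (e + ((2 + 2 * e) + l * e) * s + l * e) < 25 * e ^ 3 * l := by
  have h0 : e ≤ e * l := Nat.le_mul_of_pos_right _ hl
  have h3 : ((2 + 2 * e) + l * e) * s ≤ (4 * (e * l)) * (3 * e ^ 2) := by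
    apply Nat.mul_le_mul _ hs
    rw [mul_comm l e]; omega
  have h4 : (4 * (e * l)) * (3 * e ^ 2) = 12 * (e ^ 3 * l) := by ring
  have h5 : 4 * (e * l) ≤ e ^ 3 * l := by
    calc 4 * (e * l) = (2 ^ 2) * (e * l) := by norm_num
      _ ≤ e ^ 2 * (e * l) := by gcongr
      _ = _ := by ring
  have h6 : 0 < e ^ 3 * l := by positivity
  rw [h4] at h3
  rw [mul_comm l e] at h3 ⊢
  rw [mul_assoc 25]
  omega

/-- Integral points on a plane curve: bound efficient for small degree. -/
theorem card_curve_zeros_le_small_degree {h : MvPolynomial (Fin 2) ℤ} {e b l X : ℕ} (he : 2 ≤ e)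
    (hl : 1 ≤ l) (hb : 1 ≤ b) (hbl : b ≤ 2 ^ l) (hdeg : h.totalDegree = e)
    (hlead : coeff (Finsupp.single 0 e) h ≠ 0)
    (hirr : Irreducible (map (Int.castRingHom ℚ) h)) (hXb : 32 ^ e * b ≤ X ^ e)
    (hX : X ≤ 2 ^ (l + 6))
    (Z : Finset (Fin 2 → ℤ)) (hZ : ∀ x ∈ Z, eval x h = 0 ∧ ∀ i, |x i| ≤ b) :
    Z.card ≤ 10 ^ 6 * e ^ 10 * l ^ 4 * X := by
  classical
  have hX1 : 1 ≤ X := by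
    by_contra h0
    have : X = 0 := by omega
    rw [this, zero_pow (by omega)] at hXb
    have : 0 < 32 ^ e * b := by positivity
    omega
  set K := 25 * e ^ 3 * l with hK
  obtain ⟨S, hSK, hS⟩ := exists_primes X K
  have harith := regime_one_arith he hl hX hK hX1 hSK.le le_rfl
  have h0 : h ≠ 0 := by rintro rfl; simp at hlead
  obtain ⟨h', h0', hdeg', hZ', hH⟩ := exists_small_vanishing hb h0 hdeg.le Z hZ
  by_cases hdvd : map (Int.castRingHom ℚ) h ∣ map (Int.castRingHom ℚ) h'
  swap
  · have := card_zeros_le_of_not_dvd hirr hdvd Z (fun x hx => (hZ x hx).1) hZ'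
    have h2 : h.totalDegree * h'.totalDegree ≤ e * e := by rw [hdeg]; gcongr
    rw [← sq] at h2
    exact (this.trans h2).trans ((Nat.le_add_right _ _).trans harith)
  obtain ⟨r, hr, hrh⟩ := eq_C_mul_of_dvd hdeg hdeg' h0' hdvd
  have hirr' := irreducible_of_eq_C_mul hr hirr hrh
  have hdeg2 : h'.totalDegree = e := by
    have h1 : (C r * map (Int.castRingHom ℚ) h).totalDegree = h.totalDegree := by
      rw [totalDegree_mul_of_isDomain (by simpa using hr), totalDegree_C, zero_add,
        totalDegree_map_rat]
      intro hz; exact hirr.ne_zero hz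
    rw [← hdeg, ← h1, ← hrh, totalDegree_map_rat]
  have hlead' : coeff (Finsupp.single 0 e) h' ≠ 0 := by
    have h1 := congrArg (coeff (Finsupp.single 0 e)) hrh
    rw [coeff_C_mul, coeff_map, coeff_map] at h1
    intro hz
    rw [hz] at h1
    simp [hr, hlead] at h1
  set g := pderiv 0 h' with hg
  have hgd : ¬ map (Int.castRingHom ℚ) h' ∣ map (Int.castRingHom ℚ) g :=
    not_dvd_map_pderiv (by omega) hdeg2 hlead'
  have hgdeg : g.totalDegree ≤ e := (totalDegree_pderiv_le 0 h').trans (hdeg2 ▸ Nat.sub_le _ _)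
  have hsing : (Z.filter fun x => eval x g = 0).card ≤ e ^ 2 := by
    have := card_zeros_le_of_not_dvd hirr' hgd (Z.filter fun x => eval x g = 0)
      (fun x hx => hZ' x (Finset.mem_filter.1 hx).1) (fun x hx => (Finset.mem_filter.1 hx).2)
    have h2 : h'.totalDegree * g.totalDegree ≤ e * e := by
      rw [hdeg2]; gcongr
    nlinarith
  have hgbd : ∀ x ∈ Z, (eval x g).natAbs < 2 ^ K := by
    intro x hx
    set s := (expLE 2 e).card with hs
    have hs2 := two_mul_card_expLE_two e
    rw [← hs] at hs2
    have hs3 : s ≤ 3 * e ^ 2 := by nlinarith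
    have h1 := abs_eval_le g e _ b hb hgdeg (natAbs_coeff_pderiv_le 0 h' _ hH) x (hZ x hx).2
    rw [← hs, hdeg2] at h1
    have he2 : e ≤ 2 ^ e := Nat.lt_two_pow_self.le
    have hs4 : s ≤ 2 ^ (2 + 2 * e) := by
      calc s ≤ 3 * e ^ 2 := hs3
        _ ≤ 4 * (2 ^ e) ^ 2 := by gcongr; norm_num
        _ = _ := by rw [pow_add, mul_comm 2 e, pow_mul]; ring
    have hbe : b ^ e ≤ 2 ^ (l * e) := by rw [pow_mul]; gcongr
    have h2 : s * (e * (s * b ^ e) ^ s * b ^ e) ≤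
        2 ^ ((2 + 2 * e) + (e + ((2 + 2 * e) + l * e) * s + l * e)) := by
      rw [pow_add 2 (2 + 2 * e), pow_add 2 (e + _), pow_add 2 e, pow_mul 2 (2 + 2 * e + l * e),
        pow_add 2 (2 + 2 * e) (l * e)]
      gcongr
    refine lt_of_le_of_lt (h1.trans h2) ?_
    apply Nat.pow_lt_pow_right (by norm_num)
    exact exponent_arith he hl hs3
  have hclass : ∀ p ∈ S, (Z.filter fun x => ¬ (p : ℤ) ∣ eval x g).card ≤
      e * (8 * (X + K + 2) * (Nat.log 2 (X + K + 2) + 1)) * (4 * e ^ 2 * l) := by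
    intro p hp
    obtain ⟨hpp, hXp, hpY⟩ := hS p hp
    set Zp := Z.filter fun x => ¬ (p : ℤ) ∣ eval x g with hZp
    have h1 := card_image_nonsingular_le h' hpp Zp (fun x hx => hZ' x (Finset.mem_filter.1 hx).1)
      (fun x hx => (Finset.mem_filter.1 hx).2)
    have h2 := Finset.card_le_mul_card_image (f := fun (Q : Fin 2 → ℤ) i => (Q i : ZMod p)) Zp
      (4 * e ^ 2 * l) (fun c hc => by
        obtain ⟨P, hP, rfl⟩ := Finset.mem_image.1 hc
        rw [hZp, Finset.mem_filter] at hP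
        refine card_class_le he hl hb hbl hdeg2 hlead' hirr' hpp
          (hXb.trans (Nat.pow_le_pow_left hXp.le _)) _ (fun x hx => ?_) (hZ' P hP.1) hP.2
          (fun x hx i => ?_)
        · rw [Finset.mem_filter, hZp, Finset.mem_filter] at hx
          exact ⟨hZ' x hx.1.1, (hZ x hx.1.1).2⟩
        · have := congrFun (Finset.mem_filter.1 hx).2 i
          exact (ZMod.intCast_eq_intCast_iff_dvd_sub _ _ p).1 this.symm)
    rw [hdeg2, pow_one] at h1
    calc _ ≤ _ := h2
      _ ≤ (4 * e ^ 2 * l) * (e * p) := by gcongr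
      _ = e * p * (4 * e ^ 2 * l) := by ring
      _ ≤ _ := by gcongr
  have hns := card_le_of_not_dvd (Z.filter fun x => ¬ eval x g = 0) (fun x => eval x g)
    (fun p hp => (hS p hp).1) (fun x hx => (Finset.mem_filter.1 hx).2)
    (fun x hx => hSK.symm ▸ hgbd x (Finset.mem_filter.1 hx).1) fun p hp =>
      (Finset.card_le_card (Finset.filter_subset_filter _ (Finset.filter_subset _ _))).trans
        (hclass p hp)
  rw [← Finset.card_filter_add_card_filter_not (s := Z) fun x => eval x g = 0]
  exact (add_le_add hsing hns).trans ((Nat.le_add_left _ _).trans harith)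

section Bivariate
open scoped Polynomial

theorem card_mul_le_of_pow_dvd {R : Type*} [CommRing R] [IsDomain R] (F : R[X]) (hF : F ≠ 0)
    (T : Finset R) (m : ℕ)
    (hT : ∀ x ∈ T, (Polynomial.X - Polynomial.C x) ^ m ∣ F) : m * T.card ≤ F.natDegree := by
  classical
  have h1 : m • T.val ≤ F.roots := by
    rw [Multiset.le_iff_count]
    intro x
    rw [Multiset.count_nsmul, Polynomial.count_roots]
    by_cases hx : x ∈ T
    · have : Multiset.count x T.val = 1 := Multiset.count_eq_one_of_mem T.nodup hx
      rw [this, mul_one]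
      exact (Polynomial.le_rootMultiplicity_iff hF).2 (hT x hx)
    · have : Multiset.count x T.val = 0 := Multiset.count_eq_zero_of_notMem hx
      rw [this]; simp
  have h2 := Multiset.card_le_card h1
  rw [Multiset.card_nsmul] at h2
  exact h2.trans (Polynomial.card_roots' F)

theorem pow_dvd_of_taylor_coeff {R : Type*} [CommRing R] (F : R[X]) (x : R) (m : ℕ)
    (h : ∀ i < m, (Polynomial.taylor x F).coeff i = 0) : (Polynomial.X - Polynomial.C x) ^ m ∣ F := by
  have h1 : (Polynomial.X : R[X]) ^ m ∣ Polynomial.taylor x F := Polynomial.X_pow_dvd_iff.2 h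
  obtain ⟨G, hG⟩ := h1
  refine ⟨Polynomial.taylor (-x) G, ?_⟩
  have h2 := congrArg (Polynomial.taylor (-x)) hG
  rw [Polynomial.taylor_taylor, Polynomial.taylor_mul, Polynomial.taylor_X_pow] at h2
  simpa [sub_eq_add_neg] using h2

theorem natDegree_taylor_coeff_le {k : Type*} [Field k] (g : k[X][X]) (e : ℕ)
    (h1 : ∀ j, (g.coeff j).natDegree ≤ e) (c : k) (j : ℕ) :
    ((Polynomial.taylor (Polynomial.C c) g).coeff j).natDegree ≤ e := by
  rw [Polynomial.taylor_coeff, Polynomial.eval_eq_sum, Polynomial.sum]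
  refine Polynomial.natDegree_sum_le_of_forall_le _ _ fun i _ => ?_
  rw [← Polynomial.C_pow, Polynomial.hasseDeriv_coeff]
  refine (Polynomial.natDegree_mul_C_le _ _).trans ?_
  rw [← nsmul_eq_mul]
  exact (Polynomial.natDegree_smul_le _ _).trans (h1 _)

/-- Number of points of multiplicity at least `m` on a plane curve over a finite field. -/
theorem mul_card_mult_points_le {k : Type*} [Field k] [Fintype k] (g : k[X][X]) (hg : g ≠ 0) (e m : ℕ)
    (h1 : ∀ j, (g.coeff j).natDegree ≤ e) (h2 : g.natDegree ≤ e) (T : Finset (k × k))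
    (hT : ∀ P ∈ T, ∀ i j, i + j < m →
      (Polynomial.taylor P.1 ((Polynomial.taylor (Polynomial.C P.2) g).coeff j)).coeff i = 0) :
    m * T.card ≤ 4 * e * Fintype.card k := by
  classical
  set q := Fintype.card k
  set m' := (m + 1) / 2 with hm'
  set bad := Finset.univ.filter fun c : k => ∀ j < m',
    (Polynomial.taylor (Polynomial.C c) g).coeff j = 0 with hbad
  have hb : m' * bad.card ≤ e := by
    have := card_mul_le_of_pow_dvd g hg (bad.map ⟨Polynomial.C, Polynomial.C_injective⟩) m' (by
      intro x hx
      obtain ⟨c, hc, rfl⟩ := Finset.mem_map.1 hx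
      exact pow_dvd_of_taylor_coeff _ _ _ (Finset.mem_filter.1 hc).2)
    rw [Finset.card_map] at this
    exact this.trans h2
  have hrow : ∀ c, c ∉ bad → m' * (T.filter fun P => P.2 = c).card ≤ e := by
    intro c hc
    simp only [hbad, Finset.mem_filter, Finset.mem_univ, true_and, not_forall] at hc
    obtain ⟨j, hj, hne⟩ := hc
    have hinj : Set.InjOn Prod.fst (T.filter fun P => P.2 = c : Set (k × k)) := by
      intro P hP Q hQ h
      simp only [Finset.coe_filter, Set.mem_setOf_eq] at hP hQ
      exact Prod.ext h (hP.2.trans hQ.2.symm)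
    have := card_mul_le_of_pow_dvd _ hne ((T.filter fun P => P.2 = c).image Prod.fst) (m - j) (by
      intro x hx
      obtain ⟨P, hP, rfl⟩ := Finset.mem_image.1 hx
      rw [Finset.mem_filter] at hP
      refine pow_dvd_of_taylor_coeff _ _ _ fun i hi => ?_
      rw [← hP.2]
      exact hT P hP.1 i j (by omega))
    rw [Finset.card_image_of_injOn hinj] at this
    refine (Nat.mul_le_mul_right _ ?_).trans (this.trans (natDegree_taylor_coeff_le g e h1 c j))
    omega
  have hall : ∀ c, (T.filter fun P => P.2 = c).card ≤ q := by
    intro c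
    rw [← Finset.card_image_of_injOn (s := T.filter fun P => P.2 = c) (f := Prod.fst)]
    · exact Finset.card_le_univ _
    · intro P hP Q hQ h
      simp only [Finset.coe_filter, Set.mem_setOf_eq] at hP hQ
      exact Prod.ext h (hP.2.trans hQ.2.symm)
  have hsum : T.card = ∑ c : k, (T.filter fun P => P.2 = c).card :=
    Finset.card_eq_sum_card_fiberwise (fun _ _ => Finset.mem_univ _)
  have hmain : m' * T.card ≤ 2 * e * q := by
    rw [hsum, ← Finset.sum_filter_add_sum_filter_not _ (fun c => c ∈ bad), mul_add]
    have e1 : m' * ∑ c with c ∈ bad, (T.filter fun P => P.2 = c).card ≤ e * q := by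
      calc _ ≤ m' * (bad.card * q) := by
            gcongr
            rw [← smul_eq_mul]
            refine (Finset.sum_le_card_nsmul _ _ q fun c _ => hall c).trans ?_
            rw [Finset.filter_mem_eq_inter, Finset.univ_inter]
        _ = (m' * bad.card) * q := by ring
        _ ≤ e * q := by gcongr
    have e2 : m' * ∑ c with c ∉ bad, (T.filter fun P => P.2 = c).card ≤ e * q := by
      rw [Finset.mul_sum]
      calc _ ≤ ∑ c with c ∉ bad, e := Finset.sum_le_sum fun c hc => hrow c (Finset.mem_filter.1 hc).2
        _ ≤ ∑ c : k, e := Finset.sum_le_sum_of_subset (Finset.filter_subset _ _)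
        _ = e * q := by rw [Finset.sum_const, Finset.card_univ, smul_eq_mul, mul_comm]
    linarith
  have : m ≤ 2 * m' := by omega
  calc m * T.card ≤ 2 * m' * T.card := Nat.mul_le_mul_right _ this
    _ = 2 * (m' * T.card) := by ring
    _ ≤ 2 * (2 * e * q) := by gcongr
    _ = _ := by ring

/-- A polynomial in two variables as an iterated univariate polynomial. -/
noncomputable def toBivariate (R : Type*) [CommRing R] : MvPolynomial (Fin 2) R →ₐ[R] R[X][X] :=
  MvPolynomial.aeval ![Polynomial.C Polynomial.X, Polynomial.X]

theorem toBivariate_coeff {R : Type*} [CommRing R] (h : MvPolynomial (Fin 2) R) (i j : ℕ) :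
    ((toBivariate R h).coeff j).coeff i =
      MvPolynomial.coeff (Finsupp.single 0 i + Finsupp.single 1 j) h := by
  induction h using MvPolynomial.induction_on' with
  | monomial α a =>
    rw [toBivariate, MvPolynomial.aeval_monomial, MvPolynomial.coeff_monomial,
      Finsupp.prod_fintype _ _ fun _ => pow_zero _, Fin.prod_univ_two]
    simp only [Matrix.cons_val_zero, Matrix.cons_val_one]
    rw [← Polynomial.C_pow, ← mul_assoc,
      show algebraMap R R[X][X] a = Polynomial.C (Polynomial.C a) from rfl,
      ← Polynomial.C_mul, Polynomial.coeff_C_mul_X_pow]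
    have key : (α = Finsupp.single 0 i + Finsupp.single 1 j) ↔ j = α 1 ∧ i = α 0 := by
      constructor
      · rintro rfl; simp
      · rintro ⟨rfl, rfl⟩
        ext t; fin_cases t <;> simp
    by_cases hj : j = α 1
    · rw [if_pos hj, Polynomial.coeff_C_mul_X_pow, if_congr key rfl rfl]
      simp only [hj, true_and]
    · rw [if_neg hj, if_neg (fun h => hj (key.1 h).1), Polynomial.coeff_zero]
  | add p q hp hq => rw [map_add, Polynomial.coeff_add, Polynomial.coeff_add, MvPolynomial.coeff_add, hp, hq]

theorem toBivariate_shift {R : Type*} [CommRing R] (P : Fin 2 → R) (h : MvPolynomial (Fin 2) R) :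
    toBivariate R (MvPolynomial.aeval (fun i => MvPolynomial.C (P i) + MvPolynomial.X i) h) =
      (Polynomial.taylor (Polynomial.C (P 1)) (toBivariate R h)).map (Polynomial.taylorAlgHom (P 0)).toRingHom := by
  induction h using MvPolynomial.induction_on with
  | C a =>
    rw [← MvPolynomial.algebraMap_eq, AlgHom.commutes, AlgHom.commutes]
    rw [show algebraMap R R[X][X] a = Polynomial.C (Polynomial.C a) from rfl, Polynomial.taylor_C, Polynomial.map_C]
    congr 1
    exact (Polynomial.taylor_C (P 0) a).symm
  | add p q hp hq => simp only [map_add, Polynomial.map_add, hp, hq]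
  | mul_X p i hp =>
    rw [map_mul, map_mul, hp, map_mul, Polynomial.taylor_mul, Polynomial.map_mul]
    congr 1
    fin_cases i
    · simp [toBivariate, add_comm]
    · simp [toBivariate, add_comm]

end Bivariate

theorem map_shiftScale_one {n p : ℕ} (P : Fin n → ℤ) (h : MvPolynomial (Fin n) ℤ) :
    map (Int.castRingHom (ZMod p)) (shiftScale P 1 h) =
      aeval (fun i => C ((P i : ℤ) : ZMod p) + X i) (map (Int.castRingHom (ZMod p)) h) := by
  induction h using MvPolynomial.induction_on with
  | C a =>
    rw [← algebraMap_eq, AlgHom.commutes, algebraMap_eq, map_C]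
    simp
  | add p q hp hq => simp only [map_add, hp, hq]
  | mul_X p i hp =>
    rw [map_mul, map_mul, hp, map_mul, map_mul]
    congr 1
    simp [shiftScale]

theorem dvd_coeff_of_pow_dvd_shiftScale {n p m : ℕ} (hp : p ≠ 0) {P : Fin n → ℤ}
    {h : MvPolynomial (Fin n) ℤ} (hd : C ((p : ℤ) ^ m) ∣ shiftScale P p h) {α : Fin n →₀ ℕ}
    (hα : α.degree < m) : (p : ℤ) ∣ coeff α (shiftScale P 1 h) := by
  have h1 := (C_dvd_iff_dvd_coeff _ _).1 hd α
  rw [coeff_shiftScale] at h1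
  have h2 : (p : ℤ) ^ (α.degree + 1) ∣ (p : ℤ) ^ α.degree * coeff α (shiftScale P 1 h) :=
    (pow_dvd_pow _ hα).trans h1
  rw [pow_succ] at h2
  exact Int.dvd_of_mul_dvd_mul_left (pow_ne_zero _ (by exact_mod_cast hp)) h2

/-- Number of residue classes modulo `p` on which a primitive polynomial vanishes to high order. -/
theorem mul_card_high_classes_le {p e m : ℕ} (hp : p.Prime) {h : MvPolynomial (Fin 2) ℤ}
    (hprim : ¬ C (p : ℤ) ∣ h) (hdeg : h.totalDegree ≤ e) (Z : Finset (Fin 2 → ℤ))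
    (hZ : ∀ P ∈ Z, C ((p : ℤ) ^ m) ∣ shiftScale P p h) :
    m * (Z.image fun Q i => (Q i : ZMod p)).card ≤ 4 * e * p := by
  classical
  haveI := Fact.mk hp
  have hco : ∀ i j, ((toBivariate (ZMod p) (map (Int.castRingHom (ZMod p)) h)).coeff j).coeff i =
      ((coeff (Finsupp.single 0 i + Finsupp.single 1 j) h : ℤ) : ZMod p) := by
    intro i j
    rw [toBivariate_coeff, coeff_map]; rfl
  have hdeg' : ∀ i j, e < i + j → coeff (Finsupp.single 0 i + Finsupp.single 1 j) h = 0 := by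
    intro i j hij
    by_contra hne
    have := le_totalDegree (mem_support_iff.2 hne)
    change (Finsupp.single (0 : Fin 2) i + Finsupp.single 1 j).degree ≤ _ at this
    rw [map_add, Finsupp.degree_single, Finsupp.degree_single] at this
    omega
  have h1 := mul_card_mult_points_le (toBivariate (ZMod p) (map (Int.castRingHom (ZMod p)) h)) (by
      intro hz
      apply hprim
      rw [C_dvd_iff_dvd_coeff]
      intro α
      have h2 := hco (α 0) (α 1)
      rw [hz] at h2
      rw [← ZMod.intCast_zmod_eq_zero_iff_dvd]
      have h3 : Finsupp.single 0 (α 0) + Finsupp.single 1 (α 1) = α := by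
        ext t; fin_cases t <;> simp
      rw [h3] at h2
      simpa using h2.symm) e m (by
      intro j
      rw [Polynomial.natDegree_le_iff_coeff_eq_zero]
      intro i hi
      rw [hco, hdeg' i j (by omega), Int.cast_zero]) (by
      rw [Polynomial.natDegree_le_iff_coeff_eq_zero]
      intro j hj
      ext i
      rw [hco, hdeg' i j (by omega), Int.cast_zero, Polynomial.coeff_zero])
    ((Z.image fun Q i => (Q i : ZMod p)).image fun c => (c 0, c 1)) (by
      intro P hP i j hij
      obtain ⟨c, hc, rfl⟩ := Finset.mem_image.1 hP
      obtain ⟨Q, hQ, rfl⟩ := Finset.mem_image.1 hc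
      have h2 := congrArg (fun F => (F.coeff j).coeff i)
        (toBivariate_shift (fun i => (Q i : ZMod p)) (map (Int.castRingHom (ZMod p)) h))
      simp only [Polynomial.coeff_map] at h2
      refine Eq.trans h2.symm ?_
      rw [← map_shiftScale_one, toBivariate_coeff, coeff_map]
      refine (ZMod.intCast_zmod_eq_zero_iff_dvd _ p).2
        (dvd_coeff_of_pow_dvd_shiftScale hp.ne_zero (hZ Q hQ) ?_)
      rw [map_add, Finsupp.degree_single, Finsupp.degree_single]
      exact hij)
  rw [ZMod.card, Finset.card_image_of_injective] at h1
  · exact h1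
  · intro c c' hcc
    simp only [Prod.mk.injEq] at hcc
    funext t; fin_cases t
    · exact hcc.1
    · exact hcc.2

theorem low_arith {e l V v s k D p : ℕ} (he : 2 ≤ e) (hl : 1 ≤ l) (hV : 1 ≤ V) (hVe : 8 * l * V ≤ e)
    (hs : 2 * s + e * (e - 1) = 2 * e * (4 * e + 1)) (hD : 2 * D ≤ e * (4 * e) * (4 * e + 1))
    (hk : k = s / (2 * V)) (hp : 2 ≤ p) (b : ℕ) (hb : b ≤ 2 ^ l) (T : ℕ)
    (hT : 2 * T ≤ v * (k * (k + 1))) (hv : v ≤ V)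
    (hmain : p ^ (k * s) ≤ p ^ T * (s ^ s * b ^ D)) : False := by
  have hs1 : s ≤ 5 * e ^ 2 := by
    nlinarith [Nat.zero_le (e * (e - 1))]
  have hs2 : 7 * e ^ 2 ≤ 2 * s := by
    have : e * (e - 1) ≤ e * e := Nat.mul_le_mul_left _ (by omega)
    nlinarith
  have hkV : k * (2 * V) ≤ s := by rw [hk]; exact Nat.div_mul_le_self _ _
  have hkV2 : s < (k + 1) * (2 * V) := by
    rw [hk, mul_comm (s / (2 * V) + 1)]
    exact Nat.lt_mul_div_succ s (by omega)
  have hkl : 14 * (e * l) ≤ k := by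
    by_contra hlt
    have h1 : k + 1 ≤ 14 * (e * l) := by omega
    have h2 : (k + 1) * (2 * V) ≤ 14 * (e * l) * (2 * V) := Nat.mul_le_mul_right _ h1
    nlinarith
  have hk1 : 1 ≤ k := by nlinarith
  have hT2 : 2 * T ≤ k * s := by
    have h1 : v * (k * (k + 1)) ≤ V * (k * (2 * k)) := by gcongr; omega
    have h2 : V * (k * (2 * k)) = k * (k * (2 * V)) := by ring
    have h3 := Nat.mul_le_mul_left k hkV
    omega
  have h1 : p ^ (k * s) ≤ (s ^ s * b ^ D) ^ 2 := by
    have h2 : p ^ (2 * (k * s)) ≤ p ^ (k * s) * (s ^ s * b ^ D) ^ 2 := by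
      calc p ^ (2 * (k * s)) = (p ^ (k * s)) ^ 2 := by rw [mul_comm, pow_mul]
        _ ≤ (p ^ T * (s ^ s * b ^ D)) ^ 2 := by gcongr
        _ = p ^ (2 * T) * (s ^ s * b ^ D) ^ 2 := by rw [mul_pow, ← pow_mul, mul_comm T]
        _ ≤ _ := by gcongr; omega
    rw [two_mul, pow_add] at h2
    exact Nat.le_of_mul_le_mul_left h2 (by positivity)
  have hs3 : s ≤ 2 ^ (2 * e + 3) := by
    have : e < 2 ^ e := Nat.lt_two_pow_self
    calc s ≤ 5 * e ^ 2 := hs1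
      _ ≤ 8 * (2 ^ e) ^ 2 := by gcongr; norm_num
      _ = _ := by rw [pow_add, mul_comm 2 e, pow_mul]; ring
  have h2 : 2 ^ (k * s) ≤ 2 ^ (((2 * e + 3) * s + l * D) * 2) := by
    calc 2 ^ (k * s) ≤ p ^ (k * s) := Nat.pow_le_pow_left hp _
      _ ≤ _ := h1
      _ ≤ ((2 ^ (2 * e + 3)) ^ s * (2 ^ l) ^ D) ^ 2 := by gcongr
      _ = _ := by rw [← pow_mul, ← pow_mul, ← pow_add, ← pow_mul]
  have h3 := (Nat.pow_le_pow_iff_right (by norm_num)).1 h2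
  have h4 : D ≤ 9 * (e ^ 2 * e) := by
    have q1 : e * (4 * e) * (4 * e + 1) = 16 * (e ^ 2 * e) + 4 * e ^ 2 := by ring
    have q2 : e ^ 2 * 2 ≤ e ^ 2 * e := Nat.mul_le_mul_left _ he
    omega
  have h5 : 7 * D ≤ 18 * (e * s) := by
    have q1 := Nat.mul_le_mul_left (9 * e) hs2
    have q2 : 9 * e * (7 * e ^ 2) = 63 * (e ^ 2 * e) := by ring
    have q3 : 9 * e * (2 * s) = 18 * (e * s) := by ring
    omega
  have hs0 : 0 < s := by nlinarith
  have h6 : 14 * (e * l) * s ≤ k * s := Nat.mul_le_mul_right _ hkl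
  have h7 : 7 * (l * D) ≤ 18 * (e * l * s) := by
    calc 7 * (l * D) = l * (7 * D) := by ring
      _ ≤ l * (18 * (e * s)) := Nat.mul_le_mul_left _ h5
      _ = _ := by ring
  have h8 : (2 * e + 3) * s ≤ 4 * (e * l * s) := by
    have : 2 * e + 3 ≤ 4 * (e * l) := by nlinarith
    calc (2 * e + 3) * s ≤ 4 * (e * l) * s := Nat.mul_le_mul_right _ this
      _ = _ := by ring
  have h9 : 0 < e * l * s := by positivity
  have h10 : 14 * (e * l) * s = 14 * (e * l * s) := by ring
  omega

/-- Zeros of a plane curve of large degree in a residue class where it vanishes to low order. -/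
theorem card_low_class_le {h f₁ : MvPolynomial (Fin 2) ℤ} {e b l p V v : ℕ} (he : 2 ≤ e) (hl : 1 ≤ l)
    (hbl : b ≤ 2 ^ l) (hdeg : h.totalDegree = e)
    (hlead : coeff (Finsupp.single 0 e) h ≠ 0)
    (hirr : Irreducible (map (Int.castRingHom ℚ) h)) (hp : p.Prime) (hV : 1 ≤ V)
    (hVe : 8 * l * V ≤ e) (hv : v ≤ V) (Z : Finset (Fin 2 → ℤ))
    (hZ : ∀ x ∈ Z, eval x h = 0 ∧ ∀ i, |x i| ≤ b)
    {P : Fin 2 → ℤ} (hf : shiftScale P p h = C ((p : ℤ) ^ v) * f₁) (hf₁ : ¬ C (p : ℤ) ∣ f₁)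
    (hZP : ∀ x ∈ Z, ∀ i, (p : ℤ) ∣ x i - P i) : Z.card ≤ 4 * e ^ 2 := by
  classical
  by_contra hcard
  push Not at hcard
  obtain ⟨Q, hQZ, hdet⟩ := determinant_method (lowExp 1 e (4 * e)) Z b (fun x hx => (hZ x hx).2)
    (fun g hg hsupp => by
      by_contra hno
      push Not at hno
      have h1 := card_zeros_le_of_not_dvd hirr
        (not_dvd_of_support_subset hlead hg fun α hα => (mem_lowExp.1 (hsupp hα)).2) Z
        (fun x hx => (hZ x hx).1) hno
      have h2 : g.totalDegree ≤ 4 * e := by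
        rw [totalDegree, Finset.sup_le_iff]
        exact fun α hα => (mem_lowExp.1 (hsupp hα)).1
      have h3 : h.totalDegree * g.totalDegree ≤ e * (4 * e) := by
        rw [hdeg]; exact Nat.mul_le_mul_left _ h2
      nlinarith)
  set s := (lowExp 1 e (4 * e)).card with hs
  have hs2 : 2 * s + e * (e - 1) = 2 * e * (4 * e + 1) :=
    two_mul_card_lowExp_one_le e (4 * e) (by omega)
  have hsd := two_mul_sum_degree_lowExp_one e (4 * e) (by omega)
  set k := s / (2 * V) with hk
  have hidx := index_span_sup_ordIdeal hp (k := k) hf hf₁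
  have hmain := hdet Unit (fun _ => Ideal.span {h} ⊔ ordIdeal P p k) (fun _ => hidx.1) {p}
    (by simpa using hp) (fun _ => k) (fun _ => Finset.univ) (fun q hq j _ => by
      rw [Finset.mem_singleton] at hq
      subst hq
      exact ⟨(), fun F hF => dvd_eval_of_mem_sup hF (hZP _ (hQZ j)) (hZ _ (hQZ j)).1⟩)
  rw [Finset.prod_singleton, Finset.card_univ, Fintype.card_coe, Finset.univ_unique,
    Finset.prod_singleton, ← hs] at hmain
  refine low_arith he hl hV hVe hs2 hsd hk hp.two_le b hbl
    (∑ j ∈ Finset.Ico (k - v) k, (expLE 2 j).card) ?_ hv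
    (hmain.trans (Nat.mul_le_mul hidx.2 (Nat.mul_le_mul_right _ (Nat.factorial_le_pow s))))
  rw [Finset.mul_sum]
  calc _ ≤ ∑ j ∈ Finset.Ico (k - v) k, k * (k + 1) := by
        refine Finset.sum_le_sum fun j hj => ?_
        rw [two_mul_card_expLE_two]
        have := (Finset.mem_Ico.1 hj).2
        exact Nat.mul_le_mul (by omega) (by omega)
    _ = (k - (k - v)) * (k * (k + 1)) := by rw [Finset.sum_const, Nat.card_Ico, smul_eq_mul]
    _ ≤ _ := Nat.mul_le_mul_right _ (by omega)

theorem exists_exact_pow {n p : ℕ} {F : MvPolynomial (Fin n) ℤ} (V : ℕ)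
    (h : ¬ C ((p : ℤ) ^ (V + 1)) ∣ F) :
    ∃ v ≤ V, ∃ f₁, F = C ((p : ℤ) ^ v) * f₁ ∧ ¬ C (p : ℤ) ∣ f₁ := by
  induction V with
  | zero => exact ⟨0, le_rfl, F, by simp, by simpa using h⟩
  | succ V ih =>
    by_cases h1 : C ((p : ℤ) ^ (V + 1)) ∣ F
    · obtain ⟨f₁, hf₁⟩ := h1
      refine ⟨V + 1, le_rfl, f₁, hf₁, ?_⟩
      rintro ⟨g, rfl⟩
      exact h ⟨g, by rw [hf₁, pow_succ _ (V + 1), map_mul, mul_assoc]⟩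
    · obtain ⟨v, hv, r⟩ := ih h1
      exact ⟨v, by omega, r⟩

theorem exists_primitive {n : ℕ} (h : MvPolynomial (Fin n) ℤ) (h0 : h ≠ 0) :
    ∃ (c : ℤ) (h' : MvPolynomial (Fin n) ℤ), c ≠ 0 ∧ h = C c * h' ∧
      ∀ p : ℕ, p.Prime → ¬ C (p : ℤ) ∣ h' := by
  obtain ⟨α, hα⟩ := ne_zero_iff.1 h0
  generalize hm : (coeff α h).natAbs = m
  induction m using Nat.strong_induction_on generalizing h with
  | _ m ih =>
    by_cases hp : ∃ p : ℕ, p.Prime ∧ C (p : ℤ) ∣ h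
    · obtain ⟨p, hp, g, rfl⟩ := hp
      rw [coeff_C_mul] at hα hm
      have hg := right_ne_zero_of_mul hα
      rw [Int.natAbs_mul, Int.natAbs_natCast] at hm
      have hlt : (coeff α g).natAbs < m := by
        rw [← hm]
        have := Int.natAbs_pos.2 hg
        have := hp.two_le
        nlinarith
      obtain ⟨c, h', hc, hh, hprim⟩ := ih _ hlt g (ne_zero_iff.2 ⟨α, hg⟩) hg rfl
      exact ⟨p * c, h', mul_ne_zero (by exact_mod_cast hp.ne_zero) hc,
        by rw [hh, map_mul, mul_assoc], hprim⟩
    · push Not at hp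
      exact ⟨1, h, one_ne_zero, by simp, hp⟩

theorem regime_two_log {l δ K : ℕ} (hl : 1 ≤ l) (hδ : δ = 2 ^ 20 * l ^ 3)
    (hK : K = 2 * (l + 2) * δ + 1) :
    K + 2 ≤ 9 * l * δ ∧ 8 * (K + 2) * (Nat.log 2 (K + 2) + 1) ≤ 1800 * l ^ 2 * δ := by
  have hl3 : 1 ≤ l ^ 3 := Nat.one_le_pow _ _ hl
  have hδ1 : 2 ^ 20 ≤ δ := by rw [hδ]; exact Nat.le_mul_of_pos_right _ hl3
  have h1 : δ ≤ l * δ := Nat.le_mul_of_pos_left _ hl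
  have hK2 : K + 2 ≤ 9 * l * δ := by
    have e1 : 2 * (l + 2) * δ = 2 * (l * δ) + 4 * δ := by ring
    have e2 : 9 * l * δ = 9 * (l * δ) := by ring
    omega
  have hlog : Nat.log 2 (K + 2) + 1 ≤ 25 * l := by
    have h2 : K + 2 < 2 ^ (24 + 4 * (l - 1) + 1) := by
      have h3 : l ≤ 2 ^ (l - 1) := by
        have := Nat.lt_two_pow_self (n := l - 1)
        omega
      have h4 : l ^ 4 ≤ 2 ^ (4 * (l - 1)) := by
        rw [mul_comm 4, pow_mul]; exact Nat.pow_le_pow_left h3 4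
      calc K + 2 ≤ 9 * l * δ := hK2
        _ = 9 * 2 ^ 20 * l ^ 4 := by rw [hδ]; ring
        _ ≤ 9 * 2 ^ 20 * 2 ^ (4 * (l - 1)) := Nat.mul_le_mul_left _ h4
        _ < 2 ^ 25 * 2 ^ (4 * (l - 1)) := by gcongr; norm_num
        _ = _ := by rw [← pow_add]; congr 1; ring
    have := Nat.log_lt_of_lt_pow (by omega) h2
    omega
  refine ⟨hK2, ?_⟩
  calc 8 * (K + 2) * (Nat.log 2 (K + 2) + 1) ≤ 8 * (9 * l * δ) * (25 * l) := by gcongr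
    _ = _ := by ring

theorem regime_two_contra {s δ l b D K : ℕ} (hs0 : 2 * s = (δ + 1) * (δ + 2)) (hbl : b ≤ 2 ^ l)
    (hD : D ≤ s * δ) (hK : K = 2 * (l + 2) * δ + 1) (S : Finset ℕ) (hS : S.card = K)
    (hS2 : ∀ p ∈ S, 2 ≤ p) (c : ℕ → ℕ) (hc : ∀ p ∈ S, 2 * c p ≤ s)
    (hmain : ∏ p ∈ S, p ^ s ≤ (∏ p ∈ S, p ^ c p) * (s ^ s * b ^ D)) : False := by
  have hpos : ∀ p ∈ S, 0 < p := fun p hp => by have := hS2 p hp; omega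
  have h1 : ∏ p ∈ S, p ^ s ≤ (s ^ s * b ^ D) ^ 2 := by
    have h2 : (∏ p ∈ S, p ^ c p) ^ 2 ≤ ∏ p ∈ S, p ^ s := by
      rw [← Finset.prod_pow]
      refine Finset.prod_le_prod' fun p hp => ?_
      rw [← pow_mul]
      exact Nat.pow_le_pow_right (hpos p hp) (by have := hc p hp; omega)
    have h3 : (∏ p ∈ S, p ^ s) ^ 2 ≤ (∏ p ∈ S, p ^ s) * (s ^ s * b ^ D) ^ 2 := by
      calc _ ≤ ((∏ p ∈ S, p ^ c p) * (s ^ s * b ^ D)) ^ 2 := by gcongr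
        _ = (∏ p ∈ S, p ^ c p) ^ 2 * (s ^ s * b ^ D) ^ 2 := mul_pow _ _ _
        _ ≤ _ := Nat.mul_le_mul_right _ h2
    rw [sq] at h3
    exact Nat.le_of_mul_le_mul_left h3 (Finset.prod_pos fun p hp => pow_pos (hpos p hp) _)
  have h2 : 2 ^ (K * s) ≤ ∏ p ∈ S, p ^ s := by
    rw [← hS, mul_comm, pow_mul]
    exact Finset.pow_card_le_prod _ _ _ fun p hp => Nat.pow_le_pow_left (hS2 p hp) _
  have hs1 : s ≤ 2 ^ (2 * δ) := by
    have : δ + 1 ≤ 2 ^ δ := Nat.lt_two_pow_self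
    calc s ≤ (δ + 1) ^ 2 := by nlinarith
      _ ≤ (2 ^ δ) ^ 2 := by gcongr
      _ = _ := by rw [← pow_mul, mul_comm]
  have h3 : 2 ^ (K * s) ≤ 2 ^ ((2 * δ * s + l * (s * δ)) * 2) := by
    calc 2 ^ (K * s) ≤ (s ^ s * b ^ D) ^ 2 := h2.trans h1
      _ ≤ ((2 ^ (2 * δ)) ^ s * (2 ^ l) ^ (s * δ)) ^ 2 := by
        refine Nat.pow_le_pow_left (Nat.mul_le_mul (Nat.pow_le_pow_left hs1 _) ?_) 2
        calc b ^ D ≤ (2 ^ l) ^ D := Nat.pow_le_pow_left hbl _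
          _ ≤ _ := Nat.pow_le_pow_right (by positivity) hD
      _ = _ := by rw [← pow_mul, ← pow_mul, ← pow_add, ← pow_mul]
  have h4 := (Nat.pow_le_pow_iff_right (by norm_num)).1 h3
  have h5 : 0 < s := by nlinarith
  rw [show (2 * δ * s + l * (s * δ)) * 2 = (2 * (l + 2) * δ) * s by ring] at h4
  have := Nat.le_of_mul_le_mul_right h4 h5
  omega

theorem regime_two_total {e l δ K Y : ℕ} (hl : 1 ≤ l) (he : 1 ≤ e) (hδ : δ = 2 ^ 20 * l ^ 3)
    (hK : K ≤ 9 * l * δ) (hY : Y ≤ 1800 * l ^ 2 * δ) :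
    e * δ + K * (4 * e ^ 2 * Y ^ 2) ≤ 2 ^ 88 * l ^ 14 * e ^ 2 := by
  have h1 : K * (4 * e ^ 2 * Y ^ 2) ≤ (9 * l * δ) * (4 * e ^ 2 * (1800 * l ^ 2 * δ) ^ 2) := by gcongr
  have h2 : (9 * l * δ) * (4 * e ^ 2 * (1800 * l ^ 2 * δ) ^ 2) =
      (9 * 4 * 1800 ^ 2 * 2 ^ 60) * (l ^ 14 * e ^ 2) := by rw [hδ]; ring
  have h3 : e * δ ≤ 2 ^ 20 * (l ^ 14 * e ^ 2) := by
    rw [hδ]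
    calc e * (2 ^ 20 * l ^ 3) ≤ e ^ 2 * (2 ^ 20 * l ^ 14) := by
          gcongr
          · exact Nat.le_self_pow (by norm_num) e
          · norm_num
      _ = _ := by ring
  rw [h2] at h1
  have h4 : 2 ^ 88 * l ^ 14 * e ^ 2 = 2 ^ 88 * (l ^ 14 * e ^ 2) := mul_assoc _ _ _
  omega

theorem exists_class_reps {n : ℕ} (p : ℕ) (Z : Finset (Fin n → ℤ)) : ∃ R : Finset (Fin n → ℤ), R ⊆ Z ∧
    R.card ≤ (Z.image fun Q i => (Q i : ZMod p)).card ∧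
    ∀ Q ∈ Z, ∃ P ∈ R, ∀ i, (p : ℤ) ∣ Q i - P i := by
  classical
  choose! φ hφ using fun c (hc : c ∈ Z.image fun (Q : Fin n → ℤ) i => (Q i : ZMod p)) =>
    Finset.mem_image.1 hc
  refine ⟨(Z.image fun Q i => (Q i : ZMod p)).image φ, fun P hP => ?_, Finset.card_image_le,
    fun Q hQ => ?_⟩
  · obtain ⟨c, hc, rfl⟩ := Finset.mem_image.1 hP
    exact (hφ c hc).1
  · have hm := Finset.mem_image_of_mem (fun Q i => (Q i : ZMod p)) hQ
    refine ⟨_, Finset.mem_image_of_mem φ hm, fun i => ?_⟩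
    exact (ZMod.intCast_eq_intCast_iff_dvd_sub _ _ p).1 (congrFun (hφ _ hm).2 i)

theorem card_curve_zeros_le_large_degree {h : MvPolynomial (Fin 2) ℤ} {e b l δ : ℕ}
    (hl : 1 ≤ l) (hbl : b ≤ 2 ^ l) (hδ : δ = 2 ^ 20 * l ^ 3) (hδe : δ < e)
    (hdeg : h.totalDegree = e)
    (hlead : coeff (Finsupp.single 0 e) h ≠ 0)
    (hirr : Irreducible (map (Int.castRingHom ℚ) h))
    (hprim : ∀ p : ℕ, p.Prime → ¬ C (p : ℤ) ∣ h)
    (Z : Finset (Fin 2 → ℤ)) (hZ : ∀ x ∈ Z, eval x h = 0 ∧ ∀ i, |x i| ≤ b) :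
    Z.card ≤ 2 ^ 88 * l ^ 14 * e ^ 2 := by
  classical
  have hl3 : 1 ≤ l ^ 3 := Nat.one_le_pow _ _ hl
  have hle : 8 * l ≤ e := by
    have : l ≤ l ^ 3 := Nat.le_self_pow (by norm_num) l
    omega
  set V := e / (8 * l) with hV
  have hV1 : 1 ≤ V := Nat.div_pos hle (by omega)
  have hVe : 8 * l * V ≤ e := Nat.mul_div_le _ _
  have hVe' : e ≤ (V + 1) * (8 * l) := by
    rw [mul_comm]; exact (Nat.lt_mul_div_succ e (by omega)).le
  set K := 2 * (l + 2) * δ + 1 with hK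
  obtain ⟨hK2, hY⟩ := regime_two_log hl hδ hK
  obtain ⟨S, hSc, hS⟩ := exists_primes 0 K
  rw [zero_add] at hS
  set Y := 8 * (K + 2) * (Nat.log 2 (K + 2) + 1) with hYd
  let High : (Fin 2 → ℤ) → ℕ → Prop := fun P p => C ((p : ℤ) ^ (V + 1)) ∣ shiftScale P p h
  set Zh := Z.filter fun P => ∀ p ∈ S, High P p with hZh
  have hhigh : Zh.card ≤ e * δ := by
    by_contra hcard
    push Not at hcard
    obtain ⟨Q, hQZ, hdet⟩ := determinant_method (expLE 2 δ) Zh b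
      (fun x hx => (hZ x (Finset.mem_filter.1 hx).1).2)
      (fun g hg hsupp => by
        by_contra hno
        push Not at hno
        have h1 := card_zeros_le_of_not_dvd hirr
          (not_dvd_of_support_subset hlead hg fun α hα => by
            have := mem_expLE.1 (hsupp hα)
            have := Finsupp.le_degree 0 α
            omega) Zh
          (fun x hx => (hZ x (Finset.mem_filter.1 hx).1).1) hno
        have h2 : g.totalDegree ≤ δ := by
          rw [totalDegree, Finset.sup_le_iff]
          exact fun α hα => mem_expLE.1 (hsupp hα)
        have h3 : h.totalDegree * g.totalDegree ≤ e * δ := by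
          rw [hdeg]; exact Nat.mul_le_mul_left _ h2
        omega)
    set s := (expLE 2 δ).card with hs
    have hs2 : 2 * s = (δ + 1) * (δ + 2) := two_mul_card_expLE_two δ
    choose R _ hRc hR using fun p : ℕ => exists_class_reps p Zh
    have hRl : ∀ p ∈ S, (R p).card ≤ 32 * l * p := by
      intro p hp
      have h1 := mul_card_high_classes_le (m := V + 1) (hS p hp).1 (hprim p (hS p hp).1) hdeg.le Zh
        (fun P hP => (Finset.mem_filter.1 hP).2 p hp)
      have h2 : (V + 1) * (Zh.image fun Q i => (Q i : ZMod p)).card ≤ (V + 1) * (32 * l * p) := by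
        calc _ ≤ 4 * e * p := h1
          _ ≤ 4 * ((V + 1) * (8 * l)) * p := by gcongr
          _ = _ := by ring
      exact (hRc p).trans (Nat.le_of_mul_le_mul_left h2 (by omega))
    have hmain := hdet (Σ p : S, R p) (fun x => ordIdeal (x.2 : Fin 2 → ℤ) (x.1 : ℕ) 1)
      (fun x => (index_ordIdeal _ (hS x.1 x.1.2).1 1).1) S (fun p hp => (hS p hp).1)
      (fun _ => 1) (fun _ => Finset.univ) (fun p hp j _ => by
        obtain ⟨P, hP, hPQ⟩ := hR p _ (hQZ j)
        exact ⟨⟨⟨p, hp⟩, ⟨P, hP⟩⟩, fun F hF => dvd_eval_of_mem_ordIdeal hF hPQ⟩)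
    rw [Finset.card_univ, Fintype.card_coe, ← hs] at hmain
    simp only [one_mul] at hmain
    refine regime_two_contra (l := l) (K := K) hs2 hbl (D := ∑ α ∈ expLE 2 δ, α.degree) ?_ hK S hSc
      (fun p hp => (hS p hp).1.two_le) (fun p => (R p).card) ?_
      (hmain.trans (Nat.mul_le_mul ?_ (Nat.mul_le_mul_right _ (Nat.factorial_le_pow s))))
    · exact Finset.sum_le_card_nsmul _ _ _ fun α hα => mem_expLE.1 hα
    · intro p hp
      have h1 := hRl p hp
      have h2 := (hS p hp).2.2.trans hY
      have h3 : 2 * (2 * (32 * l * p)) ≤ (δ + 1) * (δ + 2) := by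
        calc 2 * (2 * (32 * l * p)) ≤ 2 * (2 * (32 * l * (1800 * l ^ 2 * δ))) := by gcongr
          _ = (230400 * l ^ 3) * δ := by ring
          _ ≤ (2 ^ 20 * l ^ 3) * δ := by gcongr; norm_num
          _ = δ * δ := by rw [← hδ]
          _ ≤ _ := by gcongr <;> omega
      omega
    · rw [Fintype.prod_sigma, ← Finset.prod_coe_sort S fun p => p ^ (R p).card]
      refine Finset.prod_le_prod' fun p _ => ?_
      calc _ ≤ ∏ _c : R p, (p : ℕ) ^ 1 := by
            refine Finset.prod_le_prod' fun c _ => ?_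
            refine (index_ordIdeal _ (hS p p.2).1 1).2.trans ?_
            rw [Finset.sum_range_one, card_expLE]
            simp
        _ = _ := by simp
  have hlow : ∀ p ∈ S, (Z.filter fun P => ¬ High P p).card ≤ 4 * e ^ 2 * Y ^ 2 := by
    intro p hp
    haveI := Fact.mk (hS p hp).1
    refine (Finset.card_le_mul_card_image (f := fun (Q : Fin 2 → ℤ) i => (Q i : ZMod p))
      (Z.filter fun P => ¬ High P p) (4 * e ^ 2) ?_).trans ?_
    · intro c hc
      obtain ⟨P, hP, rfl⟩ := Finset.mem_image.1 hc
      obtain ⟨v, hv, f₁, hf, hf₁⟩ := exists_exact_pow V (Finset.mem_filter.1 hP).2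
      refine card_low_class_le (by omega) hl hbl hdeg hlead hirr (hS p hp).1 hV1 hVe hv _
        (fun x hx => hZ x (Finset.mem_filter.1 (Finset.mem_filter.1 hx).1).1) hf hf₁ ?_
      intro x hx i
      exact (ZMod.intCast_eq_intCast_iff_dvd_sub _ _ p).1 (congrFun (Finset.mem_filter.1 hx).2 i).symm
    · refine Nat.mul_le_mul_left _ ((Finset.card_le_univ _).trans ?_)
      rw [Fintype.card_fun, ZMod.card, Fintype.card_fin]
      exact Nat.pow_le_pow_left (hS p hp).2.2 2
  have hcover : Z ⊆ Zh ∪ S.biUnion fun p => Z.filter fun P => ¬ High P p := by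
    intro P hP
    by_cases hh : ∀ p ∈ S, High P p
    · exact Finset.mem_union_left _ (Finset.mem_filter.2 ⟨hP, hh⟩)
    · push Not at hh
      obtain ⟨p, hp, hnp⟩ := hh
      exact Finset.mem_union_right _ (Finset.mem_biUnion.2 ⟨p, hp, Finset.mem_filter.2 ⟨hP, hnp⟩⟩)
  calc Z.card ≤ Zh.card + (S.biUnion fun p => Z.filter fun P => ¬ High P p).card :=
        (Finset.card_le_card hcover).trans (Finset.card_union_le _ _)
    _ ≤ e * δ + K * (4 * e ^ 2 * Y ^ 2) := by
      refine Nat.add_le_add hhigh ?_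
      rw [← hSc]
      exact Finset.card_biUnion_le_card_mul _ _ _ hlow
    _ ≤ _ := regime_two_total hl (by omega) hδ (by omega) hY

/-- Integral points on an irreducible plane curve with a pure power of the first variable. -/
theorem card_curve_zeros_le_of_lead {h : MvPolynomial (Fin 2) ℤ} {e b l X : ℕ} (he : 2 ≤ e)
    (hl : 1 ≤ l) (hb : 1 ≤ b) (hbl : b ≤ 2 ^ l) (hdeg : h.totalDegree = e)
    (hlead : coeff (Finsupp.single 0 e) h ≠ 0)
    (hirr : Irreducible (map (Int.castRingHom ℚ) h)) (hXb : 32 ^ e * b ≤ X ^ e)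
    (hX : X ≤ 2 ^ (l + 6))
    (Z : Finset (Fin 2 → ℤ)) (hZ : ∀ x ∈ Z, eval x h = 0 ∧ ∀ i, |x i| ≤ b) :
    Z.card ≤ 2 ^ 180 * l ^ 28 * e ^ 2 * X := by
  have hX1 : 1 ≤ X := by
    by_contra h0
    have : X = 0 := by omega
    rw [this, zero_pow (by omega)] at hXb
    have : 0 < 32 ^ e * b := by positivity
    omega
  by_cases hδ : e ≤ 2 ^ 20 * l ^ 3
  · calc Z.card ≤ 10 ^ 6 * e ^ 10 * l ^ 4 * X :=
          card_curve_zeros_le_small_degree he hl hb hbl hdeg hlead hirr hXb hX Z hZ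
      _ = 10 ^ 6 * (e ^ 8 * e ^ 2) * l ^ 4 * X := by ring
      _ ≤ 10 ^ 6 * ((2 ^ 20 * l ^ 3) ^ 8 * e ^ 2) * l ^ 4 * X := by gcongr
      _ = (10 ^ 6 * 2 ^ 160) * (l ^ 28 * e ^ 2 * X) := by ring
      _ ≤ 2 ^ 180 * (l ^ 28 * e ^ 2 * X) := by gcongr; norm_num
      _ = _ := by ring
  · push Not at hδ
    have hh0 : h ≠ 0 := by rintro rfl; simp at hlead
    obtain ⟨c, h', hc, rfl, hprim⟩ := exists_primitive h hh0
    have hh' : h' ≠ 0 := right_ne_zero_of_mul hh0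
    have hcC : (C c : MvPolynomial (Fin 2) ℤ) ≠ 0 := by simpa using hc
    rw [totalDegree_mul_of_isDomain hcC hh', totalDegree_C, zero_add] at hdeg
    rw [coeff_C_mul] at hlead
    have hirr' : Irreducible (map (Int.castRingHom ℚ) h') := by
      have hu : IsUnit (C (c : ℚ) : MvPolynomial (Fin 2) ℚ) :=
        (isUnit_iff_ne_zero.2 (by exact_mod_cast hc)).map C
      rw [map_mul, map_C] at hirr
      exact (irreducible_isUnit_mul hu).1 hirr
    have := card_curve_zeros_le_large_degree hl hbl rfl hδ hdeg (right_ne_zero_of_mul hlead) hirr'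
      hprim Z (fun x hx => ⟨by
        have := (hZ x hx).1
        rw [map_mul, eval_C] at this
        exact (mul_eq_zero.1 this).resolve_left hc, (hZ x hx).2⟩)
    calc Z.card ≤ 2 ^ 88 * l ^ 14 * e ^ 2 := this
      _ ≤ 2 ^ 180 * l ^ 28 * e ^ 2 := by gcongr <;> norm_num
      _ ≤ _ := Nat.le_mul_of_pos_right _ hX1

/-- The linear substitution `x₀ ↦ x₀`, `xᵢ ↦ xᵢ + aᵢ x₀`. -/
noncomputable def shear {R : Type*} [CommRing R] {n : ℕ} (a : Fin n → R) :
    MvPolynomial (Fin (n + 1)) R →ₐ[R] MvPolynomial (Fin (n + 1)) R :=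
  aeval (Fin.cons (X 0) fun i => X i.succ + C (a i) * X 0)

section
variable {R : Type*} [CommRing R] {n : ℕ}

theorem eval_shear (a : Fin n → R) (x : Fin (n + 1) → R) (f : MvPolynomial (Fin (n + 1)) R) :
    eval x (shear a f) = eval (Fin.cons (x 0) fun i => x i.succ + a i * x 0 : Fin (n + 1) → R) f := by
  induction f using MvPolynomial.induction_on with
  | C r => simp [shear]
  | add p q hp hq => simp only [map_add, hp, hq]
  | mul_X p i hp =>
    rw [map_mul, map_mul, hp, map_mul]
    congr 1
    refine Fin.cases ?_ (fun j => ?_) i <;> simp [shear]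

theorem shear_X_zero (a : Fin n → R) : shear a (X 0) = X 0 := by simp [shear]

theorem shear_X_succ (a : Fin n → R) (i : Fin n) : shear a (X i.succ) = X i.succ + C (a i) * X 0 := by
  simp [shear]

theorem shear_C (a : Fin n → R) (r : R) : shear a (C r) = C r := by simp [shear]

theorem shear_shear (a b : Fin n → R) (f : MvPolynomial (Fin (n + 1)) R) :
    shear a (shear b f) = shear (a + b) f := by
  have : (shear a).comp (shear b) = shear (a + b) := by
    apply MvPolynomial.algHom_ext
    intro i
    rw [AlgHom.comp_apply]
    refine Fin.cases ?_ (fun j => ?_) i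
    · rw [shear_X_zero, shear_X_zero, shear_X_zero]
    · rw [shear_X_succ, map_add, map_mul, shear_X_zero, shear_X_succ, shear_X_succ, shear_C,
        Pi.add_apply, C_add]
      ring
  exact congrArg (fun F => F f) this

theorem shear_zero (f : MvPolynomial (Fin (n + 1)) R) : shear 0 f = f := by
  induction f using MvPolynomial.induction_on with
  | C r => simp [shear]
  | add p q hp hq => simp only [map_add, hp, hq]
  | mul_X p i hp =>
    rw [map_mul, hp]
    congr 1
    refine Fin.cases ?_ (fun j => ?_) i <;> simp [shear]

/-- `shear` as an automorphism. -/
noncomputable def shearEquiv (a : Fin n → R) :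
    MvPolynomial (Fin (n + 1)) R ≃ₐ[R] MvPolynomial (Fin (n + 1)) R :=
  AlgEquiv.ofAlgHom (shear a) (shear (-a))
    (AlgHom.ext fun f => by simp [shear_shear, shear_zero])
    (AlgHom.ext fun f => by simp [shear_shear, shear_zero])

theorem shearEquiv_apply (a : Fin n → R) (f : MvPolynomial (Fin (n + 1)) R) :
    shearEquiv a f = shear a f := rfl

theorem map_shear {S : Type*} [CommRing S] (φ : R →+* S) (a : Fin n → R)
    (f : MvPolynomial (Fin (n + 1)) R) : map φ (shear a f) = shear (fun i => φ (a i)) (map φ f) := by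
  induction f using MvPolynomial.induction_on with
  | C r => simp [shear]
  | add p q hp hq => simp only [map_add, hp, hq]
  | mul_X p i hp =>
    rw [map_mul, map_mul, hp, map_mul, map_mul]
    congr 1
    refine Fin.cases ?_ (fun j => ?_) i <;> simp [shear]

theorem shear_isHomogeneous (a : Fin n → R) {f : MvPolynomial (Fin (n + 1)) R} {d : ℕ}
    (hf : f.IsHomogeneous d) : (shear a f).IsHomogeneous d := by
  have := hf.aeval (n := 1) (Fin.cons (X 0) fun i => X i.succ + C (a i) * X 0) (fun i => by
    refine Fin.cases ?_ (fun j => ?_) i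
    · exact isHomogeneous_X _ _
    · exact (isHomogeneous_X _ _).add (isHomogeneous_C_mul_X _ _))
  rwa [one_mul] at this

theorem homogeneousComponent_shear (a : Fin n → R) (f : MvPolynomial (Fin (n + 1)) R) (d : ℕ) :
    homogeneousComponent d (shear a f) = shear a (homogeneousComponent d f) := by
  conv_lhs => rw [← sum_homogeneousComponent f]
  rw [map_sum, map_sum]
  have h1 : ∀ i, homogeneousComponent d (shear a (homogeneousComponent i f)) =
      if i = d then shear a (homogeneousComponent d f) else 0 := by
    intro i
    rw [homogeneousComponent_of_mem (shear_isHomogeneous a (homogeneousComponent_isHomogeneous i f))]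
    split_ifs with h1 h2 h2
    · rw [h1]
    · exact absurd h1.symm h2
    · exact absurd h2.symm h1
    · rfl
  simp only [h1]
  rw [Finset.sum_ite_eq']
  split_ifs with h
  · rfl
  · rw [Finset.mem_range, not_lt] at h
    rw [homogeneousComponent_eq_zero _ _ (by omega), map_zero]

theorem totalDegree_shear_le (a : Fin n → R) (f : MvPolynomial (Fin (n + 1)) R) :
    (shear a f).totalDegree ≤ f.totalDegree := by
  conv_lhs => rw [← sum_homogeneousComponent f]
  rw [map_sum]
  refine totalDegree_finsetSum_le fun i hi => ?_
  have := (shear_isHomogeneous a (homogeneousComponent_isHomogeneous i f)).totalDegree_le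
  rw [Finset.mem_range] at hi
  omega

theorem totalDegree_shear (a : Fin n → R) (f : MvPolynomial (Fin (n + 1)) R) :
    (shear a f).totalDegree = f.totalDegree := by
  refine le_antisymm (totalDegree_shear_le a f) ?_
  have := totalDegree_shear_le (-a) (shear a f)
  rwa [shear_shear, neg_add_cancel, shear_zero] at this

theorem coeff_shear (a : Fin n → R) (f : MvPolynomial (Fin (n + 1)) R) (d : ℕ) :
    coeff (Finsupp.single 0 d) (shear a f) =
      eval (Fin.cons 1 a : Fin (n + 1) → R) (homogeneousComponent d f) := by
  have h : Fin.tail (Fin.cons 1 0 : Fin (n + 1) → R) = 0 := Fin.tail_cons _ _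
  have h1 := eval_of_tail_eq_zero (homogeneousComponent_isHomogeneous d (shear a f)) h
  rw [coeff_homogeneousComponent_single, Fin.cons_zero, one_pow, mul_one] at h1
  rw [← h1, homogeneousComponent_shear, eval_shear]
  simp

end

/-- A nonzero form does not vanish at some small point with first coordinate `1`. -/
theorem exists_eval_cons_one_ne_zero {n d : ℕ} {F : MvPolynomial (Fin (n + 1)) ℤ}
    (hF : F.IsHomogeneous d) (h0 : F ≠ 0) :
    ∃ a : Fin n → ℤ, (∀ i, 0 ≤ a i ∧ a i ≤ d) ∧ eval (Fin.cons 1 a : Fin (n + 1) → ℤ) F ≠ 0 := by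
  classical
  set G : MvPolynomial (Fin n) ℤ := (finSuccEquiv ℤ n F).eval 1 with hG
  have hev : ∀ a : Fin n → ℤ, eval (Fin.cons 1 a : Fin (n + 1) → ℤ) F = eval a G := by
    intro a
    rw [eval_eq_eval_mv_eval', hG, Polynomial.eval_one_map]
  have hG0 : G ≠ 0 := by
    obtain ⟨α, hα⟩ := ne_zero_iff.1 h0
    refine ne_zero_iff.2 ⟨α.tail, ?_⟩
    have hdα : α.degree = d := by
      by_contra hne; exact hα (hF.coeff_eq_zero hne)
    have hcons : ∀ i, (Finsupp.cons i α.tail).degree = i + α.tail.degree := by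
      intro i
      rw [Finsupp.degree_eq_sum, Finsupp.degree_eq_sum, Fin.sum_univ_succ]
      simp
    have hα' := hcons (α 0)
    rw [Finsupp.cons_tail, hdα] at hα'
    rw [hG, Polynomial.eval_eq_sum_range, coeff_sum, Finset.sum_eq_single (α 0)]
    · rwa [one_pow, mul_one, finSuccEquiv_coeff_coeff, Finsupp.cons_tail]
    · intro i _ hi
      rw [one_pow, mul_one, finSuccEquiv_coeff_coeff]
      refine hF.coeff_eq_zero ?_
      rw [hcons]
      omega
    · intro hn
      rw [one_pow, mul_one, Polynomial.coeff_eq_zero_of_natDegree_lt, coeff_zero]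
      simpa using hn
  have hdeg : G.totalDegree ≤ d := by
    rw [hG, Polynomial.eval_eq_sum_range]
    refine totalDegree_finsetSum_le fun i _ => ?_
    rw [one_pow, mul_one]
    by_cases hz : (finSuccEquiv ℤ n F).coeff i = 0
    · rw [hz, totalDegree_zero]; omega
    · have := totalDegree_coeff_finSuccEquiv_add_le F i hz
      have := hF.totalDegree_le
      omega
  by_contra hno
  push Not at hno
  refine hG0 (eq_zero_of_eval_zero_at_prod_finset G (fun _ => (Finset.range (d + 1)).image Nat.cast)
    (fun i => ?_) fun x hx => ?_)
  · rw [Finset.card_image_of_injective _ Nat.cast_injective, Finset.card_range]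
    exact Nat.lt_succ_of_le ((degreeOf_le_totalDegree _ _).trans hdeg)
  · rw [← hev]
    refine hno x fun i => ?_
    obtain ⟨m, hm, hmx⟩ := Finset.mem_image.1 (hx i)
    rw [Finset.mem_range] at hm
    omega

theorem card_le_of_box {n b : ℕ} (Z : Finset (Fin n → ℤ)) (hZ : ∀ x ∈ Z, ∀ i, |x i| ≤ b) :
    Z.card ≤ (2 * b + 1) ^ n := by
  classical
  have hsub : Z ⊆ Fintype.piFinset fun _ => Finset.Icc (-(b : ℤ)) b := by
    intro x hx
    rw [Fintype.mem_piFinset]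
    exact fun i => Finset.mem_Icc.2 (abs_le.1 (hZ x hx i))
  refine (Finset.card_le_card hsub).trans ?_
  rw [Fintype.card_piFinset_const, Int.card_Icc]
  exact Nat.pow_le_pow_left (by omega) _

/-- The inverse substitution on points. -/
def unshear {n : ℕ} (a : Fin n → ℤ) (x : Fin (n + 1) → ℤ) : Fin (n + 1) → ℤ :=
  Fin.cons (x 0) fun i => x i.succ - a i * x 0

theorem unshear_injective {n : ℕ} (a : Fin n → ℤ) : Function.Injective (unshear a) := by
  intro x y hxy
  have h0 : x 0 = y 0 := congrFun hxy 0
  funext i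
  refine Fin.cases h0 (fun j => ?_) i
  have h1 := congrFun hxy j.succ
  simp only [unshear, Fin.cons_succ, h0] at h1
  linarith

theorem eval_unshear {n : ℕ} (a : Fin n → ℤ) (x : Fin (n + 1) → ℤ) (f : MvPolynomial (Fin (n + 1)) ℤ) :
    eval (unshear a x) (shear a f) = eval x f := by
  rw [eval_shear]
  congr 2
  funext i
  refine Fin.cases ?_ (fun j => ?_) i <;> simp [unshear]

theorem abs_unshear_le {n d b : ℕ} {a : Fin n → ℤ} (ha : ∀ i, 0 ≤ a i ∧ a i ≤ d)
    {x : Fin (n + 1) → ℤ} (hx : ∀ i, |x i| ≤ b) (i : Fin (n + 1)) :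
    |unshear a x i| ≤ ((b * (d + 1) : ℕ) : ℤ) := by
  push_cast
  have hb : (0 : ℤ) ≤ b := by positivity
  have hd : (0 : ℤ) ≤ d := by positivity
  refine Fin.cases ?_ (fun j => ?_) i
  · have := hx 0
    simp only [unshear, Fin.cons_zero]
    nlinarith
  · simp only [unshear, Fin.cons_succ]
    calc |x j.succ - a j * x 0| ≤ |x j.succ| + |a j * x 0| := abs_sub _ _
      _ ≤ b + d * b := by
        rw [abs_mul, abs_of_nonneg (ha j).1]
        exact add_le_add (hx _) (mul_le_mul (ha j).2 (hx 0) (abs_nonneg _) hd)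
      _ = _ := by ring

theorem irreducible_map_shear {n : ℕ} (a : Fin n → ℤ) {f : MvPolynomial (Fin (n + 1)) ℤ}
    (hirr : Irreducible (map (Int.castRingHom ℚ) f)) :
    Irreducible (map (Int.castRingHom ℚ) (shear a f)) := by
  rw [map_shear, ← shearEquiv_apply]
  exact (MulEquiv.irreducible_iff (shearEquiv _).toMulEquiv).2 hirr

theorem homogeneousComponent_totalDegree_ne_zero {n : ℕ} {R : Type*} [CommSemiring R]
    {f : MvPolynomial (Fin n) R} (hf : f ≠ 0) : homogeneousComponent f.totalDegree f ≠ 0 := by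
  obtain ⟨α, hα, h⟩ := Finset.exists_mem_eq_sup f.support (support_nonempty.2 hf)
    fun α => α.sum fun _ e => e
  intro h0
  have h1 := congrArg (coeff α) h0
  rw [coeff_homogeneousComponent, coeff_zero, if_pos (show α.degree = f.totalDegree from h.symm)] at h1
  exact mem_support_iff.1 hα h1

theorem exists_shear_coeff_ne_zero {n d : ℕ} {f : MvPolynomial (Fin (n + 1)) ℤ}
    (hdeg : f.totalDegree = d) (h0 : f ≠ 0) :
    ∃ a : Fin n → ℤ, (∀ i, 0 ≤ a i ∧ a i ≤ d) ∧ coeff (Finsupp.single 0 d) (shear a f) ≠ 0 := by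
  have hne : homogeneousComponent d f ≠ 0 := hdeg ▸ homogeneousComponent_totalDegree_ne_zero h0
  obtain ⟨a, ha, hne⟩ := exists_eval_cons_one_ne_zero (homogeneousComponent_isHomogeneous d f) hne
  exact ⟨a, ha, by rwa [coeff_shear]⟩

/-- Integral points in a box on an irreducible plane curve of degree `e ≥ 2`. -/
theorem card_curve_zeros_le {h : MvPolynomial (Fin 2) ℤ} {e b l X : ℕ} (he : 2 ≤ e)
    (hl : 1 ≤ l) (hb : 1 ≤ b) (hbl : b ≤ 2 ^ l) (hdeg : h.totalDegree = e)
    (hirr : Irreducible (map (Int.castRingHom ℚ) h)) (hXb : b ≤ X ^ e)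
    (Z : Finset (Fin 2 → ℤ)) (hZ : ∀ x ∈ Z, eval x h = 0 ∧ ∀ i, |x i| ≤ b) :
    Z.card ≤ 2 ^ 214 * l ^ 28 * e ^ 2 * X := by
  classical
  wlog hXle : X ≤ b generalizing X
  · refine (this (X := b) (Nat.le_self_pow (by omega) b) le_rfl).trans ?_
    exact Nat.mul_le_mul_left _ (by omega)
  have hX1 : 1 ≤ X := by
    by_contra h0
    have : X = 0 := by omega
    rw [this, zero_pow (by omega)] at hXb
    omega
  by_cases hbe : b ≤ e
  · calc Z.card ≤ (2 * b + 1) ^ 2 := card_le_of_box Z fun x hx => (hZ x hx).2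
      _ ≤ (3 * e) ^ 2 := Nat.pow_le_pow_left (by omega) 2
      _ = 9 * e ^ 2 := by ring
      _ ≤ 2 ^ 214 * l ^ 28 * e ^ 2 := by
        gcongr
        have := Nat.one_le_pow 28 l hl
        nlinarith
      _ ≤ _ := Nat.le_mul_of_pos_right _ hX1
  · push Not at hbe
    obtain ⟨a, ha, hlead⟩ := exists_shear_coeff_ne_zero hdeg (by
      rintro rfl; simp at hdeg; omega)
    have := card_curve_zeros_le_of_lead (h := shear a h) (e := e) (b := b * (e + 1)) (l := 2 * l)
      (X := 64 * X) he (by omega) (by nlinarith) (by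
        rw [two_mul, pow_add]
        exact Nat.mul_le_mul hbl ((by omega : e + 1 ≤ b).trans hbl)) (by rw [totalDegree_shear, hdeg])
      hlead (irreducible_map_shear a hirr) (by
        calc 32 ^ e * (b * (e + 1)) ≤ 32 ^ e * (X ^ e * 2 ^ e) := by
              gcongr; exact Nat.lt_two_pow_self
          _ = (64 * X) ^ e := by rw [mul_comm (X ^ e), ← mul_assoc, ← mul_pow, ← mul_pow]; norm_num)
      (by
        calc 64 * X ≤ 64 * 2 ^ l := by gcongr; omega
          _ ≤ 64 * 2 ^ (2 * l) := by gcongr <;> omega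
          _ = _ := by rw [pow_add, mul_comm]; norm_num)
      (Z.image (unshear a)) (fun y hy => by
        obtain ⟨x, hx, rfl⟩ := Finset.mem_image.1 hy
        exact ⟨by rw [eval_unshear]; exact (hZ x hx).1, abs_unshear_le ha (hZ x hx).2⟩)
    rw [Finset.card_image_of_injective _ (unshear_injective a)] at this
    calc Z.card ≤ _ := this
      _ = 2 ^ 214 * l ^ 28 * e ^ 2 * X := by rw [mul_pow]; ring

section
variable {K : Type*} [Field K]

/-- Restriction of a bivariate polynomial to the formal arc `(u, P₁ + τ)`. -/
noncomputable def arc (P : Fin 2 → K) (u : PowerSeries K) : MvPolynomial (Fin 2) K →ₐ[K] PowerSeries K :=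
  aeval (Fin.cons u fun _ => PowerSeries.C (P 1) + PowerSeries.X)

theorem constantCoeff_arc {P : Fin 2 → K} {u : PowerSeries K} (hu : PowerSeries.constantCoeff u = P 0)
    (g : MvPolynomial (Fin 2) K) : PowerSeries.constantCoeff (arc P u g) = eval P g := by
  induction g using MvPolynomial.induction_on with
  | C r =>
    rw [eval_C, arc, aeval_C]
    exact PowerSeries.constantCoeff_C r
  | add p q hp hq => simp only [map_add, hp, hq]
  | mul_X p i hp =>
    rw [map_mul, map_mul, hp, map_mul]
    congr 1
    fin_cases i
    · simp [arc, hu]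
    · simp [arc]

/-- A nonsingular point of a plane curve lies on a formal arc contained in the curve. -/
theorem exists_arc {F : MvPolynomial (Fin 2) K} {d : ℕ} (hd : F.totalDegree ≤ d)
    (hlead : coeff (Finsupp.single 0 d) F ≠ 0) {P : Fin 2 → K} (hP : eval P F = 0)
    (hP' : eval P (pderiv 0 F) ≠ 0) :
    ∃ u : PowerSeries K, PowerSeries.constantCoeff u = P 0 ∧ arc P u F = 0 := by
  set y : Fin 1 → PowerSeries K := fun _ => PowerSeries.C (P 1) + PowerSeries.X with hy
  set c := coeff (Finsupp.single 0 d) F with hc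
  set φ : K →+* PowerSeries K := PowerSeries.C with hφ
  set G : Polynomial (PowerSeries K) :=
    Polynomial.C (φ c⁻¹) * fiberPoly y (map φ F) with hG
  have hdeg : (fiberPoly y (map φ F)).natDegree ≤ d :=
    (natDegree_fiberPoly_le _ _).trans ((totalDegree_map_le' _ _).trans hd)
  have hmonic : G.Monic := by
    refine Polynomial.monic_of_natDegree_le_of_coeff_eq_one d
      ((Polynomial.natDegree_C_mul_le _ _).trans hdeg) ?_
    rw [hG, Polynomial.coeff_C_mul, coeff_fiberPoly_top _ _ ((totalDegree_map_le' _ _).trans hd),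
      coeff_map, ← map_mul, inv_mul_cancel₀ hlead, map_one]
  have hev : ∀ (u : PowerSeries K) (H : MvPolynomial (Fin 2) K),
      (fiberPoly y (map φ H)).eval u = arc P u H := by
    intro u H
    rw [eval_fiberPoly, eval_map]
    rfl
  have hder : ∀ u : PowerSeries K, G.derivative.eval u = φ c⁻¹ * arc P u (pderiv 0 F) := by
    intro u
    rw [hG, Polynomial.derivative_C_mul, derivative_fiberPoly, pderiv_map, Polynomial.eval_mul,
      Polynomial.eval_C, hev]
  have hmem : ∀ w : PowerSeries K, w ∈ Ideal.span {(PowerSeries.X : PowerSeries K)} ↔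
      PowerSeries.constantCoeff w = 0 := by
    intro w
    rw [Ideal.mem_span_singleton, PowerSeries.X_dvd_iff]
  obtain ⟨u, hu, hu2⟩ := HenselianRing.is_henselian (I := Ideal.span {(PowerSeries.X : PowerSeries K)})
    G hmonic (PowerSeries.C (P 0)) (by
      rw [hG, Polynomial.eval_mul, Polynomial.eval_C, hev, hmem, map_mul,
        constantCoeff_arc (PowerSeries.constantCoeff_C _), hP, mul_zero]) (by
      apply IsUnit.map
      rw [hder, PowerSeries.isUnit_iff_constantCoeff, map_mul,
        constantCoeff_arc (PowerSeries.constantCoeff_C _)]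
      exact (isUnit_iff_ne_zero.2 (by
        rw [hφ, PowerSeries.constantCoeff_C]; exact mul_ne_zero (inv_ne_zero hlead) hP')))
  refine ⟨u, ?_, ?_⟩
  · rw [hmem, map_sub, PowerSeries.constantCoeff_C, sub_eq_zero] at hu2
    exact hu2
  · rw [Polynomial.IsRoot, hG, Polynomial.eval_mul, Polynomial.eval_C, hev] at hu
    refine (mul_eq_zero.1 hu).resolve_left ?_
    rw [hφ]
    exact fun h => inv_ne_zero hlead (PowerSeries.C_injective (by rw [h, map_zero]))

theorem arc_X_one (P : Fin 2 → K) (u : PowerSeries K) : arc P u (X 1 - C (P 1)) = PowerSeries.X := by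
  have h1 : arc P u (X 1) = PowerSeries.C (P 1) + PowerSeries.X := by
    rw [arc, aeval_X]; rfl
  have h2 : arc P u (C (P 1)) = PowerSeries.C (P 1) := by rw [arc, aeval_C]; rfl
  rw [map_sub, h1, h2, add_sub_cancel_left]

/-- The arc modulo `τ ^ M`. -/
noncomputable def jet (P : Fin 2 → K) (u : PowerSeries K) (M : ℕ) :
    MvPolynomial (Fin 2) K →ₗ[K] (Fin M → K) :=
  LinearMap.pi fun k => (PowerSeries.coeff (R := K) k).comp (arc P u).toLinearMap

theorem jet_eq_zero_iff (P : Fin 2 → K) (u : PowerSeries K) (M : ℕ) (g : MvPolynomial (Fin 2) K) :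
    jet P u M g = 0 ↔ PowerSeries.X ^ M ∣ arc P u g := by
  rw [PowerSeries.X_pow_dvd_iff, funext_iff]
  exact ⟨fun h m hm => h ⟨m, hm⟩, fun h m => h m m.2⟩

theorem jet_surjective (P : Fin 2 → K) (u : PowerSeries K) (M : ℕ) :
    Function.Surjective (jet P u M) := by
  intro y
  refine ⟨∑ k : Fin M, C (y k) * (X 1 - C (P 1)) ^ (k : ℕ), ?_⟩
  funext m
  change PowerSeries.coeff m (arc P u _) = y m
  have : arc P u (∑ k : Fin M, C (y k) * (X 1 - C (P 1)) ^ (k : ℕ)) =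
      ∑ k : Fin M, PowerSeries.C (y k) * PowerSeries.X ^ (k : ℕ) := by
    rw [map_sum]
    refine Finset.sum_congr rfl fun k _ => ?_
    rw [map_mul, map_pow, arc_X_one, arc, aeval_C]
    rfl
  rw [this, map_sum, Finset.sum_eq_single m]
  · rw [PowerSeries.coeff_C_mul, PowerSeries.coeff_X_pow, if_pos rfl, mul_one]
  · intro k _ hk
    rw [PowerSeries.coeff_C_mul, PowerSeries.coeff_X_pow, if_neg, mul_zero]
    exact fun h => hk (Fin.ext h.symm)
  · simp

theorem dvd_of_dvd_mul_of_irreducible {F A : MvPolynomial (Fin 2) K} (hF : Irreducible F)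
    (hA : ¬ F ∣ A) (g : MvPolynomial (Fin 2) K) (h : F ∣ A * g) : F ∣ g :=
  (hF.prime.dvd_or_dvd h).resolve_left hA

/-- Bound for the order of vanishing of a polynomial along an arc of an irreducible curve. -/
theorem not_X_pow_dvd_arc {F g : MvPolynomial (Fin 2) K} (hF : Irreducible F) {P : Fin 2 → K}
    {u : PowerSeries K} (hu : arc P u F = 0) (hg : ¬ F ∣ g) {M : ℕ}
    (hM : F.totalDegree * g.totalDegree < M) : ¬ PowerSeries.X ^ M ∣ arc P u g := by
  intro hd
  have hg0 : g ≠ 0 := by rintro rfl; exact hg (dvd_zero _)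
  have h1 := finrank_range_le_mul_of_coprime F g hF.ne_zero hg0 (dvd_of_dvd_mul_of_irreducible hF hg)
    (jet P u M) (fun h => (jet_eq_zero_iff _ _ _ _).2 (by rw [map_mul, hu, zero_mul]; exact dvd_zero _))
    (fun h => (jet_eq_zero_iff _ _ _ _).2 (by rw [map_mul]; exact hd.mul_right _))
  rw [LinearMap.range_eq_top.2 (jet_surjective P u M), finrank_top, Module.finrank_fin_fun] at h1
  omega

theorem dvd_of_arc_eq_zero {F g : MvPolynomial (Fin 2) K} (hF : Irreducible F) {P : Fin 2 → K}
    {u : PowerSeries K} (hu : arc P u F = 0) (hg : arc P u g = 0) : F ∣ g := by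
  by_contra h
  exact not_X_pow_dvd_arc hF hu h (Nat.lt_succ_self _) (by rw [hg]; exact dvd_zero _)

theorem derivative_arc (P : Fin 2 → K) (u : PowerSeries K) (g : MvPolynomial (Fin 2) K) :
    PowerSeries.derivative K (arc P u g) =
      arc P u (pderiv 1 g) + PowerSeries.derivative K u * arc P u (pderiv 0 g) := by
  induction g using MvPolynomial.induction_on with
  | C r =>
    have : arc P u (C r) = PowerSeries.C r := by rw [arc, aeval_C]; rfl
    rw [this, pderiv_C, pderiv_C, map_zero]; simp
  | add p q hp hq => simp only [map_add, hp, hq]; ring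
  | mul_X p i hp =>
    rw [map_mul, Derivation.leibniz, hp, Derivation.leibniz, Derivation.leibniz]
    have h1 : PowerSeries.derivative K (arc P u (X i)) =
        arc P u (pderiv 1 (X i)) + PowerSeries.derivative K u * arc P u (pderiv 0 (X i)) := by
      have h0 : arc P u (X 0) = u := by rw [arc, aeval_X]; rfl
      have h1 : arc P u (X 1) = PowerSeries.C (P 1) + PowerSeries.X := by rw [arc, aeval_X]; rfl
      fin_cases i
      · simp only [Fin.zero_eta, pderiv_X_self, map_one, mul_one]
        rw [pderiv_X_of_ne (by decide), map_zero, zero_add, h0]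
      · simp only [Fin.mk_one, pderiv_X_self, map_one]
        rw [pderiv_X_of_ne (by decide), map_zero, mul_zero, add_zero, h1]
        simp
    rw [h1]
    simp only [smul_eq_mul, map_add, map_mul]
    ring

/-- The derivation tangent to the curve `F = 0`. -/
noncomputable def tangentD (F g : MvPolynomial (Fin 2) K) : MvPolynomial (Fin 2) K :=
  pderiv 0 F * pderiv 1 g - pderiv 1 F * pderiv 0 g

theorem arc_tangentD {F : MvPolynomial (Fin 2) K} {P : Fin 2 → K} {u : PowerSeries K}
    (hu : arc P u F = 0) (g : MvPolynomial (Fin 2) K) :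
    arc P u (tangentD F g) = arc P u (pderiv 0 F) * PowerSeries.derivative K (arc P u g) := by
  have h1 := derivative_arc P u F
  rw [hu, map_zero] at h1
  rw [derivative_arc, tangentD, map_sub, map_mul, map_mul]
  linear_combination arc P u (pderiv 0 g) * h1

theorem coeff_iterate_mul_derivative (w : PowerSeries K) (r : ℕ) (h : PowerSeries K)
    (hd : PowerSeries.X ^ r ∣ h) :
    PowerSeries.constantCoeff ((fun g => w * PowerSeries.derivative K g)^[r] h) =
      (r.factorial : K) * PowerSeries.constantCoeff w ^ r * PowerSeries.coeff r h := by
  induction r generalizing h with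
  | zero => simp
  | succ r ih =>
    have hh : ∀ m < r, PowerSeries.coeff m (PowerSeries.derivative K h) = 0 := by
      intro m hm
      rw [PowerSeries.coeff_derivative, PowerSeries.X_pow_dvd_iff.1 hd _ (by omega), zero_mul]
    obtain ⟨h', hh'⟩ := PowerSeries.X_pow_dvd_iff.2 hh
    have hc : PowerSeries.coeff r (w * PowerSeries.derivative K h) =
        PowerSeries.constantCoeff w * ((r + 1 : K) * PowerSeries.coeff (r + 1) h) := by
      have h1 : PowerSeries.coeff r (PowerSeries.derivative K h) = PowerSeries.constantCoeff h' := by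
        have := PowerSeries.coeff_X_pow_mul h' r 0
        rw [zero_add] at this
        rw [hh', this, PowerSeries.coeff_zero_eq_constantCoeff_apply]
      have h2 : PowerSeries.coeff r (w * PowerSeries.derivative K h) =
          PowerSeries.constantCoeff (w * h') := by
        have := PowerSeries.coeff_X_pow_mul (w * h') r 0
        rw [zero_add] at this
        rw [hh', show w * (PowerSeries.X ^ r * h') = PowerSeries.X ^ r * (w * h') by ring, this,
          PowerSeries.coeff_zero_eq_constantCoeff_apply]
      rw [h2, map_mul, ← h1, PowerSeries.coeff_derivative]
      ring
    rw [Function.iterate_succ_apply, ih _ (by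
      rw [hh']; exact ⟨w * h', by ring⟩), hc, Nat.factorial_succ]
    push_cast
    ring

theorem arc_iterate_tangentD {F : MvPolynomial (Fin 2) K} {P : Fin 2 → K} {u : PowerSeries K}
    (hu : arc P u F = 0) (r : ℕ) (g : MvPolynomial (Fin 2) K) :
    arc P u ((tangentD F)^[r] g) =
      (fun h => arc P u (pderiv 0 F) * PowerSeries.derivative K h)^[r] (arc P u g) := by
  induction r generalizing g with
  | zero => rfl
  | succ r ih => rw [Function.iterate_succ_apply, ih, arc_tangentD hu, Function.iterate_succ_apply]

/-- Vanishing of the tangential derivatives forces vanishing along the arc. -/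
theorem X_pow_dvd_arc_of_tangentD {q : ℕ} [Fact q.Prime] [CharP K q] {F : MvPolynomial (Fin 2) K} {P : Fin 2 → K}
    {u : PowerSeries K} (hu0 : PowerSeries.constantCoeff u = P 0)
    (hu : arc P u F = 0) (hP' : eval P (pderiv 0 F) ≠ 0) {M : ℕ} (hM : M ≤ q)
    (g : MvPolynomial (Fin 2) K) (hg : ∀ k < M, eval P ((tangentD F)^[k] g) = 0) :
    PowerSeries.X ^ M ∣ arc P u g := by
  induction M with
  | zero => simp
  | succ M ih =>
    have h1 := ih (by omega) fun k hk => hg k (by omega)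
    have h2 := hg M (Nat.lt_succ_self _)
    rw [← constantCoeff_arc hu0, arc_iterate_tangentD hu, coeff_iterate_mul_derivative _ _ _ h1,
      constantCoeff_arc hu0] at h2
    have h3 : (M.factorial : K) ≠ 0 := by
      rw [Ne, CharP.cast_eq_zero_iff K q, (Fact.out : q.Prime).dvd_factorial]
      omega
    have h4 : PowerSeries.coeff M (arc P u g) = 0 :=
      (mul_eq_zero.1 h2).resolve_left (mul_ne_zero h3 (pow_ne_zero _ hP'))
    rw [PowerSeries.X_pow_dvd_iff] at h1 ⊢
    intro m hm
    rcases Nat.lt_succ_iff_lt_or_eq.1 hm with h | rfl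
    · exact h1 m h
    · exact h4

end

section
variable {K : Type*} [Field K]

/-- The polynomial with prescribed coefficients on a finite set of exponents. -/
noncomputable def combo {n : ℕ} (I : Finset (Fin n →₀ ℕ)) : (I → K) →ₗ[K] MvPolynomial (Fin n) K :=
  Fintype.linearCombination K fun α : I => monomial α.1 1

theorem combo_apply {n : ℕ} (I : Finset (Fin n →₀ ℕ)) (c : I → K) :
    combo I c = ∑ α : I, C (c α) * monomial α.1 1 := by
  simp only [combo, Fintype.linearCombination_apply, smul_eq_C_mul]

theorem coeff_combo {n : ℕ} (I : Finset (Fin n →₀ ℕ)) (c : I → K) (α : I) :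
    coeff α.1 (combo I c) = c α := by
  classical
  rw [combo_apply, coeff_sum, Finset.sum_eq_single α]
  · rw [coeff_C_mul, coeff_monomial, if_pos rfl, mul_one]
  · intro β _ hβ
    rw [coeff_C_mul, coeff_monomial, if_neg (fun h => hβ (Subtype.ext h)), mul_zero]
  · simp

theorem combo_ne_zero {n : ℕ} {I : Finset (Fin n →₀ ℕ)} {c : I → K} (hc : c ≠ 0) :
    combo I c ≠ 0 := by
  intro h
  apply hc
  funext α
  rw [← coeff_combo I c, h, coeff_zero, Pi.zero_apply]

theorem support_combo_subset {n : ℕ} (I : Finset (Fin n →₀ ℕ)) (c : I → K) :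
    (combo I c).support ⊆ I := by
  classical
  intro β hβ
  by_contra h
  apply mem_support_iff.1 hβ
  rw [combo_apply, coeff_sum]
  refine Finset.sum_eq_zero fun α _ => ?_
  rw [coeff_C_mul, coeff_monomial, if_neg (fun h' : α.1 = β => h (h' ▸ α.2)), mul_zero]

theorem totalDegree_le_of_support_subset_lowExp {n d a : ℕ} {g : MvPolynomial (Fin (n + 1)) K}
    (h : g.support ⊆ lowExp n d a) : g.totalDegree ≤ a := by
  rw [totalDegree, Finset.sup_le_iff]
  intro α hα
  exact (mem_lowExp.1 (h hα)).1

theorem not_dvd_combo {n d a : ℕ} {F : MvPolynomial (Fin (n + 1)) K}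
    (hF : coeff (Finsupp.single 0 d) F ≠ 0) {c : lowExp n d a → K} (hc : c ≠ 0) :
    ¬ F ∣ combo (lowExp n d a) c :=
  not_dvd_of_lt hF (combo_ne_zero hc) fun _ hα => (mem_lowExp.1 (support_combo_subset _ _ hα)).2

/-- A finite-dimensional space of power series has at least as many orders as its dimension. -/
theorem finrank_le_card_orders {V : Type*} [AddCommGroup V] [Module K V] [Module.Finite K V]
    (φ : V →ₗ[K] PowerSeries K) (N : ℕ) (hN : ∀ v ≠ 0, ¬ PowerSeries.X ^ N ∣ φ v) :
    ∃ (O : Finset ℕ) (v : O → V), Module.finrank K V ≤ O.card ∧ (∀ o ∈ O, o < N) ∧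
      ∀ o : O, (PowerSeries.X ^ (o : ℕ) ∣ φ (v o)) ∧ PowerSeries.coeff o (φ (v o)) ≠ 0 := by
  classical
  set O : Finset ℕ := (Finset.range N).filter fun o =>
    ∃ v : V, (PowerSeries.X ^ o ∣ φ v) ∧ PowerSeries.coeff o (φ v) ≠ 0 with hO
  have hv : ∀ o : O, ∃ v : V, (PowerSeries.X ^ (o : ℕ) ∣ φ v) ∧ PowerSeries.coeff o (φ v) ≠ 0 :=
    fun o => (Finset.mem_filter.1 o.2).2
  choose v hv using hv
  refine ⟨O, v, ?_, fun o ho => Finset.mem_range.1 (Finset.mem_filter.1 ho).1, hv⟩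
  set ψ : V →ₗ[K] (O → K) := LinearMap.pi fun o => (PowerSeries.coeff (R := K) (o : ℕ)).comp φ with hψ
  have hinj : Function.Injective ψ := by
    rw [← LinearMap.ker_eq_bot, LinearMap.ker_eq_bot']
    intro w hw
    by_contra hw0
    have h1 := hN w hw0
    rw [PowerSeries.X_pow_dvd_iff] at h1
    have hex : ∃ m, m < N ∧ PowerSeries.coeff m (φ w) ≠ 0 := by
      by_contra hne
      push Not at hne
      exact h1 hne
    obtain ⟨hmN, hm⟩ := Nat.find_spec hex
    have hmem : Nat.find hex ∈ O := by
      refine Finset.mem_filter.2 ⟨Finset.mem_range.2 hmN, w, ?_, hm⟩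
      rw [PowerSeries.X_pow_dvd_iff]
      intro k hk
      by_contra hne
      exact Nat.find_min hex hk ⟨hk.trans hmN, hne⟩
    exact hm (congrFun hw ⟨_, hmem⟩)
  have := LinearMap.finrank_le_finrank_of_injective hinj
  rwa [Module.finrank_fintype_fun_eq_card, Fintype.card_coe] at this

/-- Power series with distinct orders do not cancel. -/
theorem sum_ne_zero_of_distinct_orders {ι : Type*} (s : Finset ι) (w : ι → PowerSeries K)
    (hs : ∃ i ∈ s, w i ≠ 0)
    (h : ∀ i ∈ s, ∀ j ∈ s, w i ≠ 0 → w j ≠ 0 → (w i).order = (w j).order → i = j) :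
    ∑ i ∈ s, w i ≠ 0 := by
  classical
  obtain ⟨i, hi, hmin⟩ := Finset.exists_min_image (s.filter fun i => w i ≠ 0)
    (fun i => (w i).order) (by obtain ⟨i, hi, h0⟩ := hs; exact ⟨i, Finset.mem_filter.2 ⟨hi, h0⟩⟩)
  obtain ⟨his, hi0⟩ := Finset.mem_filter.1 hi
  intro hsum
  have hc := congrArg (PowerSeries.coeff (w i).order.toNat) hsum
  rw [map_sum, map_zero, Finset.sum_eq_single_of_mem i his] at hc
  · exact PowerSeries.coeff_order hi0 hc
  · intro j hj hji
    by_cases hj0 : w j = 0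
    · rw [hj0, map_zero]
    · apply PowerSeries.coeff_of_lt_order
      have h1 := hmin j (Finset.mem_filter.2 ⟨hj, hj0⟩)
      have h2 : (w i).order ≠ (w j).order := fun he => hji (h i his j hj hi0 hj0 he).symm
      rw [ENat.coe_toNat (mt PowerSeries.order_eq_top.1 hi0)]
      exact lt_of_le_of_ne h1 h2

/-- Dimension of the space of restrictions of polynomials of bounded degree to a curve. -/
theorem finrank_map_arc_le {d : ℕ} {F : MvPolynomial (Fin 2) K} (hF0 : F ≠ 0) (hd : F.totalDegree ≤ d)
    {P : Fin 2 → K} {u : PowerSeries K} (hu : arc P u F = 0) (N : ℕ) :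
    Module.finrank K (LinearMap.range ((arc P u).toLinearMap.domRestrict
      (restrictTotalDegree (Fin 2) K N))) ≤ (lowExp 1 d N).card := by
  set V := restrictTotalDegree (Fin 2) K N
  have hfin : Module.finrank K V = (expLE 2 N).card := finrank_restrictTotalDegree K 2 N
  haveI : Module.Finite K V := inferInstance
  have hrn := LinearMap.finrank_range_add_finrank_ker ((arc P u).toLinearMap.domRestrict V)
  rcases lt_or_ge N d with h | h
  · have h1 : (lowExp 1 d N).card = (expLE 2 N).card := by rw [lowExp_eq_expLE h]
    rw [h1, ← hfin, ← hrn]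
    exact Nat.le_add_right _ _
  · have h1 : (lowExp 1 d N).card + (expLE 2 (N - d)).card = (expLE 2 N).card := card_lowExp_add h
    set W := restrictTotalDegree (Fin 2) K (N - d)
    have hW : Module.finrank K W = (expLE 2 (N - d)).card := finrank_restrictTotalDegree K 2 _
    have hmem : ∀ g : W, F * g.1 ∈ V := by
      intro g
      have hg := (mem_restrictTotalDegree _ _ _).1 g.2
      rw [mem_restrictTotalDegree]
      exact (totalDegree_mul _ _).trans (by omega)
    set m : W →ₗ[K] LinearMap.ker ((arc P u).toLinearMap.domRestrict V) :=
      { toFun := fun g => ⟨⟨F * g.1, hmem g⟩, by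
          rw [LinearMap.mem_ker]
          change arc P u (F * g.1) = 0
          rw [map_mul, hu, zero_mul]⟩
        map_add' := fun g g' => Subtype.ext (Subtype.ext (mul_add _ _ _))
        map_smul' := fun r g => Subtype.ext (Subtype.ext (mul_smul_comm _ _ _)) } with hm
    have hinj : Function.Injective m := by
      intro g g' hgg
      have := congrArg (fun z => z.1.1) hgg
      exact Subtype.ext (mul_left_cancel₀ hF0 this)
    have := LinearMap.finrank_le_finrank_of_injective hinj
    omega

theorem totalDegree_tangentD_le {d : ℕ} {F : MvPolynomial (Fin 2) K} (hd : F.totalDegree ≤ d + 2)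
    (g : MvPolynomial (Fin 2) K) {m : ℕ} (hg : g.totalDegree ≤ m) :
    (tangentD F g).totalDegree ≤ m + d := by
  have key : ∀ i j : Fin 2, (pderiv i F * pderiv j g).totalDegree ≤ m + d := by
    intro i j
    rcases Nat.eq_zero_or_pos m with rfl | hm
    · have : pderiv j g = 0 := by
        rw [totalDegree_eq_zero_iff_eq_C.1 (Nat.le_zero.1 hg), pderiv_C]
      simp [this]
    · have h1 := totalDegree_pderiv_le i F
      have h2 := totalDegree_pderiv_le j g
      exact (totalDegree_mul _ _).trans (by omega)
  rw [tangentD]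
  exact (totalDegree_sub _ _).trans (max_le (key _ _) (key _ _))

theorem totalDegree_iterate_tangentD_le {d : ℕ} {F : MvPolynomial (Fin 2) K}
    (hd : F.totalDegree ≤ d + 2) (g : MvPolynomial (Fin 2) K) {m : ℕ} (hg : g.totalDegree ≤ m) (k : ℕ) :
    ((tangentD F)^[k] g).totalDegree ≤ m + k * d := by
  induction k with
  | zero => simpa using hg
  | succ k ih =>
    rw [Function.iterate_succ_apply']
    exact (totalDegree_tangentD_le hd _ ih).trans (by rw [Nat.succ_mul]; omega)

/-- `tangentD` as a linear map. -/
noncomputable def tangentLin (F : MvPolynomial (Fin 2) K) :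
    MvPolynomial (Fin 2) K →ₗ[K] MvPolynomial (Fin 2) K where
  toFun := tangentD F
  map_add' g h := by simp only [tangentD, map_add]; ring
  map_smul' r g := by
    simp only [tangentD, smul_eq_C_mul, pderiv_C_mul, RingHom.id_apply]
    ring

theorem iterate_tangentD_eq (F : MvPolynomial (Fin 2) K) (k : ℕ) (g : MvPolynomial (Fin 2) K) :
    (tangentD F)^[k] g = (tangentLin F ^ k) g := by
  rw [Module.End.pow_apply]
  rfl

end

/-- Jets of order `M` at distinct points of a curve are independent. -/
theorem card_mul_le_of_X_pow_dvd_arc {K : Type*} [Field K] {F A : MvPolynomial (Fin 2) K}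
    (hF : Irreducible F) (hA : ¬ F ∣ A) (T : Finset (Fin 2 → K)) (u : (Fin 2 → K) → PowerSeries K)
    (hu0 : ∀ P ∈ T, PowerSeries.constantCoeff (u P) = P 0) (hu : ∀ P ∈ T, arc P (u P) F = 0) (M : ℕ)
    (hdvd : ∀ P ∈ T, PowerSeries.X ^ M ∣ arc P (u P) A) :
    M * T.card ≤ F.totalDegree * A.totalDegree := by
  classical
  have hA0 : A ≠ 0 := by rintro rfl; exact hA (dvd_zero _)
  set ψ : MvPolynomial (Fin 2) K →ₗ[K] (T → Fin M → K) :=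
    LinearMap.pi fun P : T => jet P.1 (u P.1) M with hψ
  have h1 := finrank_range_le_mul_of_coprime F A hF.ne_zero hA0 (dvd_of_dvd_mul_of_irreducible hF hA) ψ
    (fun g => funext fun P => (jet_eq_zero_iff _ _ _ _).2 (by
      rw [map_mul, hu _ P.2, zero_mul]; exact dvd_zero _))
    (fun g => funext fun P => (jet_eq_zero_iff _ _ _ _).2 (by
      rw [map_mul]; exact (hdvd _ P.2).mul_right _))
  set I : Ideal (PowerSeries K) := Ideal.span {PowerSeries.X ^ M} with hI
  set φ : T → MvPolynomial (Fin 2) K →+* PowerSeries K ⧸ I := fun P =>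
    (Ideal.Quotient.mk I).comp (arc P.1 (u P.1) : MvPolynomial (Fin 2) K →+* PowerSeries K) with hφ
  have hφz : ∀ (P : T) (g : MvPolynomial (Fin 2) K), φ P g = 0 ↔ PowerSeries.X ^ M ∣ arc P.1 (u P.1) g := by
    intro P g
    rw [hφ]
    change Ideal.Quotient.mk I (arc P.1 (u P.1) g) = 0 ↔ _
    rw [Ideal.Quotient.eq_zero_iff_mem, hI, Ideal.mem_span_singleton]
  have hker : ∀ P : T, (RingHom.ker (eval P.1 : MvPolynomial (Fin 2) K →+* K)) ^ M ≤ RingHom.ker (φ P) := by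
    intro P
    have hX : ∀ g ∈ RingHom.ker (eval P.1 : MvPolynomial (Fin 2) K →+* K),
        arc P.1 (u P.1) g ∈ Ideal.span {(PowerSeries.X : PowerSeries K)} := by
      intro g hg
      rw [Ideal.mem_span_singleton, PowerSeries.X_dvd_iff, constantCoeff_arc (hu0 _ P.2)]
      exact hg
    intro g hg
    rw [RingHom.mem_ker, hφz, ← Ideal.mem_span_singleton, ← Ideal.span_singleton_pow]
    have : Ideal.map (arc P.1 (u P.1) : MvPolynomial (Fin 2) K →+* PowerSeries K)
        (RingHom.ker (eval P.1 : MvPolynomial (Fin 2) K →+* K)) ≤ Ideal.span {PowerSeries.X} :=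
      Ideal.map_le_iff_le_comap.2 hX
    have h2 := Ideal.pow_right_mono this M
    rw [← Ideal.map_pow] at h2
    exact h2 (Ideal.mem_map_of_mem _ hg)
  have hcop : Pairwise fun P Q : T => IsCoprime (RingHom.ker (φ P)) (RingHom.ker (φ Q)) := by
    intro P Q hPQ
    have h2 : IsCoprime (RingHom.ker (eval P.1 : MvPolynomial (Fin 2) K →+* K) ^ M)
        (RingHom.ker (eval Q.1 : MvPolynomial (Fin 2) K →+* K) ^ M) :=
      (isCoprime_ker_eval fun h => hPQ (Subtype.ext h)).pow
    rw [Ideal.isCoprime_iff_sup_eq] at h2 ⊢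
    rw [eq_top_iff, ← h2]
    exact sup_le_sup (hker P) (hker Q)
  have hIdealsurj : ∀ P : T, Function.Surjective (φ P) := by
    intro P z
    obtain ⟨w, rfl⟩ := Ideal.Quotient.mk_surjective z
    obtain ⟨g, hg⟩ := jet_surjective P.1 (u P.1) M fun k => PowerSeries.coeff k w
    refine ⟨g, ?_⟩
    change Ideal.Quotient.mk I (arc P.1 (u P.1) g) = _
    rw [Ideal.Quotient.eq, hI, Ideal.mem_span_singleton, PowerSeries.X_pow_dvd_iff]
    intro m hm
    rw [map_sub, sub_eq_zero]
    exact congrFun hg ⟨m, hm⟩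
  have hsurj : Function.Surjective ψ := by
    intro y
    choose g hg using fun P : T => jet_surjective P.1 (u P.1) M (y P)
    obtain ⟨r, hr⟩ := surjective_pi_of_isCoprime_ker φ hIdealsurj hcop fun P => φ P (g P)
    refine ⟨r, funext fun P => ?_⟩
    have h2 := hr P
    rw [← sub_eq_zero, ← map_sub, hφz, ← jet_eq_zero_iff, map_sub, sub_eq_zero] at h2
    exact h2.trans (hg P)
  rw [LinearMap.range_eq_top.2 hsurj, finrank_top, Module.finrank_pi_fintype] at h1
  simp only [Module.finrank_fin_fun, Finset.sum_const, Finset.card_univ, Fintype.card_coe,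
    smul_eq_mul] at h1
  rwa [mul_comm]

/-- A Frobenius power is constant along an arc to high order. -/
theorem X_pow_dvd_arc_pow_sub {q : ℕ} [Fact q.Prime] {P : Fin 2 → ZMod q} {u : PowerSeries (ZMod q)}
    (hu0 : PowerSeries.constantCoeff u = P 0) (g : MvPolynomial (Fin 2) (ZMod q)) :
    PowerSeries.X ^ q ∣ arc P u g ^ q - PowerSeries.C (eval P g) := by
  have h1 : PowerSeries.X ∣ arc P u g - PowerSeries.C (eval P g) := by
    rw [PowerSeries.X_dvd_iff, map_sub, constantCoeff_arc hu0, PowerSeries.constantCoeff_C, sub_self]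
  have h2 := pow_dvd_pow_of_dvd h1 q
  haveI : CharP (PowerSeries (ZMod q)) q := by
    refine charP_of_injective_ringHom (f := (PowerSeries.C : ZMod q →+* PowerSeries (ZMod q))) ?_ q
    exact PowerSeries.C_injective
  rwa [sub_pow_char, ← map_pow PowerSeries.C, ZMod.pow_card] at h2

open Classical in
theorem card_nonsingular_curve_points_le {q : ℕ} [Fact q.Prime] {F : MvPolynomial (Fin 2) (ZMod q)}
    {d a b M : ℕ} (hd : F.totalDegree = d) (hd2 : 2 ≤ d) (hlead : coeff (Finsupp.single 0 d) F ≠ 0)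
    (hF : Irreducible F) (ha : d * a < q) (hM : M ≤ q)
    (hcount : ∑ k ∈ Finset.range M, (lowExp 1 d (a + b + k * (d - 2))).card <
      (lowExp 1 d a).card * (lowExp 1 d b).card)
    (T : Finset (Fin 2 → ZMod q)) (hT : ∀ P ∈ T, eval P F = 0 ∧ eval P (pderiv 0 F) ≠ 0) :
    M * T.card ≤ d * (a + q * b) := by
  rcases T.eq_empty_or_nonempty with rfl | ⟨P₀, hP₀⟩
  · simp
  have hq : q.Prime := Fact.out
  have hex : ∀ P : Fin 2 → ZMod q, ∃ u : PowerSeries (ZMod q), P ∈ T →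
      (PowerSeries.constantCoeff u = P 0 ∧ arc P u F = 0) := by
    intro P
    by_cases h : P ∈ T
    · obtain ⟨u, hu⟩ := exists_arc hd.le hlead (hT P h).1 (hT P h).2
      exact ⟨u, fun _ => hu⟩
    · exact ⟨0, fun h' => absurd h' h⟩
  choose u hu using hex
  set ar := arc P₀ (u P₀) with har
  have har0 : ar F = 0 := (hu P₀ hP₀).2
  obtain ⟨O, v, hOcard, hOlt, hv⟩ := finrank_le_card_orders
    (ar.toLinearMap.comp (combo (lowExp 1 d a))) (d * a + 1) (by
      intro c hc
      refine not_X_pow_dvd_arc hF har0 (not_dvd_combo hlead hc) ?_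
      rw [hd]
      have := totalDegree_le_of_support_subset_lowExp (support_combo_subset (lowExp 1 d a) c)
      exact Nat.lt_succ_of_le (Nat.mul_le_mul_left _ this))
  rw [Module.finrank_fintype_fun_eq_card, Fintype.card_coe] at hOcard
  set α : O → MvPolynomial (Fin 2) (ZMod q) := fun o => combo (lowExp 1 d a) (v o) with hα
  have hαdeg : ∀ o, (α o).totalDegree ≤ a := fun o =>
    totalDegree_le_of_support_subset_lowExp (support_combo_subset (lowExp 1 d a) (v o))
  set J := lowExp 1 d b with hJ
  set β : J → MvPolynomial (Fin 2) (ZMod q) := fun j => monomial j.1 1 with hβ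
  have hβdeg : ∀ j, (β j).totalDegree ≤ b := fun j =>
    (totalDegree_monomial_le _ _).trans (mem_lowExp.1 j.2).1
  set n : ℕ → ℕ := fun k => a + b + k * (d - 2) with hn
  set G : ℕ → (O × J → ZMod q) →ₗ[ZMod q] MvPolynomial (Fin 2) (ZMod q) := fun k =>
    Fintype.linearCombination (ZMod q) fun p => (tangentD F)^[k] (α p.1) * β p.2 with hG
  have hGapp : ∀ k c, G k c = ∑ p, C (c p) * ((tangentD F)^[k] (α p.1) * β p.2) := by
    intro k c
    simp only [hG, Fintype.linearCombination_apply, smul_eq_C_mul]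
  have hGmem : ∀ k c, G k c ∈ restrictTotalDegree (Fin 2) (ZMod q) (n k) := by
    intro k c
    rw [hGapp]
    refine Submodule.sum_mem _ fun p _ => ?_
    rw [← smul_eq_C_mul]
    refine Submodule.smul_mem _ _ ?_
    rw [mem_restrictTotalDegree]
    have h1 := totalDegree_iterate_tangentD_le (d := d - 2) (F := F) (by omega) (α p.1) (hαdeg p.1) k
    have h2 := hβdeg p.2
    refine (totalDegree_mul _ _).trans ?_
    simp only [hn]
    omega
  set R : ℕ → Submodule (ZMod q) (PowerSeries (ZMod q)) := fun k =>
    LinearMap.range (ar.toLinearMap.domRestrict (restrictTotalDegree (Fin 2) (ZMod q) (n k))) with hR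
  have hRle : ∀ k, Module.finrank (ZMod q) (R k) ≤ (lowExp 1 d (n k)).card := fun k =>
    finrank_map_arc_le hF.ne_zero hd.le har0 (n k)
  set Ψ : (O × J → ZMod q) →ₗ[ZMod q] (∀ k : Fin M, R k) := LinearMap.pi fun k =>
    (LinearMap.rangeRestrict _).comp ((G k).codRestrict _ (hGmem k)) with hΨ
  have hker : LinearMap.ker Ψ ≠ ⊥ := by
    apply LinearMap.ker_ne_bot_of_finrank_lt
    rw [Module.finrank_pi_fintype, Module.finrank_fintype_fun_eq_card, Fintype.card_prod,
      Fintype.card_coe, Fintype.card_coe]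
    calc ∑ k : Fin M, Module.finrank (ZMod q) (R k)
        ≤ ∑ k : Fin M, (lowExp 1 d (n k)).card := Finset.sum_le_sum fun k _ => hRle k
      _ = ∑ k ∈ Finset.range M, (lowExp 1 d (n k)).card :=
          Fin.sum_univ_eq_sum_range (fun k => (lowExp 1 d (n k)).card) M
      _ < _ := hcount
      _ ≤ _ := Nat.mul_le_mul_right _ hOcard
  obtain ⟨c, hc, hc0⟩ := (Submodule.ne_bot_iff _).1 hker
  have hGdvd : ∀ k < M, F ∣ G k c := by
    intro k hk
    apply dvd_of_arc_eq_zero hF har0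
    have := congrArg Subtype.val (congrFun (LinearMap.mem_ker.1 hc) ⟨k, hk⟩)
    exact this
  set A : MvPolynomial (Fin 2) (ZMod q) := ∑ p : O × J, C (c p) * (α p.1 * β p.2 ^ q) with hA
  have hAdeg : A.totalDegree ≤ a + q * b := by
    refine (totalDegree_finsetSum_le fun p _ => ?_)
    refine (totalDegree_mul _ _).trans ?_
    rw [totalDegree_C, zero_add]
    refine (totalDegree_mul _ _).trans (add_le_add (hαdeg _) ((totalDegree_pow _ _).trans ?_))
    exact Nat.mul_le_mul_left _ (hβdeg _)
  haveI : CharP (PowerSeries (ZMod q)) q := by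
    refine charP_of_injective_ringHom (f := (PowerSeries.C : ZMod q →+* PowerSeries (ZMod q))) ?_ q
    exact PowerSeries.C_injective
  have hAF : ¬ F ∣ A := by
    intro hdvd
    have harA : ar A = 0 := by
      obtain ⟨g, hg⟩ := hdvd
      rw [hg, map_mul, har0, zero_mul]
    have harC : ∀ r, ar (C r) = PowerSeries.C r := by
      intro r; rw [har, arc, aeval_C]; rfl
    have hsum : ar A = ∑ o : O, ar (α o) * ar (combo J fun j => c (o, j)) ^ q := by
      rw [hA, map_sum, Fintype.sum_prod_type]
      refine Finset.sum_congr rfl fun o _ => ?_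
      rw [combo_apply, map_sum, sum_pow_char, Finset.mul_sum]
      refine Finset.sum_congr rfl fun j _ => ?_
      rw [map_mul, map_mul, map_mul, map_pow, harC, mul_pow, ← map_pow PowerSeries.C, ZMod.pow_card]
      ring
    have hord : ∀ o : O, (ar (α o)).order = (o : ℕ) := by
      intro o
      exact PowerSeries.order_eq_nat.2 ⟨(hv o).2, fun i hi =>
        (PowerSeries.X_pow_dvd_iff.1 (hv o).1) i hi⟩
    refine sum_ne_zero_of_distinct_orders Finset.univ _ ?_ ?_ (hsum.symm.trans harA)
    · obtain ⟨⟨o, j⟩, hoj⟩ := Function.ne_iff.1 hc0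
      refine ⟨o, Finset.mem_univ _, mul_ne_zero ?_ (pow_ne_zero _ ?_)⟩
      · intro h
        have := (hv o).2
        apply this
        change PowerSeries.coeff (o : ℕ) (ar (α o)) = 0
        rw [h, map_zero]
      · intro h
        refine not_dvd_combo (d := d) (a := b) (F := F) (c := fun j => c (o, j)) hlead ?_
          (dvd_of_arc_eq_zero hF har0 h)
        exact Function.ne_iff.2 ⟨j, hoj⟩
    · intro o _ o' _ h0 h0' hoo
      rw [PowerSeries.order_mul, PowerSeries.order_mul, PowerSeries.order_pow, PowerSeries.order_pow,
        hord, hord] at hoo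
      have hfin : ∀ o : O, ar (α o) * ar (combo J fun j => c (o, j)) ^ q ≠ 0 →
          ∃ r : ℕ, (ar (combo J fun j => c (o, j))).order = r := by
        intro o h
        refine ⟨(ar (combo J fun j => c (o, j))).order.toNat, (ENat.coe_toNat ?_).symm⟩
        intro htop
        rw [PowerSeries.order_eq_top.1 htop, zero_pow hq.ne_zero, mul_zero] at h
        exact h rfl
      obtain ⟨r, hr⟩ := hfin o h0
      obtain ⟨r', hr'⟩ := hfin o' h0'
      rw [hr, hr', nsmul_eq_mul, nsmul_eq_mul] at hoo
      have h3 : (o : ℕ) + q * r = o' + q * r' := by exact_mod_cast hoo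
      have h4 := congrArg (· % q) h3
      simp only [Nat.add_mul_mod_self_left] at h4
      have h5 : ∀ o : O, (o : ℕ) < q := fun o => by have := hOlt o o.2; omega
      rw [Nat.mod_eq_of_lt (h5 o), Nat.mod_eq_of_lt (h5 o')] at h4
      exact Subtype.ext h4
  refine (card_mul_le_of_X_pow_dvd_arc hF hAF T u (fun P hP => (hu P hP).1)
    (fun P hP => (hu P hP).2) M ?_).trans ?_
  · intro P hP
    set g : MvPolynomial (Fin 2) (ZMod q) := ∑ p : O × J, C (c p * eval P (β p.2)) * α p.1 with hg
    have h1 : PowerSeries.X ^ M ∣ arc P (u P) g := by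
      refine X_pow_dvd_arc_of_tangentD (hu P hP).1 (hu P hP).2 (hT P hP).2 hM g fun k hk => ?_
      have h2 : eval P ((tangentD F)^[k] g) = eval P (G k c) := by
        rw [iterate_tangentD_eq, hg, map_sum, map_sum, hGapp, map_sum]
        refine Finset.sum_congr rfl fun p _ => ?_
        rw [← smul_eq_C_mul, map_smul, ← iterate_tangentD_eq, smul_eval]
        simp only [map_mul, eval_C]
        ring
      rw [h2]
      obtain ⟨w, hw⟩ := hGdvd k hk
      rw [hw, map_mul, (hT P hP).1, zero_mul]
    have h2 : PowerSeries.X ^ M ∣ arc P (u P) A - arc P (u P) g := by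
      rw [hA, hg, map_sum, map_sum, ← Finset.sum_sub_distrib]
      refine Finset.dvd_sum fun p _ => ?_
      have harC : ∀ r, arc P (u P) (C r) = PowerSeries.C r := by
        intro r; rw [arc, aeval_C]; rfl
      have h3 := X_pow_dvd_arc_pow_sub (hu P hP).1 (β p.2)
      have h4 : arc P (u P) (C (c p) * (α p.1 * β p.2 ^ q)) -
          arc P (u P) (C (c p * eval P (β p.2)) * α p.1) =
          PowerSeries.C (c p) * arc P (u P) (α p.1) *
            (arc P (u P) (β p.2) ^ q - PowerSeries.C (eval P (β p.2))) := by
        simp only [map_mul, map_pow, harC]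
        ring
      rw [h4]
      exact ((pow_dvd_pow _ hM).trans h3).mul_left _
    have := dvd_add h2 h1
    rwa [sub_add_cancel] at this
  · rw [hd]
    exact Nat.mul_le_mul_left _ hAdeg

theorem two_mul_sum_card_lowExp_le (d m M : ℕ) (h2 : 2 ≤ d) (hd : d ≤ m) :
    2 * ∑ k ∈ Finset.range M, (lowExp 1 d (m + k * (d - 2))).card + M * (d * (d - 1)) + (d - 2) * d * M =
      2 * d * (m + 1) * M + (d - 2) * d * M ^ 2 := by
  induction M with
  | zero => simp
  | succ M ih =>
    rw [Finset.sum_range_succ]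
    have h := two_mul_card_lowExp_one_le d (m + M * (d - 2)) (by omega)
    obtain ⟨e, rfl⟩ : ∃ e, d = e + 2 := ⟨d - 2, by omega⟩
    simp only [Nat.add_sub_cancel] at *
    linear_combination ih + h

theorem stepanov_count_four {a b : ℕ} (hb : 20 ≤ b) (hab : b * b ≤ a) :
    ∑ k ∈ Finset.range (4 * b - 40), (lowExp 1 4 (a + b + k * (4 - 2))).card <
      (lowExp 1 4 a).card * (lowExp 1 4 b).card := by
  have hba : b ≤ a := by nlinarith
  have h1 := two_mul_card_lowExp_one_le 4 a (by omega)
  have h2 := two_mul_card_lowExp_one_le 4 b (by omega)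
  have h3 := two_mul_sum_card_lowExp_le 4 (a + b) (4 * b - 40) (by norm_num) (by omega)
  obtain ⟨x, rfl⟩ : ∃ x, b = x + 20 := ⟨b - 20, by omega⟩
  rw [show (lowExp 1 4 a).card = 4 * a - 2 by omega, show (lowExp 1 4 (x + 20)).card = 4 * x + 78 by omega]
  rw [show 4 * (x + 20) - 40 = 4 * x + 40 by omega] at h3 ⊢
  obtain ⟨y, rfl⟩ : ∃ y, a = y + 1 := ⟨a - 1, by omega⟩
  rw [show 4 * (y + 1) - 2 = 4 * y + 2 by omega]
  norm_num at h3 ⊢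
  nlinarith

theorem stepanov_count_three {a b : ℕ} (hb : 20 ≤ b) (hab : b * b ≤ a) :
    ∑ k ∈ Finset.range (3 * b - 40), (lowExp 1 3 (a + b + k * (3 - 2))).card <
      (lowExp 1 3 a).card * (lowExp 1 3 b).card := by
  have hba : b ≤ a := by nlinarith
  have h1 := two_mul_card_lowExp_one_le 3 a (by omega)
  have h2 := two_mul_card_lowExp_one_le 3 b (by omega)
  have h3 := two_mul_sum_card_lowExp_le 3 (a + b) (3 * b - 40) (by norm_num) (by omega)
  obtain ⟨x, rfl⟩ : ∃ x, b = x + 20 := ⟨b - 20, by omega⟩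
  rw [show (lowExp 1 3 a).card = 3 * a by omega, show (lowExp 1 3 (x + 20)).card = 3 * x + 60 by omega]
  rw [show 3 * (x + 20) - 40 = 3 * x + 20 by omega] at h3 ⊢
  norm_num at h3 ⊢
  nlinarith

theorem stepanov_final {d a b q N M : ℕ} (hd : d = 3 ∨ d = 4) (hM : M = d * b - 40) (hb : 20 ≤ b)
    (hab : a < (b + 1) * (b + 1)) (hdq : d * a < q) (hq : q ≤ d * a + d) (h : M * N ≤ d * (a + q * b)) :
    N ≤ q + 200 * b := by
  by_contra hN
  push Not at hN
  have h1 : M * (q + 200 * b + 1) ≤ M * N := Nat.mul_le_mul_left _ hN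
  subst hM
  obtain ⟨x, rfl⟩ : ∃ x, b = x + 20 := ⟨b - 20, by omega⟩
  have hq2 : q ≤ d * ((x + 21) * (x + 21)) := by
    refine hq.trans ?_
    rw [← Nat.mul_succ]
    exact Nat.mul_le_mul_left _ hab
  rcases hd with rfl | rfl
  · rw [show 3 * (x + 20) - 40 = 3 * x + 20 by omega] at *
    nlinarith
  · rw [show 4 * (x + 20) - 40 = 4 * x + 40 by omega] at *
    nlinarith

/-- Weil-type upper bound for the number of points on a plane curve over a prime field. -/
theorem card_curve_points_le {q : ℕ} [Fact q.Prime] {F : MvPolynomial (Fin 2) (ZMod q)}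
    {d : ℕ} (hd : F.totalDegree = d) (hd34 : d = 3 ∨ d = 4) (hlead : coeff (Finsupp.single 0 d) F ≠ 0)
    (hF : Irreducible F)
    (T : Finset (Fin 2 → ZMod q)) (hT : ∀ P ∈ T, eval P F = 0 ∧ eval P (pderiv 0 F) ≠ 0) :
    T.card ≤ q + 200 * Nat.sqrt q := by
  have hq : q.Prime := Fact.out
  have hd0 : 0 < d := by omega
  set a := (q - 1) / d with ha
  set b := Nat.sqrt a with hb
  have h1 : d * a ≤ q - 1 := Nat.mul_div_le _ _
  have h2 : q - 1 < d * (a + 1) := by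
    rw [mul_comm]; exact Nat.lt_mul_of_div_lt (Nat.lt_succ_self _) hd0
  have hq2 : q ≤ d * a + d := by rw [Nat.mul_succ] at h2; omega
  have hdq : d * a < q := by have := hq.pos; omega
  have hab : b * b ≤ a := Nat.sqrt_le a
  have hab' : a < (b + 1) * (b + 1) := Nat.lt_succ_sqrt a
  have haq : a ≤ q := by nlinarith
  have hbq : b ≤ Nat.sqrt q := Nat.sqrt_le_sqrt haq
  rcases lt_or_ge b 20 with hlt | hge
  · have h3 : T.card ≤ d * q := by
      have := card_nonsingular_zeros_le_mul_card F T (fun P hP => (hT P hP).1)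
        (fun P hP => (hT P hP).2) Finset.univ fun _ _ => Finset.mem_univ _
      rwa [hd, Finset.card_univ, Fintype.card_fun, ZMod.card, Fintype.card_fin, pow_one] at this
    have h4 : a < 400 := hab'.trans_le (by nlinarith)
    have h5 : q ≤ 1600 := by rcases hd34 with rfl | rfl <;> omega
    have h6 : q < (Nat.sqrt q + 1) * (Nat.sqrt q + 1) := Nat.lt_succ_sqrt q
    have h7 : Nat.sqrt q ≤ 40 := by
      have := Nat.sqrt_le q
      nlinarith
    have h8 : 1 ≤ Nat.sqrt q := Nat.sqrt_pos.2 hq.pos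
    rcases hd34 with rfl | rfl <;> nlinarith
  · refine (stepanov_final (M := d * b - 40) hd34 rfl hge hab' hdq hq2 ?_).trans (by omega)
    have hM : d * b - 40 ≤ q := by
      have : b ≤ a := by nlinarith
      have := Nat.mul_le_mul_left d this
      omega
    refine card_nonsingular_curve_points_le hd (by omega) hlead hF hdq hM ?_ T hT
    rcases hd34 with h | h
    · rw [h]; exact stepanov_count_three hge hab
    · rw [h]; exact stepanov_count_four hge hab

section
variable {K : Type*} [Field K]

theorem X_pow_dvd_arc_of_mem_idealOfVars {u : PowerSeries K} (hu0 : PowerSeries.constantCoeff u = 0)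
    {m : ℕ} {g : MvPolynomial (Fin 2) K} (hg : g ∈ idealOfVars (Fin 2) K ^ m) :
    PowerSeries.X ^ m ∣ arc 0 u g := by
  have h1 : Ideal.map (arc 0 u : MvPolynomial (Fin 2) K →+* PowerSeries K) (idealOfVars (Fin 2) K) ≤
      Ideal.span {PowerSeries.X} := by
    rw [idealOfVars, Ideal.map_span, Ideal.span_le]
    rintro _ ⟨_, ⟨i, rfl⟩, rfl⟩
    rw [SetLike.mem_coe, Ideal.mem_span_singleton, PowerSeries.X_dvd_iff]
    change PowerSeries.constantCoeff (arc 0 u (X i)) = 0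
    rw [constantCoeff_arc (by simpa using hu0), eval_X, Pi.zero_apply]
  have h2 := Ideal.pow_right_mono h1 m
  rw [← Ideal.map_pow, Ideal.span_singleton_pow] at h2
  have h3 := h2 (Ideal.mem_map_of_mem _ hg)
  rwa [Ideal.mem_span_singleton] at h3

theorem coeff_single_one_eq_eval_pderiv {R : Type*} [CommRing R] {n : ℕ} (i : Fin n) (F : MvPolynomial (Fin n) R) :
    eval 0 (pderiv i F) = coeff (Finsupp.single i 1) F := by
  change eval (0 : Fin n → R) _ = _
  rw [MvPolynomial.eval_zero, constantCoeff_eq, coeff_pderiv]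
  simp

/-- For an irreducible plane curve that is smooth at the origin, no multiple of the equation by a
polynomial of small degree has a gap in the middle degrees. -/
theorem exists_coeff_mul_ne_zero {F : MvPolynomial (Fin 2) K} {d : ℕ} (hF : Irreducible F)
    (hd : F.totalDegree = d) (hlead : coeff (Finsupp.single 0 d) F ≠ 0)
    (h0 : constantCoeff F = 0) (h1 : coeff (Finsupp.single 0 1) F ≠ 0) (A : MvPolynomial (Fin 2) K)
    (hA : A ≠ 0) (hAd : A.totalDegree < d * (d - 1)) :
    ∃ β : Fin 2 →₀ ℕ, d ≤ β.degree ∧ β.degree ≤ d * (d - 1) ∧ coeff β (A * F) ≠ 0 := by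
  by_contra hno
  push Not at hno
  have hd0 : d ≠ 0 := by rintro rfl; simp at hAd
  set e := d * (d - 1) with he
  have hP : eval (0 : Fin 2 → K) F = 0 := by rwa [MvPolynomial.eval_zero]
  have hP' : eval (0 : Fin 2 → K) (pderiv 0 F) ≠ 0 := by
    rwa [coeff_single_one_eq_eval_pderiv]
  obtain ⟨u, hu0, hu⟩ := exists_arc hd.le hlead hP hP'
  set π : MvPolynomial (Fin 2) K := MvPowerSeries.truncTotal d (A * F : MvPolynomial (Fin 2) K) with hπ
  have hπd : π.totalDegree < d := MvPowerSeries.totalDegree_truncTotal_lt _ hd0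
  have hdiff : A * F - π ∈ idealOfVars (Fin 2) K ^ (e + 1) := by
    rw [mem_pow_idealOfVars_iff']
    intro β hβ
    rw [coeff_sub, hπ, MvPowerSeries.coeff_truncTotal_eq_ite]
    split_ifs with h
    · rw [MvPolynomial.coeff_coe, sub_self]
    · rw [hno β (not_lt.1 h) (Nat.lt_succ_iff.1 hβ), sub_zero]
  have hdvd : PowerSeries.X ^ (e + 1) ∣ arc 0 u π := by
    have h2 := X_pow_dvd_arc_of_mem_idealOfVars (by simpa using hu0) hdiff
    rw [map_sub, map_mul, hu, mul_zero, zero_sub, dvd_neg] at h2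
    exact h2
  have hFπ : F ∣ π := by
    by_contra h
    refine not_X_pow_dvd_arc hF hu h (Nat.lt_succ_of_le ?_) hdvd
    rw [hd]
    exact Nat.mul_le_mul_left _ (by omega)
  have hπ0 : π = 0 := by
    by_contra h
    have := totalDegree_le_of_dvd_of_isDomain hFπ h
    omega
  rw [hπ0, sub_zero, mem_pow_idealOfVars_iff'] at hdiff
  have ho1 : ((e + 1 : ℕ) : ℕ∞) ≤ ((A * F : MvPolynomial (Fin 2) K) : MvPowerSeries (Fin 2) K).order :=
    MvPowerSeries.nat_le_order fun β hβ => by rw [MvPolynomial.coeff_coe]; exact hdiff β hβ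
  have ho2 : (F : MvPowerSeries (Fin 2) K).order ≤ (1 : ℕ) := by
    have := MvPowerSeries.order_le (f := (F : MvPowerSeries (Fin 2) K)) (d := Finsupp.single 0 1)
      (by rwa [MvPolynomial.coeff_coe])
    simpa using this
  have ho3 : (A : MvPowerSeries (Fin 2) K).order ≤ ((e - 1 : ℕ) : ℕ∞) := by
    obtain ⟨α, hα⟩ := support_nonempty.2 hA
    have := MvPowerSeries.order_le (f := (A : MvPowerSeries (Fin 2) K)) (d := α)
      (by rw [MvPolynomial.coeff_coe]; exact mem_support_iff.1 hα)
    refine this.trans ?_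
    have := le_totalDegree hα
    rw [Nat.cast_le]
    change α.degree ≤ _ at this
    omega
  rw [MvPolynomial.coe_mul, MvPowerSeries.order_mul] at ho1
  have := ho1.trans (add_le_add ho3 ho2)
  rw [← Nat.cast_add, Nat.cast_le] at this
  omega

/-- A criterion for irreducibility of a plane curve that is smooth at the origin. -/
theorem irreducible_of_exists_coeff_mul_ne_zero {F : MvPolynomial (Fin 2) K} {d : ℕ} (hd2 : 2 ≤ d)
    (hd : F.totalDegree = d)
    (h0 : constantCoeff F = 0) (h1 : coeff (Finsupp.single 0 1) F ≠ 0)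
    (h : ∀ A : MvPolynomial (Fin 2) K, A ≠ 0 → A.totalDegree < d * (d - 1) →
      ∃ β : Fin 2 →₀ ℕ, d ≤ β.degree ∧ β.degree ≤ d * (d - 1) ∧ coeff β (A * F) ≠ 0) :
    Irreducible F := by
  set e := d * (d - 1) with he
  have he0 : e ≠ 0 := Nat.mul_ne_zero (by omega) (by omega)
  have hF0 : F ≠ 0 := by rintro rfl; simp at h1
  have key : ∀ a b : MvPolynomial (Fin 2) K, F = a * b → constantCoeff a = 0 → IsUnit b := by
    intro a b hab ha
    have ha0 : a ≠ 0 := by rintro rfl; exact hF0 (by rw [hab, zero_mul])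
    have hb0 : b ≠ 0 := by rintro rfl; exact hF0 (by rw [hab, mul_zero])
    have hmem : ∀ g : MvPolynomial (Fin 2) K, constantCoeff g = 0 → g ∈ idealOfVars (Fin 2) K ^ 1 := by
      intro g hg
      rw [mem_pow_idealOfVars_iff']
      intro β hβ
      have : β = 0 := by rwa [Nat.lt_one_iff, Finsupp.degree_eq_zero_iff] at hβ
      rw [this]
      exact hg
    have hbc : constantCoeff b ≠ 0 := by
      intro hb
      have h2 : F ∈ idealOfVars (Fin 2) K ^ (1 + 1) := by
        rw [hab, pow_add]
        exact Ideal.mul_mem_mul (hmem a ha) (hmem b hb)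
      rw [mem_pow_idealOfVars_iff'] at h2
      exact h1 (h2 _ (by simp))
    have hdeg : a.totalDegree + b.totalDegree = d := by
      rw [← totalDegree_mul_of_isDomain ha0 hb0, ← hab, hd]
    by_contra hunit
    have hbd : b.totalDegree ≠ 0 := by
      intro hz
      rw [totalDegree_eq_zero_iff_eq_C] at hz
      apply hunit
      rw [hz]
      refine (isUnit_iff_ne_zero.2 ?_).map C
      exact hbc
    set A : MvPolynomial (Fin 2) K :=
      MvPowerSeries.truncTotal e ((b : MvPowerSeries (Fin 2) K)⁻¹) with hA
    have hAd : A.totalDegree < e := MvPowerSeries.totalDegree_truncTotal_lt _ he0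
    have hbc' : MvPowerSeries.constantCoeff (b : MvPowerSeries (Fin 2) K) ≠ 0 := hbc
    have hAb : A * b - 1 ∈ idealOfVars (Fin 2) K ^ e := by
      have h2 := MvPowerSeries.truncTotal_mul_sub_mul_truncTotal_mem_pow_idealOfVars (n := e)
        ((b : MvPowerSeries (Fin 2) K)⁻¹) (b : MvPowerSeries (Fin 2) K)
      rw [MvPowerSeries.inv_mul_cancel _ hbc', MvPowerSeries.truncTotal_one he0, ← hA] at h2
      have h3 : b - MvPowerSeries.truncTotal e (b : MvPowerSeries (Fin 2) K) ∈
          idealOfVars (Fin 2) K ^ e := by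
        rw [mem_pow_idealOfVars_iff']
        intro β hβ
        rw [coeff_sub, MvPowerSeries.coeff_truncTotal _ hβ, MvPolynomial.coeff_coe, sub_self]
      have := sub_mem (Ideal.mul_mem_left _ A h3) h2
      convert this using 1
      ring
    have hA0 : A ≠ 0 := by
      intro hz
      rw [hz, zero_mul, zero_sub, mem_pow_idealOfVars_iff'] at hAb
      have := hAb 0 (by simpa using Nat.pos_of_ne_zero he0)
      simp at this
    obtain ⟨β, hβ1, hβ2, hβ⟩ := h A hA0 hAd
    apply hβ
    have h2 : A * F - a ∈ idealOfVars (Fin 2) K ^ (e + 1) := by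
      have := Ideal.mul_mem_mul hAb (hmem a ha)
      rw [← pow_add] at this
      convert this using 1
      rw [hab]
      ring
    rw [mem_pow_idealOfVars_iff'] at h2
    have h3 := h2 β (by omega)
    rw [coeff_sub, sub_eq_zero] at h3
    rw [h3]
    exact coeff_eq_zero_of_totalDegree_lt (by change _ < β.degree; omega)
  refine irreducible_iff.2 ⟨?_, ?_⟩
  · intro hu
    have h2 := hu.map (constantCoeff (σ := Fin 2) (R := K))
    rw [h0] at h2
    exact not_isUnit_zero h2
  · intro a b hab
    have h2 : constantCoeff a * constantCoeff b = 0 := by rw [← map_mul, ← hab, h0]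
    rcases mul_eq_zero.1 h2 with h3 | h3
    · exact Or.inr (key a b hab h3)
    · exact Or.inl (key b a (hab.trans (mul_comm _ _)) h3)

end

/-- The exponent `(a, b, c)`. -/
noncomputable def exp3 (a b c : ℕ) : Fin 3 →₀ ℕ :=
  Finsupp.single 0 a + Finsupp.single 1 b + Finsupp.single 2 c

theorem exp3_apply_zero (a b c : ℕ) : exp3 a b c 0 = a := by simp [exp3]
theorem exp3_apply_one (a b c : ℕ) : exp3 a b c 1 = b := by simp [exp3]
theorem exp3_apply_two (a b c : ℕ) : exp3 a b c 2 = c := by simp [exp3]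

theorem degree_exp3 (a b c : ℕ) : (exp3 a b c).degree = a + b + c := by
  simp [exp3]

theorem exp3_eq (α : Fin 3 →₀ ℕ) : exp3 (α 0) (α 1) (α 2) = α := by
  ext i
  fin_cases i
  · exact exp3_apply_zero _ _ _
  · exact exp3_apply_one _ _ _
  · exact exp3_apply_two _ _ _

/-- Restriction of a polynomial to the plane `x₂ = t x₁`. -/
noncomputable def slice {R : Type*} [CommRing R] (t : R) :
    MvPolynomial (Fin 3) R →ₐ[R] MvPolynomial (Fin 2) R :=
  aeval ![X 0, X 1, C t * X 1]

section
variable {R : Type*} [CommRing R]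

theorem coeff_slice (t : R) (h : MvPolynomial (Fin 3) R) (β : Fin 2 →₀ ℕ) :
    coeff β (slice t h) =
      ∑ m ∈ Finset.range (β 1 + 1), coeff (exp3 (β 0) (β 1 - m) m) h * t ^ m := by
  classical
  induction h using MvPolynomial.induction_on' with
  | add p q hp hq =>
    rw [map_add, coeff_add, hp, hq, ← Finset.sum_add_distrib]
    exact Finset.sum_congr rfl fun m _ => by rw [coeff_add, add_mul]
  | monomial γ r =>
    have h1 : slice t (monomial γ r) =
        monomial (Finsupp.single 0 (γ 0) + Finsupp.single 1 (γ 1 + γ 2)) (r * t ^ γ 2) := by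
      rw [slice, aeval_monomial, Finsupp.prod_fintype _ _ (fun i => pow_zero _), Fin.prod_univ_three]
      simp only [Matrix.cons_val_zero, Matrix.cons_val_one, Matrix.cons_val]
      rw [algebraMap_eq, mul_pow, ← C_pow,
        monomial_eq (s := Finsupp.single 0 (γ 0) + Finsupp.single 1 (γ 1 + γ 2))]
      rw [Finsupp.prod_fintype _ _ (fun i => pow_zero _), Fin.prod_univ_two]
      simp only [Finsupp.coe_add, Pi.add_apply, Finsupp.single_apply, C_mul, pow_add]
      simp
      ring
    rw [h1, coeff_monomial]
    split_ifs with h2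
    · have e0 : β 0 = γ 0 := by rw [← h2]; simp
      have e1 : β 1 = γ 1 + γ 2 := by rw [← h2]; simp
      rw [Finset.sum_eq_single (γ 2)]
      · rw [e0, e1, Nat.add_sub_cancel, exp3_eq, coeff_monomial, if_pos rfl]
      · intro m hm hmγ
        rw [coeff_monomial, if_neg, zero_mul]
        intro he
        apply hmγ
        rw [he, exp3_apply_two]
      · intro hm
        rw [Finset.mem_range] at hm
        omega
    · symm
      refine Finset.sum_eq_zero fun m hm => ?_
      rw [coeff_monomial, if_neg, zero_mul]
      intro he
      apply h2
      rw [Finset.mem_range] at hm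
      ext i
      fin_cases i
      · simp [he, exp3_apply_zero]
      · have e1 : γ 1 = β 1 - m := by rw [he, exp3_apply_one]
        have e2 : γ 2 = m := by rw [he, exp3_apply_two]
        simp
        omega

theorem exists_coeff_ne_zero_of_slice {t : R} {h : MvPolynomial (Fin 3) R} {β : Fin 2 →₀ ℕ}
    (hβ : coeff β (slice t h) ≠ 0) :
    ∃ α : Fin 3 →₀ ℕ, coeff α h ≠ 0 ∧ α 0 = β 0 ∧ α.degree = β.degree := by
  rw [coeff_slice] at hβ
  obtain ⟨m, hm, hne⟩ := Finset.exists_ne_zero_of_sum_ne_zero hβ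
  refine ⟨_, left_ne_zero_of_mul hne, exp3_apply_zero _ _ _, ?_⟩
  rw [degree_exp3, Finsupp.degree_eq_sum, Fin.sum_univ_two]
  rw [Finset.mem_range] at hm
  omega

theorem totalDegree_slice_le (t : R) (h : MvPolynomial (Fin 3) R) :
    (slice t h).totalDegree ≤ h.totalDegree := by
  rw [totalDegree, Finset.sup_le_iff]
  intro β hβ
  obtain ⟨α, hα, -, hd⟩ := exists_coeff_ne_zero_of_slice (mem_support_iff.1 hβ)
  change β.degree ≤ _
  rw [← hd]
  exact le_totalDegree (mem_support_iff.2 hα)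

theorem degreeOf_slice_le (t : R) (h : MvPolynomial (Fin 3) R) :
    degreeOf 0 (slice t h) ≤ degreeOf 0 h := by
  rw [degreeOf_le_iff]
  intro β hβ
  obtain ⟨α, hα, h0, -⟩ := exists_coeff_ne_zero_of_slice (mem_support_iff.1 hβ)
  rw [← h0]
  exact monomial_le_degreeOf 0 (mem_support_iff.2 hα)

theorem coeff_single_slice (t : R) (h : MvPolynomial (Fin 3) R) (d : ℕ) :
    coeff (Finsupp.single 0 d) (slice t h) = coeff (Finsupp.single 0 d) h := by
  rw [coeff_slice]
  simp [exp3]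

theorem totalDegree_eq_of_coeff_single {n d : ℕ} {h : MvPolynomial (Fin (n + 1)) R}
    (hd : h.totalDegree ≤ d) (hl : coeff (Finsupp.single 0 d) h ≠ 0) : h.totalDegree = d := by
  refine le_antisymm hd ?_
  have := le_totalDegree (mem_support_iff.2 hl)
  rwa [Finsupp.sum_single_index rfl] at this

end

section
variable {k K : Type*} [Field k] [Field K] [Algebra (Polynomial k) K] [IsFractionRing (Polynomial k) K]

/-- The generic plane section, over the field of rational functions in the slope. -/
noncomputable def genericSlice (k K : Type*) [Field k] [Field K] [Algebra (Polynomial k) K] :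
    MvPolynomial (Fin 3) k →+* MvPolynomial (Fin 2) K :=
  (slice (algebraMap (Polynomial k) K Polynomial.X) : MvPolynomial (Fin 3) K →+* _).comp
    (map ((algebraMap (Polynomial k) K).comp Polynomial.C))

theorem genericSlice_apply (h : MvPolynomial (Fin 3) k) : genericSlice k K h =
    slice (algebraMap (Polynomial k) K Polynomial.X)
      (map ((algebraMap (Polynomial k) K).comp Polynomial.C) h) := rfl

theorem genericSlice_injective : Function.Injective (genericSlice k K) := by
  rw [injective_iff_map_eq_zero]
  intro h hh
  ext α
  have h1 := congrArg (coeff (Finsupp.single 0 (α 0) + Finsupp.single 1 (α 1 + α 2))) hh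
  rw [genericSlice_apply, coeff_slice, coeff_zero] at h1
  simp only [coeff_map, RingHom.comp_apply] at h1
  simp only [← map_pow, ← map_mul, ← map_sum] at h1
  rw [FaithfulSMul.algebraMap_eq_zero_iff] at h1
  have h2 := congrArg (fun p => Polynomial.coeff p (α 2)) h1
  simp only [Polynomial.finset_sum_coeff, Polynomial.coeff_C_mul, Polynomial.coeff_X_pow,
    Polynomial.coeff_zero] at h2
  rw [Finset.sum_eq_single (α 2)] at h2
  · have e : exp3 ((Finsupp.single 0 (α 0) + Finsupp.single 1 (α 1 + α 2) : Fin 2 →₀ ℕ) 0)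
      ((Finsupp.single 0 (α 0) + Finsupp.single 1 (α 1 + α 2) : Fin 2 →₀ ℕ) 1 - α 2) (α 2) = α := by
      rw [show (Finsupp.single 0 (α 0) + Finsupp.single 1 (α 1 + α 2) : Fin 2 →₀ ℕ) 0 = α 0 by simp,
        show (Finsupp.single 0 (α 0) + Finsupp.single 1 (α 1 + α 2) : Fin 2 →₀ ℕ) 1 - α 2 = α 1 by simp,
        exp3_eq]
    rw [e] at h2
    simpa using h2
  · intro m _ hm
    simp [hm.symm]
  · intro hm
    simp at hm

theorem exists_genericSlice_eq_C (p : Polynomial k) : ∃ w v : MvPolynomial (Fin 3) k, w ≠ 0 ∧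
    degreeOf 0 w = 0 ∧ degreeOf 0 v = 0 ∧
    genericSlice k K v = genericSlice k K w * C (algebraMap (Polynomial k) K p) := by
  have hmul : ∀ f g : MvPolynomial (Fin 3) k, degreeOf 0 f = 0 → degreeOf 0 g = 0 →
      degreeOf 0 (f * g) = 0 := fun f g hf hg => by
    have := degreeOf_mul_le 0 f g
    omega
  have hadd : ∀ f g : MvPolynomial (Fin 3) k, degreeOf 0 f = 0 → degreeOf 0 g = 0 →
      degreeOf 0 (f + g) = 0 := fun f g hf hg => by
    have := degreeOf_add_le 0 f g
    omega
  induction p using Polynomial.induction_on with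
  | C a =>
    refine ⟨1, C a, one_ne_zero, degreeOf_one _, degreeOf_C _ _, ?_⟩
    rw [genericSlice_apply, map_one, one_mul, map_C]
    exact algHom_C _ _
  | add p q hp hq =>
    obtain ⟨w, v, hw, hw0, hv0, h⟩ := hp
    obtain ⟨w', v', hw', hw0', hv0', h'⟩ := hq
    refine ⟨w * w', v * w' + v' * w, mul_ne_zero hw hw', hmul _ _ hw0 hw0',
      hadd _ _ (hmul _ _ hv0 hw0') (hmul _ _ hv0' hw0), ?_⟩
    rw [map_add, map_add, C_add, map_mul, map_mul, map_mul, h, h']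
    ring
  | monomial n a ih =>
    obtain ⟨w, v, hw, hw0, hv0, h⟩ := ih
    refine ⟨w * X 1, v * X 2, mul_ne_zero hw (X_ne_zero _), hmul _ _ hw0 ?_, hmul _ _ hv0 ?_, ?_⟩
    · rw [degreeOf_X, if_neg (by decide)]
    · rw [degreeOf_X, if_neg (by decide)]
    · have e1 : genericSlice k K (X 1) = X 1 := by
        rw [genericSlice_apply, map_X, slice, aeval_X]; rfl
      have e2 : genericSlice k K (X 2) = C (algebraMap (Polynomial k) K Polynomial.X) * X 1 := by
        rw [genericSlice_apply, map_X, slice, aeval_X]; rfl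
      rw [pow_succ, ← mul_assoc, map_mul (algebraMap (Polynomial k) K), C_mul, map_mul, map_mul, h, e1, e2]
      ring

theorem exists_genericSlice_eq (π : MvPolynomial (Fin 2) K) : ∃ w v : MvPolynomial (Fin 3) k, w ≠ 0 ∧
    degreeOf 0 w = 0 ∧ genericSlice k K v = genericSlice k K w * π := by
  have hmul : ∀ f g : MvPolynomial (Fin 3) k, degreeOf 0 f = 0 → degreeOf 0 g = 0 →
      degreeOf 0 (f * g) = 0 := fun f g hf hg => by
    have := degreeOf_mul_le 0 f g
    omega
  induction π using MvPolynomial.induction_on with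
  | C r =>
    obtain ⟨p, p', hp', rfl⟩ := IsFractionRing.div_surjective (A := Polynomial k) r
    obtain ⟨w, v, hw, hw0, hv0, h⟩ := exists_genericSlice_eq_C (K := K) p
    obtain ⟨w', v', hw', hw0', hv0', h'⟩ := exists_genericSlice_eq_C (K := K) p'
    have hp0 : algebraMap (Polynomial k) K p' ≠ 0 :=
      IsLocalization.to_map_ne_zero_of_mem_nonZeroDivisors _ le_rfl hp'
    have hv' : v' ≠ 0 := by
      rintro rfl
      rw [map_zero, eq_comm, mul_eq_zero] at h'
      rcases h' with h' | h'
      · exact hw' (genericSlice_injective (h'.trans (map_zero _).symm))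
      · exact hp0 (by simpa using h')
    refine ⟨w * v', v * w', mul_ne_zero hw hv', hmul _ _ hw0 hv0', ?_⟩
    rw [map_mul, map_mul, h, h', div_eq_mul_inv, C_mul]
    have : C (algebraMap (Polynomial k) K p') * C (algebraMap (Polynomial k) K p')⁻¹ =
        (1 : MvPolynomial (Fin 2) K) := by
      rw [← C_mul, mul_inv_cancel₀ hp0, C_1]
    linear_combination (-(genericSlice k K w * C (algebraMap (Polynomial k) K p) * genericSlice k K w')) * this
  | add p q hp hq =>
    obtain ⟨w, v, hw, hw0, h⟩ := hp
    obtain ⟨w', v', hw', hw0', h'⟩ := hq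
    refine ⟨w * w', v * w' + v' * w, mul_ne_zero hw hw', hmul _ _ hw0 hw0', ?_⟩
    rw [map_add, map_mul, map_mul, map_mul, h, h']
    ring
  | mul_X p i hp =>
    obtain ⟨w, v, hw, hw0, h⟩ := hp
    refine ⟨w, v * X i.castSucc, hw, hw0, ?_⟩
    have : genericSlice k K (X i.castSucc) = X i := by
      rw [genericSlice_apply, map_X, slice, aeval_X]
      fin_cases i <;> rfl
    rw [map_mul, h, this, mul_assoc]

/-- The generic plane section through the line `x₁ = x₂ = 0` of an irreducible surface is
irreducible. -/
theorem irreducible_genericSlice {G : MvPolynomial (Fin 3) k} {d : ℕ} (hG : Irreducible G) (hd0 : 0 < d)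
    (hd : G.totalDegree = d) (hlead : coeff (Finsupp.single 0 d) G ≠ 0) :
    Irreducible (genericSlice k K G) := by
  set F := genericSlice k K G with hF
  have hFl : coeff (Finsupp.single 0 d) F ≠ 0 := by
    rw [hF, genericSlice_apply, coeff_single_slice, coeff_map]
    simpa using hlead
  have hFd : F.totalDegree = d :=
    totalDegree_eq_of_coeff_single ((totalDegree_slice_le _ _).trans
      ((totalDegree_map_le' _ _).trans hd.le)) hFl
  have hF0 : F ≠ 0 := by
    intro h
    rw [h, coeff_zero] at hFl
    exact hFl rfl
  have hFdeg : d ≤ degreeOf 0 F := by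
    have := monomial_le_degreeOf 0 (mem_support_iff.2 hFl)
    simpa using this
  have key : ∀ a b, F = a * b → ∀ w v : MvPolynomial (Fin 3) k, w ≠ 0 → degreeOf 0 w = 0 →
      genericSlice k K v = genericSlice k K w * a → G ∣ v → IsUnit b := by
    intro a b hab w v hw hw0 hv ⟨h, hh⟩
    have ha0 : a ≠ 0 := by rintro rfl; exact hF0 (by rw [hab, zero_mul])
    have hb0 : b ≠ 0 := by rintro rfl; exact hF0 (by rw [hab, mul_zero])
    have hgw : genericSlice k K w ≠ 0 := fun h => hw (genericSlice_injective (h.trans (map_zero _).symm))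
    rw [hh, map_mul, ← hF] at hv
    have hh0 : genericSlice k K h ≠ 0 := by
      intro hz
      rw [hz, mul_zero] at hv
      exact mul_ne_zero hgw ha0 hv.symm
    have h1 := congrArg (degreeOf 0) hv
    rw [degreeOf_mul_eq hF0 hh0, degreeOf_mul_eq hgw ha0] at h1
    have h2 : degreeOf 0 (genericSlice k K w) = 0 := by
      have h3 : degreeOf 0 (map ((algebraMap (Polynomial k) K).comp Polynomial.C) w) ≤ degreeOf 0 w := by
        rw [degreeOf_le_iff]
        intro m hm
        exact monomial_le_degreeOf 0 (support_map_subset _ _ hm)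
      have := (degreeOf_slice_le (algebraMap (Polynomial k) K Polynomial.X) _).trans h3
      rw [hw0] at this
      exact Nat.le_zero.1 this
    have h4 := degreeOf_le_totalDegree a 0
    have h5 := totalDegree_mul_of_isDomain ha0 hb0
    rw [← hab, hFd] at h5
    have h6 : b.totalDegree = 0 := by omega
    rw [totalDegree_eq_zero_iff_eq_C] at h6
    rw [h6]
    refine (isUnit_iff_ne_zero.2 fun hz => hb0 ?_).map C
    rw [h6, hz, C_0]
  refine irreducible_iff.2 ⟨?_, ?_⟩
  · intro hu
    obtain ⟨g, hg⟩ := hu.exists_right_inv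
    have hg0 : g ≠ 0 := by rintro rfl; simp at hg
    have h5 := totalDegree_mul_of_isDomain hF0 hg0
    rw [hg, totalDegree_one] at h5
    omega
  · intro a b hab
    obtain ⟨w, v, hw, hw0, hv⟩ := exists_genericSlice_eq (k := k) a
    obtain ⟨w', v', hw', hw0', hv'⟩ := exists_genericSlice_eq (k := k) b
    have h1 : v * v' = w * w' * G := by
      apply genericSlice_injective (k := k) (K := K)
      rw [map_mul, map_mul, map_mul, hv, hv', ← hF, hab]
      ring
    have h2 : G ∣ v * v' := by rw [h1]; exact dvd_mul_left _ _
    rcases hG.prime.dvd_or_dvd h2 with h3 | h3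
    · exact Or.inr (key a b hab w v hw hw0 hv h3)
    · exact Or.inl (key b a (hab.trans (mul_comm _ _)) w' v' hw' hw0' hv' h3)

end

section
variable {R : Type*} [CommRing R] {n : ℕ}

/-- Translation of the variables. -/
noncomputable def translate (P : Fin n → R) : MvPolynomial (Fin n) R →ₐ[R] MvPolynomial (Fin n) R :=
  aeval fun i => C (P i) + X i

theorem translate_translate (P Q : Fin n → R) (F : MvPolynomial (Fin n) R) :
    translate P (translate Q F) = translate (P + Q) F := by
  have : (translate P).comp (translate Q) = translate (P + Q) := by
    ext i : 1
    simp only [translate, AlgHom.comp_apply, aeval_X, map_add, Pi.add_apply]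
    rw [show (aeval fun i => C (P i) + X i : MvPolynomial (Fin n) R →ₐ[R] _) (C (Q i)) = C (Q i) from
      algHom_C _ _]
    ring
  exact congrArg (fun g => g F) this

theorem translate_zero (F : MvPolynomial (Fin n) R) : translate 0 F = F := by
  simp [translate, aeval_X_left]

/-- Translation as an automorphism. -/
noncomputable def translateEquiv (P : Fin n → R) :
    MvPolynomial (Fin n) R ≃ₐ[R] MvPolynomial (Fin n) R :=
  AlgEquiv.ofAlgHom (translate P) (translate (-P))
    (AlgHom.ext fun F => by
      rw [AlgHom.comp_apply, translate_translate, add_neg_cancel, translate_zero]; rfl)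
    (AlgHom.ext fun F => by
      rw [AlgHom.comp_apply, translate_translate, neg_add_cancel, translate_zero]; rfl)

theorem irreducible_translate (P : Fin n → R) {F : MvPolynomial (Fin n) R} (hF : Irreducible F) :
    Irreducible (translate P F) :=
  (MulEquiv.irreducible_iff (translateEquiv P)).2 hF

theorem map_translate {S : Type*} [CommRing S] (φ : R →+* S) (P : Fin n → R)
    (F : MvPolynomial (Fin n) R) :
    map φ (translate P F) = translate (fun i => φ (P i)) (map φ F) := by
  induction F using MvPolynomial.induction_on with
  | C a =>
    rw [show translate P (C a) = C a from algHom_C _ _, map_C]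
    exact (algHom_C _ _).symm
  | add p q hp hq => simp only [map_add, hp, hq]
  | mul_X p i hp =>
    rw [map_mul, map_mul, hp, map_mul, map_mul]
    congr 1
    simp [translate]

theorem eval_translate (P u : Fin n → R) (F : MvPolynomial (Fin n) R) :
    eval u (translate P F) = eval (P + u) F := by
  have : ((eval u).comp (translate P : MvPolynomial (Fin n) R →+* _)) = eval (P + u) := by
    ext i <;> simp [translate]
  exact congrArg (fun g => g F) this

theorem pderiv_translate (P : Fin n → R) (F : MvPolynomial (Fin n) R) (i : Fin n) :
    pderiv i (translate P F) = translate P (pderiv i F) := by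
  classical
  induction F using MvPolynomial.induction_on with
  | C a =>
    rw [show translate P (C a) = C a from algHom_C _ _]
    simp
  | add a b ha hb => simp only [map_add, ha, hb]
  | mul_X a j ha =>
    rw [map_mul, Derivation.leibniz, Derivation.leibniz, ha]
    have : pderiv i (translate P (X j)) = translate P (pderiv i (X j)) := by
      rw [pderiv_X, translate, aeval_X, map_add, pderiv_C, zero_add, pderiv_X]
      by_cases h : j = i
      · subst h; simp
      · simp [Pi.single_eq_of_ne h, Pi.single_eq_of_ne (Ne.symm h)]
    simp only [smul_eq_mul, map_add, map_mul, this]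

theorem exists_eq_add_single {γ : Fin n →₀ ℕ} {k : ℕ} (h : γ.degree = k + 1) :
    ∃ (γ' : Fin n →₀ ℕ) (i : Fin n), γ = γ' + Finsupp.single i 1 ∧ γ'.degree = k := by
  have hne : γ ≠ 0 := by rintro rfl; simp at h
  obtain ⟨i, hi⟩ := Finsupp.ne_iff.1 hne
  have hle : Finsupp.single i 1 ≤ γ := by
    rw [Finsupp.single_le_iff]; exact Nat.one_le_iff_ne_zero.2 hi
  refine ⟨γ - Finsupp.single i 1, i, (tsub_add_cancel_of_le hle).symm, ?_⟩
  have := congrArg Finsupp.degree (tsub_add_cancel_of_le hle)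
  rw [map_add, Finsupp.degree_single] at this
  omega

theorem coeff_translate_monomial_add (P : Fin n → R) (γ α : Fin n →₀ ℕ) (i : Fin n) :
    coeff α (translate P (monomial (γ + Finsupp.single i 1) 1)) =
      P i * coeff α (translate P (monomial γ 1)) +
        if i ∈ α.support then coeff (α - Finsupp.single i 1) (translate P (monomial γ 1)) else 0 := by
  classical
  rw [show monomial (γ + Finsupp.single i 1) (1 : R) = monomial γ 1 * X i by
    rw [X, monomial_mul, mul_one], map_mul,
    show translate P (X i) = C (P i) + X i by simp [translate], mul_add, coeff_add, coeff_mul_X',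
    mul_comm _ (C (P i)), coeff_C_mul]

theorem coeff_translate_monomial_of_le (P : Fin n → R) (k : ℕ) : ∀ γ : Fin n →₀ ℕ, γ.degree = k →
    ∀ α : Fin n →₀ ℕ, k ≤ α.degree →
      coeff α (translate P (monomial γ 1)) = coeff α (monomial γ (1 : R)) := by
  classical
  induction k with
  | zero =>
    intro γ hγ α _
    rw [Finsupp.degree_eq_zero_iff] at hγ
    subst hγ
    rw [show (monomial 0 (1 : R) : MvPolynomial (Fin n) R) = C 1 from rfl,
      show translate P (C 1) = C 1 from algHom_C _ _]
  | succ k ih =>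
    intro γ hγ α hα
    obtain ⟨γ', i, rfl, hγ'⟩ := exists_eq_add_single hγ
    rw [coeff_translate_monomial_add, ih γ' hγ' α (by omega), coeff_monomial,
      if_neg (by rintro rfl; omega), mul_zero, zero_add,
      show monomial (γ' + Finsupp.single i 1) (1 : R) = monomial γ' 1 * X i by
        rw [X, monomial_mul, mul_one], coeff_mul_X']
    split_ifs with h
    · refine ih γ' hγ' _ ?_
      have hle : Finsupp.single i 1 ≤ α := by
        rw [Finsupp.single_le_iff]; exact Nat.one_le_iff_ne_zero.2 (Finsupp.mem_support_iff.1 h)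
      have := congrArg Finsupp.degree (tsub_add_cancel_of_le hle)
      rw [map_add, Finsupp.degree_single] at this
      omega
    · rfl

theorem coeff_translate_eq_sum (P : Fin n → R) (F : MvPolynomial (Fin n) R) (α : Fin n →₀ ℕ) :
    coeff α (translate P F) =
      ∑ γ ∈ F.support, coeff γ F * coeff α (translate P (monomial γ 1)) := by
  conv_lhs => rw [F.as_sum, map_sum, coeff_sum]
  refine Finset.sum_congr rfl fun γ _ => ?_
  rw [← coeff_C_mul, ← show translate P (C (coeff γ F)) = C (coeff γ F) from algHom_C _ _, ← map_mul,
    C_mul_monomial, mul_one]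

theorem coeff_translate_of_le (P : Fin n → R) {F : MvPolynomial (Fin n) R} {α : Fin n →₀ ℕ}
    (h : F.totalDegree ≤ α.degree) : coeff α (translate P F) = coeff α F := by
  classical
  rw [coeff_translate_eq_sum, Finset.sum_congr rfl fun γ hγ => by
    rw [coeff_translate_monomial_of_le P γ.degree γ rfl α ((le_totalDegree hγ).trans h)]]
  conv_rhs => rw [F.as_sum, coeff_sum]
  exact Finset.sum_congr rfl fun γ _ => by rw [coeff_monomial, coeff_monomial]; split_ifs <;> simp

theorem totalDegree_translate_le (P : Fin n → R) (F : MvPolynomial (Fin n) R) :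
    (translate P F).totalDegree ≤ F.totalDegree := by
  rw [totalDegree, Finset.sup_le_iff]
  intro α hα
  by_contra hlt
  have hlt' : F.totalDegree < α.degree := not_le.1 hlt
  rw [mem_support_iff, coeff_translate_of_le P hlt'.le] at hα
  exact absurd (le_totalDegree (mem_support_iff.2 hα)) (not_le.2 hlt')

end

theorem abs_coeff_translate_monomial_le {n b : ℕ} {P : Fin n → ℤ} (hP : ∀ i, |P i| ≤ b) (k : ℕ) :
    ∀ γ : Fin n →₀ ℕ, γ.degree = k → ∀ α : Fin n →₀ ℕ,
      |coeff α (translate P (monomial γ 1))| ≤ ((b : ℤ) + 1) ^ k := by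
  classical
  induction k with
  | zero =>
    intro γ hγ α
    rw [Finsupp.degree_eq_zero_iff] at hγ
    subst hγ
    rw [show (monomial 0 (1 : ℤ) : MvPolynomial (Fin n) ℤ) = C 1 from rfl,
      show translate P (C 1) = C 1 from algHom_C _ _, coeff_C]
    split_ifs <;> simp
  | succ k ih =>
    intro γ hγ α
    obtain ⟨γ', i, rfl, hγ'⟩ := exists_eq_add_single hγ
    rw [coeff_translate_monomial_add]
    refine (abs_add_le _ _).trans ?_
    have h1 : |P i * coeff α (translate P (monomial γ' 1))| ≤ b * ((b : ℤ) + 1) ^ k := by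
      rw [abs_mul]
      exact mul_le_mul (hP i) (ih γ' hγ' α) (abs_nonneg _) (by positivity)
    have h2 : |if i ∈ α.support then coeff (α - Finsupp.single i 1) (translate P (monomial γ' 1))
        else 0| ≤ ((b : ℤ) + 1) ^ k := by
      split_ifs
      · exact ih γ' hγ' _
      · simp; positivity
    calc _ ≤ b * ((b : ℤ) + 1) ^ k + ((b : ℤ) + 1) ^ k := add_le_add h1 h2
      _ = _ := by ring

theorem natAbs_coeff_translate_le {n b d H : ℕ} {P : Fin n → ℤ} (hP : ∀ i, |P i| ≤ b)
    {F : MvPolynomial (Fin n) ℤ} (hd : F.totalDegree ≤ d) (hH : ∀ α, (coeff α F).natAbs ≤ H)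
    (α : Fin n →₀ ℕ) :
    (coeff α (translate P F)).natAbs ≤ (expLE n d).card * (H * (b + 1) ^ d) := by
  have hsub : F.support ⊆ expLE n d := fun γ hγ => mem_expLE.2 ((le_totalDegree hγ).trans hd)
  have h1 : |coeff α (translate P F)| ≤ ((expLE n d).card * (H * (b + 1) ^ d) : ℕ) := by
    rw [coeff_translate_eq_sum]
    refine (Finset.abs_sum_le_sum_abs _ _).trans ?_
    calc _ ≤ ∑ γ ∈ F.support, ((H * (b + 1) ^ d : ℕ) : ℤ) := by
          refine Finset.sum_le_sum fun γ hγ => ?_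
          rw [abs_mul]
          push_cast
          refine mul_le_mul ?_ ((abs_coeff_translate_monomial_le hP _ γ rfl α).trans
            (pow_le_pow_right₀ (by omega) (mem_expLE.1 (hsub hγ)))) (abs_nonneg _) (by positivity)
          rw [Int.abs_eq_natAbs]
          exact_mod_cast hH γ
      _ = F.support.card * ((H * (b + 1) ^ d : ℕ) : ℤ) := by rw [Finset.sum_const, nsmul_eq_mul]
      _ ≤ _ := by
          push_cast
          gcongr
  rw [Int.abs_eq_natAbs] at h1
  exact_mod_cast h1

/-- The coefficients of `x ^ α * slice t f`, as polynomials in the slope `t`. -/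
noncomputable def sliceEntry {R : Type*} [CommRing R] (f : MvPolynomial (Fin 3) R)
    (α β : Fin 2 →₀ ℕ) : Polynomial R :=
  open Classical in
  if α ≤ β then ∑ m ∈ Finset.range ((β - α) 1 + 1),
    Polynomial.C (coeff (exp3 ((β - α) 0) ((β - α) 1 - m) m) f) * Polynomial.X ^ m else 0

theorem eval₂_sliceEntry {R S : Type*} [CommRing R] [CommRing S] (φ : R →+* S) (t : S)
    (f : MvPolynomial (Fin 3) R) (α β : Fin 2 →₀ ℕ) :
    (sliceEntry f α β).eval₂ φ t = coeff β (monomial α 1 * slice t (map φ f)) := by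
  classical
  rw [coeff_monomial_mul', sliceEntry]
  split_ifs with h
  · rw [one_mul, coeff_slice, Polynomial.eval₂_finset_sum]
    exact Finset.sum_congr rfl fun m _ => by
      rw [Polynomial.eval₂_mul, Polynomial.eval₂_C, Polynomial.eval₂_pow, Polynomial.eval₂_X, coeff_map]
  · rw [Polynomial.eval₂_zero]

theorem natDegree_sliceEntry_le {R : Type*} [CommRing R] (f : MvPolynomial (Fin 3) R)
    (α : Fin 2 →₀ ℕ) {β : Fin 2 →₀ ℕ} {e : ℕ} (hβ : β.degree ≤ e) :
    (sliceEntry f α β).natDegree ≤ e := by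
  rw [sliceEntry]
  split_ifs with h
  · refine Polynomial.natDegree_sum_le_of_forall_le _ _ fun m hm => ?_
    refine (Polynomial.natDegree_C_mul_X_pow_le _ _).trans ?_
    have h1 : (β - α) 1 ≤ β 1 := by simp
    have h2 : β 1 ≤ β.degree := by
      rw [Finsupp.degree_eq_sum, Fin.sum_univ_two]; omega
    rw [Finset.mem_range] at hm
    omega
  · simp

theorem abs_eval_sliceEntry_le {f : MvPolynomial (Fin 3) ℤ} {H e t : ℕ} (ht : 1 ≤ t)
    (hH : ∀ α, (coeff α f).natAbs ≤ H) (α : Fin 2 →₀ ℕ) {β : Fin 2 →₀ ℕ} (hβ : β.degree ≤ e) :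
    |(sliceEntry f α β).eval (t : ℤ)| ≤ ((e + 1) * (H * t ^ e) : ℕ) := by
  rw [sliceEntry]
  split_ifs with h
  · have h1 : (β - α) 1 ≤ β 1 := by simp
    have h2 : β 1 ≤ β.degree := by
      rw [Finsupp.degree_eq_sum, Fin.sum_univ_two]; omega
    rw [Polynomial.eval_finset_sum]
    refine (Finset.abs_sum_le_sum_abs _ _).trans ?_
    calc _ ≤ ∑ m ∈ Finset.range ((β - α) 1 + 1), ((H * t ^ e : ℕ) : ℤ) := by
          refine Finset.sum_le_sum fun m hm => ?_
          rw [Polynomial.eval_mul, Polynomial.eval_C, Polynomial.eval_pow, Polynomial.eval_X, abs_mul,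
            abs_of_nonneg (by positivity : (0 : ℤ) ≤ (t : ℤ) ^ m), Int.abs_eq_natAbs]
          rw [Finset.mem_range] at hm
          exact_mod_cast Nat.mul_le_mul (hH _) (Nat.pow_le_pow_right ht (by omega))
      _ = (((β - α) 1 + 1 : ℕ) : ℤ) * ((H * t ^ e : ℕ) : ℤ) := by
          rw [Finset.sum_const, nsmul_eq_mul, Finset.card_range]
      _ ≤ _ := by
          rw [← Nat.cast_mul]
          exact_mod_cast Nat.mul_le_mul_right _ (by omega)
  · rw [Polynomial.eval_zero, abs_zero]
    positivity

/-- The exponents that witness the irreducibility of a section of degree `d`. -/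
abbrev WitnessExp (d : ℕ) : Type := {β : Fin 2 →₀ ℕ // d ≤ β.degree ∧ β.degree ≤ d * (d - 1)}

/-- The matrix whose minors detect reducible sections. -/
noncomputable def witnessMatrix {R : Type*} [CommRing R] (d : ℕ) (f : MvPolynomial (Fin 3) R)
    (x : expLE 2 (d * (d - 1) - 1) → WitnessExp d) :
    Matrix (expLE 2 (d * (d - 1) - 1)) (expLE 2 (d * (d - 1) - 1)) (Polynomial R) :=
  Matrix.of fun i j => sliceEntry f i.1 (x j).1

theorem sum_sliceEntry {R S : Type*} [CommRing R] [Field S] (φ : R →+* S) (t : S)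
    (f : MvPolynomial (Fin 3) R) (I : Finset (Fin 2 →₀ ℕ)) (c : I → S) (β : Fin 2 →₀ ℕ) :
    ∑ i : I, c i * (sliceEntry f i.1 β).eval₂ φ t = coeff β (combo I c * slice t (map φ f)) := by
  rw [combo_apply, Finset.sum_mul, coeff_sum]
  refine Finset.sum_congr rfl fun i _ => ?_
  rw [mul_assoc, coeff_C_mul, eval₂_sliceEntry]

theorem exists_witnessMatrix_det_ne_zero {f : MvPolynomial (Fin 3) ℤ} {d : ℕ} (hd2 : 2 ≤ d)
    (hirr : Irreducible (map (Int.castRingHom ℚ) f)) (hd : f.totalDegree = d)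
    (hlead : coeff (Finsupp.single 0 d) f ≠ 0) (h0 : constantCoeff f = 0)
    (h1 : coeff (Finsupp.single 0 1) f ≠ 0) : ∃ x, (witnessMatrix d f x).det ≠ 0 := by
  classical
  let K := FractionRing (Polynomial ℚ)
  let φ : ℤ →+* K := ((algebraMap (Polynomial ℚ) K).comp Polynomial.C).comp (Int.castRingHom ℚ)
  haveI : CharZero K := algebraRat.charZero K
  have hφ : Function.Injective φ := RingHom.injective_int φ
  let T : K := algebraMap (Polynomial ℚ) K Polynomial.X
  have hF : slice T (map φ f) = genericSlice ℚ K (map (Int.castRingHom ℚ) f) := by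
    rw [genericSlice_apply, map_map]
  have hlF : coeff (Finsupp.single 0 d) (slice T (map φ f)) ≠ 0 := by
    rw [coeff_single_slice, coeff_map]
    exact (map_ne_zero_iff φ hφ).2 hlead
  have hdF : (slice T (map φ f)).totalDegree = d :=
    totalDegree_eq_of_coeff_single ((totalDegree_slice_le _ _).trans
      ((totalDegree_map_le' _ _).trans hd.le)) hlF
  have hirrF : Irreducible (slice T (map φ f)) := by
    rw [hF]
    refine irreducible_genericSlice (d := d) hirr (by omega) ((totalDegree_map_rat f).trans hd) ?_
    rw [coeff_map]
    simpa using hlead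
  have h0F : constantCoeff (slice T (map φ f)) = 0 := by
    have h00 : coeff 0 f = 0 := h0
    rw [constantCoeff_eq, coeff_slice]
    simp [exp3, coeff_map, h00]
  have h1F : coeff (Finsupp.single 0 1) (slice T (map φ f)) ≠ 0 := by
    rw [coeff_single_slice, coeff_map]
    exact (map_ne_zero_iff φ hφ).2 h1
  refine exists_det_ne_zero (fun (β : WitnessExp d) (i : expLE 2 (d * (d - 1) - 1)) =>
    sliceEntry f i.1 β.1) fun c hc => ?_
  let ev : Polynomial ℤ →+* K := Polynomial.eval₂RingHom φ T
  have hev : Function.Injective ev := by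
    have : ev = (algebraMap (Polynomial ℚ) K).comp (Polynomial.mapRingHom (Int.castRingHom ℚ)) := by
      ext
      · simp [ev, φ]
      · simp [ev, T]
    rw [this]
    exact (IsFractionRing.injective (Polynomial ℚ) K).comp
      (Polynomial.map_injective _ Int.cast_injective)
  have hc' : (fun i => ev (c i)) ≠ 0 := by
    intro h
    apply hc
    funext i
    exact hev ((congrFun h i).trans (map_zero ev).symm)
  have he : 0 < d * (d - 1) := Nat.mul_pos (by omega) (by omega)
  obtain ⟨β, hβ1, hβ2, hβ⟩ := exists_coeff_mul_ne_zero hirrF hdF hlF h0F h1F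
    (combo _ fun i => ev (c i)) (combo_ne_zero hc') (by
      have : (combo (expLE 2 (d * (d - 1) - 1)) fun i => ev (c i)).totalDegree ≤ d * (d - 1) - 1 := by
        rw [totalDegree, Finset.sup_le_iff]
        exact fun α hα => mem_expLE.1 (support_combo_subset _ _ hα)
      omega)
  refine ⟨⟨β, hβ1, hβ2⟩, fun hz => hβ ?_⟩
  rw [← sum_sliceEntry]
  have := congrArg ev hz
  rw [map_sum, map_zero] at this
  rw [← this]
  exact Finset.sum_congr rfl fun i _ => (map_mul ev _ _).symm

theorem irreducible_slice_of_det_ne_zero {K : Type*} [Field K] (φ : ℤ →+* K) {f : MvPolynomial (Fin 3) ℤ}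
    {d : ℕ} (hd2 : 2 ≤ d) (hd : f.totalDegree = d) (hlead : φ (coeff (Finsupp.single 0 d) f) ≠ 0)
    (h0 : constantCoeff f = 0) (h1 : φ (coeff (Finsupp.single 0 1) f) ≠ 0) (x)
    {t : K} (hdet : ((witnessMatrix d f x).det).eval₂ φ t ≠ 0) :
    Irreducible (slice t (map φ f)) := by
  classical
  have hlF : coeff (Finsupp.single 0 d) (slice t (map φ f)) ≠ 0 := by
    rwa [coeff_single_slice, coeff_map]
  have hdF : (slice t (map φ f)).totalDegree = d :=
    totalDegree_eq_of_coeff_single ((totalDegree_slice_le _ _).trans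
      ((totalDegree_map_le' _ _).trans hd.le)) hlF
  have h0F : constantCoeff (slice t (map φ f)) = 0 := by
    have h00 : coeff 0 f = 0 := h0
    rw [constantCoeff_eq, coeff_slice]
    simp [exp3, coeff_map, h00]
  refine irreducible_of_exists_coeff_mul_ne_zero hd2 hdF h0F
    (by rwa [coeff_single_slice, coeff_map]) fun A hA hAd => ?_
  by_contra hno
  push Not at hno
  set c : expLE 2 (d * (d - 1) - 1) → K := fun i => coeff i.1 A with hc
  have hcomb : combo (expLE 2 (d * (d - 1) - 1)) c = A := by
    ext α
    by_cases hα : α ∈ expLE 2 (d * (d - 1) - 1)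
    · exact coeff_combo _ c ⟨α, hα⟩
    · rw [notMem_support_iff.1 fun h => hα (support_combo_subset _ _ h), eq_comm, ← notMem_support_iff]
      intro h
      apply hα
      rw [mem_expLE]
      have := le_totalDegree h
      change α.degree ≤ _ at this
      omega
  have hc0 : c ≠ 0 := by
    intro h
    apply hA
    rw [← hcomb, h, map_zero]
  set ev : Polynomial ℤ →+* K := Polynomial.eval₂RingHom φ t with hev
  have hdet' : (ev.mapMatrix (witnessMatrix d f x)).det ≠ 0 := by
    rw [← RingHom.map_det]; exact hdet
  apply hdet'
  rw [← Matrix.exists_vecMul_eq_zero_iff]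
  refine ⟨c, hc0, ?_⟩
  funext j
  have := sum_sliceEntry φ t f _ c (x j).1
  rw [hcomb, hno _ (x j).2.1 (x j).2.2] at this
  exact this

theorem natDegree_det_le_mul {R ι : Type*} [CommRing R] [Fintype ι] [DecidableEq ι]
    (M : Matrix ι ι (Polynomial R)) {e : ℕ} (h : ∀ i j, (M i j).natDegree ≤ e) :
    M.det.natDegree ≤ e * Fintype.card ι := by
  rw [Matrix.det_apply]
  refine Polynomial.natDegree_sum_le_of_forall_le _ _ fun σ _ => ?_
  refine (Polynomial.natDegree_smul_le _ _).trans ((Polynomial.natDegree_prod_le _ _).trans ?_)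
  refine (Finset.sum_le_sum fun i _ => h (σ i) i).trans ?_
  rw [Finset.sum_const, smul_eq_mul, mul_comm, Finset.card_univ]

theorem exists_eval_natCast_ne_zero {Φ : Polynomial ℤ} (h : Φ ≠ 0) :
    ∃ t : ℕ, 1 ≤ t ∧ t ≤ Φ.natDegree + 1 ∧ Φ.eval (t : ℤ) ≠ 0 := by
  by_contra! hno
  apply h
  refine Polynomial.eq_zero_of_natDegree_lt_card_of_eval_eq_zero Φ
    (f := fun i : Fin (Φ.natDegree + 1) => ((i + 1 : ℕ) : ℤ)) ?_ (fun i => ?_) (by simp)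
  · intro i j hij
    ext
    have : ((i + 1 : ℕ) : ℤ) = ((j + 1 : ℕ) : ℤ) := hij
    omega
  · exact hno _ (by omega) (by omega)

section
variable {R : Type*} [CommRing R]

theorem eval_slice (t : R) (u : Fin 2 → R) (G : MvPolynomial (Fin 3) R) :
    eval u (slice t G) = eval ![u 0, u 1, t * u 1] G := by
  have : ((eval u).comp (slice t : MvPolynomial (Fin 3) R →+* _)) = eval ![u 0, u 1, t * u 1] := by
    ext i
    · simp [slice]
    · fin_cases i <;> simp [slice]
  exact congrArg (fun g => g G) this

theorem pderiv_zero_slice (t : R) (G : MvPolynomial (Fin 3) R) :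
    pderiv 0 (slice t G) = slice t (pderiv 0 G) := by
  induction G using MvPolynomial.induction_on with
  | C a =>
    rw [show slice t (C a) = C a from algHom_C _ _]
    simp
  | add a b ha hb => simp only [map_add, ha, hb]
  | mul_X a j ha =>
    rw [map_mul, Derivation.leibniz, Derivation.leibniz, ha]
    have : pderiv 0 (slice t (X j)) = slice t (pderiv 0 (X j)) := by
      fin_cases j
      · simp [slice]
      · simp [slice, pderiv_X]
      · simp [slice, pderiv_X]
    simp only [smul_eq_mul, map_add, map_mul, this]

end

theorem card_surface_points_le {q : ℕ} [Fact q.Prime] {G : MvPolynomial (Fin 3) (ZMod q)}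
    {d : ℕ} (hd : G.totalDegree = d) (hd34 : d = 3 ∨ d = 4) (hlead : coeff (Finsupp.single 0 d) G ≠ 0)
    (bad : Finset (ZMod q)) (hbad : ∀ t ∉ bad, Irreducible (slice t G))
    (T : Finset (Fin 3 → ZMod q)) (hT : ∀ P ∈ T, eval P G = 0 ∧ eval P (pderiv 0 G) ≠ 0) :
    T.card ≤ q * (q + 200 * Nat.sqrt q) + (bad.card + 1) * (d * q) := by
  classical
  have hline : ∀ (S : Finset (Fin 3 → ZMod q)) (φ : ZMod q → Fin 2 → ZMod q), S ⊆ T →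
      (∀ P ∈ S, ∃ s, Fin.tail P = φ s) → S.card ≤ d * q := by
    intro S φ hS hφ
    have := card_nonsingular_zeros_le_mul_card G S (fun P hP => (hT P (hS hP)).1)
      (fun P hP => (hT P (hS hP)).2) (Finset.univ.image φ) (fun P hP => by
        obtain ⟨s, hs⟩ := hφ P hP
        exact Finset.mem_image.2 ⟨s, Finset.mem_univ _, hs.symm⟩)
    rw [hd] at this
    refine this.trans (Nat.mul_le_mul_left _ (Finset.card_image_le.trans ?_))
    rw [Finset.card_univ, ZMod.card]
  have hplane : ∀ t, (T.filter fun P => P 2 = t * P 1).card ≤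
      if t ∈ bad then d * q else q + 200 * Nat.sqrt q := by
    intro t
    split_ifs with ht
    · refine hline _ (fun s => ![s, t * s]) (Finset.filter_subset _ _) fun P hP => ⟨P 1, ?_⟩
      funext i
      fin_cases i
      · rfl
      · exact (Finset.mem_filter.1 hP).2
    · have hlF : coeff (Finsupp.single 0 d) (slice t G) ≠ 0 := by rwa [coeff_single_slice]
      have hdF : (slice t G).totalDegree = d :=
        totalDegree_eq_of_coeff_single ((totalDegree_slice_le _ _).trans hd.le) hlF
      have hinj : Set.InjOn (fun P : Fin 3 → ZMod q => ![P 0, P 1])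
          (T.filter fun P => P 2 = t * P 1) := by
        intro P hP Q hQ hPQ
        have h0 : P 0 = Q 0 := congrFun hPQ 0
        have h1 : P 1 = Q 1 := congrFun hPQ 1
        funext i
        fin_cases i
        · exact h0
        · exact h1
        · change P 2 = Q 2
          rw [(Finset.mem_filter.1 hP).2, (Finset.mem_filter.1 hQ).2, h1]
      rw [← Finset.card_image_of_injOn hinj]
      refine card_curve_points_le hdF hd34 hlF (hbad t ht) _ fun u hu => ?_
      obtain ⟨P, hP, rfl⟩ := Finset.mem_image.1 hu
      obtain ⟨hPT, hP2⟩ := Finset.mem_filter.1 hP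
      have hPe : (![P 0, P 1, t * P 1] : Fin 3 → ZMod q) = P := by
        funext i
        fin_cases i
        · rfl
        · rfl
        · exact hP2.symm
      rw [pderiv_zero_slice, eval_slice, eval_slice]
      simp only [Matrix.cons_val_zero, Matrix.cons_val_one, hPe]
      exact hT P hPT
  have hcover : T ⊆ (Finset.univ.biUnion fun t => T.filter fun P => P 2 = t * P 1) ∪
      T.filter fun P => P 1 = 0 := by
    intro P hP
    rw [Finset.mem_union, Finset.mem_biUnion]
    by_cases h : P 1 = 0
    · exact Or.inr (Finset.mem_filter.2 ⟨hP, h⟩)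
    · refine Or.inl ⟨P 2 / P 1, Finset.mem_univ _, Finset.mem_filter.2 ⟨hP, ?_⟩⟩
      rw [div_mul_cancel₀ _ h]
  have hz : (T.filter fun P => P 1 = 0).card ≤ d * q := by
    refine hline _ (fun s => ![0, s]) (Finset.filter_subset _ _) fun P hP => ⟨P 2, ?_⟩
    funext i
    fin_cases i
    · exact (Finset.mem_filter.1 hP).2
    · rfl
  have hsum : ∑ t : ZMod q, (if t ∈ bad then d * q else q + 200 * Nat.sqrt q) ≤
      bad.card * (d * q) + q * (q + 200 * Nat.sqrt q) := by
    calc _ ≤ ∑ t : ZMod q, ((if t ∈ bad then d * q else 0) + (q + 200 * Nat.sqrt q)) :=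
          Finset.sum_le_sum fun t _ => by split_ifs <;> omega
      _ = _ := by
          rw [Finset.sum_add_distrib, Finset.sum_const, smul_eq_mul, Finset.card_univ, ZMod.card,
            ← Finset.sum_filter, Finset.sum_const, smul_eq_mul]
          congr 3
          ext; simp
  have h1 := (Finset.card_le_card hcover).trans (Finset.card_union_le _ _)
  have h2 := (Finset.card_biUnion_le (s := (Finset.univ : Finset (ZMod q)))
    (t := fun t => T.filter fun P => P 2 = t * P 1)).trans (Finset.sum_le_sum fun t _ => hplane t)
  have h3 : (bad.card + 1) * (d * q) = bad.card * (d * q) + d * q := by ring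
  omega

theorem card_expLE_two_eleven_le {d : ℕ} (hd34 : d = 3 ∨ d = 4) :
    (expLE 2 (d * (d - 1) - 1)).card ≤ 78 := by
  have := two_mul_card_expLE_two (d * (d - 1) - 1)
  rcases hd34 with rfl | rfl <;> omega

theorem factorial_mul_pow_le {n k y : ℕ} (hn : n ≤ k) (hy : 1 ≤ y) : n.factorial * y ^ n ≤ (k * y) ^ k := by
  rw [mul_pow]
  exact Nat.mul_le_mul ((Nat.factorial_le hn).trans (Nat.factorial_le_pow k))
    (Nat.pow_le_pow_right hy hn)

theorem mul_mul_le_pow {a b c y k : ℕ} (ha : a ≤ y) (hb : b ≤ y) (hc : c ≤ y ^ k) :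
    a * b * c ≤ y ^ (k + 2) :=
  (Nat.mul_le_mul (Nat.mul_le_mul ha hb) hc).trans (by rw [pow_add, pow_two, mul_comm])

theorem minor_arith {H t : ℕ} (ht : t ≤ 2 ^ 10) : 78 * (13 * (H * t ^ 12)) ≤ 2 ^ 131 * H := by
  have h : t ^ 12 ≤ (2 ^ 10) ^ 12 := Nat.pow_le_pow_left ht 12
  calc 78 * (13 * (H * t ^ 12)) ≤ 78 * (13 * (H * (2 ^ 10) ^ 12)) := by gcongr
    _ = (78 * 13 * 2 ^ 120) * H := by ring
    _ ≤ _ := by gcongr; norm_num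

theorem exists_primes_modulus {f : MvPolynomial (Fin 3) ℤ} {d b H : ℕ} (hd34 : d = 3 ∨ d = 4)
    (hd : f.totalDegree = d) (hirr : Irreducible (map (Int.castRingHom ℚ) f))
    (hlead : coeff (Finsupp.single 0 d) f ≠ 0) (hH : ∀ α, (coeff α f).natAbs ≤ H)
    {Q : Fin 3 → ℤ} (hQb : ∀ i, |Q i| ≤ b) (hQ : eval Q f = 0) (hQ' : eval Q (pderiv 0 f) ≠ 0) :
    ∃ N : ℕ, N ≠ 0 ∧ N ≤ (2 ^ 131 * (35 * (H * (b + 1) ^ 4))) ^ 80 ∧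
      ∀ (q : ℕ) [Fact q.Prime], ¬ q ∣ N → ∀ T : Finset (Fin 3 → ZMod q),
        (∀ P ∈ T, eval P (map (Int.castRingHom (ZMod q)) f) = 0 ∧
          eval P (pderiv 0 (map (Int.castRingHom (ZMod q)) f)) ≠ 0) →
        T.card ≤ q ^ 2 + 4000 * (q * Nat.sqrt q) := by
  classical
  set H₁ := 35 * (H * (b + 1) ^ 4) with hH₁
  set F := translate Q f with hF
  have hlF : coeff (Finsupp.single 0 d) F = coeff (Finsupp.single 0 d) f :=
    coeff_translate_of_le Q (by rw [Finsupp.degree_single]; exact hd.le)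
  have hdF : F.totalDegree = d :=
    totalDegree_eq_of_coeff_single ((totalDegree_translate_le _ _).trans hd.le) (by rwa [hlF])
  have hirrF : Irreducible (map (Int.castRingHom ℚ) F) := by
    rw [hF, map_translate]; exact irreducible_translate _ hirr
  have h0F : constantCoeff F = 0 := by
    rw [← MvPolynomial.eval_zero, hF, eval_translate, add_zero, hQ]
  have h1F : coeff (Finsupp.single 0 1) F ≠ 0 := by
    rw [coeff_single_eq, hF, pderiv_translate, eval_translate, add_zero]
    exact hQ'
  have hHF : ∀ α, (coeff α F).natAbs ≤ H₁ := by
    intro α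
    refine (natAbs_coeff_translate_le hQb (d := 4) (by omega) hH α).trans ?_
    rw [hH₁]
    refine Nat.mul_le_mul_right _ ?_
    have := six_mul_card_expLE_three 4
    omega
  clear_value H₁
  have hH1 : 1 ≤ H₁ := (Int.natAbs_pos.2 h1F).trans_le (hHF _)
  have he12 : d * (d - 1) ≤ 12 := by rcases hd34 with rfl | rfl <;> simp
  obtain ⟨x, hx⟩ := exists_witnessMatrix_det_ne_zero (by omega) hirrF hdF (by rwa [hlF]) h0F h1F
  set Φ := (witnessMatrix d F x).det with hΦ
  have hcard := card_expLE_two_eleven_le hd34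
  have hdegΦ : Φ.natDegree ≤ 936 := by
    refine (natDegree_det_le_mul (e := 12) _ fun i j =>
      natDegree_sliceEntry_le _ _ ((x j).2.2.trans he12)).trans ?_
    rw [Fintype.card_coe]
    omega
  obtain ⟨t, ht1, ht, hΦt⟩ := exists_eval_natCast_ne_zero hx
  have ht' : t ≤ 2 ^ 10 := by omega
  have hΦb : (Φ.eval (t : ℤ)).natAbs ≤ (2 ^ 131 * H₁) ^ 78 := by
    have e1 : Φ.eval (t : ℤ) = (((Polynomial.evalRingHom (t : ℤ)).mapMatrix
        (witnessMatrix d F x))).det := by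
      rw [← RingHom.map_det]; rfl
    rw [e1]
    have hent : ∀ i j, |(Polynomial.evalRingHom (t : ℤ)).mapMatrix (witnessMatrix d F x) i j| ≤
        ((12 + 1) * (H₁ * t ^ 12) : ℕ) := fun i j =>
      abs_eval_sliceEntry_le (e := 12) ht1 hHF i.1 ((x j).2.2.trans he12)
    refine (natAbs_det_le _ (fun _ => (12 + 1) * (H₁ * t ^ 12)) hent).trans ?_
    rw [Finset.prod_const, Finset.card_univ, Fintype.card_coe, show 12 + 1 = 13 from rfl]
    refine (factorial_mul_pow_le hcard (Nat.mul_pos (by norm_num) (Nat.mul_pos hH1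
      (Nat.pow_pos ht1)))).trans (Nat.pow_le_pow_left (minor_arith ht') _)
  refine ⟨(coeff (Finsupp.single 0 d) F).natAbs * (coeff (Finsupp.single 0 1) F).natAbs *
    (Φ.eval (t : ℤ)).natAbs, ?_, ?_, ?_⟩
  · refine mul_ne_zero (mul_ne_zero ?_ ?_) ?_ <;> rw [Int.natAbs_ne_zero]
    · rwa [hlF]
    · exact h1F
    · exact hΦt
  · have hle : H₁ ≤ 2 ^ 131 * H₁ := Nat.le_mul_of_pos_left _ (by positivity)
    exact mul_mul_le_pow (k := 78) ((hHF _).trans hle) ((hHF _).trans hle) hΦb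
  · intro q hq hqN T hT
    set φ := Int.castRingHom (ZMod q) with hφ
    have hφ0 : ∀ a : ℤ, a.natAbs ∣ (coeff (Finsupp.single 0 d) F).natAbs *
        (coeff (Finsupp.single 0 1) F).natAbs * (Φ.eval (t : ℤ)).natAbs → φ a ≠ 0 := by
      intro a ha hz
      apply hqN
      refine dvd_trans ?_ ha
      rw [← Int.natCast_dvd]
      exact (ZMod.intCast_zmod_eq_zero_iff_dvd a q).1 hz
    have hl : φ (coeff (Finsupp.single 0 d) F) ≠ 0 :=
      hφ0 _ (Dvd.intro _ (mul_assoc _ _ _).symm)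
    have h1 : φ (coeff (Finsupp.single 0 1) F) ≠ 0 :=
      hφ0 _ ((Dvd.intro_left _ rfl).mul_right _)
    have h2 : φ (Φ.eval (t : ℤ)) ≠ 0 := hφ0 _ (Dvd.intro_left _ rfl)
    have hΦq : Φ.map φ ≠ 0 := by
      intro hz
      apply h2
      rw [← Polynomial.eval₂_at_apply, ← Polynomial.eval_map, hz, Polynomial.eval_zero]
    have hlG : coeff (Finsupp.single 0 d) (map φ F) ≠ 0 := by rwa [coeff_map]
    have hdG : (map φ F).totalDegree = d :=
      totalDegree_eq_of_coeff_single ((totalDegree_map_le' _ _).trans hdF.le) hlG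
    have hbad : (Φ.map φ).roots.toFinset.card ≤ 936 :=
      (Multiset.toFinset_card_le _).trans ((Polynomial.card_roots' _).trans
        (Polynomial.natDegree_map_le.trans hdegΦ))
    set q' : Fin 3 → ZMod q := fun i => φ (Q i) with hq'
    have hcard := card_surface_points_le hdG hd34 hlG (Φ.map φ).roots.toFinset (fun s hs =>
      irreducible_slice_of_det_ne_zero φ (by omega) hdF hl h0F h1 x (by
        intro hz
        apply hs
        rw [Multiset.mem_toFinset, Polynomial.mem_roots hΦq, Polynomial.IsRoot, Polynomial.eval_map]
        exact hz)) (T.image fun P => P - q') (by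
      intro P hP
      obtain ⟨P', hP', rfl⟩ := Finset.mem_image.1 hP
      rw [hF, map_translate, pderiv_translate, eval_translate, eval_translate, ← hq',
        add_sub_cancel]
      exact hT P' hP')
    rw [Finset.card_image_of_injective _ (sub_left_injective)] at hcard
    have hs : 1 ≤ Nat.sqrt q := Nat.le_sqrt.2 (by have := hq.out.pos; omega)
    have e3 : ((Φ.map φ).roots.toFinset.card + 1) * (d * q) ≤ 937 * (4 * q) :=
      Nat.mul_le_mul (by omega) (Nat.mul_le_mul_right _ (by omega))
    have e4 : q ≤ q * Nat.sqrt q := Nat.le_mul_of_pos_right _ hs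
    have e5 : q * (q + 200 * Nat.sqrt q) = q ^ 2 + 200 * (q * Nat.sqrt q) := by ring
    omega

theorem coeff_finSuccEquiv_top {R : Type*} [CommRing R] {n d : ℕ} {f : MvPolynomial (Fin (n + 1)) R}
    (hd : f.totalDegree ≤ d) :
    (finSuccEquiv R n f).coeff d = C (coeff (Finsupp.single 0 d) f) := by
  have h1 : coeff 0 ((finSuccEquiv R n f).coeff d) = coeff (Finsupp.single 0 d) f := by
    rw [finSuccEquiv_coeff_coeff]
    congr 1
    ext i
    refine Fin.cases ?_ (fun j => ?_) i <;> simp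
  rw [← h1]
  by_cases h : (finSuccEquiv R n f).coeff d = 0
  · rw [h]; simp
  · have := totalDegree_coeff_finSuccEquiv_add_le f d h
    exact totalDegree_eq_zero_iff_eq_C.1 (by omega)

theorem natDegree_finSuccEquiv_eq {R : Type*} [CommRing R] {n d : ℕ}
    {f : MvPolynomial (Fin (n + 1)) R} (hd : f.totalDegree ≤ d)
    (hl : coeff (Finsupp.single 0 d) f ≠ 0) : (finSuccEquiv R n f).natDegree = d := by
  refine le_antisymm ?_ (Polynomial.le_natDegree_of_ne_zero ?_)
  · rw [natDegree_finSuccEquiv]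
    exact (degreeOf_le_totalDegree f 0).trans hd
  · rw [coeff_finSuccEquiv_top hd]
    exact (map_ne_zero_iff _ (C_injective _ _)).2 hl

theorem isCoprime_map_finSuccEquiv {k K : Type*} [Field k] [Field K] {n d : ℕ}
    [Algebra (MvPolynomial (Fin n) k) K] [IsFractionRing (MvPolynomial (Fin n) k) K]
    {f g : MvPolynomial (Fin (n + 1)) k} (hd : f.totalDegree ≤ d)
    (hl : coeff (Finsupp.single 0 d) f ≠ 0) (hf : Irreducible f) (hg : ¬ f ∣ g) :
    IsCoprime ((finSuccEquiv k n f).map (algebraMap _ K)) ((finSuccEquiv k n g).map (algebraMap _ K)) := by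
  set c := coeff (Finsupp.single 0 d) f with hc
  have hcu : IsUnit (C c⁻¹ : MvPolynomial (Fin (n + 1)) k) :=
    (isUnit_iff_ne_zero.2 (inv_ne_zero hl)).map C
  set f' := C c⁻¹ * f with hf'
  have hirr' : Irreducible f' := (irreducible_isUnit_mul hcu).2 hf
  have hF : finSuccEquiv k n f' = Polynomial.C (C c⁻¹) * finSuccEquiv k n f := by
    rw [hf', map_mul]
    congr 1
    rw [finSuccEquiv_apply, eval₂Hom_C, RingHom.comp_apply]
  have hmon : (finSuccEquiv k n f').Monic := by
    have hdeg : (finSuccEquiv k n f).natDegree = d := natDegree_finSuccEquiv_eq hd hl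
    have hle : (finSuccEquiv k n f').natDegree ≤ d := by
      rw [hF]; exact (Polynomial.natDegree_C_mul_le _ _).trans hdeg.le
    have hco : (finSuccEquiv k n f').coeff d = 1 := by
      rw [hF, Polynomial.coeff_C_mul, coeff_finSuccEquiv_top hd, ← hc, ← C_mul, inv_mul_cancel₀ hl, C_1]
    exact Polynomial.monic_of_natDegree_le_of_coeff_eq_one d hle hco
  have hirrF : Irreducible (finSuccEquiv k n f') :=
    (MulEquiv.irreducible_iff (finSuccEquiv k n)).2 hirr'
  have hirrK : Irreducible ((finSuccEquiv k n f').map (algebraMap _ K)) :=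
    (hmon.irreducible_iff_irreducible_map_fraction_map).1 hirrF
  have hcop : IsCoprime ((finSuccEquiv k n f').map (algebraMap _ K))
      ((finSuccEquiv k n g).map (algebraMap _ K)) := by
    rw [hirrK.coprime_iff_not_dvd, Polynomial.map_dvd_map _ (IsFractionRing.injective _ K) hmon]
    intro hdvd
    apply hg
    have h1 : f' ∣ g := (map_dvd_iff (finSuccEquiv k n)).1 hdvd
    exact (Dvd.intro_left _ rfl).trans h1
  rw [hF, Polynomial.map_mul] at hcop
  exact hcop.of_mul_left_right

theorem totalDegree_det_le {R ι : Type*} [CommRing R] [Fintype ι] [DecidableEq ι] {n e : ℕ}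
    (M : Matrix ι ι (MvPolynomial (Fin n) R)) (h : ∀ i j, (M i j).totalDegree ≤ e) :
    M.det.totalDegree ≤ Fintype.card ι * e := by
  rw [Matrix.det_apply]
  refine totalDegree_finsetSum_le fun σ _ => ?_
  refine (totalDegree_smul_le _ _).trans ((totalDegree_finset_prod _ _).trans ?_)
  refine (Finset.sum_le_sum fun i _ => h (σ i) i).trans ?_
  rw [Finset.sum_const, smul_eq_mul, Finset.card_univ]

/-- Elimination of the first variable. -/
theorem exists_eliminant {n d D : ℕ} {f g : MvPolynomial (Fin (n + 1)) ℤ} (hd0 : 0 < d)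
    (hd : f.totalDegree ≤ d) (hl : coeff (Finsupp.single 0 d) f ≠ 0)
    (hirr : Irreducible (map (Int.castRingHom ℚ) f))
    (hg : ¬ map (Int.castRingHom ℚ) f ∣ map (Int.castRingHom ℚ) g)
    (hgd : g.totalDegree ≤ D) (hg0 : degreeOf 0 g ≤ d) (hdD : d ≤ D) :
    ∃ R : MvPolynomial (Fin n) ℤ, R ≠ 0 ∧ R.totalDegree ≤ 2 * d * D ∧
      ∀ x, eval x f = 0 → eval x g = 0 → eval (Fin.tail x) R = 0 := by
  classical
  set F := finSuccEquiv ℤ n f with hF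
  set G := finSuccEquiv ℤ n g with hG
  have hFd : F.natDegree = d := natDegree_finSuccEquiv_eq hd hl
  have hGd : G.natDegree ≤ d := by rw [hG, natDegree_finSuccEquiv]; exact hg0
  have hco : ∀ {h : MvPolynomial (Fin (n + 1)) ℤ}, h.totalDegree ≤ D → ∀ i,
      ((finSuccEquiv ℤ n h).coeff i).totalDegree ≤ D := by
    intro h hh i
    by_cases hz : (finSuccEquiv ℤ n h).coeff i = 0
    · rw [hz, totalDegree_zero]; exact Nat.zero_le _
    · have := totalDegree_coeff_finSuccEquiv_add_le h i hz
      omega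
  refine ⟨F.resultant G, ?_, ?_, ?_⟩
  · intro hz
    let K := FractionRing (MvPolynomial (Fin n) ℚ)
    have hmapfs : ∀ h : MvPolynomial (Fin (n + 1)) ℤ,
        finSuccEquiv ℚ n (map (Int.castRingHom ℚ) h) =
          (finSuccEquiv ℤ n h).map (map (Int.castRingHom ℚ)) := by
      intro h
      ext i m
      rw [finSuccEquiv_coeff_coeff, coeff_map, Polynomial.coeff_map, coeff_map,
        finSuccEquiv_coeff_coeff]
    let φ : MvPolynomial (Fin n) ℤ →+* K := (algebraMap (MvPolynomial (Fin n) ℚ) K).comp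
      (map (Int.castRingHom ℚ))
    have hφ : Function.Injective φ :=
      (IsFractionRing.injective (MvPolynomial (Fin n) ℚ) K).comp map_rat_injective
    have hcop : IsCoprime (F.map φ) (G.map φ) := by
      have := isCoprime_map_finSuccEquiv (K := K) (d := d) (f := map (Int.castRingHom ℚ) f)
        (g := map (Int.castRingHom ℚ) g) ((totalDegree_map_le' _ _).trans hd) (by
          rw [coeff_map]; simpa using hl) hirr hg
      rwa [hmapfs, hmapfs, Polynomial.map_map, Polynomial.map_map] at this
    have h1 := Polynomial.resultant_ne_zero _ _ hcop
    rw [Polynomial.natDegree_map_eq_of_injective hφ, Polynomial.natDegree_map_eq_of_injective hφ,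
      Polynomial.resultant_map_map, hz, map_zero] at h1
    exact h1 rfl
  · rw [Polynomial.resultant]
    refine (totalDegree_det_le (e := D) _ fun i j => ?_).trans ?_
    · rw [Polynomial.sylvester, Matrix.of_apply]
      refine Fin.addCases (fun j => ?_) (fun j => ?_) j
      · rw [Fin.addCases_left]
        split_ifs
        · exact hco hgd _
        · simp
      · rw [Fin.addCases_right]
        split_ifs
        · exact hco (hd.trans hdD) _
        · simp
    · rw [Fintype.card_fin]
      exact Nat.mul_le_mul_right _ (by omega)
  · intro x hxf hxg
    obtain ⟨p, q, -, -, h⟩ := Polynomial.exists_mul_add_mul_eq_C_resultant F G le_rfl le_rfl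
      (Or.inl (by omega))
    have h2 := congrArg (fun P => (P.map (eval (Fin.tail x))).eval (x 0)) h
    simp only [Polynomial.map_add, Polynomial.map_mul, Polynomial.eval_add, Polynomial.eval_mul,
      Polynomial.map_C, Polynomial.eval_C] at h2
    rw [hF, hG, ← eval_eq_eval_mv_eval', ← eval_eq_eval_mv_eval', Fin.cons_self_tail, hxf, hxg,
      zero_mul, zero_mul, add_zero] at h2
    exact h2.symm

theorem card_zeros_le_mul_card_tail {R : Type*} [CommRing R] [IsDomain R] {n d : ℕ}
    {h : MvPolynomial (Fin (n + 1)) R} (hd : h.totalDegree ≤ d)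
    (hl : coeff (Finsupp.single 0 d) h ≠ 0) (T : Finset (Fin (n + 1) → R))
    (h0 : ∀ P ∈ T, eval P h = 0) (U : Finset (Fin n → R)) (hU : ∀ P ∈ T, Fin.tail P ∈ U) :
    T.card ≤ d * U.card := by
  classical
  refine (Finset.card_le_mul_card_image (f := (Fin.tail : (Fin (n + 1) → R) → Fin n → R)) T
    d fun y hy => ?_).trans (Nat.mul_le_mul_left _ (Finset.card_le_card
      (Finset.image_subset_iff.2 hU)))
  refine (card_fiber_zeros_le h _ y (fun Q hQ => (Finset.mem_filter.1 hQ).2)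
    (fun Q hQ => h0 Q (Finset.mem_filter.1 hQ).1) fun hz => hl ?_).trans hd
  rw [← coeff_fiberPoly_top y h hd, hz, Polynomial.coeff_zero]

theorem card_box_zeros_le {n b : ℕ} {R : MvPolynomial (Fin (n + 1)) ℤ} (hR : R ≠ 0)
    (Z : Finset (Fin (n + 1) → ℤ)) (hZ : ∀ x ∈ Z, eval x R = 0 ∧ ∀ i, |x i| ≤ b) :
    Z.card ≤ R.totalDegree * (2 * b + 1) ^ n := by
  classical
  set S : Finset ℤ := Finset.Icc (-(b : ℤ)) b with hS
  have hSc : S.card = 2 * b + 1 := by rw [hS, Int.card_Icc]; omega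
  have h := schwartz_zippel_totalDegree hR S
  have hsub : Z ⊆ (Fintype.piFinset fun _ : Fin (n + 1) => S).filter fun f => eval f R = 0 := by
    intro x hx
    rw [Finset.mem_filter, Fintype.mem_piFinset]
    exact ⟨fun i => Finset.mem_Icc.2 (abs_le.1 ((hZ x hx).2 i)), (hZ x hx).1⟩
  have hpos : (0 : ℚ≥0) < ((2 * b + 1 : ℕ) : ℚ≥0) := by exact_mod_cast Nat.succ_pos _
  rw [hSc, div_le_div_iff₀ (pow_pos hpos _) hpos, pow_succ, ← mul_assoc] at h
  have h2 := le_of_mul_le_mul_right h hpos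
  exact (Finset.card_le_card hsub).trans (by exact_mod_cast h2)

/-- Common integral zeros in a box of two coprime polynomials. -/
theorem card_common_box_zeros_le {n d D b : ℕ} {f g : MvPolynomial (Fin (n + 2)) ℤ} (hd0 : 0 < d)
    (hd : f.totalDegree ≤ d) (hl : coeff (Finsupp.single 0 d) f ≠ 0)
    (hirr : Irreducible (map (Int.castRingHom ℚ) f))
    (hg : ¬ map (Int.castRingHom ℚ) f ∣ map (Int.castRingHom ℚ) g)
    (hgd : g.totalDegree ≤ D) (hg0 : degreeOf 0 g ≤ d) (hdD : d ≤ D)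
    (Z : Finset (Fin (n + 2) → ℤ))
    (hZ : ∀ x ∈ Z, eval x f = 0 ∧ eval x g = 0 ∧ ∀ i, |x i| ≤ b) :
    Z.card ≤ d * (2 * d * D * (2 * b + 1) ^ n) := by
  classical
  obtain ⟨R, hR, hRd, hRz⟩ := exists_eliminant hd0 hd hl hirr hg hgd hg0 hdD
  refine (card_zeros_le_mul_card_tail hd hl Z (fun P hP => (hZ P hP).1) (Z.image Fin.tail)
    fun P hP => Finset.mem_image_of_mem _ hP).trans (Nat.mul_le_mul_left _ ?_)
  refine (card_box_zeros_le hR _ fun x hx => ?_).trans (Nat.mul_le_mul_right _ hRd)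
  obtain ⟨P, hP, rfl⟩ := Finset.mem_image.1 hx
  exact ⟨hRz P (hZ P hP).1 (hZ P hP).2.1, fun i => (hZ P hP).2.2 i.succ⟩

theorem card_singular_box_zeros_le {n d b : ℕ} {f : MvPolynomial (Fin (n + 2)) ℤ} (hd0 : 0 < d)
    (hd : f.totalDegree = d) (hl : coeff (Finsupp.single 0 d) f ≠ 0)
    (hirr : Irreducible (map (Int.castRingHom ℚ) f)) (Z : Finset (Fin (n + 2) → ℤ))
    (hZ : ∀ x ∈ Z, eval x f = 0 ∧ eval x (pderiv 0 f) = 0 ∧ ∀ i, |x i| ≤ b) :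
    Z.card ≤ 2 * d ^ 3 * (2 * b + 1) ^ n := by
  have h1 : (pderiv 0 f).totalDegree < d := hd ▸ totalDegree_pderiv_lt 0 (hd ▸ hd0)
  refine (card_common_box_zeros_le (D := d) hd0 hd.le hl hirr (not_dvd_map_pderiv hd0 hd hl)
    h1.le ((degreeOf_le_totalDegree _ _).trans h1.le) le_rfl Z hZ).trans_eq (by ring)

theorem surface_determinant_bound {f : MvPolynomial (Fin 3) ℤ} {N : ℕ}
    (hN : ∀ (q : ℕ) [Fact q.Prime], ¬ q ∣ N → ∀ T : Finset (Fin 3 → ZMod q),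
      (∀ P ∈ T, eval P (map (Int.castRingHom (ZMod q)) f) = 0 ∧
        eval P (pderiv 0 (map (Int.castRingHom (ZMod q)) f)) ≠ 0) →
      T.card ≤ q ^ 2 + 4000 * (q * Nat.sqrt q))
    (I : Finset (Fin 3 →₀ ℕ)) (Λ : Finset (Fin 3 → ℤ)) {b : ℕ}
    (hΛ : ∀ x ∈ Λ, eval x f = 0 ∧ ∀ i, |x i| ≤ b)
    (hno : ∀ g : MvPolynomial (Fin 3) ℤ, g ≠ 0 → g.support ⊆ I → ∃ x ∈ Λ, eval x g ≠ 0) :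
    ∃ Q : I → Fin 3 → ℤ, (∀ j, Q j ∈ Λ) ∧ ∀ (S : Finset ℕ), (∀ q ∈ S, q.Prime ∧ ¬ q ∣ N) →
      ∀ k : ℕ → ℕ,
      ∏ q ∈ S, q ^ (k q * (Finset.univ.filter fun j => ¬ (q : ℤ) ∣ eval (Q j) (pderiv 0 f)).card) ≤
        (∏ q ∈ S, q ^ ((q ^ 2 + 4000 * (q * Nat.sqrt q)) * (expLE 3 (k q - 1)).card)) *
          (I.card.factorial * b ^ ∑ α ∈ I, α.degree) := by
  classical
  obtain ⟨Q, hQ, hdet⟩ := determinant_method I Λ b (fun x hx => (hΛ x hx).2) hno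
  refine ⟨Q, hQ, fun S hS k => ?_⟩
  choose R hRs hRc hR using fun q : ℕ =>
    exists_class_reps q (Λ.filter fun x => ¬ (q : ℤ) ∣ eval x (pderiv 0 f))
  have hRcard : ∀ q ∈ S, (R q).card ≤ q ^ 2 + 4000 * (q * Nat.sqrt q) := by
    intro q hq
    haveI := Fact.mk (hS q hq).1
    refine (hRc q).trans (hN q (hS q hq).2 _ fun P hP => ?_)
    obtain ⟨x, hx, rfl⟩ := Finset.mem_image.1 hP
    rw [Finset.mem_filter] at hx
    rw [pderiv_map, eval_zmod, eval_zmod, (hΛ x hx.1).1, Int.cast_zero, Ne,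
      ZMod.intCast_zmod_eq_zero_iff_dvd]
    exact ⟨rfl, hx.2⟩
  have hidx : ∀ x : (Σ q : S, R q),
      (Ideal.span {f} ⊔ ordIdeal (x.2 : Fin 3 → ℤ) (x.1 : ℕ) (k x.1)).toAddSubgroup.index ≠ 0 ∧
      (Ideal.span {f} ⊔ ordIdeal (x.2 : Fin 3 → ℤ) (x.1 : ℕ) (k x.1)).toAddSubgroup.index ≤
        (x.1 : ℕ) ^ (expLE 3 (k x.1 - 1)).card := by
    rintro ⟨⟨q, hq⟩, ⟨P, hP⟩⟩
    have hP' := Finset.mem_filter.1 (hRs q hP)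
    obtain ⟨f₁, hf, hf₁⟩ := exists_shiftScale_eq_of_nonsingular (hS q hq).1 (hΛ P hP'.1).1 hP'.2
    obtain ⟨h1, h2⟩ := index_span_sup_ordIdeal (k := k q) (hS q hq).1 hf hf₁
    refine ⟨h1, h2.trans (Nat.pow_le_pow_right (hS q hq).1.pos ?_)⟩
    have : Finset.Ico (k q - 1) (k q) ⊆ {k q - 1} := by
      intro j hj
      rw [Finset.mem_Ico] at hj
      rw [Finset.mem_singleton]
      omega
    exact (Finset.sum_le_sum_of_subset this).trans_eq (Finset.sum_singleton _ _)
  have hmain := hdet (Σ q : S, R q)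
    (fun x => Ideal.span {f} ⊔ ordIdeal (x.2 : Fin 3 → ℤ) (x.1 : ℕ) (k x.1))
    (fun x => (hidx x).1) S (fun q hq => (hS q hq).1) k
    (fun q => Finset.univ.filter fun j => ¬ (q : ℤ) ∣ eval (Q j) (pderiv 0 f))
    (fun q hq j hj => by
      obtain ⟨P, hP, hPQ⟩ := hR q (Q j) (Finset.mem_filter.2 ⟨hQ j, (Finset.mem_filter.1 hj).2⟩)
      exact ⟨⟨⟨q, hq⟩, ⟨P, hP⟩⟩, fun F hF => dvd_eval_of_mem_sup hF hPQ (hΛ _ (hQ j)).1⟩)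
  refine hmain.trans (Nat.mul_le_mul_right _ ?_)
  rw [Fintype.prod_sigma, ← Finset.prod_coe_sort S
    fun q => q ^ ((q ^ 2 + 4000 * (q * Nat.sqrt q)) * (expLE 3 (k q - 1)).card)]
  refine Finset.prod_le_prod' fun q _ => ?_
  calc _ ≤ ∏ _c : R q, (q : ℕ) ^ (expLE 3 (k q - 1)).card :=
        Finset.prod_le_prod' fun c _ => (hidx ⟨q, c⟩).2
    _ = (q : ℕ) ^ ((R q).card * (expLE 3 (k q - 1)).card) := by
      rw [Finset.prod_const, Finset.card_univ, Fintype.card_coe, ← pow_mul, mul_comm]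
    _ ≤ _ := Nat.pow_le_pow_right (hS q q.2).1.pos (Nat.mul_le_mul_right _ (hRcard q q.2))

theorem surface_term_le {k E n r x L : ℝ} (hk : 1 ≤ k) (hr : 0 < r) (hkr : k * r ^ 2 ≤ x)
    (hE : 6 * E = k * (k + 1) * (k + 2)) (hn : n ≤ r) (hL : 0 ≤ L) :
    (r ^ 4 + 4000 * (r ^ 2 * n)) * E * L ≤
      x ^ 3 / 6 * (L / r ^ 2) + x ^ 2 * L + 4000 * x ^ 3 * (L / r ^ 3) := by
  have h0 : 0 ≤ k * r ^ 2 := by positivity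
  have hE1 : E ≤ k ^ 3 / 6 + k ^ 2 := by nlinarith
  have hE2 : E ≤ k ^ 3 := by
    nlinarith [mul_nonneg (sq_nonneg k) (sub_nonneg.2 hk),
      mul_nonneg (sub_nonneg.2 hk) (zero_le_one.trans hk)]
  have hE0 : 0 ≤ E := by nlinarith [show 0 ≤ k * (k + 1) * (k + 2) by positivity]
  have h3 : k ^ 3 * r ^ 6 ≤ x ^ 3 := by
    calc _ = (k * r ^ 2) ^ 3 := by ring
      _ ≤ _ := by gcongr
  have h2 : k ^ 2 * r ^ 4 ≤ x ^ 2 := by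
    calc _ = (k * r ^ 2) ^ 2 := by ring
      _ ≤ _ := by gcongr
  have a1 : r ^ 4 * E ≤ x ^ 3 / 6 / r ^ 2 + x ^ 2 := by
    calc r ^ 4 * E ≤ r ^ 4 * (k ^ 3 / 6 + k ^ 2) := by gcongr
      _ = (k ^ 3 * r ^ 6) / 6 / r ^ 2 + k ^ 2 * r ^ 4 := by field_simp
      _ ≤ _ := by gcongr
  have a2 : (r ^ 2 * n) * E ≤ x ^ 3 / r ^ 3 := by
    calc r ^ 2 * n * E ≤ r ^ 2 * r * k ^ 3 := by gcongr
      _ = (k ^ 3 * r ^ 6) / r ^ 3 := by field_simp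
      _ ≤ _ := by gcongr
  calc _ = (r ^ 4 * E + 4000 * (r ^ 2 * n * E)) * L := by ring
    _ ≤ (x ^ 3 / 6 / r ^ 2 + x ^ 2 + 4000 * (x ^ 3 / r ^ 3)) * L := by gcongr
    _ = _ := by ring

theorem surface_final_arith {α d D A s lb lD C1 C2 m ls Δ : ℝ} (hα1 : 1 ≤ α) (hα2 : α ≤ 2)
    (hd : α ^ 2 = d) (hd3 : 3 ≤ d) (hD : 1 ≤ D) (hs1 : d * D ^ 2 ≤ 2 * s) (hs2 : s ≤ 4 * D ^ 2)
    (hA0 : 0 ≤ A) (hA : lD - C1 - m ≤ A) (hm : 0 ≤ m) (hC2 : 0 ≤ C2) (hlb0 : 0 ≤ lb) (hlb : lb ≤ D)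
    (hls : ls ≤ 4 * D) (hΔ : Δ ≤ d * D ^ 3 / 3 + 5 * D ^ 2)
    (h : s * (α * D * A - 2 * D) - α * D * (s * m) ≤
      (α * D) ^ 3 / 6 * A + (α * D) ^ 2 * (2 * D) + 4000 * (α * D) ^ 3 * C2 + (s * ls + Δ * lb)) :
    α * lD ≤ lb + (2 * C1 ^ 2 + 2 + 10 * m + 37 + 32000 * C2) := by
  have hd4 : d ≤ 4 := by nlinarith
  have hD0 : 0 < D := by linarith
  have hd0 : 0 < d := by linarith
  have hs0 : 0 ≤ s := by linarith [show 0 ≤ d * D ^ 2 by positivity]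
  have e1 : d * α * D ^ 3 / 3 * A ≤ s * (α * D * A) - (α * D) ^ 3 / 6 * A := by
    have : 0 ≤ (2 * s - d * D ^ 2) * (α * D * A) := by
      refine mul_nonneg (by linarith) (by positivity)
    have h3 : (α * D) ^ 3 = d * α * D ^ 3 := by rw [← hd]; ring
    rw [h3]; linarith
  have e2 : s * (2 * D) ≤ 8 * D ^ 3 := by
    calc s * (2 * D) ≤ 4 * D ^ 2 * (2 * D) := by gcongr
      _ = _ := by ring
  have e3 : α * D * (s * m) ≤ 8 * D ^ 3 * m := by
    calc α * D * (s * m) ≤ 2 * D * (4 * D ^ 2 * m) := by gcongr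
      _ = _ := by ring
  have e4 : (α * D) ^ 2 * (2 * D) ≤ 8 * D ^ 3 := by
    rw [mul_pow, hd]
    calc d * D ^ 2 * (2 * D) ≤ 4 * D ^ 2 * (2 * D) := by gcongr
      _ = _ := by ring
  have e5 : 4000 * (α * D) ^ 3 * C2 ≤ 32000 * D ^ 3 * C2 := by
    have : (α * D) ^ 3 ≤ (2 * D) ^ 3 := by gcongr
    calc 4000 * (α * D) ^ 3 * C2 ≤ 4000 * (2 * D) ^ 3 * C2 := by gcongr
      _ = _ := by ring
  have e6 : s * ls ≤ 16 * D ^ 3 := by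
    calc s * ls ≤ s * (4 * D) := by
          exact mul_le_mul_of_nonneg_left hls hs0
      _ ≤ 4 * D ^ 2 * (4 * D) := by gcongr
      _ = _ := by ring
  have e7 : Δ * lb ≤ d * D ^ 3 / 3 * lb + 5 * D ^ 3 := by
    calc Δ * lb ≤ (d * D ^ 3 / 3 + 5 * D ^ 2) * lb := by gcongr
      _ = d * D ^ 3 / 3 * lb + 5 * D ^ 2 * lb := by ring
      _ ≤ d * D ^ 3 / 3 * lb + 5 * D ^ 2 * D := by gcongr
      _ = _ := by ring
  have e8 : d * α * D ^ 3 / 3 * A ≤ d * D ^ 3 / 3 * lb + D ^ 3 * (37 + 8 * m + 32000 * C2) := by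
    linarith
  have hD3 : 0 < D ^ 3 := by positivity
  have e9 : α * A ≤ lb + (37 + 8 * m + 32000 * C2) := by
    have h1 : D ^ 3 * (37 + 8 * m + 32000 * C2) ≤ d * D ^ 3 / 3 * (37 + 8 * m + 32000 * C2) := by
      gcongr
      nlinarith
    have h2 : d * D ^ 3 / 3 * (α * A) ≤ d * D ^ 3 / 3 * (lb + (37 + 8 * m + 32000 * C2)) := by
      linarith
    exact le_of_mul_le_mul_left h2 (by positivity)
  have e10 : α * (lD - C1 - m) ≤ α * A := by gcongr
  have e11 : α * C1 ≤ 2 * C1 ^ 2 + 2 := by nlinarith [sq_nonneg (C1 - 1), sq_nonneg (C1 + 1), sq_nonneg (α - C1)]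
  have e12 : α * m ≤ 2 * m := by gcongr
  linarith

theorem sum_filter_dvd_le {ι : Type*} [Fintype ι] (S : Finset ℕ) (hS : ∀ q ∈ S, q.Prime) (w : ι → ℤ)
    (hw : ∀ j, w j ≠ 0) {M : ℕ} (hM1 : 1 ≤ M) (hM : ∀ j, Real.log (w j).natAbs ≤ M) :
    ∑ q ∈ S, Real.log q / q * ((Finset.univ.filter fun j => (q : ℤ) ∣ w j).card : ℝ) ≤
      Fintype.card ι * (Real.log M + 3) := by
  classical
  have h1 : ∀ q ∈ S, Real.log q / q * ((Finset.univ.filter fun j => (q : ℤ) ∣ w j).card : ℝ) =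
      ∑ j, if (q : ℤ) ∣ w j then Real.log q / q else 0 := by
    intro q _
    rw [← Finset.sum_filter, Finset.sum_const, nsmul_eq_mul, mul_comm]
  rw [Finset.sum_congr rfl h1, Finset.sum_comm, ← nsmul_eq_mul, ← Finset.card_univ]
  refine Finset.sum_le_card_nsmul _ _ _ fun j _ => ?_
  rw [← Finset.sum_filter]
  exact sum_log_prime_divisors_le _ _ M (Int.natAbs_ne_zero.2 (hw j)) (fun q hq => by
    rw [Finset.mem_filter] at hq
    exact ⟨hS q hq.1, Int.natCast_dvd.1 hq.2⟩) (hM j) hM1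

theorem log_determinant_bound {S : Finset ℕ} (hS : ∀ q ∈ S, q.Prime) (u v : ℕ → ℕ) {s b Δ : ℕ}
    (hb : 1 ≤ b) (hs : 1 ≤ s)
    (h : ∏ q ∈ S, q ^ u q ≤ (∏ q ∈ S, q ^ v q) * (s.factorial * b ^ Δ)) :
    ∑ q ∈ S, (u q : ℝ) * Real.log q ≤
      ∑ q ∈ S, (v q : ℝ) * Real.log q + (s * Real.log s + Δ * Real.log b) := by
  have hlog : ∀ w : ℕ → ℕ, Real.log ((∏ q ∈ S, q ^ w q : ℕ) : ℝ) = ∑ q ∈ S, (w q : ℝ) * Real.log q := by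
    intro w
    rw [Nat.cast_prod, Real.log_prod]
    · exact Finset.sum_congr rfl fun q _ => by rw [Nat.cast_pow, Real.log_pow]
    · exact fun q hq => by exact_mod_cast (pow_pos (hS q hq).pos _).ne'
  have hpos : ∀ w : ℕ → ℕ, 0 < ∏ q ∈ S, q ^ w q := fun w =>
    Finset.prod_pos fun q hq => pow_pos (hS q hq).pos _
  have hs0 : (0 : ℝ) < s := by exact_mod_cast hs
  have hb0 : (0 : ℝ) < b := by exact_mod_cast hb
  have h1 : ((∏ q ∈ S, q ^ u q : ℕ) : ℝ) ≤ ((∏ q ∈ S, q ^ v q : ℕ) : ℝ) * ((s : ℝ) ^ s * (b : ℝ) ^ Δ) := by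
    have h2 : ∏ q ∈ S, q ^ u q ≤ (∏ q ∈ S, q ^ v q) * (s ^ s * b ^ Δ) :=
      h.trans (Nat.mul_le_mul_left _ (Nat.mul_le_mul_right _ (Nat.factorial_le_pow s)))
    exact_mod_cast h2
  have h3 := Real.log_le_log (by exact_mod_cast hpos u) h1
  rw [hlog, Real.log_mul (by exact_mod_cast (hpos v).ne') (by positivity), hlog,
    Real.log_mul (by positivity) (by positivity), Real.log_pow, Real.log_pow] at h3
  exact h3

set_option maxHeartbeats 1000000 in
theorem surface_numeric : ∃ C : ℝ, 0 ≤ C ∧ ∀ {ι : Type} [Fintype ι] (w : ι → ℤ) {d D l b Δ N : ℕ},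
    (d = 3 ∨ d = 4) → 1 ≤ D → 1 ≤ l → l ≤ D → 1 ≤ b → b ≤ 2 ^ l → N ≠ 0 →
    Real.log N ≤ (40000 * l : ℕ) → (∀ j, w j ≠ 0) →
    (∀ j, Real.log (w j).natAbs ≤ (40000 * l : ℕ)) →
    (d : ℝ) * D ^ 2 ≤ 2 * Fintype.card ι → (Fintype.card ι : ℝ) ≤ 4 * D ^ 2 →
    (Δ : ℝ) ≤ d * D ^ 3 / 3 + 5 * D ^ 2 →
    (∀ (S : Finset ℕ), (∀ q ∈ S, q.Prime ∧ ¬ q ∣ N) → ∀ k : ℕ → ℕ,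
      ∏ q ∈ S, q ^ (k q * (Finset.univ.filter fun j => ¬ (q : ℤ) ∣ w j).card) ≤
        (∏ q ∈ S, q ^ ((q ^ 2 + 4000 * (q * Nat.sqrt q)) * (expLE 3 (k q - 1)).card)) *
          ((Fintype.card ι).factorial * b ^ Δ)) →
    Real.sqrt d * Real.log D ≤ Real.log b + C * (1 + Real.log l) := by
  classical
  obtain ⟨C1, hC1, hA1⟩ := sum_log_div_ge
  obtain ⟨C2, hC2, hA2⟩ := sum_log_div_rpow_le
  refine ⟨2 * C1 ^ 2 + 10 * (Real.log 40000 + 3) + 10 + 40 + 32000 * C2, by positivity, ?_⟩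
  intro ι _ w d D l b Δ N hd34 hD hl hlD hb hbl hN hNM hw hwM hs1 hs2 hΔ hmain
  set s := Fintype.card ι with hs
  set M : ℕ := 40000 * l with hM
  have hM1 : 1 ≤ M := by omega
  have hd3 : (3 : ℝ) ≤ d := by rcases hd34 with rfl | rfl <;> norm_num
  have hd4 : (d : ℝ) ≤ 4 := by rcases hd34 with rfl | rfl <;> norm_num
  set α := Real.sqrt d with hα
  have hαd : α ^ 2 = d := Real.sq_sqrt (by linarith)
  have hα1 : 1 ≤ α := Real.one_le_sqrt.2 (by linarith)
  have hα2 : α ≤ 2 := by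
    rw [hα, show (2 : ℝ) = Real.sqrt 4 by rw [show (4 : ℝ) = 2 ^ 2 by norm_num, Real.sqrt_sq (by norm_num)]]
    exact Real.sqrt_le_sqrt hd4
  have hDr : (1 : ℝ) ≤ D := by exact_mod_cast hD
  have hs0 : 1 ≤ s := by
    have h1 : (0 : ℝ) < d * D ^ 2 := mul_pos (by linarith) (by positivity)
    have : (0 : ℝ) < s := by linarith
    exact_mod_cast this
  set S := D.primesLE.filter fun q => ¬ q ∣ N with hSd
  have hS : ∀ q ∈ S, q.Prime ∧ ¬ q ∣ N := by
    intro q hq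
    rw [hSd, Finset.mem_filter, Nat.mem_primesLE] at hq
    exact ⟨hq.1.2, hq.2⟩
  have hSD : ∀ q ∈ S, q ≤ D := by
    intro q hq
    rw [hSd, Finset.mem_filter, Nat.mem_primesLE] at hq
    exact hq.1.1
  set k : ℕ → ℕ := fun q => ⌊α * D / q⌋₊ with hk
  set m := Real.log M + 3 with hm
  have hm0 : 0 ≤ m := by
    have := Real.log_natCast_nonneg M
    linarith
  set A := ∑ q ∈ S, Real.log q / q with hA
  have hA0 : 0 ≤ A := Finset.sum_nonneg fun q _ => by positivity
  have hAl : Real.log D - C1 - m ≤ A := by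
    have h1 := hA1 D hD
    have h2 : ∑ q ∈ D.primesLE.filter (fun q => q ∣ N), Real.log q / q ≤ m :=
      sum_log_prime_divisors_le _ N M hN (fun q hq => by
        rw [Finset.mem_filter, Nat.mem_primesLE] at hq
        exact ⟨hq.1.2, hq.2⟩) hNM hM1
    have h3 := Finset.sum_filter_add_sum_filter_not D.primesLE (fun q => q ∣ N)
      (fun q => Real.log q / (q : ℝ))
    linarith
  have hθ : ∑ q ∈ S, Real.log q ≤ 2 * D :=
    (Finset.sum_le_sum_of_subset_of_nonneg (Finset.filter_subset _ _)
      fun q _ _ => Real.log_natCast_nonneg q).trans (sum_primesLE_log_le D)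
  have hlog := log_determinant_bound (fun q hq => (hS q hq).1) _ _ hb hs0 (hmain S hS k)
  have hlow : s * (α * D * A - 2 * D) - α * D * (s * m) ≤
      ∑ q ∈ S, ((k q * (Finset.univ.filter fun j => ¬ (q : ℤ) ∣ w j).card : ℕ) : ℝ) * Real.log q := by
    have hsum := sum_filter_dvd_le S (fun q hq => (hS q hq).1) w hw hM1 hwM
    have hterm : ∀ q ∈ S, s * (α * D * (Real.log q / q) - Real.log q) -
        α * D * (Real.log q / q * ((Finset.univ.filter fun j => (q : ℤ) ∣ w j).card : ℝ)) ≤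
        ((k q * (Finset.univ.filter fun j => ¬ (q : ℤ) ∣ w j).card : ℕ) : ℝ) * Real.log q := by
      intro q hq
      have hq0 : (0 : ℝ) < q := by exact_mod_cast (hS q hq).1.pos
      have hL : 0 ≤ Real.log q := Real.log_natCast_nonneg q
      have hc : ((Finset.univ.filter fun j => (q : ℤ) ∣ w j).card : ℝ) +
          ((Finset.univ.filter fun j => ¬ (q : ℤ) ∣ w j).card : ℝ) = s := by
        have := Finset.card_filter_add_card_filter_not (s := (Finset.univ : Finset ι)) (fun j => (q : ℤ) ∣ w j)
        rw [Finset.card_univ] at this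
        exact_mod_cast this
      have hk1 : (k q : ℝ) ≤ α * D / q := Nat.floor_le (by positivity)
      have hk2 : α * D / q - 1 ≤ k q := by linarith [Nat.lt_floor_add_one (α * D / q)]
      set bq := ((Finset.univ.filter fun j => (q : ℤ) ∣ w j).card : ℝ) with hbq
      have hbq0 : 0 ≤ bq := Nat.cast_nonneg _
      rw [Nat.cast_mul, ← sub_eq_iff_eq_add'.2 hc.symm]
      have e1 : s * (α * D / q - 1) * Real.log q ≤ s * k q * Real.log q := by gcongr
      have e2 : k q * bq * Real.log q ≤ α * D / q * bq * Real.log q := by gcongr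
      calc _ = s * (α * D / q - 1) * Real.log q - α * D / q * bq * Real.log q := by field_simp
        _ ≤ s * k q * Real.log q - k q * bq * Real.log q := by linarith
        _ = _ := by ring
    refine le_trans ?_ (Finset.sum_le_sum hterm)
    rw [Finset.sum_sub_distrib, ← Finset.mul_sum, ← Finset.mul_sum, Finset.sum_sub_distrib,
      ← Finset.mul_sum, ← hA]
    have e3 : (s : ℝ) * (α * D * A - 2 * D) ≤ s * (α * D * A - ∑ q ∈ S, Real.log q) := by gcongr
    have e4 := mul_le_mul_of_nonneg_left hsum (show 0 ≤ α * D by positivity)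
    linarith
  have hup : ∑ q ∈ S, (((q ^ 2 + 4000 * (q * Nat.sqrt q)) * (expLE 3 (k q - 1)).card : ℕ) : ℝ) *
      Real.log q ≤ (α * D) ^ 3 / 6 * A + (α * D) ^ 2 * (2 * D) + 4000 * (α * D) ^ 3 * C2 := by
    have hterm : ∀ q ∈ S, (((q ^ 2 + 4000 * (q * Nat.sqrt q)) * (expLE 3 (k q - 1)).card : ℕ) : ℝ) *
        Real.log q ≤ (α * D) ^ 3 / 6 * (Real.log q / q) + (α * D) ^ 2 * Real.log q +
          4000 * (α * D) ^ 3 * (Real.log q / (q : ℝ) ^ (3 / 2 : ℝ)) := by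
      intro q hq
      have hq0 : (0 : ℝ) < q := by exact_mod_cast (hS q hq).1.pos
      have hL : 0 ≤ Real.log q := Real.log_natCast_nonneg q
      have hqD : (q : ℝ) ≤ D := by exact_mod_cast hSD q hq
      have hk1 : 1 ≤ k q := by
        refine Nat.le_floor ?_
        rw [Nat.cast_one, le_div_iff₀ hq0]
        exact mul_le_mul hα1 hqD hq0.le (by linarith)
      have hr : Real.sqrt q ^ 2 = q := Real.sq_sqrt hq0.le
      have hr0 : 0 < Real.sqrt q := Real.sqrt_pos.2 hq0
      have hn : ((Nat.sqrt q : ℕ) : ℝ) ≤ Real.sqrt q := Real.nat_sqrt_le_real_sqrt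
      have hkr : (k q : ℝ) * Real.sqrt q ^ 2 ≤ α * D := by
        rw [hr, ← le_div_iff₀ hq0]
        exact Nat.floor_le (by positivity)
      have hE : 6 * ((expLE 3 (k q - 1)).card : ℝ) = k q * (k q + 1) * (k q + 2) := by
        have := six_mul_card_expLE_three (k q - 1)
        rw [show k q - 1 + 1 = k q by omega, show k q - 1 + 2 = k q + 1 by omega,
          show k q - 1 + 3 = k q + 2 by omega] at this
        exact_mod_cast this
      have h := surface_term_le (by exact_mod_cast hk1) hr0 hkr hE hn hL
      have h32 : (q : ℝ) ^ (3 / 2 : ℝ) = Real.sqrt q ^ 3 := by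
        rw [Real.sqrt_eq_rpow, ← Real.rpow_natCast, ← Real.rpow_mul hq0.le]
        norm_num
      rw [h32]
      have h4 : Real.sqrt q ^ 4 = (q : ℝ) ^ 2 := by
        rw [show 4 = 2 * 2 from rfl, pow_mul, hr]
      rw [h4, hr] at h
      push_cast
      exact h
    refine (Finset.sum_le_sum hterm).trans ?_
    rw [Finset.sum_add_distrib, Finset.sum_add_distrib, ← Finset.mul_sum, ← Finset.mul_sum,
      ← Finset.mul_sum, ← hA]
    gcongr
    exact hA2 S
  have hlb : Real.log b ≤ D := by
    have h1 : Real.log b ≤ l * Real.log 2 := by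
      rw [← Real.log_pow]
      exact Real.log_le_log (by exact_mod_cast hb) (by exact_mod_cast hbl)
    have h2 : Real.log 2 ≤ 1 := by linarith [Real.log_two_lt_d9]
    have h3 : (l : ℝ) ≤ D := by exact_mod_cast hlD
    exact h1.trans ((mul_le_of_le_one_right (Nat.cast_nonneg l) h2).trans h3)
  have hls : Real.log s ≤ 4 * D := by
    have h1 : Real.log s ≤ Real.log ((2 * D) ^ 2) := by
      refine Real.log_le_log (by exact_mod_cast hs0) (hs2.trans_eq (by ring))
    rw [Real.log_pow] at h1
    have h2 := Real.log_le_sub_one_of_pos (show (0 : ℝ) < 2 * D by linarith)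
    push_cast at h1
    linarith
  have hfin := surface_final_arith (C1 := C1) (C2 := C2) hα1 hα2 hαd hd3 hDr hs1 hs2 hA0 hAl hm0 hC2
    (Real.log_natCast_nonneg b) hlb hls hΔ
    (hlow.trans (hlog.trans (add_le_add_left hup _)))
  refine hfin.trans (add_le_add_right ?_ _)
  have hlr : (1 : ℝ) ≤ l := by exact_mod_cast hl
  have hl0 : 0 ≤ Real.log l := Real.log_natCast_nonneg l
  have hMl : m = Real.log 40000 + Real.log l + 3 := by
    rw [hm, hM]
    push_cast
    rw [Real.log_mul (by norm_num) (by linarith)]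
  have h4 : 0 ≤ Real.log 40000 := Real.log_nonneg (by norm_num)
  rw [hMl]
  linarith [mul_nonneg (show 0 ≤ 2 * C1 ^ 2 + 10 * (Real.log 40000 + 3) + 40 + 32000 * C2 by positivity) hl0]

theorem two_mul_card_lowExp_two {d : ℕ} (hd34 : d = 3 ∨ d = 4) (m : ℕ) :
    d * m ^ 2 ≤ 2 * (lowExp 2 d m).card ∧ 2 * (lowExp 2 d m).card ≤ d * m ^ 2 + 3 * m + 4 := by
  have h0 := six_mul_card_expLE_three m
  rcases le_or_gt d m with h | h
  · obtain ⟨k, rfl⟩ := Nat.exists_eq_add_of_le h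
    have h1 := card_lowExp_add (n := 2) h
    have h2 := six_mul_card_expLE_three k
    rw [Nat.add_sub_cancel_left] at h1
    rcases hd34 with rfl | rfl <;> constructor <;> linarith [Nat.zero_le k]
  · rw [lowExp_eq_expLE h, show 2 + 1 = 3 from rfl]
    rcases hd34 with rfl | rfl <;> interval_cases m <;> omega

theorem two_mul_cube_le_sum_sq (D : ℕ) : 2 * D ^ 3 ≤ 6 * ∑ m ∈ Finset.range D, m ^ 2 + 3 * D ^ 2 := by
  induction D with
  | zero => simp
  | succ D ih => rw [Finset.sum_range_succ]; linarith

theorem sum_degree_lowExp_two_le {d : ℕ} (hd34 : d = 3 ∨ d = 4) {D : ℕ} (hD : 2 ≤ D) :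
    ((∑ α ∈ lowExp 2 d D, α.degree : ℕ) : ℝ) ≤ d * D ^ 3 / 3 + 5 * D ^ 2 := by
  have h1 := sum_degree_lowExp 2 d D
  have h2 := (two_mul_card_lowExp_two hd34 D).2
  have h3 : d * ∑ m ∈ Finset.range D, m ^ 2 ≤ 2 * ∑ m ∈ Finset.range D, (lowExp 2 d m).card := by
    rw [Finset.mul_sum, Finset.mul_sum]
    exact Finset.sum_le_sum fun m _ => (two_mul_card_lowExp_two hd34 m).1
  have h4 := two_mul_cube_le_sum_sq D
  have h5 : 2 * (D * (lowExp 2 d D).card) ≤ D * (d * D ^ 2 + 3 * D + 4) := by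
    rw [mul_left_comm]; exact Nat.mul_le_mul_left _ h2
  set Δ := ∑ α ∈ lowExp 2 d D, α.degree
  set s1 := ∑ m ∈ Finset.range D, (lowExp 2 d m).card
  set s2 := ∑ m ∈ Finset.range D, m ^ 2
  have h6 : 3 * Δ ≤ d * D ^ 3 + 15 * D ^ 2 := by
    have h8 : 2 * D ≤ D ^ 2 := by rw [sq]; exact Nat.mul_le_mul_right _ hD
    rcases hd34 with rfl | rfl <;> linarith
  have h7 : (3 : ℝ) * Δ ≤ d * D ^ 3 + 15 * D ^ 2 := by exact_mod_cast h6
  linarith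

theorem log_le_of_le_two_pow {N M : ℕ} (h : N ≤ 2 ^ M) : Real.log N ≤ M := by
  rcases Nat.eq_zero_or_pos N with rfl | hN
  · simp
  have h1 : Real.log N ≤ Real.log ((2 : ℝ) ^ M) :=
    Real.log_le_log (by exact_mod_cast hN) (by exact_mod_cast h)
  rw [Real.log_pow] at h1
  exact h1.trans (mul_le_of_le_one_right (Nat.cast_nonneg M) (by linarith [Real.log_two_lt_d9]))

theorem surface_modulus_arith {b l N : ℕ} (hl : 1 ≤ l) (hbl : b ≤ 2 ^ l)
    (hN : N ≤ (2 ^ 131 * (35 * (2 ^ (350 * l) * (b + 1) ^ 4))) ^ 80) : N ≤ 2 ^ (40000 * l) := by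
  have h1 : b + 1 ≤ 2 ^ (l + 1) := by
    have := Nat.one_le_two_pow (n := l)
    rw [pow_succ]; omega
  calc N ≤ (2 ^ 131 * (2 ^ 6 * (2 ^ (350 * l) * (2 ^ (l + 1)) ^ 4))) ^ 80 :=
        hN.trans (by gcongr; norm_num)
    _ = 2 ^ ((131 + (6 + (350 * l + (l + 1) * 4))) * 80) := by
        rw [← pow_mul 2 (l + 1), ← pow_add, ← pow_add, ← pow_add, ← pow_mul]
    _ ≤ _ := Nat.pow_le_pow_right (by norm_num) (by omega)

theorem surface_derivative_arith {b l N : ℕ} (hl : 1 ≤ l) (hbl : b ≤ 2 ^ l)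
    (hN : N ≤ 35 * (4 * 2 ^ (350 * l) * b ^ 4)) : N ≤ 2 ^ (40000 * l) := by
  calc N ≤ 2 ^ 6 * (2 ^ 2 * 2 ^ (350 * l) * (2 ^ l) ^ 4) := hN.trans (by gcongr <;> norm_num)
    _ = 2 ^ (6 + (2 + 350 * l + l * 4)) := by rw [← pow_mul 2 l, ← pow_add, ← pow_add, ← pow_add]
    _ ≤ _ := Nat.pow_le_pow_right (by norm_num) (by omega)

/-- The auxiliary surface through the nonsingular integral points of bounded height. -/
theorem exists_surface_aux : ∃ C : ℝ, 0 ≤ C ∧ ∀ {f : MvPolynomial (Fin 3) ℤ} {d b l D : ℕ},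
    (d = 3 ∨ d = 4) → f.totalDegree = d → Irreducible (map (Int.castRingHom ℚ) f) →
    coeff (Finsupp.single 0 d) f ≠ 0 → (∀ α, (coeff α f).natAbs ≤ 2 ^ (350 * l)) →
    1 ≤ l → 1 ≤ b → b ≤ 2 ^ l → 2 ≤ D → l ≤ D →
    Real.log b + C * (1 + Real.log l) < Real.sqrt d * Real.log D →
    ∀ Λ : Finset (Fin 3 → ℤ), (∀ x ∈ Λ, eval x f = 0 ∧ eval x (pderiv 0 f) ≠ 0 ∧ ∀ i, |x i| ≤ b) →
    ∃ g : MvPolynomial (Fin 3) ℤ, g ≠ 0 ∧ g.support ⊆ lowExp 2 d D ∧ ∀ x ∈ Λ, eval x g = 0 := by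
  classical
  obtain ⟨C, hC, hnum⟩ := surface_numeric
  refine ⟨C, hC, fun {f d b l D} hd34 hd hirr hlead hH hl hb hbl hD hlD hlt Λ hΛ => ?_⟩
  by_contra! hno
  have hd4 : d ≤ 4 := by omega
  obtain ⟨P, hP, -⟩ := hno 1 one_ne_zero (by
    intro α hα
    rw [MvPolynomial.mem_support_iff, coeff_one, ne_eq, ite_eq_right_iff, Classical.not_imp] at hα
    rw [mem_lowExp, ← hα.1]
    simp only [map_zero, Finsupp.coe_zero, Pi.zero_apply]
    omega)
  obtain ⟨N, hN0, hN, hNT⟩ := exists_primes_modulus hd34 hd hirr hlead hH (hΛ P hP).2.2 (hΛ P hP).1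
    (hΛ P hP).2.1
  obtain ⟨Q, hQ, hdet⟩ := surface_determinant_bound hNT (lowExp 2 d D) Λ
    (fun x hx => ⟨(hΛ x hx).1, (hΛ x hx).2.2⟩) hno
  have hcard := two_mul_card_lowExp_two hd34 D
  rw [← Fintype.card_coe (lowExp 2 d D)] at hcard hdet
  refine absurd (hnum (fun j => eval (Q j) (pderiv 0 f)) (Δ := ∑ α ∈ lowExp 2 d D, α.degree) hd34
    (by omega) hl hlD hb hbl hN0 (log_le_of_le_two_pow (surface_modulus_arith hl hbl hN))
    (fun j => (hΛ _ (hQ j)).2.1) (fun j => log_le_of_le_two_pow (surface_derivative_arith hl hbl ?_))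
    (by exact_mod_cast hcard.1) ?_ (sum_degree_lowExp_two_le hd34 hD) hdet) (not_le.2 hlt)
  · have h35 : (expLE 3 4).card = 35 := by have := six_mul_card_expLE_three 4; omega
    rw [← h35]
    refine abs_eval_le _ 4 _ b hb ((totalDegree_pderiv_le 0 f).trans (by omega)) (fun α => ?_) _
      (hΛ _ (hQ j)).2.2
    exact (natAbs_coeff_pderiv_le 0 f _ hH α).trans (Nat.mul_le_mul_right _ (hd.le.trans hd4))
  · have h2 : 2 * Fintype.card (lowExp 2 d D) ≤ 2 * (4 * D ^ 2) := by
      refine hcard.2.trans ?_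
      have : d * D ^ 2 ≤ 4 * D ^ 2 := Nat.mul_le_mul_right _ hd4
      have h8 : 2 * D ≤ D ^ 2 := by rw [sq]; exact Nat.mul_le_mul_right _ hD
      linarith
    exact_mod_cast Nat.le_of_mul_le_mul_left h2 two_pos

theorem exists_int_multiple {σ : Type*} (q : MvPolynomial σ ℚ) : ∃ (H : MvPolynomial σ ℤ) (c : ℤ),
    c ≠ 0 ∧ map (Int.castRingHom ℚ) H = C (c : ℚ) * q := by
  induction q using MvPolynomial.induction_on with
  | C a =>
    refine ⟨C a.num, a.den, by exact_mod_cast a.den_ne_zero, ?_⟩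
    rw [map_C, ← C_mul, mul_comm, Int.cast_natCast, Rat.mul_den_eq_num]; rfl
  | add p q hp hq =>
    obtain ⟨H, c, hc, h⟩ := hp
    obtain ⟨H', c', hc', h'⟩ := hq
    refine ⟨C c' * H + C c * H', c * c', mul_ne_zero hc hc', ?_⟩
    rw [map_add, map_mul, map_mul, h, h', map_C, map_C, Int.cast_mul, C_mul, eq_intCast, eq_intCast]
    ring
  | mul_X p i hp =>
    obtain ⟨H, c, hc, h⟩ := hp
    exact ⟨H * X i, c, hc, by rw [map_mul, map_X, h, mul_assoc]⟩

theorem eval_rat {n : ℕ} (x : Fin n → ℤ) (H : MvPolynomial (Fin n) ℤ) :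
    eval (fun i => (x i : ℚ)) (map (Int.castRingHom ℚ) H) = (eval x H : ℤ) := by
  rw [eval_map]
  exact (eval₂_comp_left (Int.castRingHom ℚ) (RingHom.id ℤ) x H).symm

theorem totalDegree_pos_of_irreducible {K : Type*} [Field K] {n : ℕ} {f : MvPolynomial (Fin n) K}
    (hf : Irreducible f) : 0 < f.totalDegree := by
  rw [Nat.pos_iff_ne_zero]
  intro h
  rw [totalDegree_eq_zero_iff_eq_C] at h
  refine hf.not_isUnit (h ▸ (IsUnit.mk0 _ fun h0 => hf.ne_zero ?_).map C)
  rw [h, h0, C_0]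

/-- Counting zeros factor by factor. -/
theorem card_le_of_factors {α : Type*} {n T : ℕ} {P : MvPolynomial (Fin n) ℚ} (hP : P ≠ 0)
    (Z : Finset α) (π : α → Fin n → ℤ) (hZ : ∀ x ∈ Z, eval (fun i => (π x i : ℚ)) P = 0)
    (hT : ∀ H : MvPolynomial (Fin n) ℤ, Irreducible (map (Int.castRingHom ℚ) H) →
      map (Int.castRingHom ℚ) H ∣ P → 1 ≤ H.totalDegree → H.totalDegree ≤ P.totalDegree →
      ∀ W ⊆ Z, (∀ x ∈ W, eval (π x) H = 0) → W.card ≤ H.totalDegree * T) :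
    Z.card ≤ P.totalDegree * T := by
  classical
  induction P using WfDvdMonoid.induction_on_irreducible generalizing Z with
  | zero => exact absurd rfl hP
  | unit u hu =>
    rw [Finset.card_eq_zero.2 (Finset.eq_empty_of_forall_notMem fun x hx => ?_)]
    · exact zero_le
    · exact (hu.map (eval fun i => (π x i : ℚ))).ne_zero (hZ x hx)
  | mul a i ha hi ih =>
    obtain ⟨H, c, hc, hH⟩ := exists_int_multiple i
    replace hc : (c : ℚ) ≠ 0 := by exact_mod_cast hc
    have hdvd : map (Int.castRingHom ℚ) H ∣ i := by
      refine ⟨C (c : ℚ)⁻¹, ?_⟩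
      rw [hH, mul_right_comm, ← C_mul, mul_inv_cancel₀ hc, C_1, one_mul]
    have hirr : Irreducible (map (Int.castRingHom ℚ) H) := by
      rw [hH]
      exact (irreducible_isUnit_mul ((IsUnit.mk0 (c : ℚ) hc).map C)).2 hi
    have hdeg : H.totalDegree = i.totalDegree := by
      rw [← totalDegree_map_rat, hH, totalDegree_mul_of_isDomain (by simpa using hc) hi.ne_zero,
        totalDegree_C, zero_add]
    have hsum := totalDegree_mul_of_isDomain hi.ne_zero ha
    have hev : ∀ x, (eval (π x) H : ℚ) = c * eval (fun j => (π x j : ℚ)) i := fun x => by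
      rw [← eval_rat, hH, map_mul, eval_C]
    have h1 : (Z.filter fun x => eval (π x) H = 0).card ≤ H.totalDegree * T := by
      refine hT H hirr (hdvd.mul_right a) ?_ (by rw [hsum, hdeg]; exact Nat.le_add_right _ _) _
        (Finset.filter_subset _ _) fun x hx => (Finset.mem_filter.1 hx).2
      rw [hdeg]; exact totalDegree_pos_of_irreducible hi
    have h2 : (Z.filter fun x => ¬ eval (π x) H = 0).card ≤ a.totalDegree * T := by
      refine ih ha _ (fun x hx => ?_) fun G hG hGd hG1 hG2 W hW => ?_
      · have h3 := hZ x (Finset.mem_filter.1 hx).1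
        rw [map_mul] at h3
        refine (mul_eq_zero.1 h3).resolve_left fun h0 => (Finset.mem_filter.1 hx).2 ?_
        have := hev x
        rw [h0, mul_zero] at this
        exact_mod_cast this
      · exact hT G hG (hGd.mul_left i) hG1 (by rw [hsum]; omega) W
          (hW.trans (Finset.filter_subset _ _))
    have h3 := Finset.card_filter_add_card_filter_not (s := Z) fun x => eval (π x) H = 0
    rw [hsum, add_mul, ← hdeg]
    omega

theorem totalDegree_aeval_le {σ τ R : Type*} [CommRing R] {g : σ → MvPolynomial τ R}
    (hg : ∀ i, (g i).totalDegree ≤ 1) (f : MvPolynomial σ R) :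
    (aeval g f).totalDegree ≤ f.totalDegree := by
  rw [aeval_def, eval₂_eq]
  refine totalDegree_finsetSum_le fun α hα => (totalDegree_mul _ _).trans ?_
  rw [algebraMap_eq, totalDegree_C, zero_add]
  refine (totalDegree_finset_prod _ _).trans (le_trans (Finset.sum_le_sum fun i _ => ?_)
    (le_totalDegree hα))
  exact (totalDegree_pow _ _).trans (mul_le_of_le_one_right' (hg i))

/-- Polynomials of degree one are affine functions. -/
theorem exists_affine_form {n : ℕ} {R : Type*} [CommRing R] {H : MvPolynomial (Fin n) R}
    (hH : H.totalDegree = 1) : ∃ (α : Fin n → R) (γ : R), α ≠ 0 ∧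
      ∀ y, eval y H = ∑ i, α i * y i + γ := by
  have key : H = ∑ i, C (coeff (Finsupp.single i 1) H) * X i + C (coeff 0 H) := by
    classical
    ext m
    rw [coeff_add, coeff_sum, coeff_C]
    simp only [coeff_C_mul, coeff_X']
    by_cases hm : m.degree ≤ 1
    · rcases Nat.le_one_iff_eq_zero_or_eq_one.1 hm with h0 | h1
      · rw [Finsupp.degree_eq_zero_iff] at h0
        subst h0
        simp
      · obtain ⟨i, rfl⟩ := (Finsupp.sum_eq_one_iff m).1 h1
        simp [Finsupp.single_left_inj, Finsupp.single_eq_zero, eq_comm]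
    · have hc : coeff m H = 0 := by
        by_contra h
        exact hm ((le_totalDegree (mem_support_iff.2 h)).trans hH.le)
      rw [hc, if_neg (by rintro rfl; simp at hm), Finset.sum_eq_zero, add_zero]
      rintro i -
      rw [if_neg (by rintro rfl; simp at hm), mul_zero]
  refine ⟨fun i => coeff (Finsupp.single i 1) H, coeff 0 H, fun h => ?_, fun y => ?_⟩
  · replace h := fun i => congrFun h i
    simp only [Pi.zero_apply] at h
    simp only [h, C_0, zero_mul, Finset.sum_const_zero, zero_add] at key
    rw [key, totalDegree_C] at hH
    exact zero_ne_one hH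
  · conv_lhs => rw [key]
    simp

theorem eval_affine_comb {n : ℕ} {R : Type*} [CommRing R] {H : MvPolynomial (Fin n) R}
    (hH : H.totalDegree = 1) {x y : Fin n → R} (hx : eval x H = 0) (hy : eval y H = 0) (t : R) :
    eval (fun i => x i + t * (y i - x i)) H = 0 := by
  obtain ⟨α, γ, -, hev⟩ := exists_affine_form hH
  rw [hev] at hx hy ⊢
  have : ∑ i, α i * (x i + t * (y i - x i)) =
      (1 - t) * ∑ i, α i * x i + t * ∑ i, α i * y i := by
    rw [Finset.mul_sum, Finset.mul_sum, ← Finset.sum_add_distrib]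
    exact Finset.sum_congr rfl fun i _ => by ring
  rw [this]
  linear_combination (1 - t) * hx + t * hy

theorem eval_aeval {σ τ R : Type*} [CommRing R] (g : σ → MvPolynomial τ R) (y : τ → R)
    (f : MvPolynomial σ R) : eval y (aeval g f) = eval (fun i => eval y (g i)) f := by
  induction f using MvPolynomial.induction_on with
  | C a => simp
  | add p q hp hq => simp only [map_add, hp, hq]
  | mul_X p i hp => rw [map_mul, map_mul, hp, map_mul, aeval_X, eval_X]

theorem card_plane_curve_zeros_le {P : MvPolynomial (Fin 2) ℚ} {d b l : ℕ} (hP : P ≠ 0)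
    (hPd : P.totalDegree ≤ d) (hl : 1 ≤ l) (hb : 1 ≤ b) (hbl : b ≤ 2 ^ l)
    (Z : Finset (Fin 2 → ℤ)) (hZ : ∀ x ∈ Z, eval (fun i => (x i : ℚ)) P = 0 ∧ ∀ i, |x i| ≤ b)
    (hlin : ∀ H : MvPolynomial (Fin 2) ℤ, H.totalDegree = 1 → map (Int.castRingHom ℚ) H ∣ P →
      ∀ x ∈ Z, ∀ y ∈ Z, eval x H = 0 → eval y H = 0 → x = y) :
    Z.card ≤ d * (2 ^ 214 * l ^ 28 * d * (Nat.sqrt b + 1)) := by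
  refine (card_le_of_factors (T := 2 ^ 214 * l ^ 28 * d * (Nat.sqrt b + 1)) hP Z id
    (fun x hx => (hZ x hx).1) fun H hH hHP h1 h2 W hW hWH => ?_).trans (Nat.mul_le_mul_right _ hPd)
  have hd : 1 ≤ d := h1.trans (h2.trans hPd)
  rcases h1.eq_or_lt with h1 | h1
  · rw [← h1, one_mul]
    refine le_trans (Finset.card_le_one.2 fun x hx y hy => hlin H h1.symm hHP x (hW hx) y (hW hy)
      (hWH x hx) (hWH y hy)) (Nat.one_le_iff_ne_zero.2 ?_)
    positivity
  · refine (card_curve_zeros_le (X := Nat.sqrt b + 1) h1 hl hb hbl rfl hH ?_ W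
      fun x hx => ⟨hWH x hx, (hZ x (hW hx)).2⟩).trans ?_
    · exact (Nat.lt_succ_sqrt' b).le.trans (Nat.pow_le_pow_right (Nat.succ_pos _) h1)
    · calc 2 ^ 214 * l ^ 28 * H.totalDegree ^ 2 * (Nat.sqrt b + 1)
          = H.totalDegree * (2 ^ 214 * l ^ 28 * H.totalDegree * (Nat.sqrt b + 1)) := by ring
        _ ≤ _ := by gcongr; exact h2.trans hPd

/-- Points of a surface over a line, none of which lies on a line of the surface. -/
theorem card_over_line_le {f : MvPolynomial (Fin 3) ℤ} {d b l : ℕ} (hd : f.totalDegree ≤ d)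
    (hlead : coeff (Finsupp.single 0 d) f ≠ 0) (hl : 1 ≤ l) (hb : 1 ≤ b) (hbl : b ≤ 2 ^ l)
    {H : MvPolynomial (Fin 2) ℤ} (hH : H.totalDegree = 1) (Z : Finset (Fin 3 → ℤ))
    (hZ : ∀ x ∈ Z, eval x f = 0 ∧ eval (Fin.tail x) H = 0 ∧ ∀ i, |x i| ≤ b)
    (hnl : ∀ x ∈ Z, ∀ v : Fin 3 → ℤ, v ≠ 0 → (∀ i, |v i| ≤ 2 * b) →
      ∃ t : ℤ, eval (fun i => x i + t * v i) f ≠ 0) :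
    Z.card ≤ d * (2 ^ 214 * l ^ 28 * d * (Nat.sqrt b + 1)) := by
  classical
  obtain ⟨α, γ, hα, hev⟩ := exists_affine_form hH
  obtain ⟨k, hk⟩ : ∃ k, α k ≠ 0 := by
    by_contra! h
    exact hα (funext h)
  obtain ⟨j, hjk, hj⟩ : ∃ j : Fin 2, j ≠ k ∧ ∀ i, i ≠ k → i = j := by
    clear hk
    revert k
    decide
  have hkq : (α k : ℚ) ≠ 0 := by exact_mod_cast hk
  set g : Fin 3 → MvPolynomial (Fin 2) ℚ := Fin.cons (X 0) fun i =>
    if i = k then C (-(α j : ℚ) / α k) * X 1 + C (-(γ : ℚ) / α k) else X 1 with hg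
  set P := aeval g (map (Int.castRingHom ℚ) f) with hPdef
  have hPeval : ∀ y : Fin 2 → ℚ, eval y P = eval (fun i => eval y (g i))
      (map (Int.castRingHom ℚ) f) := fun y => eval_aeval g y _
  have hPd : P.totalDegree ≤ d := by
    refine (totalDegree_aeval_le (fun i => ?_) _).trans ((totalDegree_map_le' _ _).trans hd)
    refine Fin.cases ?_ (fun i => ?_) i
    · exact (totalDegree_X _).le
    · rw [hg, Fin.cons_succ]
      split_ifs
      · refine (totalDegree_add _ _).trans (max_le ((totalDegree_mul _ _).trans ?_) ?_)
        · rw [totalDegree_C, zero_add, totalDegree_X]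
        · rw [totalDegree_C]; exact zero_le_one
      · exact (totalDegree_X _).le
  have hP0 : P ≠ 0 := by
    intro h0
    have hz : fiberPoly (fun i => eval ![0, 0] (g i.succ)) (map (Int.castRingHom ℚ) f) = 0 := by
      refine Polynomial.funext fun r => ?_
      rw [eval_fiberPoly, Polynomial.eval_zero]
      have h1 := hPeval ![r, 0]
      rw [h0, map_zero] at h1
      refine Eq.trans ?_ h1.symm
      congr 2
      funext i
      refine Fin.cases ?_ (fun i => ?_) i
      · simp [hg]
      · rw [Fin.cons_succ, hg, Fin.cons_succ]
        split_ifs <;> simp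
    have h2 := coeff_fiberPoly_top (fun i => eval ![0, 0] (g i.succ)) (map (Int.castRingHom ℚ) f)
      ((totalDegree_map_le' _ _).trans hd)
    rw [hz, Polynomial.coeff_zero, coeff_map, eq_intCast] at h2
    exact hlead (by exact_mod_cast h2.symm)
  set π : (Fin 3 → ℤ) → Fin 2 → ℤ := fun z => ![z 0, z j.succ] with hπ
  have hrec : ∀ z : Fin 3 → ℤ, eval (Fin.tail z) H = 0 →
      eval (fun i => (π z i : ℚ)) P = (eval z f : ℤ) := by
    intro z hz
    rw [hPeval, ← eval_rat]
    congr 2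
    funext i
    refine Fin.cases ?_ (fun i => ?_) i
    · simp [hg, hπ]
    · rw [hg, Fin.cons_succ]
      split_ifs with hik
      · subst hik
        rw [hev, Fintype.sum_eq_add i j hjk.symm (fun m hm => absurd (hj m hm.1) hm.2)] at hz
        have hz' : (α i : ℚ) * z i.succ + α j * z j.succ + γ = 0 := by exact_mod_cast hz
        simp only [hπ, map_add, map_mul, eval_C, eval_X, Matrix.cons_val_one, Matrix.cons_val_fin_one]
        field_simp
        linear_combination -hz'
      · rw [hj i hik]; simp [hπ]
  have hinj : ∀ x ∈ Z, ∀ y ∈ Z, π x = π y → x = y := by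
    intro x hx y hy hxy
    have h1 := (hZ x hx).2.1
    have h2 := (hZ y hy).2.1
    rw [hev, Fintype.sum_eq_add k j hjk.symm (fun m hm => absurd (hj m hm.1) hm.2)] at h1 h2
    have h0 : x 0 = y 0 := congrFun hxy 0
    have h3 : x j.succ = y j.succ := congrFun hxy 1
    funext i
    refine Fin.cases h0 (fun i => ?_) i
    by_cases hik : i = k
    · subst hik
      refine mul_left_cancel₀ hk ?_
      simp only [Fin.tail] at h1 h2
      rw [h3] at h1
      linear_combination h1 - h2
    · rw [hj i hik, h3]
  rw [← Finset.card_image_of_injOn fun x hx y hy h => hinj x hx y hy h]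
  refine card_plane_curve_zeros_le hP0 hPd hl hb hbl _ (fun y hy => ?_) fun G hG hGP x hx y hy hxG hyG => ?_
  · obtain ⟨x, hx, rfl⟩ := Finset.mem_image.1 hy
    refine ⟨by rw [hrec x (hZ x hx).2.1, (hZ x hx).1, Int.cast_zero], fun i => ?_⟩
    fin_cases i
    · exact (hZ x hx).2.2 0
    · exact (hZ x hx).2.2 j.succ
  · obtain ⟨x, hx', rfl⟩ := Finset.mem_image.1 hx
    obtain ⟨y, hy', rfl⟩ := Finset.mem_image.1 hy
    clear hx hy
    rename x ∈ Z => hx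
    rename y ∈ Z => hy
    by_contra hne
    obtain ⟨t, ht⟩ := hnl x hx (fun i => y i - x i)
      (fun h => hne (by rw [show x = y from funext fun i => by have := congrFun h i; simp at this; omega]))
      (fun i => by
        have h1 := abs_le.1 ((hZ x hx).2.2 i)
        have h2 := abs_le.1 ((hZ y hy).2.2 i)
        rw [abs_le]; constructor <;> linarith)
    refine ht ?_
    have h1 := hrec (fun i => x i + t * (y i - x i))
      (eval_affine_comb hH (hZ x hx).2.1 (hZ y hy).2.1 t)
    have h2 := eval_affine_comb hG hxG hyG t
    have h3 : (fun i => π x i + t * (π y i - π x i)) = π fun i => x i + t * (y i - x i) := by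
      funext i
      fin_cases i <;> rfl
    rw [h3] at h2
    obtain ⟨Q, hQ⟩ := hGP
    rw [hQ, map_mul, eval_rat, h2, Int.cast_zero, zero_mul] at h1
    exact_mod_cast h1.symm

theorem card_nonlineal_le {f g : MvPolynomial (Fin 3) ℤ} {d b l D : ℕ} (hd34 : d = 3 ∨ d = 4)
    (hd : f.totalDegree = d) (hirr : Irreducible (map (Int.castRingHom ℚ) f))
    (hlead : coeff (Finsupp.single 0 d) f ≠ 0) (hl : 1 ≤ l) (hb : 1 ≤ b) (hbl : b ≤ 2 ^ l)
    (hdD : d ≤ D) (hg0 : g ≠ 0) (hg : g.support ⊆ lowExp 2 d D) (Z : Finset (Fin 3 → ℤ))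
    (hZ : ∀ x ∈ Z, eval x f = 0 ∧ eval x g = 0 ∧ ∀ i, |x i| ≤ b)
    (hnl : ∀ x ∈ Z, ∀ v : Fin 3 → ℤ, v ≠ 0 → (∀ i, |v i| ≤ 2 * b) →
      ∃ t : ℤ, eval (fun i => x i + t * v i) f ≠ 0) :
    Z.card ≤ 8 * D * (2 ^ 220 * l ^ 28 * (l * (Nat.sqrt b + 1) + D)) := by
  classical
  have hd4 : d ≤ 4 := by omega
  have hgd : g.totalDegree ≤ D := Finset.sup_le fun α hα => (mem_lowExp.1 (hg hα)).1
  have hg0d : degreeOf 0 g ≤ d := by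
    rw [degreeOf_le_iff]
    exact fun α hα => (mem_lowExp.1 (hg hα)).2.le
  have hndvd := not_dvd_of_support_subset hlead hg0 fun α hα => (mem_lowExp.1 (hg hα)).2
  obtain ⟨R, hR, hRd, hRz⟩ := exists_eliminant (by omega) hd.le hlead hirr hndvd hgd hg0d hdD
  have hR8 : R.totalDegree ≤ 8 * D := hRd.trans (Nat.mul_le_mul_right _ (by omega))
  have hRQ : map (Int.castRingHom ℚ) R ≠ 0 := fun h =>
    hR (map_rat_injective (h.trans (map_zero _).symm))
  set A := 2 ^ 214 * l ^ 28 with hA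
  have hT : 2 ^ 220 * l ^ 28 * (l * (Nat.sqrt b + 1) + D) =
      64 * A * (l * (Nat.sqrt b + 1) + D) := by rw [hA]; ring
  rw [hT]
  refine (card_le_of_factors (T := 64 * A * (l * (Nat.sqrt b + 1) + D)) hRQ Z Fin.tail
    (fun x hx => ?_) fun H hH hHR h1 h2 W hW hWH => ?_).trans
    (Nat.mul_le_mul_right _ ((totalDegree_map_rat R).le.trans hR8))
  · rw [eval_rat, hRz x (hZ x hx).1 (hZ x hx).2.1, Int.cast_zero]
  rw [totalDegree_map_rat] at h2
  rcases h1.eq_or_lt with h1 | h1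
  · refine (card_over_line_le hd.le hlead hl hb hbl h1.symm W
      (fun x hx => ⟨(hZ x (hW hx)).1, hWH x hx, (hZ x (hW hx)).2.2⟩)
      fun x hx => hnl x (hW hx)).trans ?_
    rw [← h1, one_mul]
    calc d * (A * d * (Nat.sqrt b + 1)) ≤ 4 * (A * 4 * (Nat.sqrt b + 1)) := by gcongr
      _ = 16 * A * (1 * (Nat.sqrt b + 1) + 0) := by ring
      _ ≤ _ := by gcongr <;> omega
  have hc : ∀ X, b ≤ X ^ H.totalDegree → W.card ≤ 4 * (A * H.totalDegree ^ 2 * X) := by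
    intro X hX
    refine (card_zeros_le_mul_card_tail hd.le hlead W (fun x hx => (hZ x (hW hx)).1)
      (W.image Fin.tail) fun P hP => Finset.mem_image_of_mem _ hP).trans
      (Nat.mul_le_mul hd4 (card_curve_zeros_le h1 hl hb hbl rfl hH hX _ fun y hy => ?_))
    obtain ⟨x, hx, rfl⟩ := Finset.mem_image.1 hy
    exact ⟨hWH x hx, fun i => (hZ x (hW hx)).2.2 i.succ⟩
  rcases lt_or_ge H.totalDegree l with h3 | h3
  · refine (hc (Nat.sqrt b + 1) ((Nat.lt_succ_sqrt' b).le.trans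
      (Nat.pow_le_pow_right (Nat.succ_pos _) h1))).trans ?_
    calc 4 * (A * H.totalDegree ^ 2 * (Nat.sqrt b + 1))
        = H.totalDegree * (4 * A * (H.totalDegree * (Nat.sqrt b + 1) + 0)) := by ring
      _ ≤ _ := by gcongr <;> omega
  · refine (hc 2 (hbl.trans (Nat.pow_le_pow_right two_pos h3))).trans ?_
    calc 4 * (A * H.totalDegree ^ 2 * 2) = H.totalDegree * (8 * A * H.totalDegree) := by ring
      _ ≤ H.totalDegree * (8 * A * (8 * D)) := by gcongr; exact h2.trans hR8
      _ = H.totalDegree * (64 * A * (0 + D)) := by ring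
      _ ≤ _ := by gcongr; exact Nat.zero_le _

theorem linePoly_eq_zero {n : ℕ} {f : MvPolynomial (Fin n) ℤ} {x v : Fin n → ℤ}
    (h : ∀ t : ℤ, eval (fun i => x i + t * v i) f = 0) : linePoly x v f = 0 :=
  Polynomial.funext fun t => by rw [eval_linePoly, h, Polynomial.eval_zero]

theorem eval_dirDeriv_of_line {n : ℕ} {f : MvPolynomial (Fin n) ℤ} {x v : Fin n → ℤ}
    (h : ∀ t : ℤ, eval (fun i => x i + t * v i) f = 0) (t : ℤ) :
    eval (fun i => x i + t * v i) (dirDeriv v f) = 0 := by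
  rw [← eval_linePoly, ← derivative_linePoly, linePoly_eq_zero h, Polynomial.derivative_zero,
    Polynomial.eval_zero]

theorem eval_top_of_line {n d : ℕ} {f : MvPolynomial (Fin n) ℤ} {x v : Fin n → ℤ}
    (hd : f.totalDegree ≤ d) (h : ∀ t : ℤ, eval (fun i => x i + t * v i) f = 0) :
    eval v (homogeneousComponent d f) = 0 := by
  rw [← coeff_linePoly_top x v hd, linePoly_eq_zero h, Polynomial.coeff_zero]

theorem eval_rat_of_line {n : ℕ} {f : MvPolynomial (Fin n) ℤ} {x v : Fin n → ℤ}
    (h : ∀ t : ℤ, eval (fun i => x i + t * v i) f = 0) (t : ℚ) :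
    eval (fun i => (x i : ℚ) + t * v i) (map (Int.castRingHom ℚ) f) = 0 := by
  have : linePoly (fun i => (x i : ℚ)) (fun i => (v i : ℚ)) (map (Int.castRingHom ℚ) f) = 0 := by
    refine Polynomial.eq_zero_of_infinite_isRoot _ (Set.Infinite.mono ?_
      (Set.infinite_range_of_injective (Int.cast_injective (α := ℚ))))
    rintro _ ⟨t, rfl⟩
    rw [Set.mem_setOf_eq, Polynomial.IsRoot, eval_linePoly]
    have := eval_rat (fun i => x i + t * v i) f
    rw [h, Int.cast_zero] at this
    rw [← this]
    push_cast
    rfl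
  rw [← eval_linePoly, this, Polynomial.eval_zero]

/-- Integer vectors with coprime entries. -/
def IsPrimVec {n : ℕ} (v : Fin n → ℤ) : Prop :=
  v ≠ 0 ∧ ∀ c : ℤ, (∀ i, c ∣ v i) → IsUnit c

theorem IsPrimVec.exists_int_mul {n : ℕ} {u v : Fin n → ℤ} (hv : IsPrimVec v) {q : ℚ}
    (h : ∀ i, (u i : ℚ) = q * v i) : ∃ k : ℤ, q = k := by
  have h1 : IsUnit (q.den : ℤ) := by
    refine hv.2 _ fun i => ?_
    have h2 := h i
    rw [← Rat.num_div_den q, div_mul_eq_mul_div, eq_div_iff (by exact_mod_cast q.den_ne_zero)] at h2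
    have h3 : u i * q.den = q.num * v i := by exact_mod_cast h2
    refine IsCoprime.dvd_of_dvd_mul_left (y := q.num) ?_ ⟨u i, by rw [← h3, mul_comm]⟩
    rw [Int.isCoprime_iff_nat_coprime, Int.natAbs_natCast]
    exact Nat.coprime_comm.1 q.reduced
  refine ⟨q.num, ?_⟩
  rw [Int.isUnit_iff] at h1
  have h2 : q.den = 1 := by omega
  conv_lhs => rw [← Rat.num_div_den q, h2, Nat.cast_one, div_one]

theorem exists_isPrimVec {n : ℕ} {w : Fin n → ℤ} (hw : w ≠ 0) :
    ∃ (v : Fin n → ℤ) (g : ℤ), IsPrimVec v ∧ g ≠ 0 ∧ ∀ i, w i = g * v i := by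
  obtain ⟨i, hi⟩ : ∃ i, w i ≠ 0 := by
    by_contra! h
    exact hw (funext h)
  obtain ⟨v, hv, hg⟩ := Finset.extract_gcd w ⟨i, Finset.mem_univ i⟩
  refine ⟨v, Finset.univ.gcd w, ⟨?_, fun c hc => ?_⟩, fun h => hi ?_, fun i => hv i (Finset.mem_univ i)⟩
  · rintro rfl
    exact hi (by rw [hv i (Finset.mem_univ i), Pi.zero_apply, mul_zero])
  · exact isUnit_of_dvd_one (hg ▸ Finset.dvd_gcd fun i _ => hc i)
  · rw [hv i (Finset.mem_univ i), h, zero_mul]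

theorem card_progression_le {n b M : ℕ} {v : Fin n → ℤ} (hv : IsPrimVec v) {k : Fin n} (hM : 1 ≤ M)
    (hk : (M : ℤ) ≤ |v k|) (F : Finset (Fin n → ℤ)) (hF : ∀ x ∈ F, ∀ i, |x i| ≤ b)
    (hq : ∀ x ∈ F, ∀ y ∈ F, ∃ q : ℚ, ∀ i, (x i : ℚ) - y i = q * v i) : F.card ≤ 2 * b / M + 1 := by
  rw [← Finset.card_range (2 * b / M + 1)]
  refine Finset.card_le_card_of_injOn (fun x => (x k + b).toNat / M) (fun x hx => ?_) ?_
  · have := abs_le.1 (hF x hx k)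
    rw [Finset.coe_range, Set.mem_Iio, Nat.lt_succ_iff]
    exact Nat.div_le_div_right (by omega)
  · intro x hx y hy hxy
    have h1 := abs_le.1 (hF x hx k)
    have h2 := abs_le.1 (hF y hy k)
    obtain ⟨q, hq⟩ := hq x hx y hy
    obtain ⟨m, rfl⟩ := hv.exists_int_mul (u := fun i => x i - y i) (q := q) (by exact_mod_cast hq)
    have h3 : ∀ i, x i - y i = m * v i := by exact_mod_cast hq
    rcases eq_or_ne m 0 with rfl | hm
    · funext i
      have := h3 i
      rw [zero_mul] at this
      omega
    exfalso
    have h4 : (M : ℤ) ≤ |x k - y k| := by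
      rw [h3 k, abs_mul]
      exact hk.trans (le_mul_of_one_le_left (abs_nonneg _) (Int.one_le_abs hm))
    have h5 := Nat.div_add_mod (x k + b).toNat M
    have h6 := Nat.div_add_mod (y k + b).toNat M
    have h7 := Nat.mod_lt (x k + b).toNat hM
    have h8 := Nat.mod_lt (y k + b).toNat hM
    simp only at hxy
    rw [hxy] at h5
    rcases le_abs.1 h4 with h | h <;> omega

theorem totalDegree_dirDeriv_lt {n : ℕ} {R : Type*} [CommRing R] (v : Fin n → R)
    {f : MvPolynomial (Fin n) R} (hf : 0 < f.totalDegree) :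
    (dirDeriv v f).totalDegree < f.totalDegree := by
  refine Nat.lt_of_le_pred hf (totalDegree_finsetSum_le fun i _ => ?_)
  refine (totalDegree_mul _ _).trans ?_
  rw [totalDegree_C, zero_add]
  exact Nat.le_pred_of_lt (totalDegree_pderiv_lt i hf)

theorem tail_ne_zero_of_eval_top {n d : ℕ} {f : MvPolynomial (Fin (n + 1)) ℤ}
    (hlead : coeff (Finsupp.single 0 d) f ≠ 0) {v : Fin (n + 1) → ℤ} (hv : v ≠ 0)
    (h : eval v (homogeneousComponent d f) = 0) : Fin.tail v ≠ 0 := by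
  intro h0
  rw [eval_of_tail_eq_zero (homogeneousComponent_isHomogeneous d f) h0,
    coeff_homogeneousComponent_single] at h
  have h1 := eq_zero_of_pow_eq_zero ((mul_eq_zero.1 h).resolve_left hlead)
  exact hv (funext fun i => Fin.cases h1 (fun i => congrFun h0 i) i)

/-- Points of a box on lines of a fixed direction contained in a surface. -/
theorem card_direction_le {f : MvPolynomial (Fin 3) ℤ} {d b M : ℕ} (hd0 : 0 < d)
    (hd : f.totalDegree = d) (hirr : Irreducible (map (Int.castRingHom ℚ) f))
    (hlead : coeff (Finsupp.single 0 d) f ≠ 0) {v : Fin 3 → ℤ} (hv : IsPrimVec v)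
    (hfv : dirDeriv v f ≠ 0) {k : Fin 3} (hM : 1 ≤ M) (hk : (M : ℤ) ≤ |v k|)
    (Z : Finset (Fin 3 → ℤ)) (hZ : ∀ x ∈ Z, ∀ i, |x i| ≤ b)
    (hline : ∀ x ∈ Z, ∀ t : ℤ, eval (fun i => x i + t * v i) f = 0) :
    Z.card ≤ (2 * b / M + 1) * (2 * d ^ 3) := by
  classical
  rcases Z.eq_empty_or_nonempty with rfl | ⟨x₀, hx₀⟩
  · simp
  have hlt : (dirDeriv v f).totalDegree < f.totalDegree := totalDegree_dirDeriv_lt v (hd ▸ hd0)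
  obtain ⟨R, hR, hRd, hRz⟩ := exists_eliminant hd0 hd.le hlead hirr
    (not_dvd_of_totalDegree_lt (fun h => hfv (map_rat_injective (h.trans (map_zero _).symm)))
      (by rwa [totalDegree_map_rat, totalDegree_map_rat]))
    (D := d) (by omega) ((degreeOf_le_totalDegree _ _).trans (by omega)) le_rfl
  have hu : Fin.tail v ≠ 0 := tail_ne_zero_of_eval_top hlead hv.1
    (eval_top_of_line hd.le (hline x₀ hx₀))
  obtain ⟨P, hP⟩ : ∃ P : Fin 2 → ℤ, eval P R ≠ 0 := by
    by_contra! h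
    exact hR (MvPolynomial.funext fun P => by rw [h P, map_zero])
  set N : ℚ := (v 1 : ℚ) ^ 2 + (v 2 : ℚ) ^ 2 with hN
  have hN0 : N ≠ 0 := by
    intro h
    have h1 : (v 1 : ℚ) = 0 := by nlinarith [sq_nonneg (v 1 : ℚ), sq_nonneg (v 2 : ℚ)]
    have h2 : (v 2 : ℚ) = 0 := by nlinarith [sq_nonneg (v 1 : ℚ), sq_nonneg (v 2 : ℚ)]
    refine hu (funext fun i => ?_)
    fin_cases i
    · exact_mod_cast h1
    · exact_mod_cast h2
  set φ := linePoly (fun i => (P i : ℚ)) ![-(v 2 : ℚ), v 1] (map (Int.castRingHom ℚ) R) with hφ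
  have hφ0 : φ ≠ 0 := by
    intro h
    have h1 := eval_linePoly (fun i => (P i : ℚ)) ![-(v 2 : ℚ), v 1] (map (Int.castRingHom ℚ) R) 0
    rw [← hφ, h, Polynomial.eval_zero] at h1
    simp only [zero_mul, add_zero] at h1
    rw [eval_rat] at h1
    exact hP (by exact_mod_cast h1.symm)
  set s : (Fin 3 → ℤ) → ℚ := fun x => (v 1 * (x 2 - P 1) - v 2 * (x 1 - P 0)) / N with hs
  set τ : (Fin 3 → ℤ) → ℚ := fun x => (v 1 * (x 1 - P 0) + v 2 * (x 2 - P 1)) / N with hτ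
  set q : (Fin 3 → ℤ) → Fin 3 → ℚ := fun x i => x i + -τ x * v i with hq
  have hqt : ∀ x, Fin.tail (q x) = fun i => (P i : ℚ) + s x * ![-(v 2 : ℚ), v 1] i := by
    intro x
    funext i
    fin_cases i
    · change (x 1 : ℚ) + -τ x * v 1 = P 0 + s x * -v 2
      simp only [hs, hτ]
      field_simp
      rw [hN]; ring
    · change (x 2 : ℚ) + -τ x * v 2 = P 1 + s x * v 1
      simp only [hs, hτ]
      field_simp
      rw [hN]; ring
  have hroot : ∀ x ∈ Z, s x ∈ φ.roots.toFinset := by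
    intro x hx
    rw [Multiset.mem_toFinset, Polynomial.mem_roots hφ0, Polynomial.IsRoot, hφ, eval_linePoly,
      ← hqt x]
    exact eval_rat_of_line (x := Fin.tail x) (v := Fin.tail v) (f := R) (fun t =>
      hRz (fun i => x i + t * v i) (hline x hx t) (eval_dirDeriv_of_line (hline x hx) t)) (-τ x)
  have hqc : (Z.image q).card ≤ d * (2 * d * d) := by
    refine (card_zeros_le_mul_card_tail (h := map (Int.castRingHom ℚ) f)
      ((totalDegree_map_le' _ _).trans hd.le) ?_ _ (fun y hy => ?_)
      (φ.roots.toFinset.image fun t i => (P i : ℚ) + t * ![-(v 2 : ℚ), v 1] i) fun y hy => ?_).trans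
      (Nat.mul_le_mul_left _ ?_)
    · rw [coeff_map, eq_intCast]; exact_mod_cast hlead
    · obtain ⟨x, hx, rfl⟩ := Finset.mem_image.1 hy
      exact eval_rat_of_line (hline x hx) (-τ x)
    · obtain ⟨x, hx, rfl⟩ := Finset.mem_image.1 hy
      exact Finset.mem_image.2 ⟨s x, hroot x hx, (hqt x).symm⟩
    · refine Finset.card_image_le.trans ((Multiset.toFinset_card_le _).trans
        ((Polynomial.card_roots' _).trans ((natDegree_linePoly_le _ _ _).trans
        ((totalDegree_map_le' _ _).trans hRd))))
  refine (Finset.card_le_mul_card_image (f := q) Z (2 * b / M + 1) fun y _ => ?_).trans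
    (Nat.mul_le_mul_left _ (hqc.trans_eq (by ring)))
  refine card_progression_le hv hM hk _ (fun x hx => hZ x (Finset.mem_filter.1 hx).1)
    fun x hx x' hx' => ⟨τ x - τ x', fun i => ?_⟩
  have h1 := congrFun ((Finset.mem_filter.1 hx).2.trans (Finset.mem_filter.1 hx').2.symm) i
  simp only [hq] at h1
  linear_combination h1

theorem eval_mul_of_isHomogeneous {n d : ℕ} {R : Type*} [CommRing R] {F : MvPolynomial (Fin n) R}
    (hF : F.IsHomogeneous d) (c : R) (v : Fin n → R) :
    eval (fun i => c * v i) F = c ^ d * eval v F := by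
  rw [eval_eq', eval_eq', Finset.mul_sum]
  refine Finset.sum_congr rfl fun α hα => ?_
  have h1 : α.degree = d := by
    rw [Finsupp.degree_eq_weight_one]; exact hF (mem_support_iff.1 hα)
  simp only [mul_pow, Finset.prod_mul_distrib, Finset.prod_pow_eq_pow_sum]
  rw [← Finsupp.degree_eq_sum, h1]
  ring

section
variable {K : Type*} [Field K]

/-- The scalar normalizing a nonzero projective tail. -/
noncomputable def projScale (v : Fin 3 → K) : K :=
  open Classical in (if v 1 ≠ 0 then v 1 else v 2)⁻¹

/-- The normalized representative of a projective point with nonzero tail. -/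
noncomputable def projNorm (v : Fin 3 → K) : Fin 3 → K := fun i => projScale v * v i

theorem projScale_ne_zero {v : Fin 3 → K} (hv : Fin.tail v ≠ 0) : projScale v ≠ 0 := by
  rw [projScale]
  refine inv_ne_zero ?_
  split_ifs with h
  · exact h
  · intro h2
    refine hv (funext fun i => ?_)
    fin_cases i
    · exact not_not.1 h
    · exact h2

theorem tail_projNorm {v : Fin 3 → K} (hv : Fin.tail v ≠ 0) :
    (∃ y, Fin.tail (projNorm v) = ![1, y]) ∨ Fin.tail (projNorm v) = ![0, 1] := by
  by_cases h : v 1 = 0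
  · right
    have h2 : v 2 ≠ 0 := fun h2 => hv (by funext i; fin_cases i; exacts [h, h2])
    funext i
    fin_cases i
    · change projScale v * v 1 = 0
      rw [h, mul_zero]
    · change projScale v * v 2 = 1
      rw [projScale, if_neg (by simpa using h), inv_mul_cancel₀ h2]
  · left
    refine ⟨projScale v * v 2, ?_⟩
    funext i
    fin_cases i
    · change projScale v * v 1 = 1
      rw [projScale, if_pos h, inv_mul_cancel₀ h]
    · rfl

theorem exists_scale_of_projNorm_eq {v w : Fin 3 → K} (hv : Fin.tail v ≠ 0) (hw : Fin.tail w ≠ 0)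
    (h : projNorm v = projNorm w) : ∃ c : K, c ≠ 0 ∧ ∀ i, w i = c * v i := by
  refine ⟨(projScale w)⁻¹ * projScale v, mul_ne_zero (inv_ne_zero (projScale_ne_zero hw))
    (projScale_ne_zero hv), fun i => ?_⟩
  have h1 := congrFun h i
  simp only [projNorm] at h1
  rw [mul_assoc, h1, inv_mul_cancel_left₀ (projScale_ne_zero hw)]

theorem tail_ne_zero_of_nonsingular {n d : ℕ} (hd : 2 ≤ d) {F : MvPolynomial (Fin (n + 1)) K}
    (hF : F.IsHomogeneous d) {v : Fin (n + 1) → K} (h0 : eval v F = 0)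
    (h1 : eval v (pderiv 0 F) ≠ 0) : Fin.tail v ≠ 0 := by
  intro ht
  rw [eval_of_tail_eq_zero hF ht] at h0
  rw [eval_of_tail_eq_zero hF.pderiv ht, coeff_pderiv, ← Finsupp.single_add,
    Nat.sub_add_cancel (by omega)] at h1
  rcases mul_eq_zero.1 h0 with h | h
  · exact h1 (by rw [h]; ring)
  · refine h1 ?_
    rw [eq_zero_of_pow_eq_zero h, zero_pow (by omega), mul_zero]

end

theorem card_image_projNorm_le {F : MvPolynomial (Fin 3) ℤ} {d p : ℕ} [Fact p.Prime] (hd : 2 ≤ d)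
    (hF : F.IsHomogeneous d) (V : Finset (Fin 3 → ℤ))
    (h0 : ∀ v ∈ V, eval v F = 0) (h1 : ∀ v ∈ V, ¬ (p : ℤ) ∣ eval v (pderiv 0 F)) :
    (V.image fun v => projNorm fun i => (v i : ZMod p)).card ≤ d * (p + 1) ∧
      ∀ v ∈ V, ∀ w ∈ V, projNorm (fun i => (v i : ZMod p)) = projNorm (fun i => (w i : ZMod p)) →
        ∃ (c : ℤ) (u : Fin 3 → ℤ), ¬ (p : ℤ) ∣ c ∧ ∀ i, c * w i = v i + p * u i := by
  classical
  have hFp := hF.map (Int.castRingHom (ZMod p))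
  have hz : ∀ v ∈ V, eval (fun i => (v i : ZMod p)) (map (Int.castRingHom (ZMod p)) F) = 0 :=
    fun v hv => by rw [eval_zmod, h0 v hv, Int.cast_zero]
  have hn : ∀ v ∈ V, eval (fun i => (v i : ZMod p)) (pderiv 0 (map (Int.castRingHom (ZMod p)) F)) ≠ 0 :=
    fun v hv => by
      rw [pderiv_map, eval_zmod, Ne, ZMod.intCast_zmod_eq_zero_iff_dvd]
      exact h1 v hv
  have ht : ∀ v ∈ V, Fin.tail (fun i => (v i : ZMod p)) ≠ 0 := fun v hv =>
    tail_ne_zero_of_nonsingular hd hFp (hz v hv) (hn v hv)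
  constructor
  · refine (card_nonsingular_zeros_le_mul_card (map (Int.castRingHom (ZMod p)) F) _ (fun y hy => ?_)
      (fun y hy => ?_) (insert ![0, 1] (Finset.univ.image fun y : ZMod p => ![1, y]))
      fun y hy => ?_).trans (Nat.mul_le_mul hFp.totalDegree_le ?_)
    · obtain ⟨v, hv, rfl⟩ := Finset.mem_image.1 hy
      exact (eval_mul_of_isHomogeneous hFp _ _).trans (by rw [hz v hv, mul_zero])
    · obtain ⟨v, hv, rfl⟩ := Finset.mem_image.1 hy
      refine (eval_mul_of_isHomogeneous hFp.pderiv _ _).trans_ne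
        (mul_ne_zero (pow_ne_zero _ (projScale_ne_zero (ht v hv))) (hn v hv))
    · obtain ⟨v, hv, rfl⟩ := Finset.mem_image.1 hy
      rcases tail_projNorm (ht v hv) with ⟨y, h⟩ | h
      · exact Finset.mem_insert_of_mem (Finset.mem_image.2 ⟨y, Finset.mem_univ _, h.symm⟩)
      · rw [h]; exact Finset.mem_insert_self _ _
    · refine (Finset.card_insert_le _ _).trans (Nat.succ_le_succ (Finset.card_image_le.trans ?_))
      rw [Finset.card_univ, ZMod.card]
  · intro v hv w hw hvw
    obtain ⟨c, hc, h⟩ := exists_scale_of_projNorm_eq (ht w hw) (ht v hv) hvw.symm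
    have hc' : ((c.val : ℤ) : ZMod p) = c := by
      rw [Int.cast_natCast, ZMod.natCast_zmod_val]
    have h2 : ∀ i, (p : ℤ) ∣ c.val * w i - v i := fun i => by
      rw [← ZMod.intCast_zmod_eq_zero_iff_dvd, Int.cast_sub, Int.cast_mul, hc', ← h i, sub_self]
    choose u hu using h2
    refine ⟨c.val, u, ?_, fun i => by rw [← hu i]; ring⟩
    rw [← ZMod.intCast_zmod_eq_zero_iff_dvd, hc']
    exact hc

theorem dvd_eval_dirDeriv {n : ℕ} {F : MvPolynomial (Fin n) ℤ} {v u : Fin n → ℤ} {p : ℤ} (hp : p ≠ 0)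
    (h0 : eval v F = 0) (h1 : eval (fun i => v i + p * u i) F = 0) :
    p ∣ eval v (dirDeriv u F) := by
  obtain ⟨k, hk⟩ := Polynomial.binomExpansion (linePoly v u F) 0 p
  rw [derivative_linePoly, eval_linePoly, eval_linePoly, eval_linePoly, zero_add] at hk
  simp only [zero_mul, add_zero] at hk
  rw [h0, h1] at hk
  refine ⟨-k, mul_right_cancel₀ hp ?_⟩
  linear_combination -hk

/-- The determinant of three integral vectors. -/
def det3 (u v w : Fin 3 → ℤ) : ℤ :=
  u 0 * (v 1 * w 2 - v 2 * w 1) - u 1 * (v 0 * w 2 - v 2 * w 0) + u 2 * (v 0 * w 1 - v 1 * w 0)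

theorem det3_eq_zero {F : MvPolynomial (Fin 3) ℤ} {d p H : ℕ} [hp : Fact p.Prime]
    (hF : F.IsHomogeneous d) {v w w' : Fin 3 → ℤ}
    (hv0 : eval v F = 0) (hw0 : eval w F = 0) (hw0' : eval w' F = 0)
    (hv1 : ¬ (p : ℤ) ∣ eval v (pderiv 0 F)) (hH : 2 * H < p) (hvH : ∀ i, |v i| ≤ H)
    (hwH : ∀ i, |w i| ≤ H) (hwH' : ∀ i, |w' i| ≤ H)
    {c c' : ℤ} {u u' : Fin 3 → ℤ} (hc : ¬ (p : ℤ) ∣ c) (hc' : ¬ (p : ℤ) ∣ c')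
    (hu : ∀ i, c * w i = v i + p * u i) (hu' : ∀ i, c' * w' i = v i + p * u' i) :
    det3 v w w' = 0 := by
  have hpp : Prime (p : ℤ) := Nat.prime_iff_prime_int.1 hp.out
  have hd1 : ∀ x : Fin 3 → ℤ, eval v (dirDeriv x F) = x 0 * eval v (pderiv 0 F) +
      x 1 * eval v (pderiv 1 F) + x 2 * eval v (pderiv 2 F) := by
    intro x
    simp [dirDeriv, Fin.sum_univ_three]
  have he : eval v (dirDeriv v F) = 0 := by
    have := eval_dirDeriv_of_line (f := F) (x := v) (v := v) (fun t => ?_) 0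
    · simpa using this
    · rw [show (fun i => v i + t * v i) = fun i => (1 + t) * v i by funext i; ring,
        eval_mul_of_isHomogeneous hF, hv0, mul_zero]
  have htan : ∀ {w u : Fin 3 → ℤ} {c : ℤ}, eval w F = 0 → (∀ i, c * w i = v i + p * u i) →
      (p : ℤ) ∣ eval v (dirDeriv u F) := by
    intro w u c hw hu
    refine dvd_eval_dirDeriv hpp.ne_zero hv0 ?_
    simp only [← hu]
    rw [eval_mul_of_isHomogeneous hF, hw, mul_zero]
  obtain ⟨a, ha⟩ := htan hw0 hu
  obtain ⟨a', ha'⟩ := htan hw0' hu'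
  rw [hd1] at he ha ha'
  have h1 : (p : ℤ) ∣ det3 v u u' * eval v (pderiv 0 F) := by
    refine ⟨a' * (v 1 * u 2 - v 2 * u 1) - a * (v 1 * u' 2 - v 2 * u' 1), ?_⟩
    simp only [det3]
    linear_combination (u 1 * u' 2 - u 2 * u' 1) * he - (v 1 * u' 2 - v 2 * u' 1) * ha +
      (v 1 * u 2 - v 2 * u 1) * ha'
  obtain ⟨k, hk⟩ := (hpp.dvd_or_dvd h1).resolve_right hv1
  have h2 : (p : ℤ) ^ 3 ∣ c * c' * det3 v w w' := by
    refine ⟨k, ?_⟩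
    have h3 : c * c' * det3 v w w' = det3 v (fun i => c * w i) fun i => c' * w' i := by
      simp only [det3]; ring
    rw [h3]
    simp only [hu, hu']
    have h4 : det3 v (fun i => v i + p * u i) (fun i => v i + p * u' i) = p ^ 2 * det3 v u u' := by
      simp only [det3]; ring
    rw [h4, hk]; ring
  have hcop : IsCoprime ((p : ℤ) ^ 3) (c * c') :=
    IsCoprime.pow_left (((hpp.irreducible.coprime_iff_not_dvd).2 hc).mul_right
      ((hpp.irreducible.coprime_iff_not_dvd).2 hc'))
  refine Int.eq_zero_of_abs_lt_dvd (hcop.dvd_of_dvd_mul_left h2) ?_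
  have hm : ∀ {a b c : ℤ}, |a| ≤ H → |b| ≤ H → |c| ≤ H → |a * (b * c)| ≤ H ^ 3 := by
    intro a b c ha hb hc
    rw [abs_mul, abs_mul]
    calc |a| * (|b| * |c|) ≤ H * (H * H) := by gcongr
      _ = _ := by ring
  have m1 := abs_le.1 (hm (hvH 0) (hwH 1) (hwH' 2))
  have m2 := abs_le.1 (hm (hvH 0) (hwH 2) (hwH' 1))
  have m3 := abs_le.1 (hm (hvH 1) (hwH 0) (hwH' 2))
  have m4 := abs_le.1 (hm (hvH 1) (hwH 2) (hwH' 0))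
  have m5 := abs_le.1 (hm (hvH 2) (hwH 0) (hwH' 1))
  have m6 := abs_le.1 (hm (hvH 2) (hwH 1) (hwH' 0))
  have hlt : 6 * (H : ℤ) ^ 3 < (p : ℤ) ^ 3 := by
    have h5 : (2 * H : ℤ) < p := by exact_mod_cast hH
    have h6 : (2 * H : ℤ) ^ 3 < (p : ℤ) ^ 3 := pow_lt_pow_left₀ h5 (by positivity) (by norm_num)
    have h7 : (0 : ℤ) ≤ (H : ℤ) ^ 3 := by positivity
    linarith
  rw [abs_lt, det3]
  constructor <;> linarith

theorem IsPrimVec.eq_or_eq_neg {n : ℕ} {v w : Fin n → ℤ} (hv : IsPrimVec v) (hw : IsPrimVec w)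
    {q : ℚ} (h : ∀ i, (w i : ℚ) = q * v i) : w = v ∨ w = -v := by
  obtain ⟨k, rfl⟩ := hv.exists_int_mul h
  have h1 : ∀ i, w i = k * v i := by exact_mod_cast h
  rcases Int.isUnit_iff.1 (hw.2 k fun i => ⟨v i, h1 i⟩) with rfl | rfl
  · left; funext i; rw [h1, one_mul]
  · right; funext i; rw [h1, Pi.neg_apply, neg_one_mul]

theorem card_le_two_of_proportional {n : ℕ} (W : Finset (Fin n → ℤ)) (hW : ∀ w ∈ W, IsPrimVec w)
    (h : ∀ v ∈ W, ∀ w ∈ W, ∃ q : ℚ, ∀ i, (w i : ℚ) = q * v i) : W.card ≤ 2 := by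
  classical
  rcases W.eq_empty_or_nonempty with rfl | ⟨v, hv⟩
  · simp
  refine (Finset.card_le_card (t := {v, -v}) fun w hw => ?_).trans Finset.card_le_two
  obtain ⟨q, hq⟩ := h v hv w hw
  rw [Finset.mem_insert, Finset.mem_singleton]
  exact (hW v hv).eq_or_eq_neg (hW w hw) hq

theorem linePoly_affine_ne_zero {K : Type*} [Field K] [Infinite K] {m : ℕ}
    {F : MvPolynomial (Fin 2) K} (hF : F.IsHomogeneous m) (h0 : F ≠ 0) :
    linePoly ![1, 0] ![0, 1] F ≠ 0 := by
  intro h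
  refine h0 ((mul_eq_zero.1 (?_ : X 0 * F = 0)).resolve_left (X_ne_zero 0))
  refine MvPolynomial.funext fun y => ?_
  rw [map_mul, eval_X, map_zero]
  rcases eq_or_ne (y 0) 0 with hy | hy
  · rw [hy, zero_mul]
  have h1 := eval_linePoly ![1, 0] ![0, 1] F (y 1 / y 0)
  rw [h, Polynomial.eval_zero] at h1
  have h2 : y = fun i => y 0 * ((![1, 0] : Fin 2 → K) i + y 1 / y 0 * (![0, 1] : Fin 2 → K) i) := by
    funext i
    fin_cases i
    · simp
    · simp [mul_div_cancel₀, hy]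
  rw [h2, eval_mul_of_isHomogeneous hF, ← h1, mul_zero, mul_zero]

/-- Primitive integral points of an irreducible plane projective curve on a line. -/
theorem card_collinear_le {F : MvPolynomial (Fin 3) ℤ} {d : ℕ} (hd : 2 ≤ d)
    (hF : F.IsHomogeneous d) (hlead : coeff (Finsupp.single 0 d) F ≠ 0)
    (hirr : Irreducible (map (Int.castRingHom ℚ) F)) {a : Fin 3 → ℤ} (ha : a ≠ 0)
    (W : Finset (Fin 3 → ℤ)) (hW : ∀ w ∈ W, IsPrimVec w) (h0 : ∀ w ∈ W, eval w F = 0)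
    (hlin : ∀ w ∈ W, ∑ i, a i * w i = 0) : W.card ≤ 2 * (d * (2 * d ^ 2 + 1)) := by
  classical
  have hd0 : 0 < d := by omega
  have hFd : F.totalDegree = d := hF.totalDegree (fun h => hlead (by rw [h, coeff_zero]))
  set g : MvPolynomial (Fin 3) ℤ := ∑ i, C (a i) * X i with hg
  have hgd : g.totalDegree ≤ 1 := totalDegree_finsetSum_le fun i _ =>
    (totalDegree_mul _ _).trans (by rw [totalDegree_C, zero_add, totalDegree_X])
  have hge : ∀ x, eval x g = ∑ i, a i * x i := fun x => by simp [hg]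
  have hg0 : g ≠ 0 := by
    intro h
    refine ha (funext fun i => ?_)
    have h1 := hge (Pi.single i 1)
    rw [h, map_zero] at h1
    simpa [Pi.single_apply] using h1.symm
  obtain ⟨R, hR, hRd, hRz⟩ := exists_eliminant hd0 hFd.le hlead hirr
    (not_dvd_of_totalDegree_lt (g := map (Int.castRingHom ℚ) g)
      (fun h => hg0 (map_rat_injective (h.trans (map_zero _).symm)))
      (by rw [totalDegree_map_rat, totalDegree_map_rat]; omega))
    (D := d) (by omega) ((degreeOf_le_totalDegree _ _).trans (by omega)) le_rfl
  set m := R.totalDegree with hm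
  set Q := map (Int.castRingHom ℚ) (homogeneousComponent m R) with hQ
  have hQh : Q.IsHomogeneous m := (homogeneousComponent_isHomogeneous m R).map _
  have hQ0 : Q ≠ 0 := fun h => homogeneousComponent_totalDegree_ne_zero hR
    (map_rat_injective (h.trans (map_zero _).symm))
  have hQw : ∀ w ∈ W, eval (Fin.tail fun i => (w i : ℚ)) Q = 0 := by
    intro w hw
    rw [show (Fin.tail fun i => (w i : ℚ)) = fun i => ((Fin.tail w i : ℤ) : ℚ) from rfl, eval_rat,
      eval_top_of_line (x := 0) (f := R) le_rfl fun t => ?_, Int.cast_zero]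
    have h1 : (fun i => (0 : Fin 2 → ℤ) i + t * Fin.tail w i) = Fin.tail fun i => t * w i := by
      funext i; simp [Fin.tail]
    rw [h1]
    refine hRz _ ?_ ?_
    · rw [eval_mul_of_isHomogeneous hF, h0 w hw, mul_zero]
    · rw [hge, ← mul_zero t, ← hlin w hw, Finset.mul_sum]
      exact Finset.sum_congr rfl fun i _ => by ring
  set ψ := linePoly ![1, 0] ![0, 1] Q with hψ
  have hψ0 : ψ ≠ 0 := linePoly_affine_ne_zero hQh hQ0
  have ht : ∀ w ∈ W, Fin.tail (fun i => (w i : ℚ)) ≠ 0 := by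
    intro w hw h
    have h1 : homogeneousComponent d F = F := by
      rw [homogeneousComponent_of_mem hF, if_pos rfl]
    refine tail_ne_zero_of_eval_top hlead (hW w hw).1 (by rw [h1, h0 w hw]) (funext fun i => ?_)
    have := congrFun h i
    exact Int.cast_injective (α := ℚ) (this.trans Int.cast_zero.symm)
  have hFQ := hF.map (Int.castRingHom ℚ)
  have himg : (W.image fun w => projNorm fun i => (w i : ℚ)).card ≤ d * (2 * d ^ 2 + 1) := by
    refine (card_zeros_le_mul_card_tail (h := map (Int.castRingHom ℚ) F) hFQ.totalDegree_le ?_ _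
      (fun y hy => ?_) (insert ![0, 1] (ψ.roots.toFinset.image fun y => ![1, y])) fun y hy => ?_).trans
      (Nat.mul_le_mul_left _ ((Finset.card_insert_le _ _).trans (Nat.succ_le_succ ?_)))
    · rw [coeff_map, eq_intCast]; exact_mod_cast hlead
    · obtain ⟨w, hw, rfl⟩ := Finset.mem_image.1 hy
      exact (eval_mul_of_isHomogeneous hFQ _ _).trans
        (by rw [eval_rat, h0 w hw, Int.cast_zero, mul_zero])
    · obtain ⟨w, hw, rfl⟩ := Finset.mem_image.1 hy
      rcases tail_projNorm (ht w hw) with ⟨y, h⟩ | h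
      · refine Finset.mem_insert_of_mem (Finset.mem_image.2 ⟨y, ?_, h.symm⟩)
        rw [Multiset.mem_toFinset, Polynomial.mem_roots hψ0, Polynomial.IsRoot, hψ, eval_linePoly]
        have h1 : (fun i => (![1, 0] : Fin 2 → ℚ) i + y * (![0, 1] : Fin 2 → ℚ) i) = ![1, y] := by
          funext i; fin_cases i <;> simp
        rw [h1, ← h]
        exact (eval_mul_of_isHomogeneous hQh (projScale fun i => (w i : ℚ)) _).trans
          (mul_eq_zero_of_right _ (hQw w hw))
      · rw [h]; exact Finset.mem_insert_self _ _
    · refine Finset.card_image_le.trans ((Multiset.toFinset_card_le _).trans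
        ((Polynomial.card_roots' _).trans ((natDegree_linePoly_le _ _ _).trans
        (hQh.totalDegree_le.trans (hRd.trans_eq (by ring))))))
  refine (Finset.card_le_mul_card_image (f := fun w : Fin 3 → ℤ => projNorm fun i => (w i : ℚ)) W 2
    fun y _ => ?_).trans (Nat.mul_le_mul_left _ himg)
  refine card_le_two_of_proportional _ (fun w hw => hW w (Finset.mem_filter.1 hw).1)
    fun v hv w hw => ?_
  rw [Finset.mem_filter] at hv hw
  obtain ⟨c, -, hc⟩ := exists_scale_of_projNorm_eq (ht v hv.1) (ht w hw.1) (hv.2.trans hw.2.symm)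
  exact ⟨c, hc⟩

theorem card_det3_class_le {F : MvPolynomial (Fin 3) ℤ} {d : ℕ} (hd : 2 ≤ d)
    (hF : F.IsHomogeneous d) (hlead : coeff (Finsupp.single 0 d) F ≠ 0)
    (hirr : Irreducible (map (Int.castRingHom ℚ) F)) (W : Finset (Fin 3 → ℤ))
    (hW : ∀ w ∈ W, IsPrimVec w) (h0 : ∀ w ∈ W, eval w F = 0)
    (hdet : ∀ u ∈ W, ∀ v ∈ W, ∀ w ∈ W, det3 u v w = 0) : W.card ≤ 2 * (d * (2 * d ^ 2 + 1)) := by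
  by_cases hc : ∃ v ∈ W, ∃ w ∈ W, (![v 1 * w 2 - v 2 * w 1, -(v 0 * w 2 - v 2 * w 0),
      v 0 * w 1 - v 1 * w 0] : Fin 3 → ℤ) ≠ 0
  · obtain ⟨v, hv, w, hw, hne⟩ := hc
    refine card_collinear_le hd hF hlead hirr hne W hW h0 fun u hu => ?_
    rw [← hdet u hu v hv w hw, det3, Fin.sum_univ_three]
    simp only [Matrix.cons_val]
    ring
  · push Not at hc
    refine (card_le_two_of_proportional W hW fun v hv w hw => ?_).trans ?_
    · obtain ⟨k, hk⟩ : ∃ k, v k ≠ 0 := by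
        by_contra! h
        exact (hW v hv).1 (funext h)
      have hkq : (v k : ℚ) ≠ 0 := by exact_mod_cast hk
      refine ⟨w k / v k, fun i => ?_⟩
      have h1 := hc v hv w hw
      have e0 : v 1 * w 2 - v 2 * w 1 = 0 := congrFun h1 0
      have e1 : -(v 0 * w 2 - v 2 * w 0) = 0 := congrFun h1 1
      have e2 : v 0 * w 1 - v 1 * w 0 = 0 := congrFun h1 2
      rw [div_mul_eq_mul_div, eq_div_iff hkq]
      have h2 : w i * v k = w k * v i := by
        fin_cases i <;> fin_cases k <;> simp only [Fin.zero_eta, Fin.mk_one, Fin.reduceFinMk] <;>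
          linarith
      exact_mod_cast h2
    · exact Nat.le_mul_of_pos_right _ (by positivity)

theorem card_directions_arith {l H X : ℕ} (hl : 1 ≤ l) (hH1 : 1 ≤ H) (hH : H ≤ 2 ^ (l + 2))
    (hX : X = 2 * H + 400 * l + 2) : 8 * X * (Nat.log 2 X + 1) ≤ 35552 * l ^ 2 * H := by
  have h1 : X ≤ 404 * l * H := by
    have h2 : 1 ≤ l * H := Nat.mul_pos hl hH1
    have h3 : l ≤ l * H := Nat.le_mul_of_pos_right _ hH1
    have h4 : H ≤ l * H := Nat.le_mul_of_pos_left _ hl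
    rw [mul_assoc]
    omega
  have h2 : Nat.log 2 X < l + 10 := by
    refine Nat.log_lt_of_lt_pow (by omega) ?_
    have h3 : l < 2 ^ l := Nat.lt_two_pow_self
    rw [pow_add] at hH ⊢
    omega
  calc 8 * X * (Nat.log 2 X + 1) ≤ 8 * (404 * l * H) * (11 * l) := by gcongr; omega
    _ = _ := by ring

theorem card_directions_le {F : MvPolynomial (Fin 3) ℤ} {d l H : ℕ} (hd34 : d = 3 ∨ d = 4)
    (hF : F.IsHomogeneous d) (hlead : coeff (Finsupp.single 0 d) F ≠ 0)
    (hirr : Irreducible (map (Int.castRingHom ℚ) F)) (hht : ∀ α, (coeff α F).natAbs ≤ 2 ^ (350 * l))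
    (hl : 1 ≤ l) (hH1 : 1 ≤ H) (hH : H ≤ 2 ^ (l + 2)) (V : Finset (Fin 3 → ℤ))
    (hV : ∀ v ∈ V, IsPrimVec v ∧ eval v F = 0 ∧ ∀ i, |v i| ≤ H) : V.card ≤ 2 ^ 38 * l ^ 3 * H := by
  classical
  have hd : F.totalDegree = d := hF.totalDegree (by rintro rfl; simp at hlead)
  have hd2 : 2 ≤ d := by omega
  have hd4 : d ≤ 4 := by omega
  have hs := card_singular_box_zeros_le (n := 1) (by omega) hd hlead hirr
    (V.filter fun v => eval v (pderiv 0 F) = 0) (b := H) fun v hv => by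
      rw [Finset.mem_filter] at hv
      exact ⟨(hV v hv.1).2.1, hv.2, (hV v hv.1).2.2⟩
  obtain ⟨S, hSK, hS⟩ := exists_primes (2 * H) (400 * l)
  have hn := card_le_of_not_dvd (V.filter fun v => ¬ eval v (pderiv 0 F) = 0)
    (fun v => eval v (pderiv 0 F)) (S := S) (B := 264 * (4 * (35552 * l ^ 2 * H + 1)))
    (fun p hp => (hS p hp).1) (fun v hv => (Finset.mem_filter.1 hv).2) (fun v hv => ?_)
    (fun p hp => ?_)
  · refine (Finset.card_filter_add_card_filter_not (s := V) _).symm.trans_le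
      ((add_le_add hs hn).trans ?_)
    have h1 : 2 * d ^ 3 * (2 * H + 1) ^ 1 ≤ 2 * 4 ^ 3 * (2 * H + H) := by rw [pow_one]; gcongr
    have h2 : H ≤ l ^ 3 * H := Nat.le_mul_of_pos_left _ (by positivity)
    have h3 : l ≤ l ^ 3 * H := (Nat.le_self_pow (by norm_num) l).trans
      (Nat.le_mul_of_pos_right _ hH1)
    have h4 : 400 * l * (264 * (4 * (35552 * l ^ 2 * H + 1))) =
      400 * 264 * 4 * 35552 * (l ^ 3 * H) + 400 * 264 * 4 * l := by ring
    rw [hSK, h4, mul_assoc (2 ^ 38)]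
    refine (Nat.add_le_add_right h1 _).trans ?_
    omega
  · have h35 : (expLE 3 4).card = 35 := by have := six_mul_card_expLE_three 4; omega
    rw [Finset.mem_filter] at hv
    have := abs_eval_le (pderiv 0 F) 4 _ H hH1 ((totalDegree_pderiv_le 0 F).trans (by omega))
      (natAbs_coeff_pderiv_le 0 F _ hht) v (hV v hv.1).2.2
    rw [hSK]
    refine this.trans_lt ?_
    calc _ ≤ 2 ^ 6 * (2 ^ 2 * 2 ^ (350 * l) * (2 ^ (l + 2)) ^ 4) := by
          rw [h35, hd]; gcongr <;> omega
      _ = 2 ^ (354 * l + 16) := by ring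
      _ < _ := Nat.pow_lt_pow_right (by norm_num) (by omega)
  · obtain ⟨hpp, hHp, hpY⟩ := hS p hp
    haveI := Fact.mk hpp
    set W := (V.filter fun v => ¬ eval v (pderiv 0 F) = 0).filter
      fun x => ¬ (p : ℤ) ∣ eval x (pderiv 0 F) with hW
    have hWV : ∀ v ∈ W, v ∈ V ∧ ¬ (p : ℤ) ∣ eval v (pderiv 0 F) := fun v hv => by
      rw [hW, Finset.mem_filter, Finset.mem_filter] at hv
      exact ⟨hv.1.1, hv.2⟩
    obtain ⟨h1, h2⟩ := card_image_projNorm_le (p := p) hd2 hF W (fun v hv => (hV v (hWV v hv).1).2.1)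
      fun v hv => (hWV v hv).2
    refine (Finset.card_le_mul_card_image W 264 fun y hy => ?_).trans
      (Nat.mul_le_mul_left _ (h1.trans (Nat.mul_le_mul hd4 (Nat.succ_le_succ
        (hpY.trans (card_directions_arith hl hH1 hH rfl))))))
    have hyV : ∀ v ∈ W.filter fun x => projNorm (fun i => (x i : ZMod p)) = y, v ∈ V := fun v hv =>
      (hWV v (Finset.mem_filter.1 hv).1).1
    refine (card_det3_class_le hd2 hF hlead hirr _ (fun w hw => (hV w (hyV w hw)).1)
      (fun w hw => (hV w (hyV w hw)).2.1) fun u hu v hv w hw => ?_).trans ?_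
    · have h0 := fun v hv => (hV v (hyV v hv)).2
      rw [Finset.mem_filter] at hu hv hw
      obtain ⟨c, u', hc, hu'⟩ := h2 u hu.1 v hv.1 (hu.2.trans hv.2.symm)
      obtain ⟨c', u'', hc', hu''⟩ := h2 u hu.1 w hw.1 (hu.2.trans hw.2.symm)
      have hm : ∀ v ∈ W, eval v F = 0 ∧ ∀ i, |v i| ≤ H := fun v hv => (hV v (hWV v hv).1).2
      exact det3_eq_zero hF (hm u hu.1).1 (hm v hv.1).1 (hm w hw.1).1 (hWV u hu.1).2 hHp
        (hm u hu.1).2 (hm v hv.1).2 (hm w hw.1).2 hc hc' hu' hu''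
    · calc 2 * (d * (2 * d ^ 2 + 1)) ≤ 2 * (4 * (2 * 4 ^ 2 + 1)) := by gcongr
        _ = 264 := by norm_num

theorem exists_dyadic_line {n : ℕ} {f : MvPolynomial (Fin (n + 1)) ℤ} {b l : ℕ} (hbl : b ≤ 2 ^ l)
    {x w : Fin (n + 1) → ℤ} (hw : w ≠ 0) (hwb : ∀ i, |w i| ≤ 2 * b)
    (h : ∀ t : ℤ, eval (fun i => x i + t * w i) f = 0) :
    ∃ (v : Fin (n + 1) → ℤ) (k : Fin (n + 1)) (j : ℕ), IsPrimVec v ∧ j < l + 2 ∧ 2 ^ j ≤ 2 * b ∧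
      ((2 ^ j : ℕ) : ℤ) ≤ |v k| ∧ (∀ i, |v i| ≤ ((2 ^ (j + 1) : ℕ) : ℤ)) ∧
      ∀ t : ℤ, eval (fun i => x i + t * v i) f = 0 := by
  obtain ⟨v, g, hv, hg, hvw⟩ := exists_isPrimVec hw
  obtain ⟨k, hk⟩ := Finite.exists_max fun i => |v i|
  have hk0 : (v k).natAbs ≠ 0 := fun h0 => hv.1 (funext fun i => by
    have := hk i
    rw [Int.natAbs_eq_zero.1 h0, abs_zero] at this
    exact abs_nonpos_iff.1 this)
  have hvb : (v k).natAbs ≤ 2 * b := by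
    have h1 := hwb k
    rw [hvw, Int.abs_eq_natAbs, Int.natAbs_mul] at h1
    exact (Nat.le_mul_of_pos_left _ (Int.natAbs_pos.2 hg)).trans (by exact_mod_cast h1)
  have hj := Nat.pow_log_le_self 2 hk0
  refine ⟨v, k, Nat.log 2 (v k).natAbs, hv, ?_, hj.trans hvb, ?_, fun i => (hk i).trans ?_,
    fun t => ?_⟩
  · refine Nat.log_lt_of_lt_pow hk0 (hvb.trans_lt ?_)
    have := Nat.two_pow_pos l
    rw [pow_add]
    omega
  · rw [Int.abs_eq_natAbs]; exact_mod_cast hj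
  · rw [Int.abs_eq_natAbs]; exact_mod_cast (Nat.lt_pow_succ_log_self one_lt_two _).le
  · have h1 := eval_rat_of_line h (t / g)
    have hg' : (g : ℚ) ≠ 0 := by exact_mod_cast hg
    have h2 : (fun i => (x i : ℚ) + (t : ℚ) / g * (w i : ℚ)) =
        fun i => ((x i + t * v i : ℤ) : ℚ) := by
      funext i
      rw [hvw]
      push_cast
      field_simp
    rw [h2, eval_rat (fun i => x i + t * v i)] at h1
    exact_mod_cast h1

theorem card_lineal_le {f : MvPolynomial (Fin 3) ℤ} {d b l : ℕ} (hd34 : d = 3 ∨ d = 4)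
    (hd : f.totalDegree = d) (hirr : Irreducible (map (Int.castRingHom ℚ) f))
    (hlead : coeff (Finsupp.single 0 d) f ≠ 0) (hht : ∀ α, (coeff α f).natAbs ≤ 2 ^ (350 * l))
    (htop : Irreducible (map (Int.castRingHom ℚ) (homogeneousComponent d f)))
    (hncc : ∀ v : Fin 3 → ℤ, v ≠ 0 → dirDeriv v f ≠ 0) (hl : 1 ≤ l) (hbl : b ≤ 2 ^ l)
    (Z : Finset (Fin 3 → ℤ)) (hZ : ∀ x ∈ Z, (∀ i, |x i| ≤ b) ∧
      ∃ v : Fin 3 → ℤ, v ≠ 0 ∧ (∀ i, |v i| ≤ 2 * b) ∧ ∀ t : ℤ, eval (fun i => x i + t * v i) f = 0) :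
    Z.card ≤ 2 ^ 50 * l ^ 4 * b := by
  classical
  have h := fun x : Z => exists_dyadic_line hbl (hZ x x.2).2.choose_spec.1
    (hZ x x.2).2.choose_spec.2.1 (hZ x x.2).2.choose_spec.2.2
  choose v k j hv hj hjb hk hvj hline using h
  have hfib : ∀ i ∈ (Finset.univ.image j), (Finset.univ.filter fun x => j x = i).card ≤
      2 ^ 48 * l ^ 3 * b := by
    intro i hi
    obtain ⟨x₀, -, hx₀⟩ := Finset.mem_image.1 hi
    set W := Finset.univ.filter fun x => j x = i with hW
    have hWj : ∀ x ∈ W, j x = i := fun x hx => (Finset.mem_filter.1 hx).2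
    have hc := Finset.card_le_mul_card_image (f := v) W ((2 * b / 2 ^ i + 1) * (2 * d ^ 3))
      fun u hu => by
        obtain ⟨x, hx, rfl⟩ := Finset.mem_image.1 hu
        rw [← Finset.card_map (Function.Embedding.subtype _)]
        refine card_direction_le (by omega) hd hirr hlead (hv x) (hncc _ (hv x).1)
          Nat.one_le_two_pow (hWj x hx ▸ hk x) _ (fun y hy => ?_) fun y hy => ?_
        all_goals
          obtain ⟨z, hz, rfl⟩ := Finset.mem_map.1 hy
        · exact (hZ z z.2).1
        · rw [← (Finset.mem_filter.1 hz).2]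
          exact hline z
    have hi2 : 2 ^ i ≤ 2 * b := hx₀ ▸ hjb x₀
    have hV := card_directions_le hd34 (homogeneousComponent_isHomogeneous d f)
      (by rwa [coeff_homogeneousComponent_single]) htop (l := l) (H := 2 ^ (i + 1)) (fun α => by
        rw [coeff_homogeneousComponent]
        split_ifs
        · exact hht α
        · simp) hl Nat.one_le_two_pow
      (Nat.pow_le_pow_right two_pos (by have := hj x₀; omega)) (W.image v) fun u hu => by
        obtain ⟨x, hx, rfl⟩ := Finset.mem_image.1 hu
        exact ⟨hv x, eval_top_of_line hd.le (hline x), hWj x hx ▸ hvj x⟩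
    have hq : (2 * b / 2 ^ i + 1) * 2 ^ i ≤ 4 * b := by
      rw [add_mul, one_mul]
      have := Nat.div_mul_le_self (2 * b) (2 ^ i)
      omega
    calc _ ≤ _ := hc
      _ ≤ ((2 * b / 2 ^ i + 1) * (2 * 4 ^ 3)) * (2 ^ 38 * l ^ 3 * 2 ^ (i + 1)) := by
        gcongr; omega
      _ = 2 ^ 46 * l ^ 3 * ((2 * b / 2 ^ i + 1) * 2 ^ i) := by ring
      _ ≤ 2 ^ 46 * l ^ 3 * (4 * b) := by gcongr
      _ = _ := by ring
  have h1 := Finset.card_le_mul_card_image (f := j) Finset.univ _ hfib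
  have h2 : (Finset.univ.image j).card ≤ 4 * l := by
    refine (Finset.card_le_card (t := Finset.range (l + 2)) fun i hi => ?_).trans ?_
    · obtain ⟨x, -, rfl⟩ := Finset.mem_image.1 hi
      exact Finset.mem_range.2 (hj x)
    · rw [Finset.card_range]; omega
  rw [Finset.card_univ, Fintype.card_coe] at h1
  calc _ ≤ _ := h1
    _ ≤ 2 ^ 48 * l ^ 3 * b * (4 * l) := by gcongr
    _ = _ := by ring

theorem irreducible_of_rIrreducible {n d : ℕ} {F : MvPolynomial (Fin n) ℚ} (hd34 : d = 3 ∨ d = 4)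
    (hF : F.totalDegree = d) (h : RIrreducible 2 F) : Irreducible F := by
  refine ⟨fun hu => ?_, fun p q hpq => ?_⟩
  · have := (isUnit_iff_totalDegree_of_isReduced.1 hu).2
    omega
  · have h0 : p * q ≠ 0 := by
      rw [← hpq]; rintro rfl; rw [totalDegree_zero] at hF; omega
    have h1 := totalDegree_mul_of_isDomain (left_ne_zero_of_mul h0) (right_ne_zero_of_mul h0)
    rw [← hpq] at h1
    rcases le_or_gt p.totalDegree 2 with h2 | h2
    · exact Or.inl (h p ⟨q, hpq⟩ h2)
    · exact Or.inr (h q ⟨p, by rw [hpq, mul_comm]⟩ (by omega))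

/-- No nonzero translation direction leaves the polynomial function invariant. -/
def Aperiodic {n : ℕ} (p : MvPolynomial (Fin n) ℚ) : Prop :=
  ∀ v : Fin n → ℚ, (∀ (x : Fin n → ℚ) (t : ℚ), eval (fun i => x i + t * v i) p = eval x p) → v = 0

theorem aperiodic_of_isNCC {p : MvPolynomial (Fin 3) ℚ} (h : IsNCC p) : Aperiodic p := by
  intro v hv
  by_contra hne
  obtain ⟨k, hk⟩ := Function.ne_iff.1 hne
  rw [Pi.zero_apply] at hk
  let c : Fin 2 → Fin 3 → ℚ := fun j =>
    Pi.single (k.succAbove j) 1 - Pi.single k (v (k.succAbove j) / v k)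
  have hform : ∀ (j : Fin 2) (x : Fin 3 → ℚ), eval x (linForm (c j)) =
      x (k.succAbove j) + -(x k / v k) * v (k.succAbove j) := by
    intro j x
    simp only [c, linForm, map_sum, eval_mul, eval_C, eval_X, Pi.sub_apply, sub_mul,
      Finset.sum_sub_distrib, Pi.single_apply, ite_mul, zero_mul, Finset.sum_ite_eq',
      Finset.mem_univ, if_true]
    ring
  refine h ⟨c 0, c 1, aeval (k.insertNth 0 ![X 0, X 1] : Fin 3 → MvPolynomial (Fin 2) ℚ) p,
    MvPolynomial.funext fun x => ?_⟩
  rw [eval_aeval, eval_aeval, ← hv x (-(x k / v k))]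
  congr 2
  funext i
  revert i
  rw [Fin.forall_iff_succAbove k]
  refine ⟨?_, fun j => ?_⟩
  · rw [Fin.insertNth_apply_same, map_zero]
    field_simp
    ring
  · rw [Fin.insertNth_apply_succAbove, ← hform]
    fin_cases j <;> simp

theorem Aperiodic.C_mul {n : ℕ} {p : MvPolynomial (Fin n) ℚ} (h : Aperiodic p) {r : ℚ} (hr : r ≠ 0) :
    Aperiodic (C r * p) := fun v hv => h v fun x t => by
  have := hv x t
  rwa [eval_mul, eval_mul, eval_C, eval_C, mul_right_inj' hr] at this

theorem Aperiodic.shear {n : ℕ} {p : MvPolynomial (Fin (n + 1)) ℚ} (h : Aperiodic p)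
    (a : Fin n → ℚ) : Aperiodic (shear a p) := by
  intro v hv
  have h1 := h (Fin.cons (v 0) fun i => v i.succ + a i * v 0) fun y t => by
    have h2 := hv (Fin.cons (y 0) fun i => y i.succ - a i * y 0) t
    rw [eval_shear, eval_shear] at h2
    refine (congrArg (fun z => eval z p) ?_).trans (h2.trans (congrArg (fun z => eval z p) ?_))
    all_goals
      funext i
      refine Fin.cases ?_ (fun j => ?_) i <;> simp
    ring
  have h0 : v 0 = 0 := congrFun h1 0
  funext i
  refine Fin.cases h0 (fun j => ?_) i
  simpa [h0] using congrFun h1 j.succ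

theorem Aperiodic.dirDeriv_ne_zero {n : ℕ} {f : MvPolynomial (Fin n) ℤ}
    (h : Aperiodic (map (Int.castRingHom ℚ) f)) {v : Fin n → ℤ} (hv : v ≠ 0) :
    dirDeriv v f ≠ 0 := by
  intro h0
  refine hv (funext fun i => ?_)
  have h1 : dirDeriv (fun i => (v i : ℚ)) (map (Int.castRingHom ℚ) f) = 0 := by
    rw [← map_zero (map (Int.castRingHom ℚ)), ← h0]
    simp [dirDeriv, pderiv_map]
  have h2 := h (fun i => (v i : ℚ)) fun x t => by
    have h3 := Polynomial.natDegree_eq_zero_of_derivative_eq_zero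
      ((derivative_linePoly x (fun i => (v i : ℚ)) (map (Int.castRingHom ℚ) f)).trans
        (by rw [h1, map_zero]))
    rw [← eval_linePoly, Polynomial.eq_C_of_natDegree_eq_zero h3, Polynomial.eval_C,
      Polynomial.coeff_zero_eq_eval_zero, eval_linePoly]
    simp
  exact Int.cast_eq_zero.1 (congrFun h2 i)

/-- The bound for the number of zeros in terms of the degree of an auxiliary polynomial. -/
def zeroBound (b l D : ℕ) : ℕ := 2 ^ 224 * l ^ 29 * (D * (Nat.sqrt b + 1 + D) + b)

theorem exists_card_zeros_le_of_height : ∃ C : ℝ, 0 ≤ C ∧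
    ∀ {f : MvPolynomial (Fin 3) ℤ} {d b l D : ℕ}, (d = 3 ∨ d = 4) → f.totalDegree = d →
    Irreducible (map (Int.castRingHom ℚ) f) → coeff (Finsupp.single 0 d) f ≠ 0 →
    (∀ α, (coeff α f).natAbs ≤ 2 ^ (350 * l)) →
    Irreducible (map (Int.castRingHom ℚ) (homogeneousComponent d f)) →
    Aperiodic (map (Int.castRingHom ℚ) f) →
    1 ≤ l → 1 ≤ b → b ≤ 2 ^ l → 4 ≤ D → l ≤ D →
    Real.log b + C * (1 + Real.log l) < Real.sqrt d * Real.log D →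
    ∀ Z : Finset (Fin 3 → ℤ), (∀ x ∈ Z, eval x f = 0 ∧ ∀ i, |x i| ≤ b) →
      Z.card ≤ zeroBound b l D := by
  classical
  obtain ⟨C, hC, haux⟩ := exists_surface_aux
  refine ⟨C, hC, fun {f d b l D} hd34 hd hirr hlead hht htop hap hl hb hbl hD hlD hlt Z hZ => ?_⟩
  have hd4 : d ≤ 4 := by omega
  have hs := card_singular_box_zeros_le (n := 1) (by omega) hd hlead hirr
    (Z.filter fun v => eval v (pderiv 0 f) = 0) (b := b) fun v hv => by
      rw [Finset.mem_filter] at hv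
      exact ⟨(hZ v hv.1).1, hv.2, (hZ v hv.1).2⟩
  set Λ := Z.filter fun v => ¬ eval v (pderiv 0 f) = 0 with hΛ
  have hΛZ : ∀ x ∈ Λ, x ∈ Z := fun x hx => (Finset.mem_filter.1 hx).1
  obtain ⟨g, hg0, hg, hgΛ⟩ := haux hd34 hd hirr hlead hht hl hb hbl (by omega) hlD hlt Λ
    fun x hx => ⟨(hZ x (hΛZ x hx)).1, (Finset.mem_filter.1 hx).2, (hZ x (hΛZ x hx)).2⟩
  have h1 := card_lineal_le hd34 hd hirr hlead hht htop (fun v => hap.dirDeriv_ne_zero) hl hbl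
    (Λ.filter fun x => ∃ v : Fin 3 → ℤ, v ≠ 0 ∧ (∀ i, |v i| ≤ 2 * b) ∧
      ∀ t : ℤ, eval (fun i => x i + t * v i) f = 0) fun x hx => by
      rw [Finset.mem_filter] at hx
      exact ⟨(hZ x (hΛZ x hx.1)).2, hx.2⟩
  have h2 := card_nonlineal_le hd34 hd hirr hlead hl hb hbl (hd4.trans hD) hg0 hg
    (Λ.filter fun x => ¬ ∃ v : Fin 3 → ℤ, v ≠ 0 ∧ (∀ i, |v i| ≤ 2 * b) ∧
      ∀ t : ℤ, eval (fun i => x i + t * v i) f = 0) (fun x hx => by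
      have hx := (Finset.mem_filter.1 hx).1
      exact ⟨(hZ x (hΛZ x hx)).1, hgΛ x hx, (hZ x (hΛZ x hx)).2⟩) fun x hx v hv hvb => by
      by_contra! hno
      exact (Finset.mem_filter.1 hx).2 ⟨v, hv, hvb, hno⟩
  have h3 := (Finset.card_filter_add_card_filter_not (s := Λ) _).symm.trans_le (add_le_add h1 h2)
  refine (Finset.card_filter_add_card_filter_not (s := Z) _).symm.trans_le
    ((add_le_add hs h3).trans ?_)
  have h4 : 2 * d ^ 3 * (2 * b + 1) ^ 1 ≤ 2 * 4 ^ 3 * (2 * b + b) := by rw [pow_one]; gcongr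
  have h5 : b ≤ l ^ 29 * b := Nat.le_mul_of_pos_left _ (by positivity)
  have h6 : l ^ 4 * b ≤ l ^ 29 * b := by gcongr; norm_num
  have h7 : 8 * D * (2 ^ 220 * l ^ 28 * (l * (Nat.sqrt b + 1) + D)) ≤
      2 ^ 223 * (l ^ 29 * (D * (Nat.sqrt b + 1 + D))) := by
    calc _ ≤ 8 * D * (2 ^ 220 * l ^ 28 * (l * (Nat.sqrt b + 1) + l * D)) := by
          gcongr; exact Nat.le_mul_of_pos_left _ hl
      _ = _ := by ring
  have h8 : zeroBound b l D = 2 ^ 224 * (l ^ 29 * (D * (Nat.sqrt b + 1 + D))) +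
    2 ^ 224 * (l ^ 29 * b) := by rw [zeroBound]; ring
  rw [h8, mul_assoc (2 ^ 50)]
  refine (add_le_add h4 (add_le_add_right h7 _)).trans ?_
  generalize l ^ 29 * (D * (Nat.sqrt b + 1 + D)) = u at *
  omega

theorem exists_card_zeros_le : ∃ C : ℝ, 0 ≤ C ∧
    ∀ {f : MvPolynomial (Fin 3) ℤ} {d b l D : ℕ}, (d = 3 ∨ d = 4) → f.totalDegree = d →
    Irreducible (map (Int.castRingHom ℚ) f) → coeff (Finsupp.single 0 d) f ≠ 0 →
    Irreducible (map (Int.castRingHom ℚ) (homogeneousComponent d f)) →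
    Aperiodic (map (Int.castRingHom ℚ) f) →
    1 ≤ l → 1 ≤ b → b ≤ 2 ^ l → 4 ≤ D → l ≤ D →
    Real.log b + C * (1 + Real.log l) < Real.sqrt d * Real.log D →
    ∀ Z : Finset (Fin 3 → ℤ), (∀ x ∈ Z, eval x f = 0 ∧ ∀ i, |x i| ≤ b) →
      Z.card ≤ zeroBound b l D := by
  obtain ⟨C, hC, hcard⟩ := exists_card_zeros_le_of_height
  refine ⟨C, hC, fun {f d b l D} hd34 hd hirr hlead htop hap hl hb hbl hD hlD hlt Z hZ => ?_⟩
  have hd4 : d ≤ 4 := by omega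
  have h0 : f ≠ 0 := by rintro rfl; simp at hlead
  obtain ⟨f', h0', hd', hZ', hH⟩ := exists_small_vanishing hb h0 hd.le Z hZ
  by_cases hdvd : map (Int.castRingHom ℚ) f ∣ map (Int.castRingHom ℚ) f'
  · obtain ⟨r, hr, h⟩ := eq_C_mul_of_dvd hd hd' h0' hdvd
    refine hcard hd34 ?_ (irreducible_of_eq_C_mul hr hirr h) (fun hz => ?_) (fun α => ?_)
      (irreducible_of_eq_C_mul hr htop ?_) (h ▸ hap.C_mul hr) hl hb hbl hD hlD hlt Z
      fun x hx => ⟨hZ' x hx, (hZ x hx).2⟩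
    · rw [← totalDegree_map_rat, h, totalDegree_mul_of_isDomain (by simpa using hr) hirr.ne_zero,
        totalDegree_C, zero_add, totalDegree_map_rat, hd]
    · have h1 := congrArg (coeff (Finsupp.single 0 d)) h
      rw [coeff_C_mul, coeff_map, coeff_map, hz] at h1
      simp [hr, hlead] at h1
    · have hexp : (expLE 3 d).card ≤ 35 := by
        have := six_mul_card_expLE_three d
        rcases hd34 with rfl | rfl <;> omega
      refine (hH α).trans ?_
      calc _ ≤ (2 ^ 6 * (2 ^ l) ^ 4) ^ 35 := by
            refine (Nat.pow_le_pow_left (Nat.mul_le_mul (hexp.trans (by norm_num))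
              ((Nat.pow_le_pow_left hbl d).trans
                (Nat.pow_le_pow_right (Nat.two_pow_pos l) hd4))) _).trans
              (Nat.pow_le_pow_right (by positivity) hexp)
        _ = 2 ^ (210 + 140 * l) := by ring
        _ ≤ _ := Nat.pow_le_pow_right two_pos (by omega)
    · ext α
      have h1 := congrArg (coeff α) h
      rw [coeff_C_mul, coeff_map, coeff_map] at h1 ⊢
      rw [coeff_homogeneousComponent, coeff_homogeneousComponent]
      split_ifs
      · exact h1
      · simp
  · refine (card_common_box_zeros_le (n := 1) (by omega) hd.le hlead hirr hdvd hd'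
      ((degreeOf_le_totalDegree _ _).trans hd') le_rfl Z
      fun x hx => ⟨(hZ x hx).1, hZ' x hx, (hZ x hx).2⟩).trans ?_
    calc d * (2 * d * d * (2 * b + 1) ^ 1) ≤ 4 * (2 * 4 * 4 * (2 * b + b) ^ 1) := by gcongr
      _ = 384 * 1 * b := by ring
      _ ≤ 2 ^ 224 * l ^ 29 * (D * (Nat.sqrt b + 1 + D) + b) := by
        gcongr
        · norm_num
        · exact Nat.one_le_pow _ _ hl
        · exact Nat.le_add_left _ _

theorem exists_degree_zeroBound_le {C : ℝ} (hC : 0 ≤ C) {d b l : ℕ} (hd34 : d = 3 ∨ d = 4)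
    (hb : 1 ≤ b) (hl : 1 ≤ l) : ∃ D : ℕ, 4 ≤ D ∧ l ≤ D ∧
      Real.log b + C * (1 + Real.log l) < Real.sqrt d * Real.log D ∧
      (zeroBound b l D : ℝ) ≤
        2 ^ 226 * (Real.exp C + 5) ^ 2 * l ^ (31 + 2 * ⌈C⌉₊) * (b : ℝ) ^ (2 / Real.sqrt d) := by
  have hb' : (1 : ℝ) ≤ b := by exact_mod_cast hb
  have hb0 : (0 : ℝ) < b := by linarith
  have hl' : (1 : ℝ) ≤ l := by exact_mod_cast hl
  have hs0 : 0 < Real.sqrt d := Real.sqrt_pos.2 (by rcases hd34 with rfl | rfl <;> norm_num)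
  have hs1 : 1 ≤ Real.sqrt d := by
    rw [Real.one_le_sqrt]; rcases hd34 with rfl | rfl <;> norm_num
  have hs2 : Real.sqrt d ≤ 2 := by
    rw [Real.sqrt_le_left two_pos.le]; rcases hd34 with rfl | rfl <;> norm_num
  set E := Real.log b + C * (1 + Real.log l) with hE
  set y := (b : ℝ) ^ (1 / Real.sqrt d) with hy
  set w := (l : ℝ) ^ (⌈C⌉₊ + 1) with hw
  set A := Real.exp C + 5 with hA
  have hyy : y ^ 2 = (b : ℝ) ^ (2 / Real.sqrt d) := by
    rw [hy, ← Real.rpow_natCast, ← Real.rpow_mul hb0.le]; congr 1; push_cast; ring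
  have hy1 : 1 ≤ y := Real.one_le_rpow hb' (by positivity)
  have hw1 : 1 ≤ w := one_le_pow₀ hl'
  have hA1 : 1 ≤ A := by have := Real.exp_pos C; linarith
  have hexp : Real.exp (E / Real.sqrt d) ≤ Real.exp C * (l : ℝ) ^ ⌈C⌉₊ * y := by
    have h1 : E / Real.sqrt d ≤ C + Real.log l * ⌈C⌉₊ + Real.log b * (1 / Real.sqrt d) := by
      have h2 : C * (1 + Real.log l) / Real.sqrt d ≤ C * (1 + Real.log l) :=
        div_le_self (by have := Real.log_nonneg hl'; positivity) hs1
      have h3 := mul_le_mul_of_nonneg_left (Nat.le_ceil C) (Real.log_nonneg hl')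
      rw [hE, add_div, div_eq_mul_one_div (Real.log b)]
      linarith
    refine (Real.exp_le_exp.2 h1).trans_eq ?_
    rw [Real.exp_add, Real.exp_add, ← Real.rpow_def_of_pos hb0, ← Real.rpow_natCast,
      Real.rpow_def_of_pos (by linarith : (0 : ℝ) < l)]
  set D := ⌊Real.exp (E / Real.sqrt d)⌋₊ + l + 4 with hD
  have hD1 : Real.exp (E / Real.sqrt d) < D := by
    refine (Nat.lt_floor_add_one _).trans_le ?_
    exact_mod_cast (by omega : _ + 1 ≤ D)
  have hDA : (D : ℝ) ≤ A * w * y := by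
    have h1 := Nat.floor_le (Real.exp_pos (E / Real.sqrt d)).le
    have h2 : (l : ℝ) ^ ⌈C⌉₊ ≤ w := pow_le_pow_right₀ hl' (Nat.le_succ _)
    have h3 : (l : ℝ) ≤ w := le_self_pow₀ hl' (Nat.succ_ne_zero _)
    have h4 : w ≤ w * y := le_mul_of_one_le_right (by positivity) hy1
    have h5 : Real.exp C * (l : ℝ) ^ ⌈C⌉₊ * y ≤ Real.exp C * w * y := by gcongr
    rw [hD]
    push_cast
    rw [hA, add_mul, add_mul]
    linarith
  refine ⟨D, by omega, by omega, ?_, ?_⟩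
  · rw [← div_lt_iff₀' hs0]
    exact (Real.lt_log_iff_exp_lt ((Real.exp_pos _).trans hD1)).2 hD1
  · have hsq : (Nat.sqrt b : ℝ) ≤ y := Real.nat_sqrt_le_real_sqrt.trans (by
      rw [Real.sqrt_eq_rpow, hy]
      exact Real.rpow_le_rpow_of_exponent_le hb' (one_div_le_one_div_of_le hs0 hs2))
    have hby : (b : ℝ) ≤ y ^ 2 := by
      rw [hyy]
      conv_lhs => rw [← Real.rpow_one (b : ℝ)]
      exact Real.rpow_le_rpow_of_exponent_le hb' ((one_le_div hs0).2 hs2)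
    have hAw : 1 ≤ A * w := one_le_mul_of_one_le_of_one_le hA1 hw1
    have hz : y ≤ A * w * y := le_mul_of_one_le_left (by positivity) hAw
    have h1 : (Nat.sqrt b : ℝ) + 1 + D ≤ 3 * (A * w * y) := by linarith
    rw [← hyy, zeroBound]
    simp only [Nat.cast_mul, Nat.cast_add, Nat.cast_pow, Nat.cast_ofNat, Nat.cast_one]
    calc _ ≤ 2 ^ 224 * (l : ℝ) ^ 29 * (A * w * y * (3 * (A * w * y)) + (A * w * y) ^ 2) := by
          gcongr
          exact hby.trans (by gcongr)
      _ = 2 ^ 226 * A ^ 2 * ((l : ℝ) ^ 29 * w ^ 2) * y ^ 2 := by ring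
      _ = _ := by rw [hw]; ring

theorem exists_Naff_le : ∃ (c : ℝ) (κ : ℕ), ∀ (f : MvPolynomial (Fin 3) ℤ) (d : ℕ),
    f.totalDegree = d → (d = 3 ∨ d = 4) → Irreducible (map (Int.castRingHom ℚ) f) →
    IsNCC (map (Int.castRingHom ℚ) f) →
    RIrreducible 2 (map (Int.castRingHom ℚ) (homogeneousComponent d f)) →
    ∀ B : ℝ, 2 ≤ B → (Naff f B : ℝ) ≤ c * Real.log B ^ κ * B ^ (2 / Real.sqrt d) := by
  classical
  obtain ⟨C, hC, hcard⟩ := exists_card_zeros_le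
  refine ⟨2 ^ 226 * (Real.exp C + 5) ^ 2 * 8 ^ (31 + 2 * ⌈C⌉₊) * 25, 31 + 2 * ⌈C⌉₊,
    fun f d hd hd34 hirr hncc htop B hB => ?_⟩
  have hf0 : f ≠ 0 := by rintro rfl; simp at hirr
  have htop0 : homogeneousComponent d f ≠ 0 := hd ▸ homogeneousComponent_totalDegree_ne_zero hf0
  have htopd := (homogeneousComponent_isHomogeneous d f).totalDegree htop0
  obtain ⟨a, ha, hlead⟩ := exists_shear_coeff_ne_zero hd hf0
  set b := ⌊B⌋₊ * (d + 1) with hbdef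
  have hfl : 1 ≤ ⌊B⌋₊ := (Nat.one_le_floor_iff _).2 (by linarith)
  have hb : 1 ≤ b := Nat.mul_pos hfl (Nat.succ_pos d)
  set l := Nat.log 2 b + 1 with hl
  obtain ⟨D, hD4, hlD, hlt, hbound⟩ := exists_degree_zeroBound_le hC hd34 hb (Nat.succ_pos _ : 1 ≤ l)
  set S := {x : Fin 3 → ℤ | eval x f = 0 ∧ ∀ i, (|x i| : ℝ) ≤ B} with hS
  have hSb : ∀ x ∈ S, ∀ i, |x i| ≤ (⌊B⌋₊ : ℤ) := fun x hx i => by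
    rw [Int.abs_eq_natAbs]
    exact_mod_cast Nat.le_floor (by rw [Nat.cast_natAbs, Int.cast_abs]; exact hx.2 i)
  have hfin : S.Finite := (Set.finite_Icc (fun _ => -(⌊B⌋₊ : ℤ)) fun _ => (⌊B⌋₊ : ℤ)).subset
    fun x hx => ⟨fun i => (abs_le.1 (hSb x hx i)).1, fun i => (abs_le.1 (hSb x hx i)).2⟩
  have hN : Naff f B ≤ zeroBound b l D := by
    rw [Naff, Set.ncard_eq_toFinset_card _ hfin,
      ← Finset.card_image_of_injective _ (unshear_injective a)]
    refine hcard hd34 ((totalDegree_shear a f).trans hd) (irreducible_map_shear a hirr) hlead ?_ ?_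
      (Nat.succ_pos _) hb (Nat.lt_pow_succ_log_self one_lt_two b).le hD4 hlD hlt _ fun y hy => ?_
    · rw [homogeneousComponent_shear]
      exact irreducible_map_shear a (irreducible_of_rIrreducible hd34
        ((totalDegree_map_rat _).trans htopd) htop)
    · rw [map_shear]
      exact (aperiodic_of_isNCC hncc).shear _
    · obtain ⟨x, hx, rfl⟩ := Finset.mem_image.1 hy
      have hx := hfin.mem_toFinset.1 hx
      exact ⟨(eval_unshear a x f).trans hx.1, abs_unshear_le ha (hSb x hx)⟩
  have hB0 : 0 < B := by linarith
  have hbB : (b : ℝ) ≤ 5 * B := by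
    have h1 := Nat.floor_le hB0.le
    have h2 : (d : ℝ) + 1 ≤ 5 := by rcases hd34 with rfl | rfl <;> norm_num
    rw [hbdef, mul_comm 5]
    push_cast
    gcongr
  have hs1 : 1 ≤ Real.sqrt d := by
    rw [Real.one_le_sqrt]; rcases hd34 with rfl | rfl <;> norm_num
  have hlL : (l : ℝ) ≤ 8 * Real.log B := by
    have h1 : Real.log 2 ≤ Real.log B := Real.log_le_log two_pos hB
    have h2 : ((2 ^ Nat.log 2 b : ℕ) : ℝ) ≤ 2 ^ 3 * B :=
      (Nat.cast_le.2 (Nat.pow_log_le_self 2 (by omega))).trans (hbB.trans (by linarith))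
    rw [Nat.cast_pow] at h2
    have h3 := Real.log_le_log (by positivity) h2
    rw [Real.log_mul (by norm_num) hB0.ne', Nat.cast_ofNat, Real.log_pow, Real.log_pow] at h3
    have h4 := Real.log_two_gt_d9
    have h5 : (l : ℝ) = Nat.log 2 b + 1 := by rw [hl]; push_cast; ring
    push_cast at h3
    nlinarith
  have hrp : (b : ℝ) ^ (2 / Real.sqrt d) ≤ 25 * B ^ (2 / Real.sqrt d) := by
    refine (Real.rpow_le_rpow (by positivity) hbB (by positivity)).trans ?_
    rw [Real.mul_rpow (by norm_num) hB0.le]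
    gcongr
    calc (5 : ℝ) ^ (2 / Real.sqrt d) ≤ 5 ^ (2 : ℝ) :=
          Real.rpow_le_rpow_of_exponent_le (by norm_num) (div_le_self two_pos.le hs1)
      _ = 25 := by norm_num
  calc (Naff f B : ℝ) ≤ zeroBound b l D := Nat.cast_le.2 hN
    _ ≤ _ := hbound
    _ ≤ 2 ^ 226 * (Real.exp C + 5) ^ 2 * (8 * Real.log B) ^ (31 + 2 * ⌈C⌉₊) *
        (25 * B ^ (2 / Real.sqrt d)) :=
      mul_le_mul (mul_le_mul_of_nonneg_left (pow_le_pow_left₀ (Nat.cast_nonneg _) hlL _)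
        (by positivity)) hrp (by positivity) (mul_nonneg (by positivity)
          (pow_nonneg ((Nat.cast_nonneg _).trans hlL) _))
    _ = _ := by rw [mul_pow]; ring

end AffGrowth

/-- Base case of affine dimension growth for surfaces, `d ∈ {3,4}`: there are universal constants
`c`, `κ` such that every irreducible (over ℚ) NCC polynomial `f ∈ ℤ[y₁,y₂,y₃]` of degree
`d ∈ {3,4}` whose top-degree part is `2`-irreducible over ℚ satisfies, for all `B ≥ 2`:
`N_aff(f,B) ≤ c·(log B)^κ·B` if `d = 4`, and `N_aff(f,B) ≤ c·(log B)^κ·B^{2/√3}` if `d = 3`. -/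
theorem affine_surface_growth_deg_three_four :
    ∃ (c : ℝ) (κ : ℕ), ∀ (f : MvPolynomial (Fin 3) ℤ) (d : ℕ), f.totalDegree = d →
      (d = 3 ∨ d = 4) →
      Irreducible (MvPolynomial.map (Int.castRingHom ℚ) f) →
      IsNCC (MvPolynomial.map (Int.castRingHom ℚ) f) →
      RIrreducible 2 (MvPolynomial.map (Int.castRingHom ℚ)
        (MvPolynomial.homogeneousComponent d f)) →
      ∀ B : ℝ, 2 ≤ B →
        (d = 4 → (Naff f B : ℝ) ≤ c * Real.log B ^ κ * B) ∧
        (d = 3 → (Naff f B : ℝ) ≤ c * Real.log B ^ κ * B ^ ((2 : ℝ) / Real.sqrt 3)) := by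
  obtain ⟨c, κ, h⟩ := AffGrowth.exists_Naff_le
  refine ⟨c, κ, fun f d hd hd34 hirr hncc htop B hB => ⟨?_, ?_⟩⟩
  · rintro rfl
    have := h f 4 hd hd34 hirr hncc htop B hB
    rwa [Nat.cast_ofNat, show Real.sqrt 4 = 2 by
      rw [show (4 : ℝ) = 2 ^ 2 by norm_num, Real.sqrt_sq two_pos.le], div_self two_ne_zero,
      Real.rpow_one] at this
  · rintro rfl
    exact h f 3 hd hd34 hirr hncc htop B hB
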